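/- (BGG Theorem for root-reductive Lie algebras.) Let g be a root-reductive Lie algebra with splitting maximal toral subalgebra h and Dynkin Borel subalgebra b ⊇ h. For λ, μ ∈ h*, there exists a nonzero g-module homomorphism from M(λ) to M(μ) if and only if λ is strongly linked to μ. In particular, every Verma submodule of M(μ) is of the form M(w·μ) for some element w of the Weyl group W. -/

import Mathlib

noncomputable section
namespace Paper

variable (K : Type) [Field K] [IsAlgClosed K] [CharZero K]
variable (g : Type) [LieRing g] [LieAlgebra K g]

def adWeightSpace (h : LieSubalgebra K g) (α : Module.Dual K h) : Submodule K g where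
  carrier := {x | ∀ H : h, ⁅(H : g), x⁆ = α H • x}
  add_mem' := by intro a b ha hb H; rw [lie_add, ha H, hb H, smul_add]
  zero_mem' := by intro H; rw [lie_zero, smul_zero]
  smul_mem' := by intro c x hx H; rw [lie_smul, hx H, smul_comm]

def IsRootOf (h : LieSubalgebra K g) (α : Module.Dual K h) : Prop :=
  α ≠ 0 ∧ adWeightSpace K g h α ≠ ⊥

def IsToralIn (s t : LieSubalgebra K g) : Prop :=
  t ≤ s ∧ IsLieAbelian t ∧
    s.toSubmodule ≤ ⨆ α : Module.Dual K t, s.toSubmodule ⊓ adWeightSpace K g t α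

def IsMaxToralIn (s t : LieSubalgebra K g) : Prop :=
  IsToralIn K g s t ∧ ∀ t' : LieSubalgebra K g, IsToralIn K g s t' → t ≤ t' → t' = t

/-- A root-reductive Lie algebra `g` together with a splitting maximal toral subalgebra `h`
and a splitting Borel subalgebra `b ⊇ h` determined by a set `pos` of positive roots. -/
structure Setup where
  /-- the exhausting chain of finite-dimensional reductive subalgebras -/
  F : ℕ → LieSubalgebra K g
  F_mono : Monotone F
  F_exhaust : ∀ x : g, ∃ n, x ∈ F n
  F_findim : ∀ n, FiniteDimensional K (F n)
  /-- each `F n` is reductive: every abelian ideal is central -/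
  F_reductive : ∀ n, ∀ I : LieIdeal K (F n), IsLieAbelian I → I ≤ LieAlgebra.center K (F n)
  /-- the nested chain of Cartan subalgebras witnessing the root inclusions -/
  C : ℕ → LieSubalgebra K g
  C_mono : Monotone C
  C_le : ∀ n, C n ≤ F n
  C_cartan : ∀ n, (LieSubalgebra.comap (F n).incl (C n)).IsCartanSubalgebra
  /-- each inclusion `F n ↪ F (n+1)` is a root inclusion with respect to `C (n+1)`:
  every root space of `F n` relative to `C n` is a root space of `F (n+1)` -/
  C_rootIncl : ∀ n, ∀ α : Module.Dual K (C n), α ≠ 0 →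
    (F n).toSubmodule ⊓ adWeightSpace K g (C n) α ≠ ⊥ →
    ∃ β : Module.Dual K (C (n + 1)),
      (F n).toSubmodule ⊓ adWeightSpace K g (C n) α
        = (F (n + 1)).toSubmodule ⊓ adWeightSpace K g (C (n + 1)) β
  /-- the splitting maximal toral subalgebra -/
  h : LieSubalgebra K g
  h_maxToral : ∀ n, IsMaxToralIn K g (F n) (h ⊓ F n)
  /-- `g` is the direct sum of its `h`-weight spaces -/
  h_indep : iSupIndep fun α : Module.Dual K h => adWeightSpace K g h α
  h_span : (⨆ α : Module.Dual K h, adWeightSpace K g h α) = ⊤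
  /-- the set `Δ⁺` of positive roots -/
  pos : Set (Module.Dual K h)
  pos_root : ∀ α ∈ pos, IsRootOf K g h α
  pos_add : ∀ α ∈ pos, ∀ β ∈ pos, IsRootOf K g h (α + β) → α + β ∈ pos
  pos_polar : ∀ α : Module.Dual K h, IsRootOf K g h α → (α ∈ pos ↔ ¬(-α ∈ pos))
  neg_add : ∀ α β : Module.Dual K h, IsRootOf K g h α → IsRootOf K g h β →
    α ∉ pos → β ∉ pos → IsRootOf K g h (α + β) → α + β ∉ pos
  /-- the splitting Borel subalgebra -/
  b : LieSubalgebra K g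
  b_eq : b.toSubmodule = h.toSubmodule ⊔ ⨆ α ∈ pos, adWeightSpace K g h α


variable {K g}

namespace Setup

variable (S : Setup K g)

/-- `h ∩ g_n`. -/
def hn (n : ℕ) : LieSubalgebra K g := S.h ⊓ S.F n

/-- restriction of a functional on `h` to `h ∩ g_n`. -/
def resDual (n : ℕ) (lam : Module.Dual K S.h) : Module.Dual K (S.hn n) :=
  lam.comp (LieSubalgebra.inclusion (inf_le_left : S.hn n ≤ S.h)).toLinearMap

/-- the `α`-root space of `g_n` relative to `h ∩ g_n`. -/
def rootSpaceN (n : ℕ) (α : Module.Dual K (S.hn n)) : Submodule K g :=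
  (S.F n).toSubmodule ⊓ adWeightSpace K g (S.hn n) α

/-- the set of `b`-positive roots of `g_n`. -/
def posRootsN (n : ℕ) : Set (Module.Dual K (S.hn n)) :=
  {α | α ≠ 0 ∧ S.rootSpaceN n α ≠ ⊥ ∧ S.rootSpaceN n α ≤ S.b.toSubmodule}

/-- `ρ_n`, the half sum of the positive roots of `g_n` with respect to `b ∩ g_n`. -/
def rhoN (n : ℕ) : Module.Dual K (S.hn n) :=
  (2 : K)⁻¹ • ∑ᶠ α ∈ S.posRootsN n, α

/-- `α` is a simple `b`-positive root: it is positive and cannot be written as a sum of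
two or more positive roots. -/
def IsSimpleRoot (α : Module.Dual K S.h) : Prop :=
  α ∈ S.pos ∧ ¬∃ s : Multiset (Module.Dual K S.h),
    2 ≤ Multiset.card s ∧ (∀ β ∈ s, β ∈ S.pos) ∧ s.sum = α

/-- `b` is a Dynkin Borel subalgebra: it is generated, as a Lie subalgebra, by `h` together
with the simple root spaces. -/
def IsDynkin : Prop :=
  S.b = LieSubalgebra.lieSpan K g
    ((S.h : Set g) ∪ ⋃ α ∈ {α | S.IsSimpleRoot α}, (adWeightSpace K g S.h α : Set g))

/-- the partial order `≼` on `h^*`: `lam ≼ mu` iff `mu - lam` is a `ℤ≥0`-linear combination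
of positive roots. -/
def wle (lam mu : Module.Dual K S.h) : Prop :=
  ∃ s : Multiset (Module.Dual K S.h), (∀ β ∈ s, β ∈ S.pos) ∧ mu - lam = s.sum

/-- `g` is locally semisimple: each `g_n` is a semisimple Lie algebra. -/
def IsLocallySemisimple : Prop := ∀ n, LieAlgebra.IsSemisimple K (S.F n)

end Setup


/-- the universal enveloping algebra of `g`. -/
abbrev Env (K g : Type) [Field K] [LieRing g] [LieAlgebra K g] : Type :=
  UniversalEnvelopingAlgebra K g

namespace Setup

variable {K : Type} [Field K] [IsAlgClosed K] [CharZero K]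
variable {g : Type} [LieRing g] [LieAlgebra K g]
variable (S : Setup K g)

/-- the nilpotent radical `n⁺ = ⨁_{α ∈ Δ⁺} g^α` of `b`, as a subspace of `g`. -/
def nplus : Submodule K g := ⨆ α ∈ S.pos, adWeightSpace K g S.h α

/-- the left ideal of `U(g)` generated by `n⁺` and the elements `H - lam(H)`, `H ∈ h`. -/
def vermaIdeal (lam : Module.Dual K S.h) : Submodule (Env K g) (Env K g) :=
  Submodule.span (Env K g)
    ((UniversalEnvelopingAlgebra.ι K '' (S.nplus : Set g)) ∪
      Set.range fun H : S.h =>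
        UniversalEnvelopingAlgebra.ι K (H : g) - algebraMap K (Env K g) (lam H))

/-- the Verma module `M(lam) = U(g)/I`. -/
abbrev Verma (lam : Module.Dual K S.h) : Type := Env K g ⧸ S.vermaIdeal lam

/-- the maximal proper submodule of the Verma module `M(lam)`,
i.e. the sum of all proper submodules. -/
def maxSub (lam : Module.Dual K S.h) : Submodule (Env K g) (S.Verma lam) :=
  sSup {N : Submodule (Env K g) (S.Verma lam) | N ≠ ⊤}

/-- the simple module `L(lam)`, the unique simple quotient of `M(lam)`. -/
abbrev SimpleL (lam : Module.Dual K S.h) : Type := S.Verma lam ⧸ S.maxSub lam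

/-- `H` is the coroot `h_α` of the root `α`:  `α(H) = 2` and `H ∈ [g^α, g^{-α}]`. -/
def IsCoroot (α : Module.Dual K S.h) (H : S.h) : Prop :=
  α H = 2 ∧ ∃ x ∈ adWeightSpace K g S.h α, ∃ y ∈ adWeightSpace K g S.h (-α),
    (H : g) = ⁅x, y⁆

/-- the dot-reflection `s_α · mu = mu - (mu + ρ)(h_α) α` associated to a root `α`
with coroot `Hα`, relative to the half sum `ρ` of positive roots. -/
def dotReflect (ρ α : Module.Dual K S.h) (Hα : S.h) (mu : Module.Dual K S.h) :
    Module.Dual K S.h :=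
  mu - ((mu + ρ) Hα) • α

/-- `ρ` is the global half sum of positive roots: its restriction to each `h ∩ g_n`
is the half sum `ρ_n` of positive roots of `g_n`. -/
def IsGlobalRho (ρ : Module.Dual K S.h) : Prop := ∀ n : ℕ, S.resDual n ρ = S.rhoN n

/-- `lam` is strongly linked to `mu` (relative to `ρ`). -/
inductive StronglyLinked (ρ : Module.Dual K S.h) :
    Module.Dual K S.h → Module.Dual K S.h → Prop
  | refl (mu : Module.Dual K S.h) : StronglyLinked ρ mu mu
  | step {lam mu : Module.Dual K S.h} (α : Module.Dual K S.h) (Hα : S.h) :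
      α ∈ S.pos → S.IsCoroot α Hα →
      S.wle (S.dotReflect ρ α Hα mu) mu →
      StronglyLinked ρ lam (S.dotReflect ρ α Hα mu) →
      StronglyLinked ρ lam mu

/-- `lam` is antidominant: `(lam + ρ)(h_α)` is not a positive integer
for any positive root `α`. -/
def IsAntidominant (ρ lam : Module.Dual K S.h) : Prop :=
  ∀ α ∈ S.pos, ∀ Hα : S.h, S.IsCoroot α Hα → ¬∃ k : ℕ, 0 < k ∧ (lam + ρ) Hα = (k : K)

/-- `lam` is almost antidominant: `(lam + ρ)(h_α)` is a positive integer
for only finitely many positive roots `α`. -/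
def IsAlmostAntidominant (ρ lam : Module.Dual K S.h) : Prop :=
  {α | α ∈ S.pos ∧ ∃ Hα : S.h, S.IsCoroot α Hα ∧
    ∃ k : ℕ, 0 < k ∧ (lam + ρ) Hα = (k : K)}.Finite

end Setup

namespace Setup

variable {K : Type} [Field K] [IsAlgClosed K] [CharZero K]
variable {g : Type} [LieRing g] [LieAlgebra K g]
variable (S : Setup K g)

/-- the reflection `s_α : mu ↦ mu - mu(h_α) α`, as a linear map on `h^*`. -/
def reflectionMap (α : Module.Dual K S.h) (Hα : S.h) :
    Module.Dual K S.h →ₗ[K] Module.Dual K S.h where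
  toFun mu := mu - mu Hα • α
  map_add' mu ν := by
    simp only [LinearMap.add_apply, add_smul]
    abel
  map_smul' c mu := by
    simp only [LinearMap.smul_apply, RingHom.id_apply, smul_sub, smul_smul, smul_eq_mul]

/-- the reflection `s_α` associated to a root `α` with coroot `Hα`,
as a linear automorphism of `h^*`. -/
def reflection (α : Module.Dual K S.h) (Hα : S.h) (h2 : α Hα = 2) :
    Module.Dual K S.h ≃ₗ[K] Module.Dual K S.h :=
  LinearEquiv.ofInvolutive (S.reflectionMap α Hα) (by
    intro mu
    show S.reflectionMap α Hα (mu - mu Hα • α) = mu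
    show (mu - mu Hα • α) - ((mu - mu Hα • α) Hα) • α = mu
    rw [LinearMap.sub_apply, LinearMap.smul_apply, h2, smul_eq_mul]
    module)

/-- the Weyl group of `g`, realized as the group of linear automorphisms of `h^*`
generated by the reflections in the roots. -/
def weylGroup : Subgroup (Module.Dual K S.h ≃ₗ[K] Module.Dual K S.h) :=
  Subgroup.closure
    {w | ∃ (α : Module.Dual K S.h) (Hα : S.h) (hc : S.IsCoroot α Hα),
      IsRootOf K g S.h α ∧ w = S.reflection α Hα hc.1}

/-- the dot action `w · mu = w(mu + ρ) - ρ`. -/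
def dotAct (ρ : Module.Dual K S.h) (w : Module.Dual K S.h ≃ₗ[K] Module.Dual K S.h)
    (mu : Module.Dual K S.h) : Module.Dual K S.h :=
  w (mu + ρ) - ρ

/-- the root lattice `Λ`, the `ℤ`-span of the roots in `h^*`. -/
def rootLattice : Submodule ℤ (Module.Dual K S.h) :=
  Submodule.span ℤ {α : Module.Dual K S.h | IsRootOf K g S.h α}

end Setup

set_option linter.unusedSectionVars false

section

open MvPolynomial

/-- A Lie algebra `g` split (as a vector space) into the span of independent vectors `X i` and the
subalgebra `ker π`, together with a character `μ` of the latter. -/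
structure IndData (K g ι : Type) [Field K] [LieRing g] [LieAlgebra K g] [LinearOrder ι] where
  X : ι → g
  π : g →ₗ[K] (ι →₀ K)
  μ : g →ₗ[K] K
  π_X : ∀ i, π (X i) = Finsupp.single i 1
  μ_X : ∀ i, μ (X i) = 0
  π_lie : ∀ y z, π y = 0 → π z = 0 → π ⁅y, z⁆ = 0
  μ_lie : ∀ y z, π y = 0 → π z = 0 → μ ⁅y, z⁆ = 0

namespace IndData

variable {K g ι : Type} [Field K] [LieRing g] [LieAlgebra K g] [LinearOrder ι]
variable (I : IndData K g ι)

/-- the component of `y` along the vectors `X i`, as a linear polynomial -/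
def lin : g →ₗ[K] MvPolynomial ι K := Finsupp.linearCombination K MvPolynomial.X ∘ₗ I.π

/-- the part of `y` along the vectors `X i` with `i ≤ j` -/
def low (j : ι) : g →ₗ[K] g :=
  Finsupp.linearCombination K (fun i => if i ≤ j then I.X i else 0) ∘ₗ I.π

/-- the complement of `low` -/
def up (j : ι) : g →ₗ[K] g := LinearMap.id - I.low j

/-- polynomials of degree less than `n` -/
def Fil (K ι : Type) [Field K] (n : ℕ) : Submodule K (MvPolynomial ι K) :=
  Submodule.span K {p | ∃ M : ι →₀ ℕ, M.degree < n ∧ p = monomial M 1}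

def adR (x : g) : g →ₗ[K] g := -(LieAlgebra.ad K g x : g →ₗ[K] g)

lemma adR_apply (x y : g) : adR (K := K) x y = ⁅y, x⁆ := by
  simp [adR]

open Classical in
/-- the lower order part of the action, correct in degree less than `n` -/
def corr : ℕ → (MvPolynomial ι K →ₗ[K] (g →ₗ[K] MvPolynomial ι K))
  | 0 => 0
  | n + 1 => (basisMonomials ι K).constr K fun M =>
      if h : M.support.Nonempty then
        let j := M.support.min' h
        let z : MvPolynomial ι K := monomial (M - Finsupp.single j 1) 1
        ((LinearMap.mulLeft K (MvPolynomial.X j) + (corr n).flip (I.X j)) ∘ₗ (corr n z) +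
          (LinearMap.mulRight K z ∘ₗ I.lin + corr n z) ∘ₗ adR (I.X j)) ∘ₗ I.up j
      else LinearMap.smulRight I.μ 1

/-- `i` is at most all variables of `M`. -/
def LeAll (i : ι) (M : ι →₀ ℕ) : Prop := ∀ k ∈ M.support, i ≤ k

lemma exists_min (M : ι →₀ ℕ) (hM : M ≠ 0) : ∃ (j : ι) (N : ι →₀ ℕ), 
    M = N + Finsupp.single j 1 ∧ LeAll j N := by
  classical
  have h : M.support.Nonempty := Finsupp.support_nonempty_iff.2 hM
  refine ⟨M.support.min' h, M - Finsupp.single (M.support.min' h) 1, ?_, ?_⟩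
  · rw [tsub_add_cancel_of_le]
    have := M.support.min'_mem h
    rw [Finsupp.single_le_iff]
    exact Nat.one_le_iff_ne_zero.2 (Finsupp.mem_support_iff.1 this)
  · intro k hk
    apply Finset.min'_le
    have := Finsupp.support_tsub hk
    exact this

lemma monomial_mem_Fil {n : ℕ} {M : ι →₀ ℕ} (h : M.degree < n) :
    (monomial M 1 : MvPolynomial ι K) ∈ Fil K ι n := Submodule.subset_span ⟨M, h, rfl⟩

lemma corr_zero_monomial (n : ℕ) (y : g) : I.corr (n + 1) (monomial 0 1) y = C (I.μ y) := by
  have : (monomial 0 1 : MvPolynomial ι K) = basisMonomials ι K 0 := by simp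
  rw [this, corr, Module.Basis.constr_basis]
  simp [MvPolynomial.smul_eq_C_mul]

lemma corr_succ (n : ℕ) (y : g) (j : ι) (N : ι →₀ ℕ) (hj : LeAll j N) :
    I.corr (n + 1) (monomial (N + Finsupp.single j 1) 1) y =
      MvPolynomial.X j * I.corr n (monomial N 1) (I.up j y) +
      I.corr n (I.corr n (monomial N 1) (I.up j y)) (I.X j) +
      I.lin ⁅I.up j y, I.X j⁆ * monomial N 1 + I.corr n (monomial N 1) ⁅I.up j y, I.X j⁆ := by
  classical
  have : ∀ M, (monomial M 1 : MvPolynomial ι K) = basisMonomials ι K M := by simp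
  have hs : (N + Finsupp.single j 1).support.Nonempty := by
    refine ⟨j, ?_⟩
    simp
  have hmin : (N + Finsupp.single j 1).support.min' hs = j := by
    apply le_antisymm
    · apply Finset.min'_le; simp
    · apply Finset.le_min'
      intro k hk
      by_cases hkj : k = j
      · exact hkj.ge
      · apply hj
        simpa [Finsupp.single_apply, Ne.symm hkj] using hk
  rw [this (N + _), corr, Module.Basis.constr_basis, dif_pos hs]
  simp only [hmin, add_tsub_cancel_right]
  simp [adR_apply, add_assoc]

end IndData

end

section
open MvPolynomial
namespace IndData
variable {K g ι : Type} [Field K] [LieRing g] [LieAlgebra K g] [LinearOrder ι]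
variable (I : IndData K g ι)

lemma lin_X (i : ι) : I.lin (I.X i) = MvPolynomial.X i := by simp [lin, I.π_X]

lemma low_mem (j : ι) (y : g) : I.low j y ∈ Submodule.span K (I.X '' {i | i ≤ j}) := by
  rw [low, LinearMap.comp_apply, Finsupp.linearCombination_apply]
  refine Submodule.sum_mem _ fun i _ => Submodule.smul_mem _ _ ?_
  split_ifs with h
  · exact Submodule.subset_span ⟨i, h, rfl⟩
  · exact Submodule.zero_mem _

lemma low_add_up (j : ι) (y : g) : I.low j y + I.up j y = y := by simp [up]

lemma π_low (j k : ι) (y : g) : I.π (I.low j y) k = if k ≤ j then I.π y k else 0 := by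
  classical
  rw [low, LinearMap.comp_apply, Finsupp.linearCombination_apply, Finsupp.sum, map_sum,
    Finsupp.finsetSum_apply]
  have : ∀ i, (I.π (I.π y i • if i ≤ j then I.X i else 0)) k
      = if i = k then (if k ≤ j then I.π y k else 0) else 0 := by
    intro i
    rw [map_smul, Finsupp.smul_apply, smul_eq_mul]
    by_cases hi : i ≤ j
    · rw [if_pos hi, I.π_X, Finsupp.single_apply]
      by_cases hik : i = k
      · subst hik; simp [hi]
      · simp [hik]
    · rw [if_neg hi]
      by_cases hik : i = k
      · subst hik; simp [hi]
      · simp [hik]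
  rw [Finset.sum_congr rfl fun i _ => this i, Finset.sum_ite_eq']
  split_ifs with h1 h2 <;> simp_all

lemma π_up (j k : ι) (y : g) : I.π (I.up j y) k = if k ≤ j then 0 else I.π y k := by
  have : I.up j y = y - I.low j y := rfl
  rw [this, map_sub, Finsupp.sub_apply, π_low]
  split_ifs <;> simp

lemma lin_up_mem (j : ι) (y : g) :
    I.lin (I.up j y) ∈ Submodule.span K ((MvPolynomial.X : ι → MvPolynomial ι K) '' {i | j ≤ i}) := by
  rw [lin, LinearMap.comp_apply, Finsupp.linearCombination_apply]
  refine Submodule.sum_mem _ fun i _ => ?_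
  rw [π_up]
  split_ifs with h
  · simp
  · exact Submodule.smul_mem _ _ (Submodule.subset_span ⟨i, (not_le.1 h).le, rfl⟩)

lemma up_X_of_le {i j : ι} (h : i ≤ j) : I.up j (I.X i) = 0 := by
  have : I.up j (I.X i) = I.X i - I.low j (I.X i) := rfl
  rw [this, low, LinearMap.comp_apply, I.π_X]; simp [h]

lemma up_X_of_lt {i j : ι} (h : j < i) : I.up j (I.X i) = I.X i := by
  have : I.up j (I.X i) = I.X i - I.low j (I.X i) := rfl
  rw [this, low, LinearMap.comp_apply, I.π_X]; simp [h.not_ge]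

lemma Fil_mono {m n : ℕ} (h : m ≤ n) : Fil K ι m ≤ Fil K ι n := by
  apply Submodule.span_mono
  rintro p ⟨M, hM, rfl⟩; exact ⟨M, hM.trans_le h, rfl⟩

lemma X_mul_mem_Fil {n : ℕ} {p : MvPolynomial ι K} (i : ι) (hp : p ∈ Fil K ι n) :
    MvPolynomial.X i * p ∈ Fil K ι (n + 1) := by
  induction hp using Submodule.span_induction with
  | mem x hx =>
    obtain ⟨M, hM, rfl⟩ := hx
    rw [MvPolynomial.X, monomial_mul]
    simp only [mul_one]
    apply monomial_mem_Fil
    simp; omega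
  | zero => simp
  | add x y _ _ hx hy => rw [mul_add]; exact Submodule.add_mem _ hx hy
  | smul a x _ hx => rw [mul_smul_comm]; exact Submodule.smul_mem _ _ hx

lemma lin_mul_mem_Fil {n : ℕ} {p : MvPolynomial ι K} (y : g) (hp : p ∈ Fil K ι n) :
    I.lin y * p ∈ Fil K ι (n + 1) := by
  rw [lin, LinearMap.comp_apply, Finsupp.linearCombination_apply, Finsupp.sum, Finset.sum_mul]
  refine Submodule.sum_mem _ fun i _ => ?_
  rw [smul_mul_assoc]
  exact Submodule.smul_mem _ _ (X_mul_mem_Fil i hp)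

lemma exists_min' {n : ℕ} (M : ι →₀ ℕ) (hM : M ≠ 0) (hn : M.degree < n + 1) : ∃ (j : ι) (N : ι →₀ ℕ),
    M = N + Finsupp.single j 1 ∧ LeAll j N ∧ N.degree < n := by
  obtain ⟨j, N, rfl, h⟩ := exists_min M hM
  refine ⟨j, N, rfl, h, ?_⟩
  simp at hn; omega

lemma corr_monomial_mem (n : ℕ) : ∀ (M : ι →₀ ℕ), M.degree < n → ∀ y,
    I.corr n (monomial M 1) y ∈ Fil K ι (M.degree + 1) := by
  induction n with
  | zero => intro M hM; omega
  | succ n ih =>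
    have ih' : ∀ m ≤ n, ∀ p ∈ Fil K ι m, ∀ y, I.corr n p y ∈ Fil K ι m := by
      intro m hm p hp y
      induction hp using Submodule.span_induction with
      | mem x hx =>
        obtain ⟨M, hM, rfl⟩ := hx
        exact Fil_mono hM (ih M (by omega) y)
      | zero => simp
      | add x y _ _ hx hy => rw [map_add]; exact Submodule.add_mem _ hx hy
      | smul a x _ hx => rw [map_smul]; exact Submodule.smul_mem _ _ hx
    intro M hM y
    by_cases h0 : M = 0
    · subst h0
      rw [corr_zero_monomial]
      have : (C (I.μ y) : MvPolynomial ι K) = I.μ y • monomial 0 1 := by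
        rw [smul_monomial, smul_eq_mul, mul_one]; rfl
      rw [this]
      exact Submodule.smul_mem _ _ (monomial_mem_Fil (by simp))
    · obtain ⟨j, N, rfl, hj, hN⟩ := exists_min' M h0 hM
      have hd : (N + Finsupp.single j 1).degree = N.degree + 1 := by simp
      rw [corr_succ _ _ _ _ _ hj, hd]
      have h1 := ih N hN (I.up j y)
      refine Submodule.add_mem _ (Submodule.add_mem _ (Submodule.add_mem _ ?_ ?_) ?_) ?_
      · exact X_mul_mem_Fil _ h1
      · exact Fil_mono (by omega) (ih' _ (by omega) _ h1 _)
      · exact lin_mul_mem_Fil _ _ (monomial_mem_Fil (by omega))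
      · exact Fil_mono (by omega) (ih N hN _)

lemma corr_mem {n m : ℕ} (hm : m ≤ n) {p : MvPolynomial ι K} (hp : p ∈ Fil K ι m) (y : g) :
    I.corr n p y ∈ Fil K ι m := by
  induction hp using Submodule.span_induction with
  | mem x hx =>
    obtain ⟨M, hM, rfl⟩ := hx
    exact Fil_mono hM (I.corr_monomial_mem n M (by omega) y)
  | zero => simp
  | add x y _ _ hx hy => rw [map_add]; exact Submodule.add_mem _ hx hy
  | smul a x _ hx => rw [map_smul]; exact Submodule.smul_mem _ _ hx

lemma corr_stable (n : ℕ) : ∀ p ∈ Fil K ι n, I.corr (n + 1) p = I.corr n p := by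
  induction n with
  | zero =>
    intro p hp
    have : Fil K ι 0 = ⊥ := by simp [Fil]
    rw [this, Submodule.mem_bot] at hp
    simp [hp]
  | succ n ih =>
    intro p hp
    induction hp using Submodule.span_induction with
    | zero => simp
    | add x y _ _ hx hy => rw [map_add, map_add, hx, hy]
    | smul a x _ hx => rw [map_smul, map_smul, hx]
    | mem x hx =>
      obtain ⟨M, hM, rfl⟩ := hx
      ext1 y
      by_cases h0 : M = 0
      · subst h0
        rw [corr_zero_monomial, corr_zero_monomial]
      · obtain ⟨j, N, rfl, hj, hN⟩ := exists_min' M h0 hM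
        rw [corr_succ _ _ _ _ _ hj, corr_succ _ _ _ _ _ hj, ih _ (monomial_mem_Fil hN),
          ih _ (I.corr_mem le_rfl (monomial_mem_Fil hN) _)]

lemma corr_stable' {m n : ℕ} (h : m ≤ n) {p : MvPolynomial ι K} (hp : p ∈ Fil K ι m) :
    I.corr n p = I.corr m p := by
  induction n, h using Nat.le_induction with
  | base => rfl
  | succ n hn ih => rw [corr_stable _ _ _ (Fil_mono hn hp), ih]

/-- the lower order part of the action -/
def D : MvPolynomial ι K →ₗ[K] (g →ₗ[K] MvPolynomial ι K) :=
  (basisMonomials ι K).constr K fun M => I.corr (M.degree + 1) (monomial M 1)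

lemma D_monomial (M : ι →₀ ℕ) : I.D (monomial M 1) = I.corr (M.degree + 1) (monomial M 1) := by
  have : (monomial M 1 : MvPolynomial ι K) = basisMonomials ι K M := by simp
  rw [this, D, Module.Basis.constr_basis]; simp

lemma D_eq {n : ℕ} {p : MvPolynomial ι K} (hp : p ∈ Fil K ι n) : I.D p = I.corr n p := by
  induction hp using Submodule.span_induction with
  | mem x hx =>
    obtain ⟨M, hM, rfl⟩ := hx
    rw [D_monomial, I.corr_stable' hM (monomial_mem_Fil (by omega))]
  | zero => simp
  | add x y _ _ hx hy => rw [map_add, map_add, hx, hy]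
  | smul a x _ hx => rw [map_smul, map_smul, hx]

lemma D_mem {n : ℕ} {p : MvPolynomial ι K} (hp : p ∈ Fil K ι n) (y : g) : I.D p y ∈ Fil K ι n := by
  rw [I.D_eq hp]; exact I.corr_mem le_rfl hp y

/-- the action of `g` on polynomials in the complementary variables -/
def act : g →ₗ[K] Module.End K (MvPolynomial ι K) :=
  LinearMap.mul K (MvPolynomial ι K) ∘ₗ I.lin + I.D.flip

lemma act_apply (y : g) (p : MvPolynomial ι K) : I.act y p = I.lin y * p + I.D p y := rfl

lemma act_one (y : g) : I.act y (monomial 0 1) = I.lin y + C (I.μ y) := by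
  rw [act_apply, D_monomial, corr_zero_monomial]; simp

lemma D_X_of_le {i : ι} {M : ι →₀ ℕ} (h : LeAll i M) : I.D (monomial M 1) (I.X i) = 0 := by
  rw [D_monomial]
  by_cases h0 : M = 0
  · subst h0
    rw [corr_zero_monomial, I.μ_X, map_zero]
  · obtain ⟨j, N, rfl, hj⟩ := exists_min M h0
    rw [corr_succ _ _ _ _ _ hj, I.up_X_of_le]
    · simp
    · apply h; simp

lemma act_X_of_le {i : ι} {M : ι →₀ ℕ} (h : LeAll i M) :
    I.act (I.X i) (monomial M 1) = monomial (M + Finsupp.single i 1) 1 := by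
  rw [act_apply, I.D_X_of_le h, lin_X, MvPolynomial.X, monomial_mul, add_comm M]; simp

lemma leAll_add {j i : ι} {N : ι →₀ ℕ} (hj : LeAll j N) (h : j ≤ i) :
    LeAll j (N + Finsupp.single i 1) := by
  classical
  intro k hk
  by_cases hki : k = i
  · exact hki ▸ h
  · apply hj
    simpa [Finsupp.single_apply, Ne.symm hki] using hk

lemma lin_up_mul (j : ι) (y : g) (N : ι →₀ ℕ) :
    I.lin (I.up j y) * monomial N 1 ∈
      Submodule.span K {p | ∃ i, j ≤ i ∧ p = monomial (N + Finsupp.single i 1) 1} := by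
  have := I.lin_up_mem j y
  generalize I.lin (I.up j y) = q at this
  induction this using Submodule.span_induction with
  | mem x hx =>
    obtain ⟨i, hi, rfl⟩ := hx
    apply Submodule.subset_span
    refine ⟨i, hi, ?_⟩
    rw [MvPolynomial.X, monomial_mul, add_comm N]; simp
  | zero => simp
  | add x y _ _ hx hy => rw [add_mul]; exact Submodule.add_mem _ hx hy
  | smul a x _ hx => rw [smul_mul_assoc]; exact Submodule.smul_mem _ _ hx

lemma act_up (j : ι) (y : g) {N : ι →₀ ℕ} (hj : LeAll j N) :
    I.act (I.up j y) (monomial (N + Finsupp.single j 1) 1) =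
      I.act (I.X j) (I.act (I.up j y) (monomial N 1)) + I.act ⁅I.up j y, I.X j⁆ (monomial N 1) := by
  have hup : I.up j (I.up j y) = I.up j y := by
    have h0 : I.up j (I.up j y) = I.up j y - I.low j (I.up j y) := rfl
    have : I.low j (I.up j y) = 0 := by
      rw [low, LinearMap.comp_apply, Finsupp.linearCombination_apply]
      apply Finset.sum_eq_zero
      intro i _
      rw [π_up]; split_ifs <;> simp_all
    rw [h0, this, sub_zero]
  have hX : I.act (I.X j) (I.lin (I.up j y) * monomial N 1)
      = MvPolynomial.X j * (I.lin (I.up j y) * monomial N 1) := by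
    have := I.lin_up_mul j y N
    generalize I.lin (I.up j y) * monomial N 1 = q at this
    induction this using Submodule.span_induction with
    | mem x hx =>
      obtain ⟨i, hi, rfl⟩ := hx
      rw [I.act_X_of_le (leAll_add hj hi), MvPolynomial.X, monomial_mul,
        add_comm (Finsupp.single j 1)]
      simp
    | zero => simp
    | add x y _ _ hx hy => rw [map_add, mul_add, hx, hy]
    | smul a x _ hx => rw [map_smul, mul_smul_comm, hx]
  have hd : (N + Finsupp.single j 1).degree = N.degree + 1 := by simp
  have hN : (monomial N 1 : MvPolynomial ι K) ∈ Fil K ι (N.degree + 1) :=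
    monomial_mem_Fil (by omega)
  have hz : (monomial (N + Finsupp.single j 1) 1 : MvPolynomial ι K)
      = MvPolynomial.X j * monomial N 1 := by
    rw [MvPolynomial.X, monomial_mul, add_comm N]; simp
  rw [act_apply _ (I.up j y), I.D_monomial, hd, corr_succ _ _ _ _ _ hj, hup, ← I.D_eq hN,
    ← I.D_eq (I.D_mem hN _), act_apply _ (I.up j y), map_add, hX, act_apply _ (I.X j), lin_X,
    act_apply _ ⁅_, _⁆, hz]
  ring

def LieOn (y z : g) (p : MvPolynomial ι K) : Prop :=
  I.act ⁅y, z⁆ p = I.act y (I.act z p) - I.act z (I.act y p)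

variable {I}

lemma LieOn.symm {y z : g} {p : MvPolynomial ι K} (h : I.LieOn y z p) : I.LieOn z y p := by
  unfold LieOn at *
  rw [← lie_skew, map_neg, LinearMap.neg_apply, h]; abel

lemma LieOn.add_left {y y' z : g} {p : MvPolynomial ι K} (h : I.LieOn y z p) (h' : I.LieOn y' z p) :
    I.LieOn (y + y') z p := by
  unfold LieOn at *
  simp only [add_lie, map_add, LinearMap.add_apply, h, h']; abel

lemma lieOn_of_span {s : Set (MvPolynomial ι K)} {y z : g} (h : ∀ p ∈ s, I.LieOn y z p)
    {p : MvPolynomial ι K} (hp : p ∈ Submodule.span K s) : I.LieOn y z p := by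
  induction hp using Submodule.span_induction with
  | mem x hx => exact h x hx
  | zero => simp [LieOn]
  | add x y _ _ hx hy => unfold LieOn at *; simp only [map_add, hx, hy]; abel
  | smul a x _ hx => unfold LieOn at *; simp only [map_smul, hx, smul_sub]

lemma lieOn_of_span_left {s : Set g} {z : g} {p : MvPolynomial ι K} (h : ∀ y ∈ s, I.LieOn y z p)
    {y : g} (hy : y ∈ Submodule.span K s) : I.LieOn y z p := by
  induction hy using Submodule.span_induction with
  | mem x hx => exact h x hx
  | zero => simp [LieOn]
  | add x y _ _ hx hy => exact hx.add_left hy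
  | smul a x _ hx =>
    unfold LieOn at *; simp only [map_smul, smul_lie, LinearMap.smul_apply, hx, smul_sub]

variable (I)

lemma lieOn_X (y : g) {i : ι} {M : ι →₀ ℕ} (h : LeAll i M) : I.LieOn y (I.X i) (monomial M 1) := by
  rw [← I.low_add_up i y]
  apply LieOn.add_left
  · refine lieOn_of_span_left ?_ (I.low_mem i y)
    rintro _ ⟨k, hk : k ≤ i, rfl⟩
    have hkM : LeAll k M := fun l hl => hk.trans (h l hl)
    rcases hk.eq_or_lt with rfl | hlt
    · simp [LieOn]
    · have := I.act_up k (I.X i) hkM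
      rw [I.up_X_of_lt hlt] at this
      apply LieOn.symm
      unfold LieOn
      rw [I.act_X_of_le hkM, this]; abel
  · unfold LieOn
    rw [I.act_X_of_le h, I.act_up i y h]; abel

lemma lieOn_all (n : ℕ) : ∀ p ∈ Fil K ι n, ∀ y z, I.LieOn y z p := by
  induction n with
  | zero =>
    intro p hp
    have : Fil K ι 0 = ⊥ := by simp [Fil]
    rw [this, Submodule.mem_bot] at hp
    simp [hp, LieOn]
  | succ n ih =>
    intro p hp y z
    refine lieOn_of_span ?_ hp
    rintro _ ⟨M, hM, rfl⟩
    by_cases h0 : M = 0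
    · subst h0
      have hle : ∀ i : ι, LeAll i (0 : ι →₀ ℕ) := by intro i k hk; simp at hk
      have key : ∀ y : g, ∃ u ∈ Submodule.span K (Set.range I.X), ∃ v, I.π v = 0 ∧ y = u + v := by
        intro y
        refine ⟨Finsupp.linearCombination K I.X (I.π y), ?_,
          y - Finsupp.linearCombination K I.X (I.π y), ?_, by abel⟩
        · rw [Finsupp.linearCombination_apply]
          exact Submodule.sum_mem _ fun i _ => Submodule.smul_mem _ _
            (Submodule.subset_span ⟨i, rfl⟩)
        · rw [map_sub, sub_eq_zero]
          conv_rhs => rw [Finsupp.linearCombination_apply, Finsupp.sum, map_sum]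
          simp only [map_smul, I.π_X]
          conv_lhs => rw [← Finsupp.sum_single (I.π y)]
          simp [Finsupp.sum]
      obtain ⟨u, hu, v, hv, rfl⟩ := key y
      obtain ⟨u', hu', v', hv', rfl⟩ := key z
      have hA : ∀ u ∈ Submodule.span K (Set.range I.X), ∀ w, I.LieOn u w (monomial 0 1) := by
        intro u hu w
        refine lieOn_of_span_left ?_ hu
        rintro _ ⟨i, rfl⟩
        exact (I.lieOn_X w (hle i)).symm
      refine (hA _ hu _).add_left (((hA _ hu' _).add_left ?_).symm)
      unfold LieOn
      have hl : ∀ w, I.π w = 0 → I.act w (monomial 0 1) = I.μ w • monomial 0 1 := by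
        intro w hw
        rw [act_one, lin, LinearMap.comp_apply, hw, smul_monomial, map_zero, zero_add, smul_eq_mul,
          mul_one]; rfl
      rw [hl _ (I.π_lie _ _ hv' hv), I.μ_lie _ _ hv' hv, hl _ hv, map_smul, hl _ hv', map_smul,
        hl _ hv, smul_smul, smul_smul, mul_comm]; simp
    · obtain ⟨k, N, rfl, hk, hN⟩ := exists_min' M h0 hM
      have hNF : (monomial N 1 : MvPolynomial ι K) ∈ Fil K ι n := monomial_mem_Fil hN
      have hL : ∀ y w, I.LieOn (I.low k y) w (monomial (N + Finsupp.single k 1) 1) := by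
        intro y w
        refine lieOn_of_span_left ?_ (I.low_mem k y)
        rintro _ ⟨i, hi : i ≤ k, rfl⟩
        exact (I.lieOn_X w fun l hl => hi.trans (leAll_add hk le_rfl l hl)).symm
      rw [← I.low_add_up k y, ← I.low_add_up k z]
      refine (hL _ _).add_left (((hL _ _).add_left ?_).symm)
      set y' := I.up k y with hy'
      set z' := I.up k z with hz'
      rw [← I.act_X_of_le hk]
      have hA : ∀ y w : g, I.LieOn y (I.X k) (I.act (I.up k w) (monomial N 1)) := by
        intro y w
        rw [act_apply]
        have h1 : I.LieOn y (I.X k) (I.lin (I.up k w) * monomial N 1) := by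
          refine lieOn_of_span ?_ (I.lin_up_mul k w _)
          rintro _ ⟨i, hi, rfl⟩
          exact I.lieOn_X y (leAll_add hk hi)
        have h2 : I.LieOn y (I.X k) (I.D (monomial N 1) (I.up k w)) := ih _ (I.D_mem hNF _) _ _
        unfold LieOn at *
        simp only [map_add, h1, h2]; abel
      have e1 : I.LieOn y' (I.X k) (I.act z' (monomial N 1)) := hA y' z
      have e2 : I.LieOn z' (I.X k) (I.act y' (monomial N 1)) := hA z' y
      clear_value y' z'
      have e3 := ih _ hNF z' y'
      have e4 := ih _ hNF y' (I.X k)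
      have e5 := ih _ hNF z' (I.X k)
      have e6 := ih _ hNF ⁅z', y'⁆ (I.X k)
      have e7 := ih _ hNF ⁅y', I.X k⁆ z'
      have e8 := ih _ hNF y' ⁅z', I.X k⁆
      have hj : ⁅⁅z', y'⁆, I.X k⁆ = -(⁅⁅y', I.X k⁆, z'⁆ + ⁅y', ⁅z', I.X k⁆⁆) := by
        rw [← lie_skew ⁅y', I.X k⁆ z', leibniz_lie z', leibniz_lie y']
        simp only [lie_lie]
        rw [← lie_skew y' (I.X k)]
        simp only [lie_neg]
        abel
      unfold LieOn at *
      rw [hj, map_neg, map_add, LinearMap.neg_apply, LinearMap.add_apply, e7, e8, e3, map_sub] at e6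
      have a1 := eq_add_of_sub_eq e4.symm
      have a2 := eq_add_of_sub_eq e5.symm
      have b1 := eq_add_of_sub_eq e1.symm
      have b2 := eq_add_of_sub_eq e2.symm
      have c := eq_add_of_sub_eq e6.symm
      rw [c, a1, a2, map_add, map_add, b1, b2]
      abel

end IndData

end

section
open MvPolynomial
namespace IndData
attribute [local instance] LieRing.ofAssociativeRing
variable {K g ι : Type} [Field K] [LieRing g] [LieAlgebra K g] [LinearOrder ι]
variable (I : IndData K g ι)

lemma mem_Fil_totalDegree (p : MvPolynomial ι K) : p ∈ Fil K ι (p.totalDegree + 1) := by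
  rw [p.as_sum]
  refine Submodule.sum_mem _ fun M hM => ?_
  have : (monomial M (p.coeff M) : MvPolynomial ι K) = p.coeff M • monomial M 1 := by
    rw [smul_monomial, smul_eq_mul, mul_one]
  rw [this]
  refine Submodule.smul_mem _ _ (monomial_mem_Fil ?_)
  have h1 := le_totalDegree hM
  have h2 : (M.degree : ℕ) = M.sum fun _ e => e := by
    simp [Finsupp.degree_apply, Finsupp.sum]
  rw [← p.as_sum]
  omega

lemma totalDegree_lt {n : ℕ} {p : MvPolynomial ι K} (hp : p ∈ Fil K ι n) (h0 : p ≠ 0) :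
    p.totalDegree < n := by
  have : p = 0 ∨ p.totalDegree < n := by
    clear h0
    induction hp using Submodule.span_induction with
    | mem x hx =>
      obtain ⟨M, hM, rfl⟩ := hx
      right
      refine lt_of_le_of_lt (totalDegree_monomial_le M 1) ?_
      simpa [Finsupp.degree_apply, Finsupp.sum] using hM
    | zero => left; rfl
    | add x y _ _ hx hy =>
      rcases hx with rfl | hx
      · simpa using hy
      rcases hy with rfl | hy
      · right; simpa using hx
      · right; exact lt_of_le_of_lt (totalDegree_add x y) (max_lt hx hy)
    | smul a x _ hx =>
      rcases hx with rfl | hx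
      · left; simp
      · right; exact lt_of_le_of_lt (totalDegree_smul_le a x) hx
  exact this.resolve_left h0

lemma exists_Fil (p : MvPolynomial ι K) : ∃ n, p ∈ Fil K ι n := ⟨_, mem_Fil_totalDegree p⟩

lemma mul_mem_Fil {a b : ℕ} {p q : MvPolynomial ι K} (hp : p ∈ Fil K ι (a + 1))
    (hq : q ∈ Fil K ι (b + 1)) : p * q ∈ Fil K ι (a + b + 1) := by
  by_cases h : p * q = 0
  · rw [h]; exact Submodule.zero_mem _
  have h1 := totalDegree_lt hp (left_ne_zero_of_mul h)
  have h2 := totalDegree_lt hq (right_ne_zero_of_mul h)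
  have h3 := totalDegree_mul p q
  exact Fil_mono (by omega) (mem_Fil_totalDegree _)

/-- the action as a representation -/
def actHom : g →ₗ⁅K⁆ Module.End K (MvPolynomial ι K) where
  toLinearMap := I.act
  map_lie' := by
    intro y z
    ext1 M
    ext1
    obtain ⟨n, hn⟩ := exists_Fil (monomial M 1 : MvPolynomial ι K)
    exact I.lieOn_all n _ hn y z

def rep : UniversalEnvelopingAlgebra K g →ₐ[K] Module.End K (MvPolynomial ι K) :=
  UniversalEnvelopingAlgebra.lift K I.actHom

local notation "ε" => UniversalEnvelopingAlgebra.ι K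

lemma rep_ι (y : g) : I.rep (ε y) = I.act y := by
  simp only [rep, UniversalEnvelopingAlgebra.lift_ι_apply]; rfl

/-- ordered monomials -/
def Psi : MvPolynomial ι K →ₗ[K] UniversalEnvelopingAlgebra K g :=
  (basisMonomials ι K).constr K fun M =>
    ((Finsupp.toMultiset M).sort.map fun i => ε (I.X i)).prod

lemma Psi_monomial (M : ι →₀ ℕ) : I.Psi (monomial M 1) =
    ((Finsupp.toMultiset M).sort.map fun i => ε (I.X i)).prod := by
  have : (monomial M 1 : MvPolynomial ι K) = basisMonomials ι K M := by simp
  rw [this, Psi, Module.Basis.constr_basis]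

lemma Psi_one : I.Psi (monomial 0 1) = 1 := by
  rw [Psi_monomial]; simp

lemma Psi_add {j : ι} {N : ι →₀ ℕ} (hj : LeAll j N) :
    I.Psi (monomial (N + Finsupp.single j 1) 1) = ε (I.X j) * I.Psi (monomial N 1) := by
  rw [Psi_monomial, Psi_monomial]
  have : Finsupp.toMultiset (N + Finsupp.single j 1) = j ::ₘ Finsupp.toMultiset N := by
    simp [add_comm]
  rw [this, Multiset.sort_cons]
  · simp
  · intro k hk
    exact hj k (by simpa using hk)

lemma Fil_induction {P : MvPolynomial ι K → Prop} (h0 : P (monomial 0 1))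
    (hzero : P 0) (hadd : ∀ p q, P p → P q → P (p + q)) (hsmul : ∀ (c : K) p, P p → P (c • p))
    (hstep : ∀ (n : ℕ) (j : ι) (N : ι →₀ ℕ), LeAll j N → N.degree < n → (∀ p ∈ Fil K ι n, P p) →
      P (monomial (N + Finsupp.single j 1) 1)) (p : MvPolynomial ι K) : P p := by
  have key : ∀ n, ∀ p ∈ Fil K ι n, P p := by
    intro n
    induction n with
    | zero =>
      intro p hp
      have : Fil K ι 0 = ⊥ := by simp [Fil]
      rw [this, Submodule.mem_bot] at hp
      exact hp ▸ hzero
    | succ n ih =>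
      intro p hp
      induction hp using Submodule.span_induction with
      | mem x hx =>
        obtain ⟨M, hM, rfl⟩ := hx
        by_cases hM0 : M = 0
        · exact hM0 ▸ h0
        · obtain ⟨j, N, rfl, hj, hN⟩ := exists_min' M hM0 hM
          exact hstep n j N hj hN ih
      | zero => exact hzero
      | add x y _ _ hx hy => exact hadd _ _ hx hy
      | smul a x _ hx => exact hsmul _ _ hx
  obtain ⟨n, hn⟩ := exists_Fil p
  exact key n p hn

lemma Psi_act (V : Submodule K g) (hX : ∀ i, I.X i ∈ V) (hV : ∀ y ∈ V, ∀ i, ⁅y, I.X i⁆ ∈ V)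
    (J : Submodule (UniversalEnvelopingAlgebra K g) (UniversalEnvelopingAlgebra K g))
    (hJ : ∀ y ∈ V, I.π y = 0 → ε y - algebraMap K _ (I.μ y) ∈ J)
    (p : MvPolynomial ι K) : ∀ y ∈ V, ε y * I.Psi p - I.Psi (I.act y p) ∈ J := by
  have hle : ∀ {i : ι} {M : ι →₀ ℕ}, LeAll i M →
      ε (I.X i) * I.Psi (monomial M 1) - I.Psi (I.act (I.X i) (monomial M 1)) ∈ J := by
    intro i M h
    rw [act_X_of_le _ h, Psi_add _ h, sub_self]; exact J.zero_mem
  have hJs : ∀ (c : K) (x : UniversalEnvelopingAlgebra K g), x ∈ J → c • x ∈ J := by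
    intro c x hx
    rw [Algebra.smul_def]; exact J.smul_mem _ hx
  have hspan : ∀ {s : Set g} {q : MvPolynomial ι K}, (∀ y ∈ s, ε y * I.Psi q - I.Psi (I.act y q) ∈ J) →
      ∀ y ∈ Submodule.span K s, ε y * I.Psi q - I.Psi (I.act y q) ∈ J := by
    intro s q h y hy
    induction hy using Submodule.span_induction with
    | mem x hx => exact h x hx
    | zero => simp
    | add x y _ _ hx hy =>
      have := J.add_mem hx hy
      convert this using 1
      simp only [map_add, LinearMap.add_apply, add_mul]; abel
    | smul a x _ hx =>
      have := hJs a _ hx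
      convert this using 1
      simp only [map_smul, LinearMap.smul_apply, smul_mul_assoc, smul_sub]
  have hlowV : ∀ j y, I.low j y ∈ V := fun j y => by
    refine (Submodule.span_le.2 ?_) (I.low_mem j y)
    rintro _ ⟨i, _, rfl⟩; exact hX i
  induction p using Fil_induction with
  | h0 =>
    intro y hy
    have hd : Finsupp.linearCombination K I.X (I.π y) ∈ Submodule.span K (Set.range I.X) := by
      rw [Finsupp.linearCombination_apply]
      exact Submodule.sum_mem _ fun i _ => Submodule.smul_mem _ _
            (Submodule.subset_span ⟨i, rfl⟩)
    have hπ : I.π (y - Finsupp.linearCombination K I.X (I.π y)) = 0 := by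
      rw [map_sub, sub_eq_zero]
      conv_rhs => rw [Finsupp.linearCombination_apply, Finsupp.sum, map_sum]
      simp only [map_smul, I.π_X]
      conv_lhs => rw [← Finsupp.sum_single (I.π y)]
      simp [Finsupp.sum]
    generalize Finsupp.linearCombination K I.X (I.π y) = u at *
    have h1 : ε u * I.Psi (monomial 0 1) - I.Psi (I.act u (monomial 0 1)) ∈ J := by
      refine hspan ?_ u hd
      rintro _ ⟨i, rfl⟩
      exact hle (by intro k hk; simp at hk)
    have hu : u ∈ V := by
      refine (Submodule.span_le.2 ?_) hd
      rintro _ ⟨i, rfl⟩; exact hX i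
    have h2 := hJ _ (V.sub_mem hy hu) hπ
    have h3 : I.act (y - u) (monomial 0 1) = I.μ (y - u) • monomial 0 1 := by
      rw [act_one, lin, LinearMap.comp_apply, hπ, smul_monomial, map_zero, zero_add, smul_eq_mul,
        mul_one]; rfl
    have h4 : ε (y - u) * I.Psi (monomial 0 1) - I.Psi (I.act (y - u) (monomial 0 1)) ∈ J := by
      rw [h3, map_smul, Psi_one, mul_one, ← Algebra.algebraMap_eq_smul_one]; exact h2
    have := J.add_mem h1 h4
    convert this using 1
    simp only [map_sub, LinearMap.sub_apply, sub_mul]; abel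
  | hzero => intro y _; simp
  | hadd p q hp hq =>
    intro y hy
    have := J.add_mem (hp y hy) (hq y hy)
    convert this using 1
    simp only [map_add, mul_add]; abel
  | hsmul c p hp =>
    intro y hy
    have := hJs c _ (hp y hy)
    convert this using 1
    simp only [map_smul, mul_smul_comm, smul_sub]
  | hstep n j N hj hN ih =>
    intro y hy
    have hNF : (monomial N 1 : MvPolynomial ι K) ∈ Fil K ι n := monomial_mem_Fil hN
    have h1 : ε (I.low j y) * I.Psi (monomial (N + Finsupp.single j 1) 1) -
        I.Psi (I.act (I.low j y) (monomial (N + Finsupp.single j 1) 1)) ∈ J := by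
      refine hspan ?_ _ (I.low_mem j y)
      rintro _ ⟨i, hi : i ≤ j, rfl⟩
      exact hle fun l hl => hi.trans (leAll_add hj le_rfl l hl)
    have hup : I.up j y ∈ V := V.sub_mem hy (hlowV j y)
    have h2 : ε (I.up j y) * I.Psi (monomial (N + Finsupp.single j 1) 1) -
        I.Psi (I.act (I.up j y) (monomial (N + Finsupp.single j 1) 1)) ∈ J := by
      rw [act_up _ _ _ hj, Psi_add _ hj]
      have a1 := ih _ hNF _ (hV _ hup j)
      have a2 := J.smul_mem (ε (I.X j)) (ih _ hNF _ hup)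
      have a3 : ε (I.X j) * I.Psi (I.act (I.up j y) (monomial N 1)) -
          I.Psi (I.act (I.X j) (I.act (I.up j y) (monomial N 1))) ∈ J := by
        rw [act_apply _ (I.up j y)]
        have b1 := ih _ (I.D_mem hNF (I.up j y)) _ (hX j)
        have b2 : ε (I.X j) * I.Psi (I.lin (I.up j y) * monomial N 1) -
            I.Psi (I.act (I.X j) (I.lin (I.up j y) * monomial N 1)) ∈ J := by
          have := I.lin_up_mul j y N
          generalize I.lin (I.up j y) * monomial N 1 = q at this
          induction this using Submodule.span_induction with
          | mem x hx =>
            obtain ⟨i, hi, rfl⟩ := hx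
            exact hle (leAll_add hj hi)
          | zero => simp
          | add x y _ _ hx hy =>
            have := J.add_mem hx hy
            convert this using 1
            simp only [map_add, mul_add]; abel
          | smul a x _ hx =>
            have := hJs a _ hx
            convert this using 1
            simp only [map_smul, mul_smul_comm, smul_sub]
        have := J.add_mem b1 b2
        convert this using 1
        simp only [map_add, mul_add]; abel
      have := J.add_mem (J.add_mem a1 a2) a3
      convert this using 1
      simp only [LieHom.map_lie, LieRing.of_associative_ring_bracket, smul_eq_mul, map_add]
      noncomm_ring
    have := J.add_mem h1 h2
    convert this using 1
    nth_rewrite 1 2 [← I.low_add_up j y]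
    simp only [map_add, LinearMap.add_apply, add_mul]; abel

end IndData

end

section
open MvPolynomial
namespace IndData
attribute [local instance] LieRing.ofAssociativeRing
variable {K g ι : Type} [Field K] [LieRing g] [LieAlgebra K g] [LinearOrder ι]
variable (I : IndData K g ι)
local notation "ε" => UniversalEnvelopingAlgebra.ι K

/-- the subalgebra generated by the vectors `X i` with `i ∈ s` -/
def sub (s : Set ι) : Subalgebra K (UniversalEnvelopingAlgebra K g) :=
  Algebra.adjoin K (Set.image (fun i => ε (I.X i)) s)

/-- the span of the vectors `X i` is a subalgebra -/
def Closed (s : Set ι) : Prop := ∀ i ∈ s, ∀ j ∈ s, ⁅I.X i, I.X j⁆ ∈ Submodule.span K (I.X '' s)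

lemma act_Psi_of_closed (h : I.Closed Set.univ) (i : ι) (p : MvPolynomial ι K) :
    ε (I.X i) * I.Psi p = I.Psi (I.act (I.X i) p) := by
  rw [← sub_eq_zero, ← Submodule.mem_bot (UniversalEnvelopingAlgebra K g)]
  refine I.Psi_act (Submodule.span K (I.X '' Set.univ)) ?_ ?_ ⊥ ?_ p _ ?_
  · intro i; exact Submodule.subset_span ⟨i, trivial, rfl⟩
  · intro y hy j
    induction hy using Submodule.span_induction with
    | mem x hx => obtain ⟨i, _, rfl⟩ := hx; exact h i trivial j trivial
    | zero => simp
    | add x y _ _ hx hy => rw [add_lie]; exact Submodule.add_mem _ hx hy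
    | smul a x _ hx => rw [smul_lie]; exact Submodule.smul_mem _ _ hx
  · intro y hy h0
    have : Finsupp.linearCombination K I.X (I.π y) = y := by
      clear h0
      induction hy using Submodule.span_induction with
      | mem x hx => obtain ⟨i, _, rfl⟩ := hx; simp [I.π_X]
      | zero => simp
      | add x y _ _ hx hy => rw [map_add, map_add, hx, hy]
      | smul a x _ hx => rw [map_smul, map_smul, hx]
    rw [h0, map_zero] at this
    subst this; simp
  · exact Submodule.subset_span ⟨i, trivial, rfl⟩

lemma mul_Psi (h : I.Closed Set.univ) {u : UniversalEnvelopingAlgebra K g}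
    (hu : u ∈ I.sub Set.univ) : ∀ p, u * I.Psi p = I.Psi (I.rep u p) := by
  induction hu using Algebra.adjoin_induction with
  | mem x hx =>
    obtain ⟨i, _, rfl⟩ := hx
    intro p
    change ε (I.X i) * _ = I.Psi (I.rep (ε (I.X i)) p)
    rw [act_Psi_of_closed _ h, rep_ι]
  | algebraMap c => intro p; simp [Algebra.algebraMap_eq_smul_one]
  | add x y _ _ hx hy => intro p; simp only [add_mul, map_add, LinearMap.add_apply, hx, hy]
  | mul x y _ _ hx hy =>
    intro p; rw [mul_assoc, hy, hx, map_mul, Module.End.mul_apply]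

lemma eq_Psi (h : I.Closed Set.univ) {u : UniversalEnvelopingAlgebra K g}
    (hu : u ∈ I.sub Set.univ) : u = I.Psi (I.rep u (monomial 0 1)) := by
  rw [← I.mul_Psi h hu, Psi_one, mul_one]

lemma Psi_monomial_mem {s : Set ι} {M : ι →₀ ℕ} (hM : ∀ i ∈ M.support, i ∈ s) :
    I.Psi (monomial M 1) ∈ I.sub s := by
  rw [Psi_monomial]
  refine Subalgebra.list_prod_mem _ ?_
  intro x hx
  rw [List.mem_map] at hx
  obtain ⟨i, hi, rfl⟩ := hx
  refine Algebra.subset_adjoin ⟨i, hM i ?_, rfl⟩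
  simpa using hi

lemma lead (p q : MvPolynomial ι K) (b : ℕ) (hq : q ∈ Fil K ι (b + 1)) :
    ∀ a, p ∈ Fil K ι (a + 1) → I.rep (I.Psi p) q - p * q ∈ Fil K ι (a + b) := by
  have key : ∀ n, ∀ M : ι →₀ ℕ, M.degree = n →
      I.rep (I.Psi (monomial M 1)) q - monomial M 1 * q ∈ Fil K ι (n + b) := by
    intro n
    induction n with
    | zero =>
      intro M hM
      have : M = 0 := by rwa [Finsupp.degree_eq_zero_iff] at hM
      subst this
      rw [Psi_one]; simp
    | succ n ih =>
      intro M hM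
      obtain ⟨j, N, rfl, hj⟩ := exists_min M (by rintro rfl; simp at hM)
      have hN : N.degree = n := by simpa using hM
      have h1 := ih N hN
      rw [Psi_add _ hj, map_mul, Module.End.mul_apply, rep_ι]
      have hz : (monomial (N + Finsupp.single j 1) 1 : MvPolynomial ι K)
          = MvPolynomial.X j * monomial N 1 := by
        rw [MvPolynomial.X, monomial_mul, add_comm N]; simp
      have h2 : monomial N 1 * q ∈ Fil K ι (n + b + 1) :=
        mul_mem_Fil (monomial_mem_Fil (by omega)) hq
      obtain ⟨w, hw⟩ : ∃ w, w = I.rep (I.Psi (monomial N 1)) q - monomial N 1 * q := ⟨_, rfl⟩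
      rw [← hw] at h1
      have h3 : I.rep (I.Psi (monomial N 1)) q = monomial N 1 * q + w := by rw [hw]; ring
      rw [h3, act_apply, lin_X, hz, mul_add, map_add]
      have h4 := X_mul_mem_Fil j h1
      have h5 := I.D_mem h2 (I.X j)
      have h6 := I.D_mem (Fil_mono (by omega : n + b ≤ n + b + 1) h1) (I.X j)
      have := Submodule.add_mem _ h4 (Submodule.add_mem _ h5 h6)
      rw [show n + 1 + b = n + b + 1 by omega]
      convert this using 1
      simp only [LinearMap.add_apply]; ring
  intro a hp
  induction hp using Submodule.span_induction with
  | mem x hx =>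
    obtain ⟨M, hM, rfl⟩ := hx
    exact Fil_mono (by omega) (key _ M rfl)
  | zero => simp
  | add x y _ _ hx hy =>
    have := Submodule.add_mem _ hx hy
    convert this using 1
    simp only [map_add, LinearMap.add_apply]; ring
  | smul c x _ hx =>
    have := Submodule.smul_mem _ c hx
    convert this using 1
    simp only [map_smul, LinearMap.smul_apply, smul_sub, smul_mul_assoc]

lemma rep_ne_zero (h : I.Closed Set.univ) {u : UniversalEnvelopingAlgebra K g}
    (hu : u ∈ I.sub Set.univ) (hu0 : u ≠ 0) {q : MvPolynomial ι K} (hq : q ≠ 0) : I.rep u q ≠ 0 := by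
  intro h0
  have h1 := I.eq_Psi h hu
  set p := I.rep u (monomial 0 1) with hp
  have hp0 : p ≠ 0 := by rintro h2; rw [h2, map_zero] at h1; exact hu0 h1
  have h3 := I.lead p q _ (mem_Fil_totalDegree q) _ (mem_Fil_totalDegree p)
  rw [← h1, h0, zero_sub, neg_mem_iff] at h3
  have h4 := totalDegree_lt h3 (mul_ne_zero hp0 hq)
  rw [totalDegree_mul_of_isDomain hp0 hq] at h4
  exact lt_irrefl _ h4

/-- the subalgebra generated by the `X i` has no zero divisors -/
theorem sub_mul_ne_zero (h : I.Closed Set.univ) {u w : UniversalEnvelopingAlgebra K g}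
    (hu : u ∈ I.sub Set.univ) (hw : w ∈ I.sub Set.univ) (hu0 : u ≠ 0) (hw0 : w ≠ 0) :
    u * w ≠ 0 := by
  intro h0
  have h1 : I.rep w (monomial 0 1) ≠ 0 := by
    intro h2; have := I.eq_Psi h hw; rw [h2, map_zero] at this; exact hw0 this
  apply I.rep_ne_zero h hu hu0 h1
  rw [← Module.End.mul_apply, ← map_mul, h0]; simp

lemma adjoin_range_ι : Algebra.adjoin K (Set.range (ε : g → UniversalEnvelopingAlgebra K g)) = ⊤ := by
  set S := Algebra.adjoin K (Set.range (ε : g → UniversalEnvelopingAlgebra K g)) with hS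
  let φ : g →ₗ⁅K⁆ S :=
    { toFun := fun x => ⟨ε x, Algebra.subset_adjoin ⟨x, rfl⟩⟩
      map_add' := fun x y => by ext; simp
      map_smul' := fun c x => by ext; simp
      map_lie' := fun {x y} => by ext; simp [LieRing.of_associative_ring_bracket] }
  have h : S.val.comp (UniversalEnvelopingAlgebra.lift K φ) = AlgHom.id K _ := by
    apply UniversalEnvelopingAlgebra.hom_ext
    ext x
    simp [φ]
  rw [eq_top_iff]
  intro x _
  have := AlgHom.congr_fun h x
  rw [AlgHom.id_apply] at this
  rw [← this]
  exact (UniversalEnvelopingAlgebra.lift K φ x).2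

/-- the left ideal defining the induced module -/
def ideal : Submodule (UniversalEnvelopingAlgebra K g) (UniversalEnvelopingAlgebra K g) :=
  Submodule.span _ {x | ∃ y, I.π y = 0 ∧ x = ε y - algebraMap K _ (I.μ y)}

lemma rep_ideal {x : UniversalEnvelopingAlgebra K g} (hx : x ∈ I.ideal) :
    I.rep x (monomial 0 1) = 0 := by
  induction hx using Submodule.span_induction with
  | mem x hx =>
    obtain ⟨y, hy, rfl⟩ := hx
    have h3 : I.act y (monomial 0 1) = I.μ y • monomial 0 1 := by
      rw [act_one, lin, LinearMap.comp_apply, hy, smul_monomial, map_zero, zero_add, smul_eq_mul,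
        mul_one]; rfl
    rw [map_sub, rep_ι, LinearMap.sub_apply, h3, AlgHom.commutes, Module.algebraMap_end_apply,
      sub_self]
  | zero => simp
  | add x y _ _ hx hy => rw [map_add, LinearMap.add_apply, hx, hy, add_zero]
  | smul a x _ hx => rw [smul_eq_mul, map_mul, Module.End.mul_apply, hx, map_zero]

lemma sub_Psi_mem (u : UniversalEnvelopingAlgebra K g) :
    u - I.Psi (I.rep u (monomial 0 1)) ∈ I.ideal := by
  have key : ∀ u : UniversalEnvelopingAlgebra K g, ∀ p, u * I.Psi p - I.Psi (I.rep u p) ∈ I.ideal := by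
    intro u
    have hu : u ∈ Algebra.adjoin K (Set.range (ε : g → UniversalEnvelopingAlgebra K g)) := by
      rw [adjoin_range_ι]; trivial
    induction hu using Algebra.adjoin_induction with
    | mem x hx =>
      obtain ⟨y, rfl⟩ := hx
      intro p
      rw [rep_ι]
      exact I.Psi_act ⊤ (fun _ => trivial) (fun _ _ _ => trivial) I.ideal
        (fun y _ h => Submodule.subset_span ⟨y, h, rfl⟩) p y trivial
    | algebraMap c =>
      intro p
      rw [AlgHom.commutes, Module.algebraMap_end_apply, map_smul, ← Algebra.smul_def, sub_self]
      exact Submodule.zero_mem _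
    | add x y _ _ hx hy =>
      intro p
      have := I.ideal.add_mem (hx p) (hy p)
      convert this using 1
      simp only [map_add, LinearMap.add_apply, add_mul]; abel
    | mul x y _ _ hx hy =>
      intro p
      have := I.ideal.add_mem (hx (I.rep y p)) (I.ideal.smul_mem x (hy p))
      convert this using 1
      simp only [map_mul, Module.End.mul_apply, smul_eq_mul, mul_sub, mul_assoc]; abel
  have := key u (monomial 0 1)
  rwa [Psi_one, mul_one] at this

theorem mem_ideal_iff (u : UniversalEnvelopingAlgebra K g) :
    u ∈ I.ideal ↔ I.rep u (monomial 0 1) = 0 := by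
  refine ⟨I.rep_ideal, fun h => ?_⟩
  have := I.sub_Psi_mem u
  rwa [h, map_zero, sub_zero] at this

theorem exists_sub (u : UniversalEnvelopingAlgebra K g) :
    ∃ a ∈ I.sub Set.univ, u - a ∈ I.ideal := by
  refine ⟨_, ?_, I.sub_Psi_mem u⟩
  generalize I.rep u (monomial 0 1) = p
  obtain ⟨n, hn⟩ := exists_Fil p
  induction hn using Submodule.span_induction with
  | mem x hx => obtain ⟨M, hM, rfl⟩ := hx; exact I.Psi_monomial_mem fun _ _ => trivial
  | zero => simp
  | add x y _ _ hx hy => rw [map_add]; exact add_mem hx hy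
  | smul c x _ hx => rw [map_smul]; exact Subalgebra.smul_mem _ hx c

theorem eq_zero_of_mem_ideal (h : I.Closed Set.univ) {u : UniversalEnvelopingAlgebra K g}
    (hu : u ∈ I.sub Set.univ) (hi : u ∈ I.ideal) : u = 0 := by
  rw [I.eq_Psi h hu, I.rep_ideal hi, map_zero]

section bottom
variable {i₀ : ι}

/-- polynomials not involving the variable `i₀` -/
def Free (K : Type) [Field K] (i₀ : ι) : Submodule K (MvPolynomial ι K) :=
  Submodule.span K {p | ∃ M : ι →₀ ℕ, M i₀ = 0 ∧ p = monomial M 1}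

lemma act_bot (hb : ∀ i, i₀ ≤ i) (p : MvPolynomial ι K) :
    I.act (I.X i₀) p = MvPolynomial.X i₀ * p := by
  obtain ⟨n, hn⟩ := exists_Fil p
  induction hn using Submodule.span_induction with
  | mem x hx =>
    obtain ⟨M, hM, rfl⟩ := hx
    rw [act_apply, I.D_X_of_le (fun k _ => hb k), lin_X, add_zero]
  | zero => simp
  | add x y _ _ hx hy => rw [map_add, mul_add, hx, hy]
  | smul a x _ hx => rw [map_smul, mul_smul_comm, hx]

def FF (K : Type) [Field K] (i₀ : ι) (n : ℕ) : Submodule K (MvPolynomial ι K) :=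
  Submodule.span K {p | ∃ M : ι →₀ ℕ, M.degree < n ∧ M i₀ = 0 ∧ p = monomial M 1}

lemma FF_mono {m n : ℕ} (h : m ≤ n) : FF K i₀ m ≤ FF K i₀ n := by
  apply Submodule.span_mono
  rintro p ⟨M, hM, h0, rfl⟩; exact ⟨M, hM.trans_le h, h0, rfl⟩

lemma X_mul_mem_FF {n : ℕ} {p : MvPolynomial ι K} {i : ι} (hi : i ≠ i₀) (hp : p ∈ FF K i₀ n) :
    MvPolynomial.X i * p ∈ FF K i₀ (n + 1) := by
  induction hp using Submodule.span_induction with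
  | mem x hx =>
    obtain ⟨M, hM, h0, rfl⟩ := hx
    rw [MvPolynomial.X, monomial_mul, mul_one]
    refine Submodule.subset_span ⟨_, ?_, ?_, rfl⟩
    · simp; omega
    · simp [h0, hi]
  | zero => simp
  | add x y _ _ hx hy => rw [mul_add]; exact Submodule.add_mem _ hx hy
  | smul a x _ hx => rw [mul_smul_comm]; exact Submodule.smul_mem _ _ hx

lemma D_FF (h : I.Closed {i | i ≠ i₀}) (n : ℕ) :
    ∀ p ∈ FF K i₀ n, ∀ i, i ≠ i₀ → I.D p (I.X i) ∈ FF K i₀ n := by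
  induction n with
  | zero =>
    intro p hp i hi
    have : FF K i₀ 0 = ⊥ := by simp [FF]
    rw [this, Submodule.mem_bot] at hp
    simp [hp]
  | succ n ih =>
    have ihact : ∀ p ∈ FF K i₀ n, ∀ i, i ≠ i₀ → I.act (I.X i) p ∈ FF K i₀ (n + 1) := by
      intro p hp i hi
      rw [act_apply, lin_X]
      exact Submodule.add_mem _ (X_mul_mem_FF hi hp) (FF_mono (Nat.le_succ n) (ih p hp i hi))
    intro p hp i hi
    induction hp using Submodule.span_induction with
    | mem x hx =>
      obtain ⟨M, hM, h0, rfl⟩ := hx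
      by_cases hM0 : M = 0
      · subst hM0
        rw [I.D_X_of_le (by intro k hk; simp at hk)]; exact Submodule.zero_mem _
      obtain ⟨j, N, rfl, hj, hN⟩ := exists_min' M hM0 hM
      rw [Finsupp.add_apply, Nat.add_eq_zero_iff] at h0
      have hj0 : j ≠ i₀ := by rintro rfl; simp at h0
      have hNF : (monomial N 1 : MvPolynomial ι K) ∈ FF K i₀ n :=
        Submodule.subset_span ⟨N, hN, h0.1, rfl⟩
      rcases le_or_gt i j with hij | hij
      · rw [I.D_X_of_le fun l hl => hij.trans (leAll_add hj le_rfl l hl)]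
        exact Submodule.zero_mem _
      have h1 := I.act_up j (I.X i) hj
      rw [I.up_X_of_lt hij, act_apply, act_apply _ (I.X i), lin_X, map_add,
        MvPolynomial.X, monomial_mul, monomial_mul, mul_one, add_comm _ N,
        I.act_X_of_le (leAll_add hj hij.le), add_comm _ (N + Finsupp.single j 1), add_right_comm,
        add_assoc] at h1
      have h2 := add_left_cancel (h1.trans (add_assoc _ _ _))
      rw [h2]
      refine Submodule.add_mem _ (ihact _ (ih _ hNF i hi) _ hj0) ?_
      have hl := h i hi j hj0
      generalize ⁅I.X i, I.X j⁆ = y at hl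
      induction hl using Submodule.span_induction with
      | mem x hx => obtain ⟨k, hk, rfl⟩ := hx; exact ihact _ hNF _ hk
      | zero => simp
      | add x y _ _ hx hy => rw [map_add, LinearMap.add_apply]; exact Submodule.add_mem _ hx hy
      | smul a x _ hx => rw [map_smul, LinearMap.smul_apply]; exact Submodule.smul_mem _ _ hx
    | zero => simp
    | add x y _ _ hx hy => rw [map_add, LinearMap.add_apply]; exact Submodule.add_mem _ hx hy
    | smul a x _ hx => rw [map_smul, LinearMap.smul_apply]; exact Submodule.smul_mem _ _ hx

lemma act_free (h : I.Closed {i | i ≠ i₀}) {p : MvPolynomial ι K} (hp : p ∈ Free K i₀) {i : ι}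
    (hi : i ≠ i₀) : I.act (I.X i) p ∈ Free K i₀ := by
  have hle : ∀ n, FF K i₀ n ≤ Free K i₀ := by
    intro n
    apply Submodule.span_mono
    rintro p ⟨M, _, h0, rfl⟩; exact ⟨M, h0, rfl⟩
  induction hp using Submodule.span_induction with
  | mem x hx =>
    obtain ⟨M, h0, rfl⟩ := hx
    have hm : (monomial M 1 : MvPolynomial ι K) ∈ FF K i₀ (M.degree + 1) :=
      Submodule.subset_span ⟨M, by omega, h0, rfl⟩
    rw [act_apply, lin_X]
    exact Submodule.add_mem _ (hle _ (X_mul_mem_FF hi hm)) (hle _ (I.D_FF h _ _ hm i hi))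
  | zero => simp
  | add x y _ _ hx hy => rw [map_add]; exact Submodule.add_mem _ hx hy
  | smul a x _ hx => rw [map_smul]; exact Submodule.smul_mem _ _ hx

lemma rep_free (h : I.Closed {i | i ≠ i₀}) {a : UniversalEnvelopingAlgebra K g}
    (ha : a ∈ I.sub {i | i ≠ i₀}) : ∀ p ∈ Free K i₀, I.rep a p ∈ Free K i₀ := by
  induction ha using Algebra.adjoin_induction with
  | mem x hx =>
    obtain ⟨i, hi, rfl⟩ := hx
    intro p hp
    change I.rep (ε (I.X i)) p ∈ _
    rw [rep_ι]; exact I.act_free h hp hi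
  | algebraMap c =>
    intro p hp; rw [AlgHom.commutes, Module.algebraMap_end_apply]; exact Submodule.smul_mem _ _ hp
  | add x y _ _ hx hy =>
    intro p hp; rw [map_add]; exact Submodule.add_mem _ (hx p hp) (hy p hp)
  | mul x y _ _ hx hy => intro p hp; rw [map_mul]; exact hx _ (hy p hp)

lemma coeff_free {p : MvPolynomial ι K} (hp : p ∈ Free K i₀) {M : ι →₀ ℕ} (hM : M i₀ ≠ 0) :
    p.coeff M = 0 := by
  classical
  induction hp using Submodule.span_induction with
  | mem x hx =>
    obtain ⟨N, h0, rfl⟩ := hx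
    rw [coeff_monomial, if_neg]
    rintro rfl; exact hM h0
  | zero => simp
  | add x y _ _ hx hy => rw [coeff_add, hx, hy, add_zero]
  | smul a x _ hx => rw [coeff_smul, hx, smul_zero]

/-- If `X i₀ * w + a` lies in the ideal then so do both summands. -/
theorem mem_of_add_mem (hb : ∀ i, i₀ ≤ i) (h : I.Closed {i | i ≠ i₀})
    {w a : UniversalEnvelopingAlgebra K g} (ha : a ∈ I.sub {i | i ≠ i₀})
    (hwa : ε (I.X i₀) * w + a ∈ I.ideal) : w ∈ I.ideal ∧ a ∈ I.ideal := by
  rw [mem_ideal_iff, map_add, map_mul, rep_ι, LinearMap.add_apply, Module.End.mul_apply,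
    act_bot _ hb] at hwa
  have hf : I.rep a (monomial 0 1) ∈ Free K i₀ :=
    I.rep_free h ha _ (Submodule.subset_span ⟨0, rfl, rfl⟩)
  rw [mem_ideal_iff, mem_ideal_iff]
  generalize I.rep a (monomial 0 1) = q at *
  generalize I.rep w (monomial 0 1) = r at *
  have hr : r = 0 := by
    ext M
    have h1 := congrArg (coeff (Finsupp.single i₀ 1 + M)) hwa
    rw [coeff_add, coeff_X_mul, coeff_free hf (by simp), add_zero] at h1
    simpa using h1
  subst hr
  exact ⟨rfl, by simpa using hwa⟩

theorem exists_mul_add (u : UniversalEnvelopingAlgebra K g) (hb : ∀ i, i₀ ≤ i) :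
    ∃ w, ∃ a ∈ I.sub {i | i ≠ i₀}, u - (ε (I.X i₀) * w + a) ∈ I.ideal := by
  have h1 := I.sub_Psi_mem u
  suffices h : ∃ w, ∃ a ∈ I.sub {i | i ≠ i₀}, I.Psi (I.rep u (monomial 0 1)) = ε (I.X i₀) * w + a by
    obtain ⟨w, a, ha, h⟩ := h
    exact ⟨w, a, ha, h ▸ h1⟩
  generalize I.rep u (monomial 0 1) = p
  obtain ⟨n, hn⟩ := exists_Fil p
  induction hn using Submodule.span_induction with
  | mem x hx =>
    obtain ⟨M, hM, rfl⟩ := hx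
    by_cases h0 : M i₀ = 0
    · refine ⟨0, _, I.Psi_monomial_mem (s := {i | i ≠ i₀}) (M := M) ?_, by simp⟩
      rintro i hi rfl
      simp [h0] at hi
    · refine ⟨I.Psi (monomial (M - Finsupp.single i₀ 1) 1), 0, zero_mem _, ?_⟩
      rw [← Psi_add _ (fun k _ => hb k), add_zero, tsub_add_cancel_of_le]
      rw [Finsupp.single_le_iff]; omega
  | zero => exact ⟨0, 0, zero_mem _, by simp⟩
  | add x y _ _ hx hy =>
    obtain ⟨w, a, ha, h⟩ := hx
    obtain ⟨w', a', ha', h'⟩ := hy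
    refine ⟨w + w', a + a', add_mem ha ha', ?_⟩
    rw [map_add, h, h', mul_add]; abel
  | smul c x _ hx =>
    obtain ⟨w, a, ha, h⟩ := hx
    refine ⟨c • w, c • a, Subalgebra.smul_mem _ ha c, ?_⟩
    rw [map_smul, h, smul_add, mul_smul_comm]

end bottom

end IndData

end

section

open LieAlgebra LieAlgebra.IsKilling LieModule Module

section principal
variable {K L : Type*} [Field K] [IsAlgClosed K] [CharZero K] [LieRing L] [LieAlgebra K L]
  [FiniteDimensional K L] [LieAlgebra.IsKilling K L] (H : LieSubalgebra K L) [H.IsCartanSubalgebra]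

theorem exists_principal : ∃ (h : H) (e f : L), ⁅e, f⁆ = h ∧ ⁅(h : L), e⁆ = (2 : K) • e ∧
    ⁅(h : L), f⁆ = -((2 : K) • f) ∧ ∀ α : H → K, rootSpace H α ≠ ⊥ →
      ∃ n : ℤ, α h = 2 * (n : K) ∧ (n = 0 → α = 0) := by
  classical
  obtain ⟨b⟩ := (rootSystem H).nonempty_base
  let φ : Dual K (Dual K H) := b.toWeightBasis.constr K (fun _ => (2 : K))
  let h : H := (Module.evalEquiv K H).symm φ
  have hh : ∀ i : b.support, (i : H.root).1 h = 2 := by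
    intro i
    have h1 : φ ((rootSystem H).root i) = 2 := by
      rw [← b.toWeightBasis_apply, Module.Basis.constr_basis]
    rw [← h1]
    have h2 : φ = Module.evalEquiv K H h := by simp [h]
    rw [h2]
    rfl
  have hsl := fun i : b.support =>
    exists_isSl2Triple_of_weight_isNonZero (LieSubalgebra.isNonZero_coe_root (i : H.root))
  choose x e f hs he hf using hsl
  have hx : ∀ i, x i = coroot (i : H.root).1 := fun i =>
    (hs i).h_eq_coroot (LieSubalgebra.isNonZero_coe_root (i : H.root)) (he i) (hf i)
  have hef : ∀ i j : b.support, i ≠ j → ⁅e i, f j⁆ = 0 := by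
    intro i j hij
    by_contra h0
    have h1 : ⁅e i, f j⁆ ∈ rootSpace H (((i : H.root).1 : H → K) + -((j : H.root).1 : H → K)) :=
      lie_mem_genWeightSpace_of_mem_genWeightSpace (he i) (hf j)
    have h2 : rootSpace H (((i : H.root).1 : H → K) + -((j : H.root).1 : H → K)) ≠ ⊥ := by
      intro h3; rw [h3] at h1; exact h0 h1
    let β : Weight K H L := ⟨_, h2⟩
    have h3 : β.IsNonZero := by
      intro h4
      have h5 : ((i : H.root).1 : H → K) + -((j : H.root).1 : H → K) = 0 := h4
      rw [← sub_eq_add_neg, sub_eq_zero] at h5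
      exact hij (Subtype.ext (Subtype.ext (DFunLike.coe_injective h5)))
    apply b.sub_notMem_range_root i.2 j.2
    refine ⟨⟨β, by simpa using h3⟩, ?_⟩
    ext y
    simp [β, sub_eq_add_neg]
  let c := b.toCoweightBasis.repr h
  have hc : (h : L) = ∑ i, c i • x i := by
    have h1 := b.toCoweightBasis.sum_repr h
    simp only [hx]
    conv_lhs => rw [← h1]
    simp [c]
  have hlie : ∀ (α : H → K) (y : L), y ∈ rootSpace H α → ⁅(h : L), y⁆ = α h • y :=
    fun α y hy => lie_eq_smul_of_mem_rootSpace hy h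
  refine ⟨h, ∑ i, e i, ∑ i, c i • f i, ?_, ?_, ?_, ?_⟩
  · rw [hc, sum_lie]
    refine Finset.sum_congr rfl fun i _ => ?_
    rw [lie_sum, Finset.sum_eq_single i, lie_smul, (hs i).lie_e_f]
    · intro j _ hj
      rw [lie_smul, hef i j hj.symm, smul_zero]
    · simp
  · rw [lie_sum, Finset.smul_sum]
    refine Finset.sum_congr rfl fun i _ => ?_
    rw [hlie _ _ (he i), hh]
  · rw [lie_sum, Finset.smul_sum, ← Finset.sum_neg_distrib]
    refine Finset.sum_congr rfl fun i _ => ?_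
    rw [lie_smul, hlie _ _ (hf i), Pi.neg_apply, hh, neg_smul, smul_neg, smul_comm]
  · intro α hα
    by_cases h0 : α = 0
    · exact ⟨0, by simp [h0], fun _ => h0⟩
    let β : Weight K H L := ⟨α, hα⟩
    have hβ : β.IsNonZero := h0
    let β' : H.root := ⟨β, by simpa using hβ⟩
    refine ⟨b.height β', ?_, fun h1 => absurd h1 (b.height_ne_zero β')⟩
    obtain ⟨n, -, -, hn⟩ := b.exists_root_eq_sum_int β'
    rw [RootPairing.Base.height_eq_sum hn]
    have h1 : α h = (rootSystem H).root β' h := rfl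
    rw [h1, hn, LinearMap.sum_apply, Int.cast_sum, Finset.mul_sum]
    refine Finset.sum_congr rfl fun i hi => ?_
    have h2 : (rootSystem H).root i h = 2 := hh ⟨i, hi⟩
    rw [LinearMap.smul_apply, h2, zsmul_eq_mul, mul_comm]

end principal

end

section

open LieAlgebra LieAlgebra.IsKilling LieModule Module

section parity
variable {K L V : Type*} [Field K] [IsAlgClosed K] [CharZero K] [LieRing L] [LieAlgebra K L]
  [FiniteDimensional K L] [LieAlgebra.IsKilling K L] (H : LieSubalgebra K L) [H.IsCartanSubalgebra]
  [AddCommGroup V] [Module K V] [FiniteDimensional K V] [LieRingModule L V] [LieModule K L V]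

lemma eq_top_of_rootSpace_stable
    (hirr : ∀ N : Submodule K V, (∀ x : L, ∀ v ∈ N, ⁅x, v⁆ ∈ N) → N = ⊥ ∨ N = ⊤)
    (N : Submodule K V) (hN : N ≠ ⊥)
    (h : ∀ (α : H → K) (x : L), rootSpace H α ≠ ⊥ → x ∈ rootSpace H α → ∀ v ∈ N, ⁅x, v⁆ ∈ N) :
    N = ⊤ := by
  refine (hirr N ?_).resolve_left hN
  intro x
  have hx : x ∈ ⨆ χ : Weight K H L, (genWeightSpace L χ : LieSubmodule K H L) := by
    rw [iSup_genWeightSpace_eq_top']; trivial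
  induction hx using LieSubmodule.iSup_induction' with
  | mem χ y hy => exact h χ y χ.2 hy
  | zero => intro v _; simp
  | add y z _ _ hy hz => intro v hv; rw [add_lie]; exact N.add_mem (hy v hv) (hz v hv)

/-- the words obtained from `v` by applying root vectors of negative degree -/
inductive Word (h : H) (v : V) : V → Prop
  | base : Word h v v
  | step (α : H → K) (x : L) (n : ℤ) (w : V) : x ∈ rootSpace H α → α h = 2 * (n : K) → n < 0 →
      Word h v w → Word h v ⁅x, w⁆

theorem eq_zero_of_symplectic
    (hirr : ∀ N : Submodule K V, (∀ x : L, ∀ v ∈ N, ⁅x, v⁆ ∈ N) → N = ⊥ ∨ N = ⊤)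
    (ω : V →ₗ[K] V →ₗ[K] K) (hinv : ∀ (x : L) (u v : V), ω ⁅x, u⁆ v = -ω u ⁅x, v⁆)
    (halt : ∀ u v, ω u v = -ω v u) (hnd : ∀ v, (∀ u, ω u v = 0) → v = 0)
    (v₀ : V) (hv₀ : ∀ x ∈ H, ⁅x, v₀⁆ = 0) : v₀ = 0 := by
  classical
  by_contra hne
  obtain ⟨h, e, f, hef, hhe, hhf, hα⟩ := exists_principal H
  let A : End K V := toEnd K L V (h : L)
  let E : ℤ → Submodule K V := fun k => A.eigenspace (2 * (k : K))
  have memE : ∀ k v, v ∈ E k ↔ ⁅(h : L), v⁆ = (2 * (k : K)) • v := fun k v => by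
    rw [Module.End.mem_eigenspace_iff]; rfl
  have hinj : Function.Injective fun k : ℤ => 2 * (k : K) := by
    intro a b hab; simpa using hab
  have hind : iSupIndep E := (Module.End.eigenspaces_iSupIndep A).comp hinj
  have hE : ∀ (α : H → K) (x : L) (n k : ℤ) (v : V), x ∈ rootSpace H α → α h = 2 * (n : K) → v ∈ E k →
      ⁅x, v⁆ ∈ E (n + k) := by
    intro α x n k v hx hn hv
    rw [memE] at hv ⊢
    have hx' : ⁅(h : L), x⁆ = α h • x := lie_eq_smul_of_mem_rootSpace hx h
    rw [leibniz_lie, hv, hx', hn, smul_lie, lie_smul]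
    push_cast; module
  have htop : ⨆ k, E k = ⊤ := by
    apply eq_top_of_rootSpace_stable H hirr
    · intro h0
      apply hne
      have : v₀ ∈ E 0 := by
        rw [memE, hv₀ _ h.2]; simp
      have := Submodule.mem_iSup_of_mem (p := E) 0 this
      rwa [h0] at this
    · intro α x hα' hx v hv
      obtain ⟨n, hn, -⟩ := hα α hα'
      induction hv using Submodule.iSup_induction' with
      | mem k v hv => exact Submodule.mem_iSup_of_mem (n + k) (hE α x n k v hx hn hv)
      | zero => simp
      | add y z _ _ hy hz => rw [lie_add]; exact Submodule.add_mem _ hy hz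
  obtain ⟨d, hd, hmax⟩ : ∃ d, E d ≠ ⊥ ∧ ∀ k, d < k → E k = ⊥ := by
    have hfin : {k | E k ≠ ⊥}.Finite :=
      (Module.End.finite_hasEigenvalue A).preimage hinj.injOn
    have hnon : {k | E k ≠ ⊥}.Nonempty := by
      by_contra hc
      rw [Set.not_nonempty_iff_eq_empty] at hc
      have : ∀ k, E k = ⊥ := fun k => by
        by_contra hk
        have : k ∈ {k | E k ≠ ⊥} := hk
        rw [hc] at this; exact this
      simp only [this, iSup_bot] at htop
      apply hne
      have h1 : v₀ ∈ (⊤ : Submodule K V) := trivial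
      rwa [← htop] at h1
    obtain ⟨d, hd, hmax⟩ := Set.exists_max_image _ id hfin hnon
    refine ⟨d, hd, fun k hk => ?_⟩
    by_contra hk'
    exact absurd (hmax k hk') (not_le.mpr hk)
  -- a weight vector in the top eigenspace
  obtain ⟨v, hv0, hvd, χ, hχ⟩ : ∃ v, v ≠ 0 ∧ v ∈ E d ∧ ∃ χ : H → K, ∀ x : H, ⁅x, v⁆ = χ x • v := by
    let N : LieSubmodule K H V := { E d with
      lie_mem := by
        intro x m hm
        have hm : m ∈ E d := hm
        show ⁅(x : L), m⁆ ∈ E d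
        rw [memE] at hm ⊢
        have h1 : ⁅(h : L), (x : L)⁆ = 0 := congrArg Subtype.val (trivial_lie_zero H H h x)
        rw [leibniz_lie, h1, zero_lie, zero_add, hm, lie_smul] }
    have : Nontrivial N := Submodule.nontrivial_iff_ne_bot.mpr hd
    obtain ⟨χ, hχ⟩ := exists_nontrivial_weightSpace_of_isSolvable K H N
    obtain ⟨⟨⟨v, hvN⟩, hv⟩, hv'⟩ := exists_ne (0 : weightSpace N χ)
    refine ⟨v, fun h0 => hv' ?_, hvN, χ, fun x => ?_⟩
    · ext; exact h0
    · rw [mem_weightSpace] at hv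
      exact congrArg Subtype.val (hv x)
  let M : Submodule K V := Submodule.span K {w | Word H h v w}
  have hMstep : ∀ (α : H → K) (x : L) (n : ℤ), x ∈ rootSpace H α → α h = 2 * (n : K) → n < 0 →
      ∀ w ∈ M, ⁅x, w⁆ ∈ M := by
    intro α x n hx hn hn0 w hw
    induction hw using Submodule.span_induction with
    | mem w hw => exact Submodule.subset_span (Word.step α x n w hx hn hn0 hw)
    | zero => simp
    | add y z _ _ hy hz => rw [lie_add]; exact Submodule.add_mem _ hy hz
    | smul c y _ hy => rw [lie_smul]; exact Submodule.smul_mem _ _ hy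
  have hMw : ∀ w, Word H h v w → ∀ (α : H → K) (x : L), x ∈ rootSpace H α → ⁅x, w⁆ ∈ M := by
    intro w hw
    induction hw with
    | base =>
      intro α x hx
      by_cases hx0 : x = 0
      · simp [hx0]
      have hbot : rootSpace H α ≠ ⊥ := by
        intro h0; rw [h0] at hx; exact hx0 hx
      obtain ⟨n, hn, hn'⟩ := hα α hbot
      rcases lt_trichotomy n 0 with h1 | h1 | h1
      · exact Submodule.subset_span (Word.step α x n v hx hn h1 Word.base)
      · rw [hn' h1] at hx
        have hxH : x ∈ H := by simpa using hx
        have := hχ ⟨x, hxH⟩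
        change ⁅x, v⁆ = _ at this
        rw [this]
        exact Submodule.smul_mem _ _ (Submodule.subset_span Word.base)
      · have := hE α x n d v hx hn hvd
        rw [hmax _ (by omega), Submodule.mem_bot] at this
        rw [this]; exact Submodule.zero_mem _
    | step β y m w hy hm hm0 hw ih =>
      intro α x hx
      rw [leibniz_lie]
      refine Submodule.add_mem _ (ih _ _ (lie_mem_genWeightSpace_of_mem_genWeightSpace hx hy)) ?_
      exact hMstep β y m hy hm hm0 _ (ih α x hx)
  have hMtop : M = ⊤ := by
    apply eq_top_of_rootSpace_stable H hirr
    · intro h0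
      have : v ∈ M := Submodule.subset_span Word.base
      rw [h0] at this; exact hv0 this
    · intro α x _ hx w hw
      induction hw using Submodule.span_induction with
      | mem w hw => exact hMw w hw α x hx
      | zero => simp
      | add y z _ _ hy hz => rw [lie_add]; exact Submodule.add_mem _ hy hz
      | smul c y _ hy => rw [lie_smul]; exact Submodule.smul_mem _ _ hy
  have hword : ∀ w, Word H h v w → w = v ∨ ∃ k, k < d ∧ w ∈ E k := by
    intro w hw
    induction hw with
    | base => exact Or.inl rfl
    | step β y m w hy hm hm0 hw ih =>
      right
      rcases ih with rfl | ⟨k, hk, hwk⟩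
      · exact ⟨m + d, by omega, hE β y m d _ hy hm hvd⟩
      · exact ⟨m + k, by omega, hE β y m k _ hy hm hwk⟩
  have hone : ∀ u ∈ E d, ∃ c : K, u = c • v := by
    intro u hu
    have h1 : u ∈ M := by rw [hMtop]; trivial
    have h2 : M ≤ Submodule.span K {v} ⊔ ⨆ k ≠ d, E k := by
      apply Submodule.span_le.mpr
      intro w hw
      rcases hword w hw with rfl | ⟨k, hk, hwk⟩
      · exact Submodule.mem_sup_left (Submodule.mem_span_singleton_self _)
      · exact Submodule.mem_sup_right (Submodule.mem_iSup_of_mem k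
          (Submodule.mem_iSup_of_mem hk.ne hwk))
    obtain ⟨a, ha, b, hb, hab⟩ := Submodule.mem_sup.mp (h2 h1)
    obtain ⟨c, rfl⟩ := Submodule.mem_span_singleton.mp ha
    refine ⟨c, ?_⟩
    have h3 : b ∈ E d := by
      have : b = u - c • v := by rw [← hab]; abel
      rw [this]; exact Submodule.sub_mem _ hu (Submodule.smul_mem _ _ hvd)
    have h4 := Submodule.disjoint_def.mp (hind d) b h3 hb
    rw [← hab, h4, add_zero]
  -- the lowest weight vector
  obtain ⟨n, hn, hfn⟩ : ∃ n : ℕ, 2 * d = n ∧ ((toEnd K L V f) ^ n) v ≠ 0 ∧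
      ((toEnd K L V f) ^ n) v ∈ E (-d) := by
    by_cases hh0 : (h : L) = 0
    · have : d = 0 := by
        have := (memE d v).mp hvd
        rw [hh0, zero_lie, eq_comm, smul_eq_zero] at this
        have := this.resolve_right hv0
        simpa using this
      subst this
      exact ⟨0, by simp, by simpa using hv0, by simpa using hvd⟩
    · have ht : IsSl2Triple (h : L) e f := by
        refine ⟨hh0, hef, ?_, ?_⟩
        · rw [hhe]; simp [two_smul]
        · rw [hhf]; simp [two_smul]
      have hP : ht.HasPrimitiveVectorWith v (2 * (d : K)) := by
        refine ⟨hv0, (memE d v).mp hvd, ?_⟩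
        have : ⁅e, v⁆ ∈ E (1 + d) := by
          rw [memE, leibniz_lie, hhe, (memE d v).mp hvd, smul_lie, lie_smul]
          push_cast; module
        rwa [hmax _ (by omega), Submodule.mem_bot] at this
      obtain ⟨n, hn⟩ := hP.exists_nat
      refine ⟨n, by exact_mod_cast hn, hP.pow_toEnd_f_ne_zero_of_eq_nat hn le_rfl, ?_⟩
      rw [memE, hP.lie_h_pow_toEnd_f, ← hn]
      push_cast; congr 1; ring
  have hskew : ∀ (m : ℕ) (u w : V), ω (((toEnd K L V f) ^ m) u) w =
      (-1) ^ m * ω u (((toEnd K L V f) ^ m) w) := by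
    intro m
    induction m with
    | zero => simp
    | succ m ih =>
      intro u w
      rw [pow_succ, Module.End.mul_apply, ih, toEnd_apply_apply, hinv, ← toEnd_apply_apply K,
        ← Module.End.mul_apply, pow_succ, mul_neg, mul_neg_one, neg_mul, ← pow_succ', ← pow_succ]
  have h0 : ω v (((toEnd K L V f) ^ n) v) = 0 := by
    have h1 := hskew n v v
    rw [halt] at h1
    have : Even n := ⟨d.toNat, by omega⟩
    rw [this.neg_one_pow, one_mul] at h1
    have : (2 : K) * ω v (((toEnd K L V f) ^ n) v) = 0 := by
      linear_combination -h1
    simpa using this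
  apply hfn.1
  apply hnd
  intro u
  have hu : u ∈ ⨆ k, E k := by rw [htop]; trivial
  induction hu using Submodule.iSup_induction' with
  | mem k u hu =>
    by_cases hk : k = d
    · subst hk
      obtain ⟨c, rfl⟩ := hone u hu
      rw [map_smul, LinearMap.smul_apply, h0, smul_zero]
    · have h1 := hinv (h : L) u (((toEnd K L V f) ^ n) v)
      rw [(memE _ _).mp hu, (memE _ _).mp hfn.2, map_smul, map_smul, LinearMap.smul_apply,
        smul_eq_mul, smul_eq_mul] at h1
      have h2 : (2 * ((k : K) - d)) * ω u (((toEnd K L V f) ^ n) v) = 0 := by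
        push_cast at h1; linear_combination h1
      rcases mul_eq_zero.mp h2 with h3 | h3
      · exfalso; apply hk
        have : ((k : K) - d) = 0 := by simpa using h3
        exact_mod_cast sub_eq_zero.mp this
      · exact h3
  | zero => simp
  | add y z _ _ hy hz => rw [map_add, LinearMap.add_apply, hy, hz, add_zero]

end parity

end

section

open LieAlgebra LieModule Module

section linear
variable {K M : Type*} [Field K] [AddCommGroup M] [Module K M]

lemma isSemisimple_of_iSup_eigenspace [FiniteDimensional K M] {A : End K M}
    (h : ⨆ c, A.eigenspace c = ⊤) : A.IsSemisimple := by
  classical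
  let s : Finset K := (Module.End.finite_hasEigenvalue A).toFinset
  let p : Polynomial K := ∏ c ∈ s, (Polynomial.X - Polynomial.C c)
  have hp : Squarefree p := by
    have : p.Separable := Polynomial.separable_prod_X_sub_C_iff'.mpr (fun x _ y _ h => h)
    exact this.squarefree
  refine Module.End.isSemisimple_of_squarefree_aeval_eq_zero hp ?_
  ext x
  have hx : x ∈ ⨆ c, A.eigenspace c := by rw [h]; trivial
  induction hx using Submodule.iSup_induction' with
  | mem c x hx =>
    by_cases h0 : x = 0
    · simp [h0]
    have hc : c ∈ s := by
      simp only [s, Set.Finite.mem_toFinset]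
      exact Module.End.hasEigenvalue_of_hasEigenvector ⟨hx, h0⟩
    have : Polynomial.X - Polynomial.C c ∣ p := Finset.dvd_prod_of_mem _ hc
    obtain ⟨q, hq⟩ := this
    rw [hq, mul_comm, map_mul, Module.End.mul_apply]
    have h1 : (Polynomial.aeval A) (Polynomial.X - Polynomial.C c) x = 0 := by
      have := Module.End.mem_eigenspace_iff.mp hx
      simp [this]
    rw [h1, map_zero, LinearMap.zero_apply]
  | zero => simp
  | add y z _ _ hy hz => rw [map_add, hy, hz, LinearMap.zero_apply, LinearMap.zero_apply, LinearMap.zero_apply, add_zero]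

lemma apply_eq_zero_of_apply_apply {A : End K M} (h : A.IsSemisimple) {x : M}
    (hx : A (A x) = 0) : A x = 0 := by
  have h1 := h.isFinitelySemisimple.genEigenspace_eq_eigenspace 0 (k := 2) (by norm_num)
  have h2 : x ∈ A.genEigenspace 0 2 := by
    have : x ∈ A.genEigenspace 0 (2 : ℕ) := by
      rw [Module.End.mem_genEigenspace_nat]
      simpa [pow_two] using hx
    exact this
  rw [h1] at h2
  simpa using Module.End.mem_eigenspace_iff.mp h2

variable [IsAlgClosed K] [FiniteDimensional K M] {ι : Type*} (f : ι → End K M)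
  (hc : ∀ i j, Commute (f i) (f j)) (hs : ∀ i, (f i).IsSemisimple)
include hc hs

lemma iSup_iInf_eigenspace : ⨆ χ : ι → K, ⨅ i, (f i).eigenspace (χ i) = ⊤ := by
  have := Module.End.iSup_iInf_maxGenEigenspace_eq_top_of_iSup_maxGenEigenspace_eq_top_of_commute f
    (fun i j _ => hc i j) (fun i => Module.End.iSup_maxGenEigenspace_eq_top (f i))
  simpa only [(hs _).isFinitelySemisimple.maxGenEigenspace_eq_eigenspace] using this

lemma iSupIndep_iInf_eigenspace : iSupIndep fun χ : ι → K => ⨅ i, (f i).eigenspace (χ i) := by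
  have := Module.End.independent_iInf_maxGenEigenspace_of_forall_mapsTo f
    (fun i j φ => Module.End.mapsTo_maxGenEigenspace_of_comm (hc j i) φ)
  simpa only [(hs _).isFinitelySemisimple.maxGenEigenspace_eq_eigenspace] using this

lemma exists_invariant_add (x : M) : ∃ y, (∀ i, f i y = 0) ∧ x - y ∈ ⨆ i, (f i).range := by
  have hx : x ∈ ⨆ χ : ι → K, ⨅ i, (f i).eigenspace (χ i) := by
    rw [iSup_iInf_eigenspace f hc hs]; trivial
  induction hx using Submodule.iSup_induction' with
  | mem χ x hx =>
    simp only [Submodule.mem_iInf, Module.End.mem_eigenspace_iff] at hx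
    by_cases h0 : ∀ i, χ i = 0
    · exact ⟨x, fun i => by rw [hx, h0, zero_smul], by simp⟩
    · push Not at h0
      obtain ⟨i, hi⟩ := h0
      refine ⟨0, by simp, Submodule.mem_iSup_of_mem i ⟨(χ i)⁻¹ • x, ?_⟩⟩
      rw [map_smul, hx, smul_smul, inv_mul_cancel₀ hi, one_smul, sub_zero]
  | zero => exact ⟨0, by simp, by simp⟩
  | add a b _ _ ha hb =>
    obtain ⟨y, hy, hy'⟩ := ha
    obtain ⟨z, hz, hz'⟩ := hb
    refine ⟨y + z, fun i => by rw [map_add, hy, hz, add_zero], ?_⟩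
    rw [add_sub_add_comm]
    exact Submodule.add_mem _ hy' hz'

lemma eq_zero_of_invariant_of_mem_range (x : M) (h0 : ∀ i, f i x = 0)
    (hx : x ∈ ⨆ i, (f i).range) : x = 0 := by
  refine Submodule.disjoint_def.mp (iSupIndep_iInf_eigenspace f hc hs 0) x ?_ ?_
  · simpa using h0
  · refine (iSup_le fun i => ?_ : ⨆ i, (f i).range ≤ _) hx
    rintro _ ⟨y, rfl⟩
    have hy : y ∈ ⨆ χ : ι → K, ⨅ i, (f i).eigenspace (χ i) := by
      rw [iSup_iInf_eigenspace f hc hs]; trivial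
    induction hy using Submodule.iSup_induction' with
    | mem χ y hy =>
      have hy' := hy
      simp only [Submodule.mem_iInf, Module.End.mem_eigenspace_iff] at hy'
      rw [hy']
      by_cases h : χ = 0
      · simp [h]
      · exact Submodule.smul_mem _ _ (Submodule.mem_iSup_of_mem χ (Submodule.mem_iSup_of_mem h hy))
    | zero => simp
    | add a b _ _ ha hb => rw [map_add]; exact Submodule.add_mem _ ha hb

end linear

section core
variable {K L : Type*} [Field K] [IsAlgClosed K] [CharZero K] [LieRing L] [LieAlgebra K L]
  [FiniteDimensional K L]

lemma lie_ad_commute {x y : L} (h : ⁅x, y⁆ = 0) : Commute (ad K L x) (ad K L y) := by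
  ext z
  have := leibniz_lie x y z
  rw [h, zero_lie, zero_add] at this
  exact this

lemma mem_center_iff' {x : L} : x ∈ center K L ↔ ∀ y : L, ⁅x, y⁆ = 0 := by
  rw [LieModule.mem_maxTrivSubmodule]
  refine forall_congr' fun y => ?_
  rw [← lie_skew, neg_eq_zero]

theorem exists_core (hab : ∀ I : LieIdeal K L, IsLieAbelian I → I ≤ center K L) (T : Set L)
    (hT : ∀ x ∈ T, ∀ y ∈ T, ⁅x, y⁆ = 0) (hss : ∀ x ∈ T, (ad K L x).IsSemisimple)
    (hrad : ¬ radical K L ≤ center K L) :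
    ∃ (W : LieIdeal K L) (ζ : L →ₗ[K] K), center K L < W ∧
      (∀ I : LieIdeal K L, center K L ≤ I → I ≤ W → I = center K L ∨ I = W) ∧
      (∀ w ∈ W, ∀ w' ∈ W, ⁅w, w'⁆ ∈ center K L) ∧
      (∀ w ∈ W, (∀ w' ∈ W, ζ ⁅w, w'⁆ = 0) → w ∈ center K L) ∧
      ∀ t ∈ T, ∀ x, ζ ⁅t, x⁆ = 0 := by
  classical
  have hwf : WellFoundedLT (LieIdeal K L) := LieSubmodule.wellFoundedLT_of_isArtinian K L L
  have hne : {I : LieIdeal K L | center K L < I ∧ I ≤ radical K L}.Nonempty :=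
    ⟨radical K L, lt_of_le_of_ne (center_le_radical K L) fun h => hrad h.ge, le_rfl⟩
  obtain ⟨W, ⟨hZW, hWr⟩, hmin⟩ := hwf.wf.has_min _ hne
  have hmin' : ∀ I : LieIdeal K L, center K L ≤ I → I ≤ W → I = center K L ∨ I = W := by
    intro I h1 h2
    by_contra hc
    push Not at hc
    exact hmin I ⟨lt_of_le_of_ne h1 (Ne.symm hc.1), h2.trans hWr⟩ (lt_of_le_of_ne h2 hc.2)
  have hWs : IsSolvable W := (LieIdeal.solvable_iff_le_radical K L W).mpr hWr
  have hZabs : ∀ I : LieIdeal K L, ⁅center K L ⊔ I, center K L ⊔ I⁆ ≤ ⁅I, I⁆ := by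
    intro I
    rw [LieSubmodule.lieIdeal_oper_eq_span, LieSubmodule.lieSpan_le]
    rintro _ ⟨⟨x, hx⟩, ⟨y, hy⟩, rfl⟩
    obtain ⟨z, hz, a, ha, rfl⟩ := (LieSubmodule.mem_sup _ _ _).mp hx
    obtain ⟨z', hz', a', ha', rfl⟩ := (LieSubmodule.mem_sup _ _ _).mp hy
    have h1 : ⁅a, z'⁆ = 0 := (mem_maxTrivSubmodule K L L z').mp hz' a
    have h2 := mem_center_iff'.mp hz
    simp only [add_lie, lie_add, h1, h2, zero_add]
    exact LieSubmodule.lie_mem_lie ha ha'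
  have hWW : ⁅W, W⁆ ≤ center K L := by
    rcases hmin' (center K L ⊔ ⁅W, W⁆) le_sup_left
      (sup_le hZW.le (LieSubmodule.lie_le_right W W)) with h | h
    · rw [← h]; exact le_sup_right
    · exfalso
      have h1 : ⁅W, W⁆ ≤ ⁅⁅W, W⁆, ⁅W, W⁆⁆ := by
        conv_lhs => rw [← h]
        exact hZabs _
      have h2 : ∀ k, ⁅W, W⁆ ≤ derivedSeriesOfIdeal K L k W := by
        intro k
        induction k with
        | zero => exact LieSubmodule.lie_le_right W W
        | succ k ih =>
          rw [derivedSeriesOfIdeal_succ]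
          exact h1.trans (LieSubmodule.mono_lie ih ih)
      obtain ⟨k, hk⟩ := IsSolvable.solvable K W
      rw [LieIdeal.derivedSeries_eq_bot_iff] at hk
      have h3 := h2 k
      rw [hk, le_bot_iff] at h3
      have : IsLieAbelian W := (LieSubmodule.lie_abelian_iff_lie_self_eq_bot W).mpr h3
      exact not_le_of_gt hZW (hab W this)
  obtain ⟨w₁, hw₁, w₂, hw₂, hw⟩ : ∃ w₁ ∈ W, ∃ w₂ ∈ W, ⁅w₁, w₂⁆ ≠ 0 := by
    by_contra hc
    push Not at hc
    refine not_le_of_gt hZW (hab W ⟨fun x y => Subtype.ext (hc x x.2 y y.2)⟩)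
  have hz : ⁅w₁, w₂⁆ ∈ center K L := hWW (LieSubmodule.lie_mem_lie hw₁ hw₂)
  obtain ⟨ζ, hζ, hζT⟩ : ∃ ζ : L →ₗ[K] K, ζ ⁅w₁, w₂⁆ ≠ 0 ∧ ∀ t ∈ T, ∀ x, ζ ⁅t, x⁆ = 0 := by
    let f : T → End K L := fun t => ad K L t
    have h1 : ⁅w₁, w₂⁆ ∉ ⨆ i, (f i).range := fun hc =>
      hw (eq_zero_of_invariant_of_mem_range f (fun i j => lie_ad_commute (hT _ i.2 _ j.2))
        (fun i => hss _ i.2) _ (fun i => (mem_maxTrivSubmodule K L L _).mp hz i) hc)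
    obtain ⟨ζ, h2, h3⟩ := Submodule.exists_le_ker_of_notMem h1
    refine ⟨ζ, h2, fun t ht x => ?_⟩
    exact h3 (Submodule.mem_iSup_of_mem (⟨t, ht⟩ : T) ⟨x, rfl⟩)
  refine ⟨W, ζ, hZW, hmin', fun w hw w' hw' => hWW (LieSubmodule.lie_mem_lie hw hw'), ?_, hζT⟩
  let R : LieIdeal K L :=
    { carrier := {w | w ∈ W ∧ ∀ w' ∈ W, ζ ⁅w, w'⁆ = 0}
      add_mem' := fun {a b} ha hb => ⟨W.add_mem ha.1 hb.1, fun w' hw' => by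
        rw [add_lie, map_add, ha.2 _ hw', hb.2 _ hw', add_zero]⟩
      zero_mem' := ⟨W.zero_mem, fun w' _ => by simp⟩
      smul_mem' := fun c x hx => ⟨W.smul_mem c hx.1, fun w' hw' => by
        rw [smul_lie, map_smul, hx.2 _ hw', smul_zero]⟩
      lie_mem := fun {x m} hm => ⟨W.lie_mem hm.1, fun w' hw' => by
        have h1 : ⁅x, ⁅m, w'⁆⁆ = 0 :=
          (mem_maxTrivSubmodule K L L _).mp (hWW (LieSubmodule.lie_mem_lie hm.1 hw')) x
        rw [leibniz_lie] at h1
        rw [eq_neg_of_add_eq_zero_left h1, map_neg, hm.2 _ (W.lie_mem hw'), neg_zero]⟩ }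
  have hR : R = center K L := by
    refine (hmin' R ?_ fun x hx => hx.1).resolve_right ?_
    · intro z hz
      exact ⟨hZW.le hz, fun w' _ => by rw [mem_center_iff'.mp hz, map_zero]⟩
    · intro h
      have : w₁ ∈ R := h ▸ hw₁
      exact hζ (this.2 w₂ hw₂)
  intro w h1 h2
  rw [← hR]
  exact ⟨h1, h2⟩

end core

end

section

open LieAlgebra LieModule Module
attribute [local instance] LieRing.ofAssociativeRing

/-- an ideal `W`, minimal over the center, together with a functional `ζ` such that
`ζ ⁅·, ·⁆` is a nondegenerate symplectic form on `W` modulo the center -/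
structure CoreData (K L : Type*) [Field K] [LieRing L] [LieAlgebra K L] (T : Set L) where
  W : LieIdeal K L
  ζ : L →ₗ[K] K
  center_lt : center K L < W
  minimal : ∀ I : LieIdeal K L, center K L ≤ I → I ≤ W → I = center K L ∨ I = W
  lie_mem : ∀ w ∈ W, ∀ w' ∈ W, ⁅w, w'⁆ ∈ center K L
  nondeg : ∀ w ∈ W, (∀ w' ∈ W, ζ ⁅w, w'⁆ = 0) → w ∈ center K L
  ζ_lie : ∀ t ∈ T, ∀ x, ζ ⁅t, x⁆ = 0

namespace CoreData
variable {K L : Type*} [Field K] [IsAlgClosed K] [CharZero K] [LieRing L] [LieAlgebra K L]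
  [FiniteDimensional K L] {T : Set L} (D : CoreData K L T)

/-- the stabilizer of `ζ` on `W` -/
def E : LieSubalgebra K L where
  carrier := {a | ∀ w ∈ D.W, D.ζ ⁅a, w⁆ = 0}
  add_mem' := fun {a b} ha hb w hw => by rw [add_lie, map_add, ha w hw, hb w hw, add_zero]
  zero_mem' := fun w _ => by simp
  smul_mem' := fun c x hx w hw => by rw [smul_lie, map_smul, hx w hw, smul_zero]
  lie_mem' := fun {a b} ha hb w hw => by
    rw [lie_lie, map_sub, ha _ (D.W.lie_mem hw), hb _ (D.W.lie_mem hw), sub_zero]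

lemma subset_E {t : L} (ht : t ∈ T) : t ∈ D.E := fun w _ => D.ζ_lie t ht w

lemma center_le_E {z : L} (hz : z ∈ center K L) : z ∈ D.E := fun w _ => by
  rw [mem_center_iff'.mp hz, map_zero]

lemma mem_center {w : L} (hw : w ∈ D.W) (hE : w ∈ D.E) : w ∈ center K L := D.nondeg w hw hE

lemma finrank_lt : finrank K D.E < finrank K L := by
  apply Submodule.finrank_lt (s := D.E.toSubmodule)
  rintro h
  apply not_le_of_gt D.center_lt
  intro w hw
  refine D.mem_center hw ?_
  have : w ∈ D.E.toSubmodule := by rw [h]; trivial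
  exact this

lemma exists_sub_mem (a : L) : ∃ w ∈ D.W, a - w ∈ D.E := by
  let B : D.W →ₗ[K] Dual K D.W := LinearMap.mk₂ K (fun w w' => D.ζ ⁅(w : L), (w' : L)⁆)
    (by intros; simp) (by intros; simp) (by intros; simp) (by intros; simp)
  let φ : Dual K D.W := D.ζ ∘ₗ ad K L a ∘ₗ D.W.toSubmodule.subtype
  have h1 : φ ∈ B.dualMap.range := by
    rw [LinearMap.range_dualMap_eq_dualAnnihilator_ker, Submodule.mem_dualAnnihilator]
    intro w hw
    have h2 : (w : L) ∈ center K L := D.nondeg w w.2 fun w' hw' =>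
      LinearMap.congr_fun (LinearMap.mem_ker.mp hw) ⟨w', hw'⟩
    have h3 : ⁅a, (w : L)⁆ = 0 := (mem_maxTrivSubmodule K L L _).mp h2 a
    show D.ζ ⁅a, (w : L)⁆ = 0
    rw [h3, map_zero]
  obtain ⟨ψ, hψ⟩ := h1
  obtain ⟨w₀, hw₀⟩ := (Module.evalEquiv K D.W).surjective ψ
  refine ⟨-(w₀ : L), D.W.neg_mem w₀.2, fun w hw => ?_⟩
  have h2 := LinearMap.congr_fun hψ ⟨w, hw⟩
  rw [← hw₀] at h2
  have h3 : D.ζ ⁅w, (w₀ : L)⁆ = D.ζ ⁅a, w⁆ := h2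
  rw [sub_neg_eq_add, add_lie, map_add, ← h3, ← map_add, ← lie_skew w, neg_add_cancel, map_zero]

/-- the center, as a submodule of `W` -/
def N : LieSubmodule K L D.W where
  carrier := {w | (w : L) ∈ center K L}
  add_mem' := fun ha hb => (center K L).add_mem ha hb
  zero_mem' := (center K L).zero_mem
  smul_mem' := fun c _ hx => (center K L).smul_mem c hx
  lie_mem := fun hm => (center K L).lie_mem hm

/-- the symplectic module -/
abbrev V : Type _ := D.W ⧸ D.N

/-- the projection -/
def proj : D.W →ₗ[K] D.V := D.N.toSubmodule.mkQ

lemma proj_surjective (v : D.V) : ∃ w, D.proj w = v := Submodule.mkQ_surjective _ v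

lemma proj_eq_zero {w : D.W} : D.proj w = 0 ↔ (w : L) ∈ center K L := by
  have : D.proj w = 0 ↔ w ∈ D.N.toSubmodule := Submodule.Quotient.mk_eq_zero _
  exact this

lemma lie_proj (x : L) (w : D.W) : ⁅x, D.proj w⁆ = D.proj ⁅x, w⁆ := rfl

lemma W_lie_V {x : L} (hx : x ∈ D.W) (v : D.V) : ⁅x, v⁆ = 0 := by
  obtain ⟨w, rfl⟩ := D.proj_surjective v
  rw [lie_proj, proj_eq_zero]
  exact D.lie_mem x hx w w.2

lemma irreducible (P : Submodule K D.V) (hP : ∀ x : L, ∀ v ∈ P, ⁅x, v⁆ ∈ P) : P = ⊥ ∨ P = ⊤ := by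
  let I : LieIdeal K L :=
    { (P.comap D.proj).map D.W.toSubmodule.subtype with
      lie_mem := by
        rintro x _ ⟨w, hw, rfl⟩
        exact ⟨⟨⁅x, (w : L)⁆, D.W.lie_mem w.2⟩, hP x _ hw, rfl⟩ }
  have hI : ∀ w : D.W, (w : L) ∈ I ↔ D.proj w ∈ P := by
    intro w
    constructor
    · rintro ⟨w', hw', h⟩
      have : w' = w := Subtype.ext h
      rw [← this]; exact hw'
    · intro h; exact ⟨w, h, rfl⟩
  have h1 : center K L ≤ I := by
    intro z hz
    have := (hI ⟨z, D.center_lt.le hz⟩).mpr (by rw [D.proj_eq_zero.mpr hz]; exact P.zero_mem)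
    exact this
  have h2 : I ≤ D.W := by
    rintro _ ⟨w, _, rfl⟩
    exact w.2
  rcases D.minimal I h1 h2 with h | h
  · left
    rw [eq_bot_iff]
    intro v hv
    obtain ⟨w, rfl⟩ := D.proj_surjective v
    have := (hI w).mpr hv
    rw [h] at this
    simpa using D.proj_eq_zero.mpr this
  · right
    rw [eq_top_iff]
    intro v _
    obtain ⟨w, rfl⟩ := D.proj_surjective v
    rw [← hI, h]
    exact w.2

/-- the symplectic form -/
def ω : D.V →ₗ[K] D.V →ₗ[K] K :=
  D.N.toSubmodule.liftQ
    { toFun := fun w => D.N.toSubmodule.liftQ (D.ζ ∘ₗ ad K L (w : L) ∘ₗ D.W.toSubmodule.subtype)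
        (by
          intro w' hw'
          have h3 : ⁅(w : L), (w' : L)⁆ = 0 := (mem_maxTrivSubmodule K L L _).mp hw' w
          show D.ζ ⁅(w : L), (w' : L)⁆ = 0
          rw [h3, map_zero])
      map_add' := by
        intro a b; refine LinearMap.ext fun c => ?_
        obtain ⟨c, rfl⟩ := D.proj_surjective c
        show D.ζ ⁅((a + b : D.W) : L), (c : L)⁆ = D.ζ ⁅(a : L), (c : L)⁆ + D.ζ ⁅(b : L), (c : L)⁆
        simp
      map_smul' := by
        intro a b; refine LinearMap.ext fun c => ?_
        obtain ⟨c, rfl⟩ := D.proj_surjective c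
        show D.ζ ⁅((a • b : D.W) : L), (c : L)⁆ = a • D.ζ ⁅(b : L), (c : L)⁆
        simp }
    (by
      intro w hw
      rw [LinearMap.mem_ker]
      refine LinearMap.ext fun w' => ?_
      obtain ⟨w', rfl⟩ := D.proj_surjective w'
      show D.ζ ⁅(w : L), (w' : L)⁆ = 0
      have h3 : ⁅(w : L), (w' : L)⁆ = 0 := mem_center_iff'.mp (show (w : L) ∈ center K L from hw) _
      rw [h3, map_zero])

lemma ω_proj (w w' : D.W) : D.ω (D.proj w) (D.proj w') = D.ζ ⁅(w : L), (w' : L)⁆ := rfl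

lemma ω_lie (x : L) (u v : D.V) : D.ω ⁅x, u⁆ v = -D.ω u ⁅x, v⁆ := by
  obtain ⟨u, rfl⟩ := D.proj_surjective u
  obtain ⟨v, rfl⟩ := D.proj_surjective v
  rw [lie_proj, lie_proj, ω_proj, ω_proj]
  have h1 : ⁅x, ⁅(u : L), (v : L)⁆⁆ = 0 :=
    (mem_maxTrivSubmodule K L L _).mp (D.lie_mem u u.2 v v.2) x
  rw [leibniz_lie] at h1
  rw [← map_neg]
  congr 1
  exact eq_neg_of_add_eq_zero_left h1

lemma ω_alt (u v : D.V) : D.ω u v = -D.ω v u := by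
  obtain ⟨u, rfl⟩ := D.proj_surjective u
  obtain ⟨v, rfl⟩ := D.proj_surjective v
  rw [ω_proj, ω_proj, ← map_neg, lie_skew]

lemma ω_nondeg (v : D.V) (h : ∀ u, D.ω u v = 0) : v = 0 := by
  obtain ⟨v, rfl⟩ := D.proj_surjective v
  rw [proj_eq_zero]
  refine D.nondeg v v.2 fun w hw => ?_
  rw [← D.ω_proj v ⟨w, hw⟩, ω_alt, h, neg_zero]

/-- the image of `L` in `End V` -/
abbrev S : LieSubalgebra K (End K D.V) := (toEnd K L D.V).range

/-- the map to the image -/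
abbrev toS : L →ₗ⁅K⁆ D.S := (toEnd K L D.V).rangeRestrict

lemma toS_surjective : Function.Surjective D.toS := LieHom.surjective_rangeRestrict _

lemma toS_W {w : L} (hw : w ∈ D.W) : D.toS w = 0 := by
  ext v
  exact D.W_lie_V hw v

lemma exists_toS_eq (s : D.S) : ∃ a ∈ D.E, D.toS a = s := by
  obtain ⟨a, rfl⟩ := D.toS_surjective s
  obtain ⟨w, hw, h⟩ := D.exists_sub_mem a
  exact ⟨a - w, h, by rw [map_sub, D.toS_W hw, sub_zero]⟩

instance : Nontrivial D.V := by
  by_contra h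
  rw [not_nontrivial_iff_subsingleton] at h
  refine not_le_of_gt D.center_lt fun w hw => ?_
  exact (D.proj_eq_zero (w := ⟨w, hw⟩)).mp (Subsingleton.elim _ _)

lemma irreducible_S (P : Submodule K D.V) (hP : ∀ x : D.S, ∀ v ∈ P, ⁅x, v⁆ ∈ P) :
    P = ⊥ ∨ P = ⊤ :=
  D.irreducible P fun x v hv => hP (D.toS x) v hv

instance : LieModule.IsIrreducible K D.S D.V := by
  refine LieModule.IsIrreducible.mk fun P hP => ?_
  have h := D.irreducible_S P.toSubmodule fun x v hv => P.lie_mem hv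
  rcases h with h | h
  · exact absurd (LieSubmodule.toSubmodule_injective h) hP
  · exact LieSubmodule.toSubmodule_injective h

instance : LieModule.IsFaithful K D.S D.V := by
  refine ⟨fun x y h => ?_⟩
  ext v
  exact LinearMap.congr_fun h v

lemma trace_eq_zero (x : D.S) : LinearMap.trace K _ (toEnd K D.S D.V x) = 0 := by
  obtain ⟨a, rfl⟩ := D.toS_surjective x
  let A : End K D.V := toEnd K L D.V a
  show LinearMap.trace K _ A = 0
  have hinj : Function.Injective D.ω.flip := by
    rw [← LinearMap.ker_eq_bot, LinearMap.ker_eq_bot']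
    intro v hv
    exact D.ω_nondeg v fun u => LinearMap.congr_fun hv u
  let e : D.V ≃ₗ[K] Dual K D.V :=
    LinearMap.linearEquivOfInjective D.ω.flip hinj (Subspace.dual_finrank_eq).symm
  have h1 : e.conj (-A) = A.dualMap := by
    ext φ v
    obtain ⟨u, rfl⟩ := e.surjective φ
    have h2 : ∀ u, e u = D.ω.flip u := fun u => rfl
    rw [LinearEquiv.conj_apply_apply, LinearEquiv.symm_apply_apply, h2, h2, LinearMap.dualMap_apply]
    show D.ω v (-⁅a, u⁆) = D.ω ⁅a, v⁆ u
    rw [map_neg, ω_lie]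
  have h2 := LinearMap.trace_conj' (-A) e
  rw [h1] at h2
  have h3 := LinearMap.trace_transpose' A
  have h4 : LinearMap.trace K _ A = LinearMap.trace K _ (-A) := by
    rw [← h2]; exact h3.symm
  rw [map_neg] at h4
  exact self_eq_neg.mp h4

instance : LieAlgebra.HasTrivialRadical K D.S :=
  LieAlgebra.hasTrivialRadical_of_isIrreducible_of_isFaithful K D.S D.V D.trace_eq_zero

instance : LieAlgebra.IsKilling K D.S := LieAlgebra.HasTrivialRadical.instIsKilling ..

end CoreData

end

section

open LieAlgebra LieModule Module
attribute [local instance] LieRing.ofAssociativeRing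

namespace CoreData
variable {K L : Type*} [Field K] [IsAlgClosed K] [CharZero K] [LieRing L] [LieAlgebra K L]
  [FiniteDimensional K L] {T : Set L} (D : CoreData K L T)

lemma mem_center_of_mem_abelian (hab : ∀ I : LieIdeal K L, IsLieAbelian I → I ≤ center K L)
    (A : LieIdeal K D.E) (hA : IsLieAbelian A) (a : D.E) (ha : a ∈ A) : (a : L) ∈ center K L := by
  let φ : D.E →ₗ⁅K⁆ D.S := D.toS.comp D.E.incl
  have hφ : Function.Surjective φ := fun s => by
    obtain ⟨a, ha, rfl⟩ := D.exists_toS_eq s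
    exact ⟨⟨a, ha⟩, rfl⟩
  have hcomm : ∀ a ∈ A, ∀ b ∈ A, ⁅(a : L), (b : L)⁆ = 0 := by
    intro a ha b hb
    have := congrArg (Subtype.val ∘ Subtype.val) (hA.trivial ⟨a, ha⟩ ⟨b, hb⟩)
    exact this
  let B : LieIdeal K D.S :=
    { A.toSubmodule.map φ.toLinearMap with
      lie_mem := by
        rintro x _ ⟨a, ha, rfl⟩
        obtain ⟨e, rfl⟩ := hφ x
        exact ⟨⁅e, a⁆, A.lie_mem ha, φ.map_lie e a⟩ }
  have hB : IsLieAbelian B := by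
    refine ⟨?_⟩
    rintro ⟨_, a, ha, rfl⟩ ⟨_, b, hb, rfl⟩
    apply Subtype.ext
    show ⁅φ a, φ b⁆ = 0
    rw [← LieHom.map_lie]
    have : ⁅a, b⁆ = 0 := Subtype.ext (hcomm a ha b hb)
    rw [this, map_zero]
  have hB0 : B = ⊥ := HasTrivialRadical.eq_bot_of_isSolvable (R := K) B
  have hAW : ∀ a ∈ A, ∀ w ∈ D.W, ⁅w, (a : L)⁆ ∈ center K L := by
    intro a ha w hw
    have h1 : φ a ∈ B := ⟨a, ha, rfl⟩
    rw [hB0, LieSubmodule.mem_bot] at h1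
    have h2 : D.proj ⟨⁅(a : L), w⁆, D.W.lie_mem hw⟩ = 0 :=
      LinearMap.congr_fun (congrArg Subtype.val h1) (D.proj ⟨w, hw⟩)
    have h3 := D.proj_eq_zero.mp h2
    rw [← lie_skew]
    exact (center K L).neg_mem h3
  let I : LieIdeal K L :=
    { (A.toSubmodule.map D.E.toSubmodule.subtype) ⊔ (center K L).toSubmodule with
      lie_mem := by
        intro x m hm
        obtain ⟨_, ⟨a, ha, rfl⟩, z, hz, rfl⟩ := Submodule.mem_sup.mp hm
        obtain ⟨w, hw, he⟩ := D.exists_sub_mem x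
        have hxz : ⁅x, z⁆ = 0 := (mem_maxTrivSubmodule K L L _).mp hz x
        refine Submodule.mem_sup.mpr ⟨⁅x - w, (a : L)⁆, ⟨⁅(⟨x - w, he⟩ : D.E), a⁆, A.lie_mem ha, rfl⟩,
          ⁅w, (a : L)⁆, hAW a ha w hw, ?_⟩
        show _ = ⁅x, (a : L) + z⁆
        rw [lie_add, hxz, add_zero, ← add_lie, sub_add_cancel] }
  have hI : IsLieAbelian I := by
    refine ⟨?_⟩
    rintro ⟨x, hx⟩ ⟨y, hy⟩
    apply Subtype.ext
    show ⁅x, y⁆ = 0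
    obtain ⟨_, ⟨a, ha, rfl⟩, z, hz, rfl⟩ := Submodule.mem_sup.mp hx
    obtain ⟨_, ⟨b, hb, rfl⟩, z', hz', rfl⟩ := Submodule.mem_sup.mp hy
    have h1 := mem_center_iff'.mp hz
    have h2 : ∀ x : L, ⁅x, z'⁆ = 0 := (mem_maxTrivSubmodule K L L _).mp hz'
    rw [add_lie, h1, lie_add, h2, add_zero, add_zero]
    exact hcomm a ha b hb
  exact hab I hI (Submodule.mem_sup_left ⟨a, ha, rfl⟩)

lemma reductive_E (hab : ∀ I : LieIdeal K L, IsLieAbelian I → I ≤ center K L) :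
    ∀ I : LieIdeal K D.E, IsLieAbelian I → I ≤ center K D.E := by
  intro I hI a ha
  rw [mem_center_iff']
  intro y
  exact Subtype.ext (mem_center_iff'.mp (D.mem_center_of_mem_abelian hab I hI a ha) y)

lemma center_E (hab : ∀ I : LieIdeal K L, IsLieAbelian I → I ≤ center K L) (a : D.E)
    (ha : a ∈ center K D.E) : (a : L) ∈ center K L :=
  D.mem_center_of_mem_abelian hab (center K D.E) inferInstance a ha

end CoreData

section base
variable {K L : Type*} [Field K] [IsAlgClosed K] [CharZero K] [LieRing L] [LieAlgebra K L]
  [FiniteDimensional K L]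

lemma isKilling_ad_range (hrad : radical K L ≤ center K L) :
    LieAlgebra.IsKilling K (ad K L).range := by
  have : LieAlgebra.HasTrivialRadical K (ad K L).range := by
    constructor
    let φ := (ad K L).rangeRestrict
    have hφ : Function.Surjective φ := LieHom.surjective_rangeRestrict _
    let R := radical K (ad K L).range
    let I : LieIdeal K L := R.comap φ
    have h1 : ∀ k, derivedSeriesOfIdeal K L k I ≤ (derivedSeriesOfIdeal K _ k R).comap φ := by
      intro k
      induction k with
      | zero => exact le_rfl
      | succ k ih =>
        rw [derivedSeriesOfIdeal_succ, derivedSeriesOfIdeal_succ]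
        exact (LieSubmodule.mono_lie ih ih).trans (LieIdeal.comap_bracket_le φ)
    obtain ⟨k, hk⟩ := IsSolvable.solvable K R
    rw [LieIdeal.derivedSeries_eq_bot_iff] at hk
    have h2 : derivedSeriesOfIdeal K L k I ≤ center K L := by
      intro x hx
      have h3 := h1 k hx
      rw [hk, LieIdeal.mem_comap, LieSubmodule.mem_bot] at h3
      rw [mem_center_iff']
      intro y
      exact LinearMap.congr_fun (congrArg Subtype.val h3) y
    have h3 : IsLieAbelian (derivedSeriesOfIdeal K L k I) := by
      refine ⟨?_⟩
      rintro ⟨x, hx⟩ ⟨y, hy⟩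
      exact Subtype.ext (mem_center_iff'.mp (h2 hx) y)
    rw [abelian_iff_derived_succ_eq_bot, ← LieIdeal.derivedSeries_eq_bot_iff] at h3
    have h4 : IsSolvable I := IsSolvable.mk h3
    have h5 := ((LieIdeal.solvable_iff_le_radical K L I).mp h4).trans hrad
    rw [LieSubmodule.eq_bot_iff]
    intro s hs
    obtain ⟨x, rfl⟩ := hφ s
    have h6 : x ∈ I := hs
    have h7 := mem_center_iff'.mp (h5 h6)
    ext y
    exact h7 y
  exact LieAlgebra.HasTrivialRadical.instIsKilling ..

lemma span_lie_eq_top_of_isKilling [LieAlgebra.IsKilling K L] :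
    Submodule.span K {z | ∃ a b : L, ⁅a, b⁆ = z} = ⊤ := by
  by_contra hne
  obtain ⟨x, hx⟩ : ∃ x, x ∉ Submodule.span K {z | ∃ a b : L, ⁅a, b⁆ = z} := by
    by_contra hc
    push Not at hc
    exact hne (eq_top_iff.mpr fun x _ => hc x)
  obtain ⟨φ, h1, h2⟩ := Submodule.exists_le_ker_of_notMem hx
  obtain ⟨c, rfl⟩ := ((killingForm K L).toDual (IsKilling.killingForm_nondegenerate K L)).surjective φ
  have h3 : c = 0 := by
    have h4 : c ∈ center K L := by
      rw [mem_center_iff']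
      intro b
      apply (IsKilling.killingForm_nondegenerate K L).1
      intro a
      have : (killingForm K L) c ⁅b, a⁆ = 0 := h2 (Submodule.subset_span ⟨b, a, rfl⟩)
      rw [← LieModule.traceForm_apply_lie_apply] at this
      exact this
    rw [center_eq_bot, LieSubmodule.mem_bot] at h4
    exact h4
  subst h3
  simp at h1

theorem center_sup_span_lie (n : ℕ) : ∀ {L : Type*} [LieRing L] [LieAlgebra K L]
    [FiniteDimensional K L], finrank K L = n →
    (∀ I : LieIdeal K L, IsLieAbelian I → I ≤ center K L) →
    (center K L).toSubmodule ⊔ Submodule.span K {z | ∃ a b : L, ⁅a, b⁆ = z} = ⊤ := by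
  induction n using Nat.strongRecOn with | ind n ih => ?_
  intro L _ _ _ hn hab
  rw [eq_top_iff]
  by_cases hrad : radical K L ≤ center K L
  · have := isKilling_ad_range hrad
    let φ := (ad K L).rangeRestrict
    have hφ : Function.Surjective φ := LieHom.surjective_rangeRestrict _
    have key : ∀ s : (ad K L).range, ∀ x, φ x = s → 
        x ∈ (center K L).toSubmodule ⊔ Submodule.span K {z | ∃ a b : L, ⁅a, b⁆ = z} := by
      have hz : ∀ x, φ x = 0 → x ∈ (center K L).toSubmodule ⊔ Submodule.span K {z | ∃ a b : L, ⁅a, b⁆ = z} := by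
        intro x hx
        refine Submodule.mem_sup_left (mem_center_iff'.mpr fun y => ?_)
        exact LinearMap.congr_fun (congrArg Subtype.val hx) y
      intro s
      have hs : s ∈ Submodule.span K {z | ∃ a b : (ad K L).range, ⁅a, b⁆ = z} := by
        rw [span_lie_eq_top_of_isKilling]; trivial
      induction hs using Submodule.span_induction with
      | mem s hs =>
        intro x hx
        obtain ⟨a, b, rfl⟩ := hs
        obtain ⟨a, rfl⟩ := hφ a
        obtain ⟨b, rfl⟩ := hφ b
        rw [← sub_add_cancel x ⁅a, b⁆]
        refine Submodule.add_mem _ (hz _ ?_) (Submodule.mem_sup_right (Submodule.subset_span ⟨a, b, rfl⟩))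
        rw [map_sub, hx, LieHom.map_lie, sub_self]
      | zero => exact hz
      | add s t _ _ hs ht =>
        intro x hx
        obtain ⟨y, hy⟩ := hφ s
        rw [← sub_add_cancel x y]
        refine Submodule.add_mem _ (ht _ ?_) (hs _ hy)
        rw [map_sub, hx, hy, add_sub_cancel_left]
      | smul c s _ hs =>
        intro x hx
        obtain ⟨y, hy⟩ := hφ s
        rw [← sub_add_cancel x (c • y)]
        refine Submodule.add_mem _ (hz _ ?_) (Submodule.smul_mem _ _ (hs _ hy))
        rw [map_sub, hx, map_smul, hy, sub_self]
    intro x _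
    exact key _ x rfl
  · obtain ⟨W, ζ, h1, h2, h3, h4, h5⟩ := exists_core hab ∅ (by simp) (by simp) hrad
    let D : CoreData K L ∅ := ⟨W, ζ, h1, h2, h3, h4, h5⟩
    have hE := ih _ (hn ▸ D.finrank_lt) (L := D.E) rfl (D.reductive_E hab)
    intro x _
    obtain ⟨w, hw, he⟩ := D.exists_sub_mem x
    rw [← sub_add_cancel x w]
    refine Submodule.add_mem _ ?_ ?_
    · have h6 : (⟨x - w, he⟩ : D.E) ∈ (⊤ : Submodule K D.E) := trivial
      rw [← hE] at h6
      have h7 : ((center K D.E).toSubmodule ⊔ Submodule.span K {z | ∃ a b : D.E, ⁅a, b⁆ = z}) ≤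
          ((center K L).toSubmodule ⊔ Submodule.span K {z | ∃ a b : L, ⁅a, b⁆ = z}).comap
            D.E.toSubmodule.subtype := by
        refine sup_le ?_ (Submodule.span_le.mpr ?_)
        · intro z hz
          exact Submodule.mem_sup_left (D.center_E hab z hz)
        · rintro _ ⟨a, b, rfl⟩
          exact Submodule.mem_sup_right (Submodule.subset_span ⟨a, b, rfl⟩)
      exact h7 h6
    · let I : LieIdeal K L :=
        { ((center K L).toSubmodule ⊔ Submodule.span K {z | ∃ a b : L, ⁅a, b⁆ = z}) ⊓ D.W.toSubmodule with
          lie_mem := by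
            intro x m hm
            exact ⟨Submodule.mem_sup_right (Submodule.subset_span ⟨x, m, rfl⟩), D.W.lie_mem hm.2⟩ }
      rcases D.minimal I (fun z hz => ⟨Submodule.mem_sup_left hz, D.center_lt.le hz⟩)
        (fun x hx => hx.2) with h | h
      · exfalso
        have hLW : ∀ x : L, ∀ w ∈ D.W, ⁅x, w⁆ ∈ center K L := by
          intro x w hw
          rw [← h]
          exact ⟨Submodule.mem_sup_right (Submodule.subset_span ⟨x, w, rfl⟩), D.W.lie_mem hw⟩
        obtain ⟨w₁, hw₁, hw₁'⟩ := SetLike.exists_of_lt D.center_lt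
        let J : LieIdeal K L :=
          { (center K L).toSubmodule ⊔ Submodule.span K {w₁} with
            lie_mem := by
              intro x m hm
              refine Submodule.mem_sup_left (hLW x m ?_)
              refine (sup_le (a := (center K L).toSubmodule) (c := D.W.toSubmodule)
                (fun z hz => D.center_lt.le hz) ?_) hm
              rw [Submodule.span_singleton_le_iff_mem]; exact hw₁ }
        have hw₁J : w₁ ∈ J := Submodule.mem_sup_right (Submodule.mem_span_singleton_self _)
        have hJW : J = D.W := by
          refine (D.minimal J (fun z hz => Submodule.mem_sup_left hz) ?_).resolve_left ?_
          · refine sup_le (a := (center K L).toSubmodule) (c := D.W.toSubmodule)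
                (fun z hz => D.center_lt.le hz) ?_
            rw [Submodule.span_singleton_le_iff_mem]; exact hw₁
          · intro hJ
            rw [hJ] at hw₁J
            exact hw₁' hw₁J
        apply hw₁'
        refine D.nondeg w₁ hw₁ fun w' hw' => ?_
        rw [← hJW] at hw'
        obtain ⟨z, hz, y, hy, rfl⟩ := Submodule.mem_sup.mp hw'
        obtain ⟨c, rfl⟩ := Submodule.mem_span_singleton.mp hy
        have : ⁅w₁, z⁆ = 0 := (mem_maxTrivSubmodule K L L _).mp hz w₁
        rw [lie_add, this, lie_smul, lie_self, smul_zero, add_zero, map_zero]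
      · have : w ∈ I := h ▸ hw
        exact this.1

lemma isSemisimple_of_quasi (hab : ∀ I : LieIdeal K L, IsLieAbelian I → I ≤ center K L) (x : L)
    (Q : K → Submodule K L) (hQ : ∀ c a, a ∈ Q c → ⁅x, a⁆ - c • a ∈ center K L)
    (htop : ⨆ c, Q c = ⊤) : (ad K L x).IsSemisimple := by
  apply isSemisimple_of_iSup_eigenspace
  rw [eq_top_iff, ← center_sup_span_lie _ rfl hab]
  refine sup_le ?_ (Submodule.span_le.mpr ?_)
  · intro z hz
    refine Submodule.mem_iSup_of_mem 0 ?_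
    rw [Module.End.mem_eigenspace_iff, zero_smul]
    exact (mem_maxTrivSubmodule K L L _).mp hz x
  · rintro _ ⟨a, b, rfl⟩
    have ha : a ∈ ⨆ c, Q c := htop ▸ trivial
    have hb : b ∈ ⨆ c, Q c := htop ▸ trivial
    rw [SetLike.mem_coe]
    induction ha using Submodule.iSup_induction' with
    | mem c a ha =>
      induction hb using Submodule.iSup_induction' with
      | mem d b hb =>
        refine Submodule.mem_iSup_of_mem (c + d) ?_
        rw [Module.End.mem_eigenspace_iff, ad_apply, leibniz_lie]
        have h1 : ⁅⁅x, a⁆, b⁆ = c • ⁅a, b⁆ := by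
          have := mem_center_iff'.mp (hQ c a ha) b
          rwa [sub_lie, smul_lie, sub_eq_zero] at this
        have h2 : ⁅a, ⁅x, b⁆⁆ = d • ⁅a, b⁆ := by
          have := (mem_maxTrivSubmodule K L L _).mp (hQ d b hb) a
          rwa [lie_sub, lie_smul, sub_eq_zero] at this
        rw [h1, h2, add_smul]
      | zero => simp
      | add b b' _ _ hb hb' => rw [lie_add]; exact Submodule.add_mem _ hb hb'
    | zero => simp
    | add a a' _ _ ha ha' => rw [add_lie]; exact Submodule.add_mem _ ha ha'

end base

end

section

open LieAlgebra LieModule Module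
attribute [local instance] LieRing.ofAssociativeRing

section linear
variable {K M N : Type*} [Field K] [IsAlgClosed K] [AddCommGroup M] [Module K M]
  [AddCommGroup N] [Module K N]

lemma iSup_eigenspace_eq_top [FiniteDimensional K M] {A : End K M} (h : A.IsSemisimple) :
    ⨆ c, A.eigenspace c = ⊤ := by
  have := Module.End.iSup_maxGenEigenspace_eq_top A
  simpa only [h.isFinitelySemisimple.maxGenEigenspace_eq_eigenspace] using this

lemma mem_iSup_of_map_mem_iSup {κ : Type*} {f : M →ₗ[K] N} (hf : Function.Surjective f)
    {P : κ → Submodule K N} {Q : κ → Submodule K M} (h : ∀ c m, f m ∈ P c → m ∈ Q c) [Nonempty κ]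
    {m : M} (hm : f m ∈ ⨆ c, P c) : m ∈ ⨆ c, Q c := by
  have h0 : ∀ m, f m = 0 → m ∈ ⨆ c, Q c := fun m hm =>
    Submodule.mem_iSup_of_mem (Classical.arbitrary κ) (h _ _ (hm ▸ Submodule.zero_mem _))
  generalize hn : f m = n at hm
  induction hm using Submodule.iSup_induction' generalizing m with
  | mem c n hc => exact Submodule.mem_iSup_of_mem c (h c m (hn ▸ hc))
  | zero => exact h0 m hn
  | add a b _ _ ha hb =>
    obtain ⟨y, hy⟩ := hf a
    rw [← sub_add_cancel m y]
    refine Submodule.add_mem _ (hb ?_) (ha hy)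
    rw [map_sub, hn, hy, add_sub_cancel_left]

lemma isSemisimple_of_surjective [FiniteDimensional K M] [FiniteDimensional K N]
    {f : M →ₗ[K] N} (hf : Function.Surjective f)
    {A : End K M} {B : End K N} (h : ∀ m, f (A m) = B (f m)) (hA : A.IsSemisimple) :
    B.IsSemisimple := by
  apply isSemisimple_of_iSup_eigenspace
  rw [eq_top_iff]
  intro n _
  obtain ⟨m, rfl⟩ := hf n
  have hm : m ∈ ⨆ c, A.eigenspace c := by rw [iSup_eigenspace_eq_top hA]; trivial
  have : ⨆ c, A.eigenspace c ≤ (⨆ c, B.eigenspace c).comap f := by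
    refine iSup_le fun c m hm => Submodule.mem_iSup_of_mem c ?_
    rw [Module.End.mem_eigenspace_iff] at hm ⊢
    rw [← h, hm, map_smul]
  exact this hm

end linear

section toral
variable {K L : Type*} [Field K] [IsAlgClosed K] [CharZero K] [LieRing L] [LieAlgebra K L]
  [FiniteDimensional K L]

lemma isSemisimple_ad_of_surjective {M : Type*} [LieRing M] [LieAlgebra K M]
    [FiniteDimensional K M] {φ : L →ₗ⁅K⁆ M} (hφ : Function.Surjective φ) {x : L}
    (h : (ad K L x).IsSemisimple) : (ad K M (φ x)).IsSemisimple := by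
  refine isSemisimple_of_surjective (f := (φ : L →ₗ[K] M)) hφ (A := ad K L x) (fun m => ?_) h
  exact φ.map_lie x m

lemma exists_mem_of_commute_map {M : Type*} [LieRing M] [LieAlgebra K M]
    [FiniteDimensional K M] {φ : L →ₗ⁅K⁆ M} (hφ : Function.Surjective φ) {T : Submodule K L}
    (hT : ∀ x ∈ T, ∀ y ∈ T, ⁅x, y⁆ = 0) (hss : ∀ x ∈ T, (ad K L x).IsSemisimple)
    (hC : ∀ x, (∀ t ∈ T, ⁅t, x⁆ = 0) → x ∈ T) (s : M) (hs : ∀ t ∈ T, ⁅φ t, s⁆ = 0) :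
    ∃ t ∈ T, φ t = s := by
  obtain ⟨a, rfl⟩ := hφ s
  obtain ⟨y, hy, hr⟩ := exists_invariant_add (fun t : T => ad K L (t : L))
    (fun i j => lie_ad_commute (hT i i.2 j j.2)) (fun i => hss i i.2) a
  have hyT : y ∈ T := hC y (fun t ht => hy ⟨t, ht⟩)
  have hφT : ∀ x ∈ T, ∀ y ∈ T, ⁅φ x, φ y⁆ = 0 := fun x hx y hy => by
    rw [← LieHom.map_lie, hT x hx y hy, map_zero]
  refine ⟨y, hyT, ?_⟩
  rw [eq_comm, ← sub_eq_zero, ← map_sub]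
  refine eq_zero_of_invariant_of_mem_range (fun t : T => ad K M (φ t))
    (fun i j => lie_ad_commute (hφT i i.2 j j.2))
    (fun i => isSemisimple_ad_of_surjective hφ (hss i i.2)) _ ?_ ?_
  · intro t
    rw [ad_apply, map_sub, lie_sub, hφT t t.2 y hyT, sub_zero]
    exact hs t t.2
  · have h7 : ⨆ i : T, (ad K L (i : L)).range ≤
        (⨆ i : T, (ad K M (φ i)).range).comap (φ : L →ₗ[K] M) := by
      refine iSup_le fun i => ?_
      rintro _ ⟨m, rfl⟩
      refine Submodule.mem_iSup_of_mem i ⟨φ m, ?_⟩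
      exact (φ.map_lie _ _).symm
    exact h7 hr

/-- the centralizer of a set -/
def centralizerOf (T : Set L) : LieSubalgebra K L where
  carrier := {x | ∀ t ∈ T, ⁅t, x⁆ = 0}
  add_mem' := fun ha hb t ht => by rw [lie_add, ha t ht, hb t ht, add_zero]
  zero_mem' := fun t _ => lie_zero t
  smul_mem' := fun c x hx t ht => by rw [lie_smul, hx t ht, smul_zero]
  lie_mem' := fun ha hb t ht => by rw [leibniz_lie, ha t ht, hb t ht, zero_lie, lie_zero, add_zero]

theorem exists_cartan_of_toral (T : Set L)
    (hT : ∀ x ∈ T, ∀ y ∈ T, ⁅x, y⁆ = 0) (hss : ∀ x ∈ T, (ad K L x).IsSemisimple) :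
    ∃ H : LieSubalgebra K L, H.IsCartanSubalgebra ∧ T ⊆ H := by
  let C : LieSubalgebra K L := centralizerOf T
  obtain ⟨x, hx⟩ := LieAlgebra.exists_isCartanSubalgebra_engel K C
  let H1 : LieSubalgebra K C := LieSubalgebra.engel K x
  have hTC : ∀ t ∈ T, t ∈ C := fun t ht s hs => hT s hs t ht
  have hTH : ∀ t (ht : t ∈ T), (⟨t, hTC t ht⟩ : C) ∈ H1 := by
    intro t ht
    have : (⟨t, hTC t ht⟩ : C) ∈ H1.normalizer := by
      rw [LieSubalgebra.mem_normalizer_iff]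
      intro y _
      have : ⁅(⟨t, hTC t ht⟩ : C), y⁆ = 0 := Subtype.ext (y.2 t ht)
      rw [this]
      exact H1.zero_mem
    rwa [hx.self_normalizing] at this
  refine ⟨H1.map C.incl, ⟨?_, ?_⟩, fun t ht => ⟨⟨t, hTC t ht⟩, hTH t ht, rfl⟩⟩
  · have := hx.nilpotent
    let f : H1 →ₗ⁅K⁆ H1.map C.incl :=
      { toFun := fun x => ⟨((x : C) : L), ⟨x, x.2, rfl⟩⟩
        map_add' := fun _ _ => rfl
        map_smul' := fun _ _ => rfl
        map_lie' := rfl }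
    refine Function.Surjective.lieAlgebra_isNilpotent (R := K) (f := f) ?_
    rintro ⟨_, y, hy, rfl⟩
    exact ⟨⟨y, hy⟩, rfl⟩
  · refine le_antisymm (fun y hy => ?_) (LieSubalgebra.le_normalizer _)
    rw [LieSubalgebra.mem_normalizer_iff] at hy
    have hyC : y ∈ C := by
      intro t ht
      apply apply_eq_zero_of_apply_apply (hss t ht) (x := y)
      have h1 := hy t ⟨⟨t, hTC t ht⟩, hTH t ht, rfl⟩
      obtain ⟨c, hc, hc'⟩ := h1
      have h2 : ⁅t, (c : L)⁆ = 0 := c.2 t ht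
      have h3 : (c : L) = ⁅y, t⁆ := hc'
      rw [h3] at h2
      show ⁅t, ⁅t, y⁆⁆ = 0
      rw [← neg_eq_zero, ← lie_neg, lie_skew, h2]
    have : (⟨y, hyC⟩ : C) ∈ H1.normalizer := by
      rw [LieSubalgebra.mem_normalizer_iff]
      intro z hz
      obtain ⟨c, hc, hc'⟩ := hy z ⟨z, hz, rfl⟩
      have : ⁅(⟨y, hyC⟩ : C), z⁆ = c := Subtype.ext hc'.symm
      rw [this]; exact hc
    rw [hx.self_normalizing] at this
    exact ⟨⟨y, hyC⟩, this, rfl⟩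

lemma CoreData.isSemisimple_of_E {T : Set L} (D : CoreData K L T)
    (hab : ∀ I : LieIdeal K L, IsLieAbelian I → I ≤ center K L) (x : D.E)
    (hx : (ad K D.E x).IsSemisimple) : (ad K L (x : L)).IsSemisimple := by
  have hE : ∀ e : D.E, e ∈ ⨆ c, (ad K D.E x).eigenspace c := fun e => by
    rw [iSup_eigenspace_eq_top hx]; trivial
  let A : End K D.V := toEnd K L D.V x
  have hV : ⨆ c, A.eigenspace c = ⊤ := by
    refine (D.irreducible _ fun a v hv => ?_).resolve_left ?_
    · obtain ⟨w, hw, he⟩ := D.exists_sub_mem a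
      have ha : ⁅a, v⁆ = ⁅a - w, v⁆ := by rw [sub_lie, D.W_lie_V hw, sub_zero]
      rw [ha]
      suffices h : ∀ e : D.E, ⁅(e : L), v⁆ ∈ ⨆ c, A.eigenspace c from h ⟨a - w, he⟩
      intro e
      clear ha
      have h6 := hE e
      induction h6 using Submodule.iSup_induction' with
      | mem c e hc =>
        induction hv using Submodule.iSup_induction' with
        | mem d v hd =>
          refine Submodule.mem_iSup_of_mem (c + d) ?_
          rw [Module.End.mem_eigenspace_iff] at hc hd ⊢
          have hc' : ⁅(x : L), (e : L)⁆ = c • (e : L) := congrArg Subtype.val hc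
          have hd' : ⁅(x : L), v⁆ = d • v := hd
          show ⁅(x : L), ⁅(e : L), v⁆⁆ = _
          rw [leibniz_lie, hc', hd', smul_lie, lie_smul, add_smul]
        | zero => rw [lie_zero]; exact Submodule.zero_mem _
        | add u v _ _ hu hv => rw [lie_add]; exact Submodule.add_mem _ hu hv
      | zero => rw [ZeroMemClass.coe_zero, zero_lie]; exact Submodule.zero_mem _
      | add u v _ _ hu hv => rw [AddMemClass.coe_add, add_lie]; exact Submodule.add_mem _ hu hv
    · intro h0
      obtain ⟨c, hc⟩ := Module.End.exists_eigenvalue A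
      exact hc (eq_bot_iff.mpr (h0 ▸ le_iSup (fun c => A.eigenspace c) c))
  let Q : K → Submodule K L := fun c =>
    (center K L).toSubmodule.comap (ad K L (x : L) - c • LinearMap.id)
  have hQ : ∀ c a, a ∈ Q c ↔ ⁅(x : L), a⁆ - c • a ∈ center K L := fun c a => Iff.rfl
  refine isSemisimple_of_quasi hab x Q (fun c a ha => ha) ?_
  rw [eq_top_iff]
  intro a _
  obtain ⟨w, hw, he⟩ := D.exists_sub_mem a
  rw [← sub_add_cancel a w]
  refine Submodule.add_mem _ ?_ ?_
  · have h7 : ⨆ c, (ad K D.E x).eigenspace c ≤ (⨆ c, Q c).comap D.E.toSubmodule.subtype := by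
      refine iSup_le fun c e hc => Submodule.mem_iSup_of_mem c ?_
      rw [Module.End.mem_eigenspace_iff] at hc
      have hc' : ⁅(x : L), (e : L)⁆ = c • (e : L) := congrArg Subtype.val hc
      show ⁅(x : L), (e : L)⁆ - c • (e : L) ∈ center K L
      rw [hc', sub_self]
      exact (center K L).zero_mem
    exact h7 (hE ⟨a - w, he⟩)
  · have h8 : (⟨w, hw⟩ : D.W) ∈ ⨆ c, (Q c).comap D.W.toSubmodule.subtype := by
      refine mem_iSup_of_map_mem_iSup (f := D.proj) D.proj_surjective
        (P := fun c => A.eigenspace c) ?_ (by rw [hV]; trivial)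
      intro c m hm
      rw [Module.End.mem_eigenspace_iff] at hm
      have h9 : D.proj (⁅(x : L), m⁆ - c • m) = 0 := by
        rw [map_sub, map_smul, ← hm]
        exact sub_self _
      exact D.proj_eq_zero.mp h9
    have h10 : ⨆ c, (Q c).comap D.W.toSubmodule.subtype ≤ (⨆ c, Q c).comap D.W.toSubmodule.subtype :=
      iSup_le fun c => Submodule.comap_mono (le_iSup Q c)
    exact h10 h8

theorem mem_of_commute_maxToral (n : ℕ) : ∀ {L : Type*} [LieRing L] [LieAlgebra K L]
    [FiniteDimensional K L], finrank K L = n →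
    (∀ I : LieIdeal K L, IsLieAbelian I → I ≤ center K L) →
    ∀ T : Submodule K L, (∀ x ∈ T, ∀ y ∈ T, ⁅x, y⁆ = 0) → (∀ x ∈ T, (ad K L x).IsSemisimple) →
    (∀ x, (∀ t ∈ T, ⁅t, x⁆ = 0) → (ad K L x).IsSemisimple → x ∈ T) →
    ∀ x, (∀ t ∈ T, ⁅t, x⁆ = 0) → x ∈ T := by
  induction n using Nat.strongRecOn with | ind n ih => ?_
  intro L _ _ _ hn hab T hT hss hmax x hx
  have hcT : ∀ z ∈ center K L, z ∈ T := by
    intro z hz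
    refine hmax z (fun t _ => (mem_maxTrivSubmodule K L L _).mp hz t) ?_
    have : ad K L z = 0 := by
      ext y; exact mem_center_iff'.mp hz y
    rw [this]
    exact Module.End.isSemisimple_zero
  by_cases hrad : radical K L ≤ center K L
  · have := isKilling_ad_range hrad
    let φ := (ad K L).rangeRestrict
    have hφ : Function.Surjective φ := LieHom.surjective_rangeRestrict _
    have hker : ∀ x, φ x = 0 → x ∈ center K L := fun x hx =>
      mem_center_iff'.mpr fun y => LinearMap.congr_fun (congrArg Subtype.val hx) y
    have hφss : ∀ x, (ad K L x).IsSemisimple → (ad K _ (φ x)).IsSemisimple := fun x h =>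
      isSemisimple_ad_of_surjective hφ h
    obtain ⟨H, hH, hTH⟩ := exists_cartan_of_toral (K := K) (φ '' T)
      (by
        rintro _ ⟨x, hx, rfl⟩ _ ⟨y, hy, rfl⟩
        rw [← LieHom.map_lie, hT x hx y hy, map_zero])
      (by
        rintro _ ⟨x, hx, rfl⟩
        exact hφss x (hss x hx))
    have hHT : ∀ y, φ y ∈ H → y ∈ T := by
      intro y hy
      refine hmax y (fun t ht => ?_) ?_
      · apply apply_eq_zero_of_apply_apply (hss t ht) (x := y)
        refine (mem_maxTrivSubmodule K L L _).mp (hker _ ?_) t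
        rw [ad_apply, LieHom.map_lie]
        have h1 := trivial_lie_zero H H ⟨φ t, hTH ⟨t, ht, rfl⟩⟩ ⟨φ y, hy⟩
        exact congrArg Subtype.val h1
      · have h2 := IsKilling.isSemisimple_ad_of_mem_isCartanSubalgebra (K := K) hy
        refine isSemisimple_of_quasi hab y
          (fun c => ((ad K _ (φ y)).eigenspace c).comap φ.toLinearMap) ?_ ?_
        · intro c a ha
          refine hker _ ?_
          have h3 := Module.End.mem_eigenspace_iff.mp (Submodule.mem_comap.mp ha)
          rw [map_sub, LieHom.map_lie, map_smul, sub_eq_zero]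
          exact h3
        · rw [eq_top_iff]
          intro m _
          refine mem_iSup_of_map_mem_iSup (f := φ.toLinearMap) hφ
            (P := fun c => (ad K _ (φ y)).eigenspace c) (fun c m h => h) ?_
          rw [iSup_eigenspace_eq_top h2]; trivial
    apply hHT
    rw [← hH.self_normalizing, LieSubalgebra.mem_normalizer_iff]
    intro s hs
    obtain ⟨t, rfl⟩ := hφ s
    rw [← LieHom.map_lie, ← lie_skew, hx t (hHT t hs), neg_zero, map_zero]
    exact H.zero_mem
  · obtain ⟨W, ζ, h1, h2, h3, h4, h5⟩ := exists_core hab T hT hss hrad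
    obtain ⟨D⟩ : Nonempty (CoreData K L (T : Set L)) := ⟨⟨W, ζ, h1, h2, h3, h4, h5⟩⟩
    let T' : Submodule K D.E := T.comap D.E.toSubmodule.subtype
    have hss' : ∀ x ∈ T', (ad K D.E x).IsSemisimple := by
      intro x hx
      have hp : D.E.toSubmodule ∈ (ad K L x).invtSubmodule := fun y hy => D.E.lie_mem x.2 hy
      exact Module.End.IsSemisimple.restrict hp (hss x hx)
    have hT' : ∀ x ∈ T', ∀ y ∈ T', ⁅x, y⁆ = 0 := fun x hx y hy => Subtype.ext (hT _ hx _ hy)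
    have hquasi : ∀ x : D.E, (ad K D.E x).IsSemisimple → (ad K L x).IsSemisimple :=
      fun x hx => D.isSemisimple_of_E hab x hx
    have hIH := ih _ (hn ▸ D.finrank_lt) (L := D.E) rfl (D.reductive_E hab) T' hT' hss'
      (fun x hx hxs => hmax x (fun t ht => congrArg Subtype.val (hx ⟨t, D.subset_E ht⟩ ht))
        (hquasi x hxs))
    have hSs : ∀ t ∈ T, (ad K D.S (D.toS t)).IsSemisimple := fun t ht =>
      isSemisimple_ad_of_surjective D.toS_surjective (hss t ht)
    have hSc : ∀ t ∈ T, ∀ t' ∈ T, ⁅D.toS t, D.toS t'⁆ = 0 := fun t ht t' ht' => by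
      rw [← LieHom.map_lie, hT t ht t' ht', map_zero]
    obtain ⟨H, hH, hTH⟩ := exists_cartan_of_toral (K := K) (D.toS '' T)
      (by
        rintro _ ⟨x, hx, rfl⟩ _ ⟨y, hy, rfl⟩
        exact hSc x hx y hy)
      (by
        rintro _ ⟨x, hx, rfl⟩
        exact hSs x hx)
    have hHT : ∀ s ∈ H, ∃ t ∈ T, D.toS t = s := by
      intro s hs
      obtain ⟨t, ht, h⟩ := exists_mem_of_commute_map (φ := D.toS.comp D.E.incl) (T := T')
        (fun s => by obtain ⟨a, ha, rfl⟩ := D.exists_toS_eq s; exact ⟨⟨a, ha⟩, rfl⟩) hT' hss' hIH s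
        (fun t ht => congrArg Subtype.val
          (trivial_lie_zero H H ⟨D.toS (t : L), hTH ⟨t, ht, rfl⟩⟩ ⟨s, hs⟩))
      exact ⟨t, ht, h⟩
    have hVT : ∀ v : D.V, (∀ t ∈ T, ⁅t, v⁆ = 0) → v = 0 := by
      intro v hv
      refine eq_zero_of_symplectic H D.irreducible_S D.ω ?_ D.ω_alt D.ω_nondeg v ?_
      · intro s u v
        obtain ⟨x, rfl⟩ := D.toS_surjective s
        exact D.ω_lie x u v
      · intro s hs
        obtain ⟨t, ht, rfl⟩ := hHT s hs
        exact hv t ht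
    obtain ⟨w, hw, he⟩ := D.exists_sub_mem x
    have hwc : w ∈ center K L := by
      refine (D.proj_eq_zero (w := ⟨w, hw⟩)).mp (hVT _ fun t ht => ?_)
      rw [D.lie_proj, D.proj_eq_zero]
      refine D.mem_center (D.W.lie_mem hw) ?_
      have h8 : ⁅t, w⁆ = -⁅t, x - w⁆ := by rw [lie_sub, hx t ht, zero_sub, neg_neg]
      show ⁅t, w⁆ ∈ D.E
      rw [h8]
      exact D.E.neg_mem (D.E.lie_mem (D.subset_E ht) he)
    have hxE : x ∈ D.E := by
      rw [← sub_add_cancel x w]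
      exact D.E.add_mem he (D.center_le_E hwc)
    exact hIH ⟨x, hxE⟩ (fun t ht => Subtype.ext (hx t ht))

end toral

end

section
open LieAlgebra LieModule Module

section toral
variable {K : Type} [Field K] [IsAlgClosed K] [CharZero K]
variable {g : Type} [LieRing g] [LieAlgebra K g]

lemma IsToralIn.isSemisimple {s t : LieSubalgebra K g} [FiniteDimensional K s]
    (ht : IsToralIn K g s t) (x : s) (hx : (x : g) ∈ t) : (ad K s x).IsSemisimple := by
  refine isSemisimple_of_iSup_eigenspace (eq_top_iff.mpr fun y _ => ?_)
  have h1 : (y : g) ∈ (⨆ c, (ad K s x).eigenspace c).map s.toSubmodule.subtype := by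
    refine (iSup_le fun α => ?_ : ⨆ α : Dual K t, s.toSubmodule ⊓ adWeightSpace K g t α ≤ _)
      (ht.2.2 y.2)
    rintro z ⟨hz, hz'⟩
    refine ⟨⟨z, hz⟩, Submodule.mem_iSup_of_mem (α ⟨x, hx⟩) ?_, rfl⟩
    rw [Module.End.mem_eigenspace_iff]
    exact Subtype.ext (hz' ⟨x, hx⟩)
  obtain ⟨z, hz, hzy⟩ := h1
  rwa [show z = y from Subtype.ext hzy] at hz

lemma isToralIn_of_isSemisimple {s t : LieSubalgebra K g} [FiniteDimensional K s] (hts : t ≤ s)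
    (hab : ∀ x ∈ t, ∀ y ∈ t, ⁅x, y⁆ = 0)
    (hss : ∀ x : s, (x : g) ∈ t → (ad K s x).IsSemisimple) : IsToralIn K g s t := by
  refine ⟨hts, ⟨fun x y => Subtype.ext (hab x x.2 y y.2)⟩, fun y hy => ?_⟩
  let f : t → End K s := fun i => ad K s ⟨i, hts i.2⟩
  have hc : ∀ i j, Commute (f i) (f j) := fun i j =>
    lie_ad_commute (Subtype.ext (hab i i.2 j j.2))
  have hs : ∀ i, (f i).IsSemisimple := fun i => hss _ i.2
  have h1 : (⟨y, hy⟩ : s) ∈ ⨆ χ : t → K, ⨅ i, (f i).eigenspace (χ i) := by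
    rw [iSup_iInf_eigenspace f hc hs]; trivial
  have h2 : y ∈ (⨆ χ : t → K, ⨅ i, (f i).eigenspace (χ i)).map s.toSubmodule.subtype :=
    ⟨_, h1, rfl⟩
  refine (?_ : Submodule.map s.toSubmodule.subtype _ ≤ _) h2
  rw [Submodule.map_iSup]
  refine iSup_le fun χ => ?_
  rintro _ ⟨v, hv, rfl⟩
  by_cases h0 : v = 0
  · simp [h0]
  simp only [SetLike.mem_coe, Submodule.mem_iInf, Module.End.mem_eigenspace_iff] at hv
  have hv' : ∀ i : t, ⁅(i : g), (v : g)⁆ = χ i • (v : g) := fun i => congrArg Subtype.val (hv i)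
  have hv0 : (v : g) ≠ 0 := fun h => h0 (Subtype.ext h)
  let α : Dual K t :=
    { toFun := χ
      map_add' := fun i j => by
        apply smul_left_injective K hv0
        show χ (i + j) • (v : g) = (χ i + χ j) • (v : g)
        rw [add_smul, ← hv', ← hv', ← hv', ← add_lie]; rfl
      map_smul' := fun c i => by
        apply smul_left_injective K hv0
        show χ (c • i) • (v : g) = (c • χ i) • (v : g)
        rw [smul_assoc, ← hv', ← hv', ← smul_lie]; rfl }
  exact Submodule.mem_iSup_of_mem α ⟨v.2, fun H => hv' H⟩

end toral

namespace Setup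
variable {K : Type} [Field K] [IsAlgClosed K] [CharZero K]
variable {g : Type} [LieRing g] [LieAlgebra K g] (S : Setup K g)

/-- The weight space of `g` of weight `α`. -/
abbrev W (α : Dual K S.h) : Submodule K g := adWeightSpace K g S.h α

lemma exists_forall_mem_F (s : Finset g) : ∃ n, ∀ x ∈ s, x ∈ S.F n := by
  classical
  induction s using Finset.induction_on with
  | empty => exact ⟨0, by simp⟩
  | insert a s _ ih =>
    obtain ⟨n, hn⟩ := ih
    obtain ⟨m, hm⟩ := S.F_exhaust a
    refine ⟨max n m, fun x hx => ?_⟩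
    rcases Finset.mem_insert.mp hx with rfl | hx
    · exact S.F_mono (le_max_right _ _) hm
    · exact S.F_mono (le_max_left _ _) (hn x hx)

lemma exists_mem_F_pair (x y : g) : ∃ n, x ∈ S.F n ∧ y ∈ S.F n := by
  classical
  obtain ⟨n, hn⟩ := S.exists_forall_mem_F {x, y}
  exact ⟨n, hn x (by simp), hn y (by simp)⟩

lemma h_lie {x y : g} (hx : x ∈ S.h) (hy : y ∈ S.h) : ⁅x, y⁆ = 0 := by
  obtain ⟨n, hxn, hyn⟩ := S.exists_mem_F_pair x y
  have := (S.h_maxToral n).1.2.1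
  have := this.trivial ⟨x, hx, hxn⟩ ⟨y, hy, hyn⟩
  exact congrArg Subtype.val this

lemma mem_h_of_commute {n : ℕ} {x : g} (hx : x ∈ S.F n)
    (h : ∀ t ∈ S.hn n, ⁅t, x⁆ = 0) : x ∈ S.h := by
  have := S.F_findim n
  have hmt := S.h_maxToral n
  let T : Submodule K (S.F n) := S.h.toSubmodule.comap (S.F n).toSubmodule.subtype
  suffices hh : (⟨x, hx⟩ : S.F n) ∈ T from hh
  refine mem_of_commute_maxToral _ rfl (S.F_reductive n) T ?_ ?_ ?_ _ ?_
  · exact fun a ha b hb => Subtype.ext (S.h_lie ha hb)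
  · exact fun a ha => hmt.1.isSemisimple a ⟨ha, a.2⟩
  · intro a ha hss
    have ha' : ∀ t ∈ S.hn n, ⁅t, (a : g)⁆ = 0 := fun t ht =>
      congrArg Subtype.val (ha ⟨t, ht.2⟩ ht.1)
    let t' : LieSubalgebra K g :=
      { (S.hn n).toSubmodule ⊔ Submodule.span K {(a : g)} with
        lie_mem' := by
          intro y z hy hz
          simp only [AddSubsemigroup.mem_carrier, AddSubmonoid.mem_toSubsemigroup,
            Submodule.mem_toAddSubmonoid, Submodule.mem_sup, Submodule.mem_span_singleton] at hy hz
          obtain ⟨y1, hy1, _, ⟨c, rfl⟩, rfl⟩ := hy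
          obtain ⟨z1, hz1, _, ⟨d, rfl⟩, rfl⟩ := hz
          have e : ⁅y1 + c • (a : g), z1 + d • (a : g)⁆ = 0 := by
            have h1 := ha' _ hy1
            have h2 := ha' _ hz1
            have h3 : ⁅(a : g), z1⁆ = 0 := by rw [← lie_skew, h2, neg_zero]
            simp [S.h_lie hy1.1 hz1.1, h1, h3]
          rw [e]
          exact Submodule.zero_mem _ }
    have ht' : ∀ y, y ∈ t' ↔ ∃ z ∈ S.hn n, ∃ c : K, z + c • (a : g) = y := by
      intro y
      show y ∈ (S.hn n).toSubmodule ⊔ Submodule.span K {(a : g)} ↔ _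
      simp [Submodule.mem_sup, Submodule.mem_span_singleton]
    have h1 : IsToralIn K g (S.F n) t' := by
      refine isToralIn_of_isSemisimple ?_ ?_ ?_
      · intro y hy
        obtain ⟨z, hz, c, rfl⟩ := (ht' y).mp hy
        exact (S.F n).add_mem hz.2 ((S.F n).smul_mem c a.2)
      · intro y hy z hz
        obtain ⟨y1, hy1, c, rfl⟩ := (ht' y).mp hy
        obtain ⟨z1, hz1, d, rfl⟩ := (ht' z).mp hz
        have h1 := ha' _ hy1
        have h2 := ha' _ hz1
        have h3 : ⁅(a : g), z1⁆ = 0 := by rw [← lie_skew, h2, neg_zero]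
        simp [S.h_lie hy1.1 hz1.1, h1, h3]
      · intro y hy
        obtain ⟨z, hz, c, hzy⟩ := (ht' y).mp hy
        have : y = ⟨z, hz.2⟩ + c • a := Subtype.ext hzy.symm
        rw [this, map_add, map_smul]
        refine Module.End.IsSemisimple.add_of_commute ?_ (hmt.1.isSemisimple _ hz) ?_
        · exact (lie_ad_commute (ha ⟨z, hz.2⟩ hz.1)).smul_right c
        · exact Module.End.IsSemisimple_smul c hss
    have h2 : t' = S.h ⊓ S.F n := hmt.2 t' h1
      (fun y hy => (ht' y).mpr ⟨y, hy, 0, by simp⟩)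
    have h3 : (a : g) ∈ t' := (ht' a).mpr ⟨0, (S.hn n).zero_mem, 1, by simp⟩
    rw [h2] at h3
    exact h3.1
  · exact fun t ht => Subtype.ext (h t ⟨ht, t.2⟩)

lemma W_zero : S.W 0 = S.h.toSubmodule := by
  apply le_antisymm
  · intro x hx
    obtain ⟨n, hn⟩ := S.F_exhaust x
    exact S.mem_h_of_commute hn fun t ht => by simpa using hx ⟨t, ht.1⟩
  · intro x hx H
    simpa using S.h_lie H.2 hx

variable {S}

lemma mem_W_zero {x : g} : x ∈ S.W 0 ↔ x ∈ S.h := by rw [W_zero]; rfl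

lemma lie_mem_W {α β : Dual K S.h} {x y : g} (hx : x ∈ S.W α) (hy : y ∈ S.W β) :
    ⁅x, y⁆ ∈ S.W (α + β) := by
  intro H
  rw [leibniz_lie, hx H, hy H, smul_lie, lie_smul, LinearMap.add_apply, add_smul]

lemma lie_mem_W' {α β γ : Dual K S.h} {x y : g} (hx : x ∈ S.W α) (hy : y ∈ S.W β)
    (h : α + β = γ) : ⁅x, y⁆ ∈ S.W γ := h ▸ lie_mem_W hx hy

/-- Induction over weight vectors. -/
lemma W_induction {p : g → Prop} (mem : ∀ α, ∀ x ∈ S.W α, p x) (add : ∀ x y, p x → p y → p (x + y))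
    (x : g) : p x := by
  have hx : x ∈ ⨆ α : Dual K S.h, S.W α := by rw [S.h_span]; trivial
  induction hx using Submodule.iSup_induction' with
  | mem α x hx => exact mem α x hx
  | zero => exact mem 0 0 (Submodule.zero_mem _)
  | add x y _ _ hx hy => exact add x y hx hy

variable (S)

lemma isRootOf_iff {α : Dual K S.h} : IsRootOf K g S.h α ↔ α ≠ 0 ∧ ∃ x ∈ S.W α, x ≠ 0 := by
  rw [IsRootOf, Submodule.ne_bot_iff]

variable {S}
lemma isRootOf_of_mem {α : Dual K S.h} (h : α ≠ 0) {x : g} (hx : x ∈ S.W α) (h0 : x ≠ 0) :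
    IsRootOf K g S.h α := S.isRootOf_iff.mpr ⟨h, x, hx, h0⟩

lemma eq_zero_of_not_isRootOf {α : Dual K S.h} (h : α ≠ 0) (hr : ¬ IsRootOf K g S.h α) {x : g}
    (hx : x ∈ S.W α) : x = 0 := by
  by_contra h0
  exact hr (isRootOf_of_mem h hx h0)

end Setup

end

section
open LieAlgebra LieModule Module

/-- Operators forming a locally nilpotent `𝔰𝔩₂`-triple. -/
structure Sl2Ops {K M : Type*} [Field K] [AddCommGroup M] [Module K M] (E F H : End K M) :
    Prop where
  EF : ∀ x, E (F x) - F (E x) = H x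
  HE : ∀ x, H (E x) = E (H x) + (2 : K) • E x
  HF : ∀ x, H (F x) = F (H x) - (2 : K) • F x
  nilpE : ∀ x, ∃ n : ℕ, (E ^ n) x = 0
  nilpF : ∀ x, ∃ n : ℕ, (F ^ n) x = 0

namespace Sl2Ops
variable {K M : Type*} [Field K] [CharZero K] [AddCommGroup M] [Module K M] {E F H : End K M}
  (S : Sl2Ops E F H)
include S

lemma symm : Sl2Ops F E (-H) where
  EF x := by rw [LinearMap.neg_apply, ← S.EF]; abel
  HE x := by rw [LinearMap.neg_apply, LinearMap.neg_apply, S.HF, map_neg]; abel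
  HF x := by rw [LinearMap.neg_apply, LinearMap.neg_apply, S.HE, map_neg]; abel
  nilpE := S.nilpF
  nilpF := S.nilpE

lemma H_E_pow {x : M} {c : K} (hx : H x = c • x) (n : ℕ) :
    H ((E ^ n) x) = (c + 2 * n) • (E ^ n) x := by
  induction n with
  | zero => simpa using hx
  | succ n ih =>
    rw [pow_succ', Module.End.mul_apply, S.HE, ih, map_smul, ← add_smul]
    push_cast; ring_nf

lemma E_pow_F {x : M} {c : K} (hx : H x = c • x) (n : ℕ) :
    (E ^ (n + 1)) (F x) = F ((E ^ (n + 1)) x) + ((n + 1) * (c + n)) • (E ^ n) x := by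
  have key : ∀ y, E (F y) = F (E y) + H y := fun y => by rw [← S.EF]; abel
  induction n with
  | zero => simp [key, hx]
  | succ n ih =>
    rw [pow_succ', Module.End.mul_apply, ih, map_add, map_smul, key, S.H_E_pow hx,
      ← Module.End.mul_apply E, ← Module.End.mul_apply E, ← pow_succ', ← pow_succ', add_assoc,
      ← add_smul]
    push_cast
    ring_nf

lemma F_pow_E {x : M} {c : K} (hx : H x = c • x) (n : ℕ) :
    (F ^ (n + 1)) (E x) = E ((F ^ (n + 1)) x) + ((n + 1) * (-c + n)) • (F ^ n) x :=
  S.symm.E_pow_F (by rw [LinearMap.neg_apply, hx, neg_smul]) n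

lemma exists_pow {x : M} (hx : x ≠ 0) : ∃ n : ℕ, (E ^ n) x ≠ 0 ∧ (E ^ (n + 1)) x = 0 := by
  classical
  have h := S.nilpE x
  obtain ⟨n, hn⟩ := Nat.exists_eq_succ_of_ne_zero
    (show Nat.find h ≠ 0 from fun h0 => hx (by simpa [h0] using Nat.find_spec h))
  refine ⟨n, Nat.find_min h (by omega), ?_⟩
  have := Nat.find_spec h
  rwa [hn] at this

lemma primitive {x : M} {c : K} (hx : H x = c • x) (h0 : x ≠ 0) (hE : E x = 0) :
    ∃ n : ℕ, c = n := by
  obtain ⟨n, hn, hn'⟩ := S.symm.exists_pow h0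
  refine ⟨n, ?_⟩
  have := S.F_pow_E hx n
  rw [hE, map_zero, hn', map_zero, zero_add] at this
  rcases smul_eq_zero.mp this.symm with h | h
  · rcases mul_eq_zero.mp h with h | h
    · exact absurd h (Nat.cast_add_one_ne_zero n)
    · linear_combination -h
  · exact absurd h hn

lemma integral {x : M} {c : K} (hx : H x = c • x) (h0 : x ≠ 0) : ∃ z : ℤ, c = z := by
  obtain ⟨n, hn, hn'⟩ := S.exists_pow h0
  rw [pow_succ'] at hn'
  obtain ⟨m, hm⟩ := S.primitive (S.H_E_pow hx n) hn hn'
  exact ⟨m - 2 * n, by push_cast; linear_combination hm⟩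

lemma F_pow_ne_zero (r : ℕ) : ∀ (d j : ℕ) (x : M), j < d → H x = (-d : K) • x →
    (E ^ (j + 1)) x = 0 → (E ^ j) x ≠ 0 → (F ^ r) x ≠ 0 := by
  induction r with
  | zero =>
    intro d j x _ _ _ h h'
    rw [pow_zero, Module.End.one_apply] at h'
    exact h (by rw [h', map_zero])
  | succ r ih =>
    intro d j x hj hx h1 h2
    rw [pow_succ, Module.End.mul_apply]
    refine ih (d + 2) (j + 1) (F x) (by omega) ?_ ?_ ?_
    · rw [S.HF, hx, map_smul, ← sub_smul]; push_cast; ring_nf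
    · rw [S.E_pow_F hx, h1, pow_succ', Module.End.mul_apply, h1]; simp
    · rw [S.E_pow_F hx, h1, map_zero, zero_add]
      refine smul_ne_zero (mul_ne_zero (Nat.cast_add_one_ne_zero j) ?_) h2
      intro h
      have : (d : K) = j := by linear_combination -h
      exact absurd (Nat.cast_injective this) (by omega)

lemma eq_zero_of_E_pow {x : M} {d : ℕ} (hx : H x = (-d : K) • x) (h : (E ^ d) x = 0) : x = 0 := by
  by_contra h0
  obtain ⟨n, hn, hn'⟩ := S.exists_pow h0
  have hnd : n < d := by
    by_contra hh
    push Not at hh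
    apply hn
    rw [← Nat.sub_add_cancel hh, pow_add, Module.End.mul_apply, h, map_zero]
  obtain ⟨r, hr⟩ := S.nilpF x
  exact S.F_pow_ne_zero r d n x hnd hx hn' hn hr

lemma eq_zero_of_F_pow {x : M} {d : ℕ} (hx : H x = (d : K) • x) (h : (F ^ d) x = 0) : x = 0 :=
  S.symm.eq_zero_of_E_pow (by rw [LinearMap.neg_apply, hx, neg_smul]) h

lemma E_ne_zero {x : M} {z : ℤ} (hx : H x = (z : K) • x) (hz : z < 0) (h0 : x ≠ 0) : E x ≠ 0 := by
  intro h
  obtain ⟨n, hn⟩ := S.primitive hx h0 h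
  have : z = n := by exact_mod_cast hn
  omega

lemma F_ne_zero {x : M} {z : ℤ} (hx : H x = (z : K) • x) (hz : 0 < z) (h0 : x ≠ 0) : F x ≠ 0 :=
  S.symm.E_ne_zero (z := -z) (by rw [LinearMap.neg_apply, hx, Int.cast_neg, neg_smul])
    (by omega) h0

end Sl2Ops

section trace
variable {K M : Type*} [Field K] [CharZero K] [AddCommGroup M] [Module K M]

/-- An operator diagonalizable with rational eigenvalues has a nonnegative rational trace form. -/
lemma exists_trace_mul_self [FiniteDimensional K M] {A : End K M}
    (h : ⨆ q : ℚ, A.eigenspace (q : K) = ⊤) :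
    ∃ q : ℚ, 0 ≤ q ∧ LinearMap.trace K M (A * A) = (q : K) ∧ (q = 0 → A = 0) := by
  classical
  let N : ℚ → Submodule K M := fun q => A.eigenspace (q : K)
  have hind : iSupIndep N := A.eigenspaces_iSupIndep.comp Rat.cast_injective
  have h_int : DirectSum.IsInternal N :=
    DirectSum.isInternal_submodule_of_iSupIndep_of_iSup_eq_top hind h
  have hfin : {i | N i ≠ ⊥}.Finite := WellFoundedGT.finite_ne_bot_of_iSupIndep hind
  have hA : ∀ q, ∀ x ∈ N q, A x = (q : K) • x := fun q x hx => Module.End.mem_eigenspace_iff.mp hx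
  have hmaps : ∀ i, Set.MapsTo (A * A) (N i) (N i) := fun q x hx => by
    rw [Module.End.mul_apply, hA q x hx, map_smul, hA q x hx]
    exact (N q).smul_mem _ ((N q).smul_mem _ hx)
  have ht := LinearMap.trace_eq_sum_trace_restrict' h_int hfin hmaps
  have ht' : ∀ i, LinearMap.trace K (N i) ((A * A).restrict (hmaps i))
      = ((i * i * finrank K (N i) : ℚ) : K) := by
    intro i
    have : (A * A).restrict (hmaps i) = ((i * i : ℚ) : K) • (1 : End K (N i)) := by
      refine LinearMap.ext fun x => Subtype.ext ?_
      show A (A x) = ((i * i : ℚ) : K) • (x : M)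
      rw [hA i x x.2, map_smul, hA i x x.2, smul_smul, Rat.cast_mul]
    rw [this, map_smul, LinearMap.trace_one]
    simp
  refine ⟨∑ i ∈ hfin.toFinset, (i * i * finrank K (N i) : ℚ), ?_, ?_, ?_⟩
  · exact Finset.sum_nonneg fun i _ => mul_nonneg (mul_self_nonneg i) (Nat.cast_nonneg _)
  · rw [ht, Rat.cast_sum]
    exact Finset.sum_congr rfl fun i _ => ht' i
  · intro h0
    rw [Finset.sum_eq_zero_iff_of_nonneg
      fun i _ => mul_nonneg (mul_self_nonneg i) (Nat.cast_nonneg _)] at h0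
    ext x
    have hx : x ∈ ⨆ q, N q := by rw [h]; trivial
    induction hx using Submodule.iSup_induction' with
    | mem q x hx =>
      by_cases hq : N q = ⊥
      · rw [hq] at hx
        rw [(Submodule.mem_bot K).mp hx, map_zero, map_zero]
      have := h0 q (by simpa using hq)
      rcases mul_eq_zero.mp this with h1 | h1
      · rw [hA q x hx, mul_self_eq_zero.mp h1]; simp
      · exact absurd (Submodule.finrank_eq_zero.mp (Nat.cast_eq_zero.mp h1)) hq
    | zero => simp
    | add a b _ _ ha hb => rw [map_add, ha, hb]; simp

end trace

end

section
open LieAlgebra LieModule Module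
namespace Setup
variable {K : Type} [Field K] [IsAlgClosed K] [CharZero K]
variable {g : Type} [LieRing g] [LieAlgebra K g] {S : Setup K g}

lemma ad_pow_mem_W {α β : Dual K S.h} {x y : g} (hx : x ∈ S.W α) (hy : y ∈ S.W β) (n : ℕ) :
    ((ad K g x) ^ n) y ∈ S.W (β + n • α) := by
  induction n with
  | zero => simpa using hy
  | succ n ih =>
    rw [pow_succ', Module.End.mul_apply]
    exact lie_mem_W' hx ih (by rw [succ_nsmul]; abel)

lemma ad_pow_mem_F {m : ℕ} {x y : g} (hx : x ∈ S.F m) (hy : y ∈ S.F m) (n : ℕ) :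
    ((ad K g x) ^ n) y ∈ S.F m := by
  induction n with
  | zero => simpa using hy
  | succ n ih =>
    rw [pow_succ', Module.End.mul_apply]
    exact (S.F m).lie_mem hx ih

/-- Root vectors act locally nilpotently. -/
lemma ad_nilpotent {α : Dual K S.h} (hα : α ≠ 0) {x : g} (hx : x ∈ S.W α) (y : g) :
    ∃ n : ℕ, ((ad K g x) ^ n) y = 0 := by
  induction y using S.W_induction with
  | mem β y hy =>
    by_contra! h
    obtain ⟨m, hxm, hym⟩ := S.exists_mem_F_pair x y
    have := S.F_findim m
    have hinj : Function.Injective fun n : ℕ => β + n • α := by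
      intro a b hab
      have : a • α = b • α := add_left_cancel hab
      rw [← Nat.cast_smul_eq_nsmul K, ← Nat.cast_smul_eq_nsmul K] at this
      exact Nat.cast_injective (smul_left_injective K hα this)
    have hli : LinearIndependent K fun n : ℕ => ((ad K g x) ^ n) y :=
      iSupIndep.linearIndependent (fun n : ℕ => S.W (β + n • α)) (S.h_indep.comp hinj)
        (fun n => ad_pow_mem_W hx hy n) h
    have hli' : LinearIndependent K
        fun n : ℕ => (⟨((ad K g x) ^ n) y, ad_pow_mem_F hxm hym n⟩ : S.F m) :=
      LinearIndependent.of_comp (S.F m).toSubmodule.subtype hli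
    have := hli'.finite
    exact not_finite ℕ
  | add y z hy hz =>
    obtain ⟨n, hn⟩ := hy
    obtain ⟨k, hk⟩ := hz
    refine ⟨n + k, ?_⟩
    rw [map_add, pow_add, Module.End.mul_apply, Module.End.mul_apply, hk, map_zero, add_zero,
      ← Module.End.mul_apply, ← pow_add, add_comm n k, pow_add, Module.End.mul_apply, hn, map_zero]

lemma ne_zero_of_apply_eq_two {α : Dual K S.h} {H : S.h} (h2 : α H = 2) : α ≠ 0 := by
  rintro rfl
  exact two_ne_zero h2.symm

lemma sl2Ops {α : Dual K S.h} {H : S.h} {e f : g} (he : e ∈ S.W α) (hf : f ∈ S.W (-α))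
    (hef : ⁅e, f⁆ = H) (h2 : α H = 2) : Sl2Ops (ad K g e) (ad K g f) (ad K g (H : g)) := by
  have hα := ne_zero_of_apply_eq_two h2
  refine ⟨fun x => ?_, fun x => ?_, fun x => ?_, ad_nilpotent hα he,
    ad_nilpotent (neg_ne_zero.mpr hα) hf⟩
  · rw [ad_apply, ad_apply, ad_apply, ad_apply, ad_apply, ← hef, lie_lie]
  · rw [ad_apply, ad_apply, ad_apply, ad_apply, leibniz_lie, he H, h2, smul_lie, add_comm]
  · rw [ad_apply, ad_apply, ad_apply, ad_apply, leibniz_lie, hf H, LinearMap.neg_apply, h2,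
      smul_lie, neg_smul]; abel

variable (S)

/-- The `h`-stable part of `F m`. -/
def Fr (m : ℕ) : LieSubalgebra K g :=
  { (⨆ β : Dual K S.h, (S.F m).toSubmodule ⊓ S.W β : Submodule K g) with
    lie_mem' := by
      intro x y hx hy
      simp only [AddSubsemigroup.mem_carrier, AddSubmonoid.mem_toSubsemigroup,
        Submodule.mem_toAddSubmonoid] at hx hy ⊢
      induction hx using Submodule.iSup_induction' with
      | mem α x hx =>
        induction hy using Submodule.iSup_induction' with
        | mem β y hy =>
          exact Submodule.mem_iSup_of_mem (α + β) ⟨(S.F m).lie_mem hx.1 hy.1, lie_mem_W hx.2 hy.2⟩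
        | zero => rw [lie_zero]; exact Submodule.zero_mem _
        | add a b _ _ ha hb => rw [lie_add]; exact Submodule.add_mem _ ha hb
      | zero => rw [zero_lie]; exact Submodule.zero_mem _
      | add a b _ _ ha hb => rw [add_lie]; exact Submodule.add_mem _ ha hb }

variable {S}

lemma mem_Fr_iff {m : ℕ} {x : g} :
    x ∈ S.Fr m ↔ x ∈ ⨆ β : Dual K S.h, (S.F m).toSubmodule ⊓ S.W β := Iff.rfl

lemma mem_Fr_of_mem {m : ℕ} {α : Dual K S.h} {x : g} (hx : x ∈ S.F m) (hα : x ∈ S.W α) :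
    x ∈ S.Fr m := mem_Fr_iff.mpr (Submodule.mem_iSup_of_mem α ⟨hx, hα⟩)

lemma Fr_induction {m : ℕ} {p : g → Prop} (mem : ∀ β, ∀ x ∈ S.F m, x ∈ S.W β → p x)
    (add : ∀ x ∈ S.Fr m, ∀ y ∈ S.Fr m, p x → p y → p (x + y)) {x : g} (hx : x ∈ S.Fr m) : p x := by
  rw [mem_Fr_iff] at hx
  induction hx using Submodule.iSup_induction' with
  | mem α x hx => exact mem α x hx.1 hx.2
  | zero => exact mem 0 0 (S.F m).zero_mem (Submodule.zero_mem _)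
  | add x y hx' hy' hx hy => exact add x hx' y hy' hx hy

lemma Fr_le (m : ℕ) : S.Fr m ≤ S.F m := by
  intro x hx
  exact Fr_induction (p := fun x => x ∈ S.F m) (fun _ _ hx _ => hx)
    (fun _ _ _ _ hx hy => (S.F m).add_mem hx hy) hx

lemma Fr_mono {m n : ℕ} (h : m ≤ n) : S.Fr m ≤ S.Fr n := by
  intro x hx
  exact Fr_induction (p := fun x => x ∈ S.Fr n)
    (fun _ _ hx hβ => mem_Fr_of_mem (S.F_mono h hx) hβ)
    (fun _ _ _ _ hx hy => (S.Fr n).add_mem hx hy) hx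

instance (m : ℕ) : FiniteDimensional K (S.Fr m) := by
  have := S.F_findim m
  exact Submodule.finiteDimensional_of_le (S₁ := (S.Fr m).toSubmodule) (S₂ := (S.F m).toSubmodule)
    (Fr_le m)

lemma exists_mem_Fr (x : g) : ∃ m, x ∈ S.Fr m := by
  induction x using S.W_induction with
  | mem α x hx =>
    obtain ⟨m, hm⟩ := S.F_exhaust x
    exact ⟨m, mem_Fr_of_mem hm hx⟩
  | add x y hx hy =>
    obtain ⟨m, hm⟩ := hx
    obtain ⟨n, hn⟩ := hy
    exact ⟨max m n, (S.Fr _).add_mem (Fr_mono (le_max_left _ _) hm) (Fr_mono (le_max_right _ _) hn)⟩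

lemma exists_F_le_Fr (n : ℕ) : ∃ m, S.F n ≤ S.Fr m := by
  have := S.F_findim n
  obtain ⟨s, hs⟩ := (Submodule.fg_top (S.F n).toSubmodule).mp (this.fg_top)
  have : ∃ m, ∀ x ∈ s, x ∈ S.Fr m := by
    classical
    clear hs
    induction s using Finset.induction_on with
    | empty => exact ⟨0, by simp⟩
    | insert a s _ ih =>
      obtain ⟨m, hm⟩ := ih
      obtain ⟨k, hk⟩ := exists_mem_Fr (S := S) a
      refine ⟨max m k, fun x hx => ?_⟩
      rcases Finset.mem_insert.mp hx with rfl | hx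
      · exact Fr_mono (le_max_right _ _) hk
      · exact Fr_mono (le_max_left _ _) (hm x hx)
  obtain ⟨m, hm⟩ := this
  refine ⟨m, fun x hx => ?_⟩
  have hx' : x ∈ Submodule.span K (s : Set g) := by rw [hs]; exact hx
  exact (Submodule.span_le (p := (S.Fr m).toSubmodule)).mpr hm hx'

lemma h_le_normalizer (m : ℕ) : S.h ≤ (S.Fr m).normalizer := by
  intro H hH
  rw [LieSubalgebra.mem_normalizer_iff]
  intro x hx
  refine Fr_induction (p := fun x => ⁅H, x⁆ ∈ S.Fr m) (fun β x hx hβ => ?_)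
    (fun x _ y _ hx hy => ?_) hx
  · rw [hβ ⟨H, hH⟩]; exact (S.Fr m).smul_mem _ (mem_Fr_of_mem hx hβ)
  · rw [lie_add]; exact (S.Fr m).add_mem hx hy

lemma Fr_le_normalizer (m : ℕ) : S.Fr m ≤ (S.Fr m).normalizer := (S.Fr m).le_normalizer

variable (S)

/-- `Fr m` as a module over its normalizer. -/
def Vm (m : ℕ) : LieSubmodule K (S.Fr m).normalizer g :=
  { (S.Fr m).toSubmodule with
    lie_mem := fun {x y} hy => (LieSubalgebra.mem_normalizer_iff _ _).mp x.2 y hy }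

instance (m : ℕ) : FiniteDimensional K (S.Vm m) := inferInstanceAs (FiniteDimensional K (S.Fr m))

/-- The trace form of `Fr m`, extended to its normalizer. -/
def B (m : ℕ) : LinearMap.BilinForm K (S.Fr m).normalizer :=
  traceForm K (S.Fr m).normalizer (S.Vm m)

variable {S}
variable {m : ℕ}

lemma B_lie (x y z : (S.Fr m).normalizer) : S.B m ⁅x, y⁆ z = S.B m x ⁅y, z⁆ :=
  traceForm_apply_lie_apply _ _ _ _ _ _

lemma B_comm (x y : (S.Fr m).normalizer) : S.B m x y = S.B m y x := traceForm_comm _ _ _ _ _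

lemma B_eq_zero_of_lie_eq_zero (x y : (S.Fr m).normalizer) (h : ∀ v ∈ S.Fr m, ⁅(y : g), v⁆ = 0) :
    S.B m x y = 0 := by
  rw [B, traceForm_apply_apply]
  have : toEnd K (S.Fr m).normalizer (S.Vm m) y = 0 := by
    ext v
    exact h v v.2
  rw [this, LinearMap.comp_zero, map_zero]

lemma B_eq_zero_of_add_ne_zero {α β : Dual K S.h} (h : α + β ≠ 0) (x y : (S.Fr m).normalizer)
    (hx : (x : g) ∈ S.W α) (hy : (y : g) ∈ S.W β) : S.B m x y = 0 := by
  obtain ⟨H, hH⟩ : ∃ H, (α + β) H ≠ 0 := by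
    by_contra! hh
    exact h (LinearMap.ext hh)
  let H' : (S.Fr m).normalizer := ⟨H, h_le_normalizer m H.2⟩
  have h1 : ⁅x, H'⁆ = (-α H) • x := Subtype.ext (by
    show ⁅(x : g), (H : g)⁆ = (-α H) • (x : g)
    rw [← lie_skew, hx H, neg_smul])
  have h2 : ⁅H', y⁆ = β H • y := Subtype.ext (hy H)
  have h3 := B_lie x H' y
  rw [h1, h2, map_smul, map_smul, LinearMap.smul_apply, smul_eq_mul, smul_eq_mul] at h3
  have : (α + β) H * S.B m x y = 0 := by
    rw [LinearMap.add_apply]; linear_combination -h3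
  exact (mul_eq_zero.mp this).resolve_left hH

lemma exists_B_self (x : (S.Fr m).normalizer) (hx : (x : g) ∈ S.h)
    (hq : ∀ β : Dual K S.h, S.W β ≠ ⊥ → ∃ q : ℚ, β ⟨x, hx⟩ = q) :
    ∃ q : ℚ, 0 ≤ q ∧ S.B m x x = q ∧ (q = 0 → ∀ v ∈ S.Fr m, ⁅(x : g), v⁆ = 0) := by
  have htop : ⨆ q : ℚ, (toEnd K (S.Fr m).normalizer (S.Vm m) x).eigenspace (q : K) = ⊤ := by
    refine eq_top_iff.mpr fun v _ => ?_
    suffices h : (v : g) ∈ (⨆ q : ℚ,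
        (toEnd K (S.Fr m).normalizer (S.Vm m) x).eigenspace (q : K)).map
          (S.Vm m).toSubmodule.subtype by
      obtain ⟨w, hw, hwv⟩ := h
      rwa [show w = v from Subtype.ext hwv] at hw
    refine Fr_induction (p := fun w => w ∈ Submodule.map _ _) ?_ ?_ v.2
    · intro β w hw hβ
      by_cases h0 : w = 0
      · rw [h0]; exact Submodule.zero_mem _
      obtain ⟨q, hq⟩ := hq β ((Submodule.ne_bot_iff _).mpr ⟨w, hβ, h0⟩)
      refine ⟨⟨w, mem_Fr_of_mem hw hβ⟩, Submodule.mem_iSup_of_mem q ?_, rfl⟩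
      rw [Module.End.mem_eigenspace_iff]
      refine Subtype.ext ?_
      show ⁅(x : g), w⁆ = (q : K) • w
      rw [← hq]
      exact hβ ⟨x, hx⟩
    · exact fun a _ b _ ha hb => Submodule.add_mem _ ha hb
  obtain ⟨q, h0, h1, h2⟩ := exists_trace_mul_self htop
  refine ⟨q, h0, ?_, fun hq0 v hv => ?_⟩
  · rw [B, traceForm_apply_apply]; exact h1
  · have := LinearMap.congr_fun (h2 hq0) ⟨v, hv⟩
    exact congrArg Subtype.val this

end Setup

end

section
open LieAlgebra LieModule Module
namespace Setup
variable {K : Type} [Field K] [IsAlgClosed K] [CharZero K]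
variable {g : Type} [LieRing g] [LieAlgebra K g] {S : Setup K g}

lemma lie_mem_h {α : Dual K S.h} {x y : g} (hx : x ∈ S.W α) (hy : y ∈ S.W (-α)) : ⁅x, y⁆ ∈ S.h :=
  mem_W_zero.mp (lie_mem_W' hx hy (add_neg_cancel α))

lemma IsCoroot.isRootOf {α : Dual K S.h} {H : S.h} (h : S.IsCoroot α H) : IsRootOf K g S.h α := by
  obtain ⟨h2, e, he, f, hf, hef⟩ := h
  refine isRootOf_of_mem (ne_zero_of_apply_eq_two h2) he ?_
  rintro rfl
  rw [zero_lie] at hef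
  have : H = 0 := Subtype.ext hef
  rw [this, map_zero] at h2
  exact two_ne_zero h2.symm

lemma IsCoroot.integral {α : Dual K S.h} {H : S.h} (h : S.IsCoroot α H) {β : Dual K S.h}
    (hβ : S.W β ≠ ⊥) : ∃ z : ℤ, β H = z := by
  obtain ⟨h2, e, he, f, hf, hef⟩ := h
  obtain ⟨x, hx, h0⟩ := (Submodule.ne_bot_iff _).mp hβ
  exact (sl2Ops he hf hef.symm h2).integral (hx H) h0

/-- A root space of a root with a coroot is one-dimensional. -/
lemma mem_span_of_mem_W {α : Dual K S.h} {H : S.h} {e f x : g} (he : e ∈ S.W α)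
    (hf : f ∈ S.W (-α)) (hef : ⁅e, f⁆ = H) (h2 : α H = 2) (hx : x ∈ S.W α) :
    ∃ c : K, x = c • e := by
  let Hx : S.h := ⟨⁅x, f⁆, lie_mem_h hx hf⟩
  refine ⟨α Hx / 2, ?_⟩
  set c := α Hx / 2
  have hx' : x - c • e ∈ S.W α := Submodule.sub_mem _ hx (Submodule.smul_mem _ _ he)
  suffices h : x - c • e = 0 from sub_eq_zero.mp h
  refine (sl2Ops he hf hef h2).eq_zero_of_F_pow (d := 2) ?_ ?_
  · rw [ad_apply, hx' H, h2]; norm_num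
  · rw [pow_two, Module.End.mul_apply, ad_apply, ad_apply]
    have e1 : ⁅f, x - c • e⁆ = ((-Hx + c • H : S.h) : g) := by
      show _ = -⁅x, f⁆ + c • (H : g)
      rw [lie_sub, lie_smul, ← lie_skew f e, hef, ← lie_skew f x]
      module
    rw [e1, ← lie_skew, hf, LinearMap.neg_apply, map_add, map_neg, map_smul, h2]
    have : -(-(α Hx) + c • (2 : K)) = 0 := by simp [c]
    rw [this, zero_smul, neg_zero]

lemma IsCoroot.unique {α : Dual K S.h} {H H' : S.h} (h : S.IsCoroot α H) (h' : S.IsCoroot α H') :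
    H = H' := by
  obtain ⟨h2, e, he, f, hf, hef⟩ := h
  obtain ⟨h2', e', he', f', hf', hef'⟩ := h'
  obtain ⟨c, rfl⟩ := mem_span_of_mem_W he hf hef.symm h2 he'
  obtain ⟨d, rfl⟩ := mem_span_of_mem_W (α := -α) (H := -H) (e := f) (f := e) hf (by rwa [neg_neg])
    (by rw [← lie_skew, ← hef]; rfl) (by simpa using h2) hf'
  have e1 : H' = (c * d) • H := Subtype.ext (by
    show (H' : g) = (c * d) • (H : g)
    rw [hef', hef, smul_lie, lie_smul, smul_smul])
  rw [e1, map_smul, h2, smul_eq_mul] at h2'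
  have : c * d = 1 := by
    have := mul_right_cancel₀ (two_ne_zero (α := K)) (h2'.trans (one_mul 2).symm)
    exact this
  rw [e1, this, one_smul]

lemma B_coroot_pos {m : ℕ} {α : Dual K S.h} {H : S.h} {e f : g} (he : e ∈ S.W α)
    (hf : f ∈ S.W (-α)) (hef : ⁅e, f⁆ = H) (h2 : α H = 2) (hem : e ∈ S.Fr m) (hfm : f ∈ S.Fr m) :
    ∃ c : ℚ, 0 < c ∧ (S.B m ⟨e, Fr_le_normalizer m hem⟩ ⟨f, Fr_le_normalizer m hfm⟩ = c) ∧
      ∀ x : S.h, S.B m ⟨H, h_le_normalizer m H.2⟩ ⟨x, h_le_normalizer m x.2⟩ = c * α x := by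
  set e' : (S.Fr m).normalizer := ⟨e, Fr_le_normalizer m hem⟩
  set f' : (S.Fr m).normalizer := ⟨f, Fr_le_normalizer m hfm⟩
  set H' : (S.Fr m).normalizer := ⟨H, h_le_normalizer m H.2⟩
  have key : ∀ x : S.h, S.B m H' ⟨x, h_le_normalizer m x.2⟩ = S.B m e' f' * α x := by
    intro x
    have h1 : H' = ⁅e', f'⁆ := Subtype.ext hef.symm
    have h3 : ⁅f', (⟨x, h_le_normalizer m x.2⟩ : (S.Fr m).normalizer)⁆ = α x • f' :=
      Subtype.ext (by
        show ⁅f, (x : g)⁆ = α x • f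
        rw [← lie_skew, hf x, LinearMap.neg_apply, neg_smul, neg_neg])
    rw [h1, B_lie, h3, map_smul, smul_eq_mul, mul_comm]
  have hc : S.IsCoroot α H := ⟨h2, e, he, f, hf, hef.symm⟩
  obtain ⟨q, hq0, hq1, hq2⟩ := exists_B_self (m := m) H' H.2 (fun β hβ => by
    obtain ⟨z, hz⟩ := hc.integral hβ
    exact ⟨z, by rw [← Rat.cast_intCast] at hz; exact_mod_cast hz⟩)
  have h4 := key H
  rw [h2] at h4
  have hB : S.B m e' f' = ((q / 2 : ℚ) : K) := by
    push_cast
    rw [← hq1]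
    exact (eq_div_iff two_ne_zero).mpr h4.symm
  refine ⟨q / 2, ?_, hB, fun x => by rw [key, hB]⟩
  rcases hq0.lt_or_eq with h | h
  · positivity
  · exfalso
    have h5 := hq2 h.symm e hem
    change ⁅(H : g), e⁆ = 0 at h5
    rw [he H, h2] at h5
    have he0 : e = 0 := (smul_eq_zero.mp h5).resolve_left two_ne_zero
    rw [he0, zero_lie] at hef
    have : H = 0 := Subtype.ext hef.symm
    rw [this, map_zero] at h2
    exact two_ne_zero h2.symm

/-- A root without a coroot. -/
def Bad (α : Dual K S.h) : Prop :=
  IsRootOf K g S.h α ∧ ¬ ∃ H, S.IsCoroot α H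

lemma Bad.apply_eq_zero {α : Dual K S.h} (h : Bad α) {x y : g} (hx : x ∈ S.W α)
    (hy : y ∈ S.W (-α)) : α ⟨⁅x, y⁆, lie_mem_h hx hy⟩ = 0 := by
  by_contra h0
  set H : S.h := ⟨⁅x, y⁆, lie_mem_h hx hy⟩
  refine h.2 ⟨(2 / α H) • H, ?_, (2 / α H) • x, Submodule.smul_mem _ _ hx, y, hy, ?_⟩
  · rw [map_smul, smul_eq_mul, div_mul_cancel₀ _ h0]
  · rw [smul_lie]; rfl

lemma Bad.lie_central {α : Dual K S.h} (h : Bad α) {x y : g} (hx : x ∈ S.W α)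
    (hy : y ∈ S.W (-α)) (v : g) : ⁅⁅x, y⁆, v⁆ = 0 := by
  induction v using S.W_induction with
  | add a b ha hb => rw [lie_add, ha, hb, add_zero]
  | mem β v hv =>
    by_cases hv0 : v = 0
    · rw [hv0, lie_zero]
    set H : S.h := ⟨⁅x, y⁆, lie_mem_h hx hy⟩ with hH
    have hαH : α H = 0 := h.apply_eq_zero hx hy
    obtain ⟨m, hm⟩ : ∃ m, x ∈ S.F m ∧ y ∈ S.F m ∧ v ∈ S.F m := by
      classical
      obtain ⟨m, hm⟩ := S.exists_forall_mem_F {x, y, v}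
      exact ⟨m, hm _ (by simp), hm _ (by simp), hm _ (by simp)⟩
    obtain ⟨hxm, hym, hvm⟩ := hm
    let U : Submodule K g := ⨆ k : ℤ, (S.F m).toSubmodule ⊓ S.W (β + k • α)
    have hUF : U ≤ (S.F m).toSubmodule := iSup_le fun k => inf_le_left
    have := S.F_findim m
    have : FiniteDimensional K U := Submodule.finiteDimensional_of_le hUF
    have hstab : ∀ (w : g) (j : ℤ), w ∈ S.F m → w ∈ S.W (j • α) → ∀ u ∈ U, ad K g w u ∈ U := by
      intro w j hw hw' u hu
      induction hu using Submodule.iSup_induction' with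
      | mem k u hu =>
        refine Submodule.mem_iSup_of_mem (j + k) ⟨(S.F m).lie_mem hw hu.1,
          lie_mem_W' hw' hu.2 ?_⟩
        rw [add_smul]; abel
      | zero => rw [map_zero]; exact Submodule.zero_mem _
      | add a b _ _ ha hb => rw [map_add]; exact Submodule.add_mem _ ha hb
    let X : End K U := (ad K g x).restrict (hstab x 1 hxm (by rwa [one_smul]))
    let Y : End K U := (ad K g y).restrict (hstab y (-1) hym (by rwa [neg_smul, one_smul]))
    have hXY : X * Y - Y * X = β H • (1 : End K U) := by
      refine LinearMap.ext fun u => Subtype.ext ?_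
      have hu : ⁅x, ⁅y, (u : g)⁆⁆ - ⁅y, ⁅x, (u : g)⁆⁆ = ⁅(H : g), (u : g)⁆ := (lie_lie x y _).symm
      refine hu.trans ?_
      show ⁅(H : g), (u : g)⁆ = β H • (u : g)
      clear hu
      obtain ⟨u, hu⟩ := u
      show ⁅(H : g), u⁆ = β H • u
      induction hu using Submodule.iSup_induction' with
      | mem k u hu =>
        rw [hu.2 H, LinearMap.add_apply, LinearMap.smul_apply, hαH, smul_zero, add_zero]
      | zero => simp
      | add a b _ _ ha hb =>
        rw [lie_add, ha, hb, smul_add]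
    have htr := congrArg (LinearMap.trace K U) hXY
    rw [map_sub, LinearMap.trace_mul_comm, sub_self, map_smul, LinearMap.trace_one, smul_eq_mul] at htr
    have hfr : (finrank K U : K) ≠ 0 := by
      rw [Nat.cast_ne_zero]
      intro h0
      rw [Submodule.finrank_eq_zero] at h0
      have : v ∈ U := Submodule.mem_iSup_of_mem 0 ⟨hvm, by rwa [zero_smul, add_zero]⟩
      rw [h0] at this
      exact hv0 ((Submodule.mem_bot K).mp this)
    have hβ : β H = 0 := (mul_eq_zero.mp htr.symm).resolve_right hfr
    have := hv H
    rwa [hβ, zero_smul] at this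

lemma Bad.B_eq_zero {m : ℕ} {α : Dual K S.h} (h : Bad α) (x y : (S.Fr m).normalizer)
    (hx : (x : g) ∈ S.W α) (hy : (y : g) ∈ S.W (-α)) : S.B m x y = 0 := by
  obtain ⟨H, hH⟩ : ∃ H, α H ≠ 0 := by
    by_contra! hh
    exact h.1.1 (LinearMap.ext hh)
  let H' : (S.Fr m).normalizer := ⟨H, h_le_normalizer m H.2⟩
  have h1 : ⁅H', x⁆ = α H • x := Subtype.ext (hx H)
  have h2 := B_lie H' x y
  rw [B_eq_zero_of_lie_eq_zero H' ⁅x, y⁆ (fun v _ => h.lie_central hx hy v), h1, map_smul,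
    LinearMap.smul_apply, smul_eq_mul] at h2
  exact (mul_eq_zero.mp h2).resolve_left hH

lemma Bad.lie_eq_zero {α β : Dual K S.h} (h : Bad α) {H : S.h} (hc : S.IsCoroot (β + α) H)
    {x u : g} (hx : x ∈ S.W α) (hu : u ∈ S.W β) : ⁅u, x⁆ = 0 := by
  obtain ⟨h2, e, he, f, hf, hef⟩ := hc
  obtain ⟨c, hc⟩ := mem_span_of_mem_W he hf hef.symm h2 (lie_mem_W hu hx)
  by_cases hc0 : c = 0
  · rw [hc, hc0, zero_smul]
  exfalso
  obtain ⟨m, hm⟩ : ∃ m, ∀ y ∈ ({x, u, e, f} : Set g), y ∈ S.F m := by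
    classical
    obtain ⟨m, hm⟩ := S.exists_forall_mem_F {x, u, e, f}
    exact ⟨m, fun y hy => hm _ (by simpa using hy)⟩
  have hx' := mem_Fr_of_mem (hm x (by simp)) hx
  have hu' := mem_Fr_of_mem (hm u (by simp)) hu
  have he' := mem_Fr_of_mem (hm e (by simp)) he
  have hf' := mem_Fr_of_mem (hm f (by simp)) hf
  obtain ⟨q, hq, hB, -⟩ := B_coroot_pos he hf hef.symm h2 he' hf'
  let x' : (S.Fr m).normalizer := ⟨x, Fr_le_normalizer m hx'⟩
  let u' : (S.Fr m).normalizer := ⟨u, Fr_le_normalizer m hu'⟩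
  let e' : (S.Fr m).normalizer := ⟨e, Fr_le_normalizer m he'⟩
  let f' : (S.Fr m).normalizer := ⟨f, Fr_le_normalizer m hf'⟩
  have h1 : ⁅x', u'⁆ = -(c • e') := Subtype.ext (by
    show ⁅x, u⁆ = -(c • e)
    rw [← lie_skew, hc])
  have h3 := B_lie x' u' f'
  rw [h.B_eq_zero x' ⁅u', f'⁆ hx (lie_mem_W' hu hf (by abel)), h1, map_neg, map_smul,
    LinearMap.neg_apply, LinearMap.smul_apply, smul_eq_mul, neg_eq_zero] at h3
  change c * S.B m ⟨e, _⟩ ⟨f, _⟩ = 0 at h3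
  rw [hB] at h3
  exact (mul_ne_zero hc0 (Rat.cast_ne_zero.mpr hq.ne')) h3

end Setup

end

section
open LieAlgebra LieModule Module
namespace Setup
variable {K : Type} [Field K] [IsAlgClosed K] [CharZero K]
variable {g : Type} [LieRing g] [LieAlgebra K g] {S : Setup K g}

open scoped DirectSum in
variable (S) in
/-- The decomposition of `g` into weight spaces. -/
def decomp : g ≃ₗ[K] ⨁ β : Dual K S.h, S.W β :=
  letI := Classical.decEq (Dual K S.h)
  (LinearEquiv.ofBijective (DirectSum.coeLinearMap S.W)
    (show Function.Bijective (DirectSum.coeLinearMap S.W) from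
    DirectSum.isInternal_submodule_of_iSupIndep_of_iSup_eq_top S.h_indep S.h_span)).symm

variable (S) in
/-- The component of weight `β`. -/
def comp (β : Dual K S.h) : g →ₗ[K] g :=
  (S.W β).subtype ∘ₗ DirectSum.component K _ _ β ∘ₗ S.decomp.toLinearMap

lemma comp_mem (β : Dual K S.h) (x : g) : S.comp β x ∈ S.W β := Subtype.coe_prop _

lemma decomp_of_mem [DecidableEq (Dual K S.h)] {β : Dual K S.h} {x : g} (hx : x ∈ S.W β) :
    S.decomp x = DirectSum.of (fun β => S.W β) β ⟨x, hx⟩ := by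
  rw [decomp, LinearEquiv.symm_apply_eq]
  rw [LinearEquiv.ofBijective_apply]
  obtain rfl : ‹DecidableEq (Dual K S.h)› = Classical.decEq _ := Subsingleton.elim _ _
  let := Classical.decEq (Dual K S.h)
  exact (DirectSum.coeLinearMap_of S.W β ⟨x, hx⟩).symm

lemma comp_of_mem {β : Dual K S.h} {x : g} (hx : x ∈ S.W β) : S.comp β x = x := by
  classical
  show ((S.decomp x β : S.W β) : g) = x
  rw [decomp_of_mem hx, DirectSum.of_eq_same]

lemma comp_of_mem_ne {β γ : Dual K S.h} {x : g} (hx : x ∈ S.W β) (h : β ≠ γ) :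
    S.comp γ x = 0 := by
  classical
  show ((S.decomp x γ : S.W γ) : g) = 0
  rw [decomp_of_mem hx, DirectSum.of_eq_of_ne _ _ _ h.symm]; rfl

lemma mem_of_comp (p : Submodule K g) {x : g} (h : ∀ β, S.comp β x ∈ p) : x ∈ p := by
  classical
  have h1 : S.decomp.symm (S.decomp x) = x := S.decomp.symm_apply_apply x
  rw [← h1]
  have h2 : ∀ y : DirectSum (Dual K S.h) (fun β => S.W β),
      (∀ β, ((y β : S.W β) : g) ∈ p) → S.decomp.symm y ∈ p := by
    intro y hy
    rw [← DirectSum.sum_support_of y, map_sum]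
    refine Submodule.sum_mem _ fun β _ => ?_
    rw [← decomp_of_mem (y β).2, LinearEquiv.symm_apply_apply]
    exact hy β
  exact h2 _ h

lemma comp_mem_Fr {m : ℕ} {x : g} (hx : x ∈ S.Fr m) (β : Dual K S.h) : S.comp β x ∈ S.F m := by
  refine Fr_induction (p := fun x => S.comp β x ∈ S.F m) (fun γ x hx hγ => ?_)
    (fun x _ y _ hx hy => ?_) hx
  · by_cases h : γ = β
    · subst h; rwa [comp_of_mem hγ]
    · rw [comp_of_mem_ne hγ h]; exact (S.F m).zero_mem
  · rw [map_add]; exact (S.F m).add_mem hx hy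

section radical
variable (R : Set (Dual K S.h))

/-- The sum of the weight spaces with weights in `R`. -/
def badSum : Submodule K g := ⨆ α ∈ R, S.W α

/-- The sum of the weight spaces with weights in `R` and of the centre. -/
def badIdeal : Submodule K g := badSum R ⊔ (center K g).toSubmodule

variable {R}
lemma mem_badSum {α : Dual K S.h} (hα : α ∈ R) {x : g} (hx : x ∈ S.W α) : x ∈ badSum R :=
  Submodule.mem_iSup_of_mem α (Submodule.mem_iSup_of_mem hα hx)

lemma mem_badIdeal_of_mem {α : Dual K S.h} (hα : α ∈ R) {x : g} (hx : x ∈ S.W α) :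
    x ∈ badIdeal R := Submodule.mem_sup_left (mem_badSum hα hx)

lemma mem_center_iff_lie {x : g} : x ∈ (center K g).toSubmodule ↔ ∀ v : g, ⁅x, v⁆ = 0 := by
  rw [LieSubmodule.mem_toSubmodule, LieModule.mem_maxTrivSubmodule]
  exact forall_congr' fun v => by rw [← lie_skew, neg_eq_zero]

lemma mem_badIdeal_of_central {x : g} (hx : ∀ v : g, ⁅x, v⁆ = 0) : x ∈ badIdeal R :=
  Submodule.mem_sup_right (mem_center_iff_lie.mpr hx)

lemma badSum_induction {p : g → Prop} (mem : ∀ α ∈ R, ∀ x ∈ S.W α, p x)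
    (zero : p 0) (add : ∀ x y, p x → p y → p (x + y)) {x : g} (hx : x ∈ badSum R) : p x := by
  rw [badSum, iSup_subtype'] at hx
  induction hx using Submodule.iSup_induction' with
  | mem α x hx => exact mem α α.2 x hx
  | zero => exact zero
  | add x y _ _ hx hy => exact add x y hx hy

lemma badIdeal_induction {p : g → Prop} (mem : ∀ α ∈ R, ∀ x ∈ S.W α, p x)
    (central : ∀ z, (∀ v : g, ⁅z, v⁆ = 0) → p z)
    (add : ∀ x y, p x → p y → p (x + y)) {x : g} (hx : x ∈ badIdeal R) : p x := by
  obtain ⟨y, hy, z, hz, rfl⟩ := Submodule.mem_sup.mp hx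
  exact add _ _ (badSum_induction mem (central 0 (by simp)) add hy)
    (central z (mem_center_iff_lie.mp hz))

lemma comp_mem_badIdeal {x : g} (hx : x ∈ badIdeal R) (β : Dual K S.h) :
    (β ∈ R ∨ ∀ v : g, ⁅S.comp β x, v⁆ = 0) := by
  by_cases hβ : β ∈ R
  · exact Or.inl hβ
  right
  refine badIdeal_induction (p := fun x => ∀ v : g, ⁅S.comp β x, v⁆ = 0) ?_ ?_ ?_ hx
  · intro α hα x hx
    rw [comp_of_mem_ne hx (by rintro rfl; exact hβ hα)]; simp
  · intro z hz
    have : z ∈ S.W 0 := fun H => by rw [← lie_skew, hz]; simp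
    by_cases h : 0 = β
    · subst h; rwa [comp_of_mem this]
    · rw [comp_of_mem_ne this h]; simp
  · intro x y hx hy v
    rw [map_add, add_lie, hx, hy, add_zero]

lemma badSum_inf_h (h0 : ∀ α ∈ R, α ≠ 0) {x : g} (hx : x ∈ badSum R) (hh : x ∈ S.h) : x = 0 := by
  rw [← mem_W_zero] at hh
  rw [← comp_of_mem hh]
  refine badSum_induction (p := fun x => S.comp 0 x = 0) ?_ (map_zero _) ?_ hx
  · exact fun α hα x hx => comp_of_mem_ne hx (h0 α hα)
  · intro x y hx hy; rw [map_add, hx, hy, add_zero]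

lemma killingForm_eq_B {m : ℕ} (x y : S.Fr m) : killingForm K (S.Fr m) x y =
    S.B m ⟨x, Fr_le_normalizer m x.2⟩ ⟨y, Fr_le_normalizer m y.2⟩ := rfl

lemma killingForm_eq_zero (hR : ∀ α ∈ R, Bad α) {m : ℕ} (x y : S.Fr m)
    (hx : (x : g) ∈ badIdeal R) : killingForm K (S.Fr m) x y = 0 := by
  rw [killingForm_eq_B]
  suffices h : (x : g) ∈ (LinearMap.ker ((S.B m).flip ⟨y, Fr_le_normalizer m y.2⟩)).map
      (S.Fr m).normalizer.toSubmodule.subtype by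
    obtain ⟨z, hz, hzx⟩ := h
    have : z = ⟨x, Fr_le_normalizer m x.2⟩ := Subtype.ext hzx
    rw [← this]; exact hz
  refine mem_of_comp (S := S) _ fun β => ?_
  have h1 : S.comp β x ∈ S.Fr m := mem_Fr_of_mem (comp_mem_Fr x.2 β) (comp_mem β _)
  refine ⟨⟨S.comp β x, Fr_le_normalizer m h1⟩, ?_, rfl⟩
  show S.B m _ _ = 0
  rcases comp_mem_badIdeal hx β with hβ | hβ
  · have key : ∀ γ, ∀ w ∈ S.F m, ∀ hγ : w ∈ S.W γ, ∀ hw : w ∈ (S.Fr m).normalizer,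
        S.B m ⟨S.comp β x, Fr_le_normalizer m h1⟩ ⟨w, hw⟩ = 0 := by
      intro γ w _ hγ hw
      by_cases h : β + γ = 0
      · exact (hR β hβ).B_eq_zero _ _ (comp_mem β _) (by
          rw [← eq_neg_of_add_eq_zero_right h]; exact hγ)
      · exact B_eq_zero_of_add_ne_zero h _ _ (comp_mem β _) hγ
    have := Fr_induction (p := fun w => ∃ hw : w ∈ (S.Fr m).normalizer,
        S.B m ⟨S.comp β x, Fr_le_normalizer m h1⟩ ⟨w, hw⟩ = 0)
      (fun γ w hw hγ => ⟨Fr_le_normalizer m (mem_Fr_of_mem hw hγ), key γ w hw hγ _⟩)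
      (by
        rintro a - b - ⟨ha, ha'⟩ ⟨hb, hb'⟩
        refine ⟨(S.Fr m).normalizer.add_mem ha hb, ?_⟩
        have := map_add (S.B m ⟨S.comp β x, Fr_le_normalizer m h1⟩) ⟨a, ha⟩ ⟨b, hb⟩
        rw [ha', hb', add_zero] at this
        exact this) y.2
    exact this.2
  · rw [B_comm]
    exact B_eq_zero_of_lie_eq_zero _ _ fun v _ => hβ v

theorem badSet_eq_empty (hR : ∀ α ∈ R, Bad α)
    (h1 : ∀ y : g, ∀ x ∈ badIdeal R, ⁅y, x⁆ ∈ badIdeal R)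
    (h2 : ∀ α ∈ R, ∀ β ∈ R, ∀ x ∈ S.W α, ∀ y ∈ S.W β, ⁅x, y⁆ ∈ badSum R) : R = ∅ := by
  by_contra hne
  obtain ⟨α, hα⟩ := Set.nonempty_iff_ne_empty.mpr hne
  obtain ⟨x, hx, hx0⟩ := (S.isRootOf_iff.mp (hR α hα).1).2
  obtain ⟨n, hn⟩ := S.F_exhaust x
  have h0 : ∀ α ∈ R, α ≠ 0 := fun α hα => (hR α hα).1.1
  have := S.F_findim n
  let J : LieIdeal K (S.F n) :=
    { (badIdeal R).comap (S.F n).toSubmodule.subtype with lie_mem := fun {y x} hx => h1 y x hx }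
  have hJ : ∀ y : S.F n, y ∈ J ↔ (y : g) ∈ badIdeal R := fun y => Iff.rfl
  obtain ⟨m, hm⟩ := exists_F_le_Fr (S := S) n
  let J' : LieIdeal K (S.Fr m) :=
    { (badIdeal R).comap (S.Fr m).toSubmodule.subtype with lie_mem := fun {y x} hx => h1 y x hx }
  have hJ' : IsSolvable J' := LieIdeal.isSolvable_of_killingForm_apply_lie_eq_zero J'
    fun x hx y _ => killingForm_eq_zero hR x y hx
  let φ : J →ₗ⁅K⁆ J' :=
    { toFun := fun z => ⟨⟨z, hm z.1.2⟩, z.2⟩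
      map_add' := fun _ _ => rfl
      map_smul' := fun _ _ => rfl
      map_lie' := rfl }
  have hJs : IsSolvable J := Function.Injective.lieAlgebra_isSolvable (f := φ) fun a b hab =>
    Subtype.ext (Subtype.ext (congrArg (fun z : J' => ((z : S.Fr m) : g)) hab))
  have hcent : ∀ I : LieIdeal K (S.F n), IsLieAbelian I → ∀ z ∈ I, (z : g) ∈ S.h := by
    intro I hI z hz
    have := mem_center_iff'.mp (S.F_reductive n I hI hz)
    refine S.mem_h_of_commute z.2 fun t ht => ?_
    rw [← lie_skew, show ⁅(z : g), t⁆ = 0 from congrArg Subtype.val (this ⟨t, ht.2⟩), neg_zero]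
  have hder : ∀ z ∈ ⁅J, J⁆, (z : g) ∈ badSum R := by
    intro z hz
    rw [← LieSubmodule.mem_toSubmodule, LieSubmodule.lieIdeal_oper_eq_linear_span'] at hz
    refine (Submodule.span_le (p := (badSum R).comap (S.F n).toSubmodule.subtype)).mpr ?_ hz
    rintro _ ⟨a, ha, b, hb, rfl⟩
    show ⁅(a : g), (b : g)⁆ ∈ badSum R
    refine badIdeal_induction (p := fun a => ⁅a, (b : g)⁆ ∈ badSum R) ?_ ?_ ?_ ((hJ a).mp ha)
    · intro α hα x hx
      refine badIdeal_induction (p := fun b => ⁅x, b⁆ ∈ badSum R) ?_ ?_ ?_ ((hJ b).mp hb)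
      · exact fun β hβ y hy => h2 α hα β hβ x hx y hy
      · intro y hy
        rw [← lie_skew, hy, neg_zero]; exact Submodule.zero_mem _
      · intro y z hy hz
        rw [lie_add]; exact Submodule.add_mem _ hy hz
    · intro y hy
      rw [hy]; exact Submodule.zero_mem _
    · intro y z hy hz
      rw [add_lie]; exact Submodule.add_mem _ hy hz
  have hI' : IsSolvable (⁅J, J⁆ : LieIdeal K (S.F n)) :=
    le_solvable_ideal_solvable (LieSubmodule.lie_le_left J J) hJs
  have hbot : (⁅J, J⁆ : LieIdeal K (S.F n)) = ⊥ := by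
    rw [← abelian_of_solvable_ideal_eq_bot_iff, LieSubmodule.eq_bot_iff]
    intro z hz
    have hz' : z ∈ (⁅J, J⁆ : LieIdeal K (S.F n)) := by
      rw [derivedAbelianOfIdeal] at hz
      split at hz
      · rw [LieSubmodule.mem_bot] at hz; rw [hz]; exact LieSubmodule.zero_mem _
      · exact derivedSeriesOfIdeal_le_self _ _ hz
    exact Subtype.ext (badSum_inf_h h0 (hder z hz')
      (hcent _ (abelian_derivedAbelianOfIdeal _) z hz))
  have hab : IsLieAbelian J := by
    rw [LieSubmodule.lie_abelian_iff_lie_self_eq_bot]; exact hbot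
  have hxh := hcent J hab ⟨x, hn⟩ (mem_badIdeal_of_mem hα hx)
  exact hx0 (badSum_inf_h h0 (mem_badSum hα hx) hxh)

end radical

variable (hD : S.IsDynkin)
include hD

omit hD in
lemma mem_b_of_pos {α : Dual K S.h} (hα : α ∈ S.pos) {x : g} (hx : x ∈ S.W α) : x ∈ S.b := by
  rw [← LieSubalgebra.mem_toSubmodule, S.b_eq]
  exact Submodule.mem_sup_right (Submodule.mem_iSup_of_mem α (Submodule.mem_iSup_of_mem hα hx))

/-- A Lie subalgebra containing `h` and the simple root spaces contains the positive ones. -/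
lemma pos_mem_of_dynkin {L : LieSubalgebra K g} (hh : S.h ≤ L)
    (hs : ∀ α, S.IsSimpleRoot α → ∀ x ∈ S.W α, x ∈ L) {α : Dual K S.h} (hα : α ∈ S.pos) {x : g}
    (hx : x ∈ S.W α) : x ∈ L := by
  have hb : x ∈ S.b := mem_b_of_pos hα hx
  rw [show S.b = _ from hD] at hb
  refine (LieSubalgebra.lieSpan_le (K := L)).mpr ?_ hb
  rintro y (hy | hy)
  · exact hh hy
  · simp only [Set.mem_iUnion] at hy
    obtain ⟨β, hβ, hy⟩ := hy
    exact hs β hβ y hy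

omit hD in
lemma neg_mem_pos {α : Dual K S.h} (hr : IsRootOf K g S.h α) (h : α ∉ S.pos) : -α ∈ S.pos := by
  by_contra h'
  exact h ((S.pos_polar α hr).mpr h')

omit hD in
lemma neg_not_mem_pos {α : Dual K S.h} (h : α ∈ S.pos) : -α ∉ S.pos :=
  (S.pos_polar α (S.pos_root α h)).mp h

omit hD in
lemma IsSimpleRoot.ne_add {α β γ : Dual K S.h} (h : S.IsSimpleRoot α) (hβ : β ∈ S.pos)
    (hγ : γ ∈ S.pos) : β + γ ≠ α := fun e =>
  h.2 ⟨{β, γ}, by simp, by simp [hβ, hγ], by simpa using e⟩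

omit hD in
lemma Bad.lie_mem {R : Set (Dual K S.h)} {α β : Dual K S.h} (h : Bad α) (h0 : β + α ≠ 0)
    (hR : Bad (β + α) → β + α ∈ R) {x y : g} (hx : x ∈ S.W α) (hy : y ∈ S.W β) :
    ⁅y, x⁆ ∈ badSum R := by
  by_cases hr : IsRootOf K g S.h (β + α)
  · by_cases hc : ∃ H, S.IsCoroot (β + α) H
    · obtain ⟨H, hH⟩ := hc
      rw [h.lie_eq_zero hH hx hy]; exact Submodule.zero_mem _
    · exact mem_badSum (hR ⟨hr, hc⟩) (lie_mem_W hy hx)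
  · rw [eq_zero_of_not_isRootOf h0 hr (lie_mem_W hy hx)]; exact Submodule.zero_mem _

omit hD in
lemma Bad.lie_central' {α β : Dual K S.h} (h : Bad α) (h0 : β + α = 0) {x y : g} (hx : x ∈ S.W α)
    (hy : y ∈ S.W β) (v : g) : ⁅⁅y, x⁆, v⁆ = 0 := by
  rw [← lie_skew y x, neg_lie, h.lie_central hx (by rwa [← eq_neg_of_add_eq_zero_left h0]), neg_zero]

lemma pos_of_bad {α : Dual K S.h} (h : Bad α) : α ∈ S.pos := by
  suffices hh : {α : Dual K S.h | Bad α ∧ α ∉ S.pos} = ∅ by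
    by_contra h'
    have : α ∈ {α : Dual K S.h | Bad α ∧ α ∉ S.pos} := ⟨h, h'⟩
    rw [hh] at this
    exact this
  set R := {α : Dual K S.h | Bad α ∧ α ∉ S.pos} with hRdef
  have hneg : ∀ α, IsRootOf K g S.h α → α ∉ S.pos → ∀ β ∈ R, ∀ y ∈ S.W α, ∀ x ∈ S.W β,
      ⁅y, x⁆ ∈ badSum R := by
    intro α hr hα β hβ y hy x hx
    refine hβ.1.lie_mem (R := R) ?_ (fun h => ⟨h, S.neg_add α β hr hβ.1.1 hα hβ.2 h.1⟩) hx hy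
    intro h0
    have := neg_mem_pos hβ.1.1 hβ.2
    rw [← eq_neg_of_add_eq_zero_left h0] at this
    exact hα this
  refine badSet_eq_empty (fun α hα => hα.1) ?_ (fun α hα β hβ x hx y hy =>
    hneg α hα.1.1 hα.2 β hβ x hx y hy)
  let N : LieSubalgebra K g :=
    { carrier := {y | ∀ x ∈ badIdeal R, ⁅y, x⁆ ∈ badIdeal R}
      add_mem' := fun {a b} ha hb x hx => by
        rw [add_lie]; exact Submodule.add_mem _ (ha x hx) (hb x hx)
      zero_mem' := fun x _ => by rw [zero_lie]; exact Submodule.zero_mem _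
      smul_mem' := fun c {a} ha x hx => by
        rw [smul_lie]; exact Submodule.smul_mem _ _ (ha x hx)
      lie_mem' := fun {a b} ha hb x hx => by
        rw [lie_lie]; exact Submodule.sub_mem _ (ha _ (hb x hx)) (hb _ (ha x hx)) }
  have hN : ∀ y, (∀ β ∈ R, ∀ x ∈ S.W β, ⁅y, x⁆ ∈ badIdeal R) → y ∈ N := by
    intro y hy x hx
    refine badIdeal_induction (p := fun x => ⁅y, x⁆ ∈ badIdeal R) hy ?_ ?_ hx
    · intro z hz
      rw [← lie_skew, hz, neg_zero]; exact Submodule.zero_mem _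
    · intro a b ha hb
      rw [lie_add]; exact Submodule.add_mem _ ha hb
  have hh : S.h ≤ N := fun H hH => hN H fun β hβ x hx => by
    rw [hx ⟨H, hH⟩]; exact Submodule.smul_mem _ _ (mem_badIdeal_of_mem hβ hx)
  intro y
  induction y using S.W_induction with
  | add a b ha hb =>
    intro x hx
    rw [add_lie]; exact Submodule.add_mem _ (ha x hx) (hb x hx)
  | mem γ y hy =>
    show y ∈ N
    by_cases hγ0 : γ = 0
    · subst hγ0
      exact hh (mem_W_zero.mp hy)
    by_cases hr : IsRootOf K g S.h γ
    swap
    · rw [eq_zero_of_not_isRootOf hγ0 hr hy]; exact N.zero_mem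
    by_cases hγ : γ ∈ S.pos
    swap
    · exact hN y fun β hβ x hx => Submodule.mem_sup_left (hneg γ hr hγ β hβ y hy x hx)
    refine pos_mem_of_dynkin hD hh (fun α hα z hz => hN z fun β hβ x hx => ?_) hγ hy
    by_cases h0 : α + β = 0
    · exact mem_badIdeal_of_central (hβ.1.lie_central' h0 hx hz)
    refine Submodule.mem_sup_left (hβ.1.lie_mem (R := R) h0 (fun hb => ⟨hb, fun hp => ?_⟩) hx hz)
    exact hα.ne_add hp (neg_mem_pos hβ.1.1 hβ.2) (by abel)

theorem not_bad (α : Dual K S.h) : ¬ Bad α := by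
  intro h
  suffices hh : {α : Dual K S.h | Bad α} = ∅ by
    have : α ∈ {α : Dual K S.h | Bad α} := h
    rw [hh] at this
    exact this
  refine badSet_eq_empty (fun α hα => hα) ?_ ?_
  · intro y
    induction y using S.W_induction with
    | add a b ha hb =>
      intro x hx
      rw [add_lie]; exact Submodule.add_mem _ (ha x hx) (hb x hx)
    | mem γ y hy =>
      intro x hx
      refine badIdeal_induction (p := fun x => ⁅y, x⁆ ∈ badIdeal _) ?_ ?_ ?_ hx
      · intro β hβ x hx
        by_cases h0 : γ + β = 0
        · exact mem_badIdeal_of_central (Bad.lie_central' hβ h0 hx hy)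
        · exact Submodule.mem_sup_left (Bad.lie_mem hβ h0 (fun hb => hb) hx hy)
      · intro z hz
        rw [← lie_skew, hz, neg_zero]; exact Submodule.zero_mem _
      · intro a b ha hb
        rw [lie_add]; exact Submodule.add_mem _ ha hb
  · intro α hα β hβ x hx y hy
    refine Bad.lie_mem hβ ?_ (fun hb => hb) hy hx
    intro h0
    have h1 := pos_of_bad hD hα
    rw [eq_neg_of_add_eq_zero_left h0] at h1
    exact neg_not_mem_pos (pos_of_bad hD hβ) h1

theorem exists_coroot {α : Dual K S.h} (h : IsRootOf K g S.h α) : ∃ H, S.IsCoroot α H := by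
  by_contra h'
  exact not_bad hD α ⟨h, h'⟩

end Setup

end

section
open LieAlgebra LieModule Module
namespace Setup
variable {K : Type} [Field K] [IsAlgClosed K] [CharZero K]
variable {g : Type} [LieRing g] [LieAlgebra K g] {S : Setup K g}

/-- An `sl₂`-triple attached to a root. -/
structure IsTriple (α : Dual K S.h) (e f : g) (H : S.h) : Prop where
  he : e ∈ S.W α
  hf : f ∈ S.W (-α)
  hef : ⁅e, f⁆ = (H : g)
  h2 : α H = 2

namespace IsTriple
variable {α : Dual K S.h} {e f : g} {H : S.h} (T : IsTriple α e f H)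
include T

lemma isCoroot : S.IsCoroot α H := ⟨T.h2, e, T.he, f, T.hf, T.hef.symm⟩

lemma ops : Sl2Ops (ad K g e) (ad K g f) (ad K g (H : g)) := sl2Ops T.he T.hf T.hef T.h2

lemma e_ne_zero : e ≠ 0 := by
  rintro rfl
  have h := T.hef
  rw [zero_lie] at h
  have h2 := T.h2
  rw [show H = 0 from Subtype.ext h.symm, map_zero] at h2
  exact two_ne_zero h2.symm

lemma f_ne_zero : f ≠ 0 := by
  rintro rfl
  have h := T.hef
  rw [lie_zero] at h
  have h2 := T.h2
  rw [show H = 0 from Subtype.ext h.symm, map_zero] at h2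
  exact two_ne_zero h2.symm

lemma symm : IsTriple (-α) f e (-H) :=
  ⟨T.hf, by rw [neg_neg]; exact T.he, by
    rw [← lie_skew, T.hef]; rfl, by rw [LinearMap.neg_apply, map_neg, neg_neg, T.h2]⟩

lemma span {x : g} (hx : x ∈ S.W α) : ∃ c : K, x = c • e :=
  mem_span_of_mem_W T.he T.hf T.hef T.h2 hx

lemma span_neg {x : g} (hx : x ∈ S.W (-α)) : ∃ c : K, x = c • f := T.symm.span hx

lemma ad_H {β : Dual K S.h} {x : g} (hx : x ∈ S.W β) : ad K g (H : g) x = β H • x := hx H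

lemma add_weight {β : Dual K S.h} (hβ : S.W β ≠ ⊥) {z : ℤ} (hz : β H = z) (h0 : z < 0) :
    S.W (β + α) ≠ ⊥ := by
  obtain ⟨x, hx, hx0⟩ := (Submodule.ne_bot_iff _).mp hβ
  refine (Submodule.ne_bot_iff _).mpr ⟨⁅e, x⁆, lie_mem_W' T.he hx (add_comm _ _), ?_⟩
  exact T.ops.E_ne_zero (by rw [T.ad_H hx, hz]) h0 hx0

lemma sub_weight {β : Dual K S.h} (hβ : S.W β ≠ ⊥) {z : ℤ} (hz : β H = z) (h0 : 0 < z) :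
    S.W (β - α) ≠ ⊥ := by
  obtain ⟨x, hx, hx0⟩ := (Submodule.ne_bot_iff _).mp hβ
  refine (Submodule.ne_bot_iff _).mpr ⟨⁅f, x⁆, lie_mem_W' T.hf hx (by abel), ?_⟩
  exact T.ops.F_ne_zero (by rw [T.ad_H hx, hz]) h0 hx0

lemma reflect_weight {β : Dual K S.h} (hβ : S.W β ≠ ⊥) {z : ℤ} (hz : β H = z) :
    S.W (β - z • α) ≠ ⊥ := by
  obtain ⟨x, hx, hx0⟩ := (Submodule.ne_bot_iff _).mp hβ
  rcases le_total 0 z with h | h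
  · obtain ⟨d, rfl⟩ := Int.eq_ofNat_of_zero_le h
    refine (Submodule.ne_bot_iff _).mpr ⟨((ad K g f) ^ d) x, ?_, fun h => hx0
      (T.ops.eq_zero_of_F_pow (by rw [T.ad_H hx, hz, Int.cast_natCast]) h)⟩
    have := ad_pow_mem_W T.hf hx d
    rwa [show β - (d : ℤ) • α = β + d • -α by rw [natCast_zsmul, smul_neg]; abel]
  · obtain ⟨d, hd⟩ := Int.eq_ofNat_of_zero_le (neg_nonneg.mpr h)
    obtain rfl : z = -(d : ℤ) := by omega
    refine (Submodule.ne_bot_iff _).mpr ⟨((ad K g e) ^ d) x, ?_, fun h => hx0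
      (T.ops.eq_zero_of_E_pow (by rw [T.ad_H hx, hz, Int.cast_neg, Int.cast_natCast]) h)⟩
    have := ad_pow_mem_W T.he hx d
    rwa [show β - -(d : ℤ) • α = β + d • α by rw [neg_smul, natCast_zsmul]; abel]

lemma two_le_smul {k : ℕ} (hk : 2 ≤ k) : S.W (k • α) = ⊥ := by
  rw [Submodule.eq_bot_iff]
  intro y hy
  have h1 := ad_pow_mem_W T.hf hy (k - 1)
  obtain ⟨k, rfl⟩ : ∃ j, k = j + 1 := ⟨k - 1, by omega⟩
  rw [Nat.add_sub_cancel, show (k + 1) • α + k • -α = α by rw [smul_neg, succ_nsmul]; abel] at h1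
  obtain ⟨c, hc⟩ := T.span h1
  have h3 : (ad K g f ^ 3) e = 0 := by
    have hfe : ⁅f, e⁆ = -(H : g) := by rw [← lie_skew, T.hef]
    have hfH : ⁅f, (H : g)⁆ = (2 : K) • f := by
      rw [← lie_skew, T.hf H, LinearMap.neg_apply, T.h2, neg_smul, neg_neg]
    simp [pow_succ, hfe, hfH]
  refine T.ops.eq_zero_of_F_pow (d := 2 * (k + 1)) ?_ ?_
  · rw [T.ad_H hy, LinearMap.smul_apply, T.h2]; congr 1
    rw [nsmul_eq_mul]; push_cast; ring
  · rw [show 2 * (k + 1) = (k - 1) + (3 + k) by omega, pow_add, Module.End.mul_apply, pow_add,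
      Module.End.mul_apply, hc, map_smul, h3, smul_zero, map_zero]

end IsTriple

lemma pos_add_ne_zero {α β : Dual K S.h} (hα : α ∈ S.pos) (hβ : β ∈ S.pos) : α + β ≠ 0 := fun h =>
  neg_not_mem_pos hβ (by rwa [← eq_neg_of_add_eq_zero_left h])

lemma W_ne_bot_of_pos {α : Dual K S.h} (hα : α ∈ S.pos) : S.W α ≠ ⊥ := (S.pos_root α hα).2

variable [hD : Fact S.IsDynkin]

theorem exists_triple {α : Dual K S.h} (h : IsRootOf K g S.h α) :
    ∃ t : g × g × S.h, IsTriple α t.1 t.2.1 t.2.2 := by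
  obtain ⟨H, h2, e, he, f, hf, hef⟩ := exists_coroot hD.out h
  exact ⟨(e, f, H), he, hf, hef.symm, h2⟩

variable (S) in
open Classical in
/-- A chosen `sl₂`-triple. -/
def triple (α : Dual K S.h) : g × g × S.h :=
  if h : ∃ t : g × g × S.h, IsTriple α t.1 t.2.1 t.2.2 then h.choose else 0

variable (S) in
/-- The raising element. -/
def eu (α : Dual K S.h) : g := (S.triple α).1

variable (S) in
/-- The lowering element. -/
def fu (α : Dual K S.h) : g := (S.triple α).2.1

variable (S) in
/-- The coroot. -/
def co (α : Dual K S.h) : S.h := (S.triple α).2.2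

lemma isTriple {α : Dual K S.h} (h : IsRootOf K g S.h α) :
    IsTriple α (S.eu α) (S.fu α) (S.co α) := by
  have h' := exists_triple h
  rw [eu, fu, co, triple, dif_pos h']
  exact h'.choose_spec

lemma isTriple_of_pos {α : Dual K S.h} (h : α ∈ S.pos) :
    IsTriple α (S.eu α) (S.fu α) (S.co α) := isTriple (S.pos_root α h)

lemma IsCoroot.eq_co {α : Dual K S.h} {H : S.h} (h : S.IsCoroot α H) : H = S.co α :=
  h.unique (isTriple h.isRootOf).isCoroot

theorem pos_sum_ne_zero {s : Multiset (Dual K S.h)} (hs : ∀ β ∈ s, β ∈ S.pos) (h0 : s ≠ 0) :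
    s.sum ≠ 0 := by
  obtain ⟨n, hn⟩ : ∃ n, Multiset.card s = n + 1 :=
    Nat.exists_eq_succ_of_ne_zero fun h => h0 (Multiset.card_eq_zero.mp h)
  clear h0
  induction n generalizing s with
  | zero =>
    obtain ⟨β, rfl⟩ := Multiset.card_eq_one.mp hn
    rw [Multiset.sum_singleton]
    exact (S.pos_root β (hs β (by simp))).1
  | succ n ih =>
    intro h0
    obtain ⟨β, hβs⟩ := Multiset.exists_mem_of_ne_zero (s := s) (by rintro rfl; simp at hn)
    obtain ⟨t, rfl⟩ := Multiset.exists_cons_of_mem hβs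
    have T := isTriple_of_pos (hs β (by simp))
    rw [Multiset.sum_cons] at h0
    have key : ∃ γ ∈ t, ∃ z : ℤ, γ (S.co β) = z ∧ z < 0 := by
      by_contra! hcon
      have : ∀ u : Multiset (Dual K S.h), u ≤ t → ∃ z : ℤ, u.sum (S.co β) = z ∧ 0 ≤ z := by
        intro u
        induction u using Multiset.induction_on with
        | empty => intro _; exact ⟨0, by simp⟩
        | cons γ u ihu =>
          intro hu
          obtain ⟨z, hz, hz0⟩ := ihu ((Multiset.le_cons_self _ _).trans hu)
          have hγ : γ ∈ t := Multiset.mem_of_le hu (by simp)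
          obtain ⟨w, hw⟩ := T.isCoroot.integral (W_ne_bot_of_pos (hs γ (by simp [hγ])))
          refine ⟨w + z, ?_, add_nonneg (hcon γ hγ w hw) hz0⟩
          rw [Multiset.sum_cons, LinearMap.add_apply, hw, hz]; push_cast; rfl
      obtain ⟨z, hz, hz0⟩ := this t le_rfl
      have := congrArg (fun φ : Dual K S.h => φ (S.co β)) h0
      simp only [LinearMap.add_apply, T.h2, hz, LinearMap.zero_apply] at this
      have : ((2 + z : ℤ) : K) = 0 := by push_cast; exact this
      rw [Int.cast_eq_zero] at this
      omega
    obtain ⟨γ, hγ, z, hz, hz0⟩ := key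
    obtain ⟨u, rfl⟩ := Multiset.exists_cons_of_mem hγ
    have hβ := hs β (by simp)
    have hγ' := hs γ (by simp)
    have hsum : γ + β ∈ S.pos := S.pos_add γ hγ' β hβ
      ⟨pos_add_ne_zero hγ' hβ, T.add_weight (W_ne_bot_of_pos hγ') hz hz0⟩
    refine ih (s := (γ + β) ::ₘ u) ?_ (by simpa using hn) ?_
    · intro δ hδ
      rcases Multiset.mem_cons.mp hδ with rfl | hδ
      · exact hsum
      · exact hs δ (by simp [hδ])
    · rw [Multiset.sum_cons, ← h0, Multiset.sum_cons]; abel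

variable (S) in
/-- The simple roots. -/
abbrev Simple := {α : Dual K S.h // S.IsSimpleRoot α}

lemma Simple.pos (i : S.Simple) : i.1 ∈ S.pos := i.2.1

lemma Simple.isTriple (i : S.Simple) : IsTriple i.1 (S.eu i.1) (S.fu i.1) (S.co i.1) :=
  isTriple_of_pos i.pos

lemma Simple.sub_weight_eq_bot {i j : S.Simple} (h : i ≠ j) : S.W (j.1 - i.1) = ⊥ := by
  by_contra h0
  have h1 : j.1 - i.1 ≠ 0 := fun h' => h (Subtype.ext (sub_eq_zero.mp h').symm)
  by_cases hp : j.1 - i.1 ∈ S.pos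
  · exact j.2.ne_add i.pos hp (by abel)
  · exact i.2.ne_add j.pos (neg_mem_pos ⟨h1, h0⟩ hp) (by abel)

lemma Simple.lie_eq_zero {i j : S.Simple} (h : i ≠ j) {x y : g} (hx : x ∈ S.W j.1)
    (hy : y ∈ S.W (-i.1)) : ⁅x, y⁆ = 0 := by
  have := lie_mem_W' hx hy (sub_eq_add_neg _ _).symm
  rwa [Simple.sub_weight_eq_bot h, Submodule.mem_bot] at this

lemma exists_cartan (i j : S.Simple) : ∃ z : ℤ, j.1 (S.co i.1) = z :=
  i.isTriple.isCoroot.integral (W_ne_bot_of_pos j.pos)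

variable (S) in
/-- The Cartan matrix. -/
def A (i j : S.Simple) : ℤ := (exists_cartan i j).choose

lemma A_spec (i j : S.Simple) : j.1 (S.co i.1) = S.A i j := (exists_cartan i j).choose_spec

lemma A_nonpos {i j : S.Simple} (h : i ≠ j) : S.A i j ≤ 0 := by
  by_contra! h0
  exact i.isTriple.sub_weight (W_ne_bot_of_pos j.pos) (A_spec i j) h0 (Simple.sub_weight_eq_bot h)

variable (S) in
/-- Integral combinations of simple roots. -/
def rt : (S.Simple →₀ ℤ) →ₗ[ℤ] Dual K S.h := Finsupp.linearCombination ℤ Subtype.val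

variable (S) in
/-- The pairing with a simple coroot. -/
def P (i : S.Simple) : (S.Simple →₀ ℤ) →ₗ[ℤ] ℤ := Finsupp.linearCombination ℤ (S.A i)

lemma rt_single (i : S.Simple) (z : ℤ) : S.rt (Finsupp.single i z) = z • i.1 :=
  Finsupp.linearCombination_single _ _ _

lemma P_single (i j : S.Simple) (z : ℤ) : S.P i (Finsupp.single j z) = z * S.A i j :=
  Finsupp.linearCombination_single _ _ _

lemma rt_co (i : S.Simple) (n : S.Simple →₀ ℤ) : S.rt n (S.co i.1) = S.P i n := by
  induction n using Finsupp.induction_linear with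
  | zero => simp
  | add a b ha hb => rw [map_add, LinearMap.add_apply, ha, hb, map_add]; push_cast; rfl
  | single j z =>
    rw [rt_single, P_single, LinearMap.smul_apply, A_spec, zsmul_eq_mul]; push_cast; rfl

/-- Nonnegative combinations are multiset sums. -/
lemma exists_multiset {n : S.Simple →₀ ℤ} (hn : 0 ≤ n) :
    ∃ s : Multiset (Dual K S.h), (∀ β ∈ s, β ∈ S.pos) ∧ S.rt n = s.sum ∧ (n ≠ 0 → s ≠ 0) := by
  classical
  refine ⟨∑ i ∈ n.support, Multiset.replicate (n i).toNat i.1, ?_, ?_, ?_⟩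
  · intro β hβ
    obtain ⟨i, hi, hβ⟩ := Multiset.mem_sum.mp hβ
    rw [Multiset.eq_of_mem_replicate hβ]
    exact i.pos
  · rw [rt, Finsupp.linearCombination_apply, Finsupp.sum, ← Multiset.coe_sumAddMonoidHom, map_sum]
    refine Finset.sum_congr rfl fun i _ => ?_
    rw [Multiset.coe_sumAddMonoidHom, Multiset.sum_replicate, ← natCast_zsmul,
      Int.toNat_of_nonneg (hn i)]
  · intro h0 h
    obtain ⟨i, hi⟩ := Finsupp.ne_iff.mp h0
    have h1 : i.1 ∈ ∑ i ∈ n.support, Multiset.replicate (n i).toNat i.1 := by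
      refine Multiset.mem_sum.mpr ⟨i, Finsupp.mem_support_iff.mpr hi, ?_⟩
      rw [Multiset.mem_replicate]
      have := hn i
      simp only [Finsupp.coe_zero, Pi.zero_apply] at this hi
      exact ⟨by omega, rfl⟩
    rw [h] at h1
    simp at h1

lemma rt_ne_zero {n : S.Simple →₀ ℤ} (hn : 0 ≤ n) (h0 : n ≠ 0) : S.rt n ≠ 0 := by
  obtain ⟨s, hs, h1, h2⟩ := exists_multiset hn
  rw [h1]
  exact pos_sum_ne_zero hs (h2 h0)

end Setup

end

section
open LieAlgebra LieModule Module
namespace Setup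
variable {K : Type} [Field K] [IsAlgClosed K] [CharZero K]
variable {g : Type} [LieRing g] [LieAlgebra K g] {S : Setup K g}
variable [hD : Fact S.IsDynkin]

/-- The inclusion of `h` in the normalizer of `Fr m`. -/
def hincl (m : ℕ) : S.h →ₗ[K] (S.Fr m).normalizer :=
  (LieSubalgebra.inclusion (h_le_normalizer m)).toLinearMap

lemma B_co_pos {α : Dual K S.h} (hα : IsRootOf K g S.h α) {m : ℕ} (he : S.eu α ∈ S.Fr m)
    (hf : S.fu α ∈ S.Fr m) :
    ∃ c : ℚ, 0 < c ∧ ∀ x : S.h, S.B m (hincl m (S.co α)) (hincl m x) = c * α x := by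
  have T := isTriple hα
  obtain ⟨c, hc, -, h⟩ := B_coroot_pos T.he T.hf T.hef T.h2 he hf
  exact ⟨c, hc, h⟩

lemma exists_forall_mem_Fr (s : Finset (Dual K S.h)) :
    ∃ m, ∀ α ∈ s, S.eu α ∈ S.Fr m ∧ S.fu α ∈ S.Fr m := by
  classical
  obtain ⟨n, hn⟩ := S.exists_forall_mem_F (s.image S.eu ∪ s.image S.fu)
  obtain ⟨m, hm⟩ := exists_F_le_Fr (S := S) n
  exact ⟨m, fun α hα => ⟨hm (hn _ (by simp only [Finset.mem_union, Finset.mem_image]; exact Or.inl ⟨α, hα, rfl⟩)),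
    hm (hn _ (by simp only [Finset.mem_union, Finset.mem_image]; exact Or.inr ⟨α, hα, rfl⟩))⟩⟩

lemma rt_apply (n : S.Simple →₀ ℤ) (x : S.h) :
    S.rt n x = ∑ i ∈ n.support, (n i : K) * i.1 x := by
  rw [rt, Finsupp.linearCombination_apply, Finsupp.sum, LinearMap.sum_apply]
  exact Finset.sum_congr rfl fun i _ => by rw [LinearMap.smul_apply, zsmul_eq_mul]

theorem exists_P_pos {n : S.Simple →₀ ℤ} (hn : 0 ≤ n) (h0 : n ≠ 0) :
    ∃ i, 0 < n i ∧ 0 < S.P i n := by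
  classical
  by_contra! hcon
  apply rt_ne_zero hn h0
  obtain ⟨m, hm⟩ := exists_forall_mem_Fr (n.support.image Subtype.val)
  have hex : ∀ i : S.Simple, ∃ c : ℚ, 0 < c ∧ (i ∈ n.support →
      ∀ x : S.h, S.B m (hincl m (S.co i.1)) (hincl m x) = c * i.1 x) := by
    intro i
    by_cases hi : i ∈ n.support
    · obtain ⟨h1, h2⟩ := hm i.1 (Finset.mem_image_of_mem _ hi)
      obtain ⟨c, hc, h⟩ := B_co_pos (S.pos_root _ i.pos) h1 h2
      exact ⟨c, hc, fun _ => h⟩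
    · exact ⟨1, one_pos, fun h => absurd h hi⟩
  choose c hc hB using hex
  let x : S.h := ∑ i ∈ n.support, ((n i / c i : ℚ) : K) • S.co i.1
  have hx : ∀ y : S.h, S.B m (hincl m x) (hincl m y) = S.rt n y := by
    intro y
    rw [map_sum, map_sum, LinearMap.sum_apply, rt_apply]
    refine Finset.sum_congr rfl fun i hi => ?_
    rw [map_smul, map_smul, LinearMap.smul_apply, hB i hi, smul_eq_mul, ← mul_assoc,
      ← Rat.cast_mul, div_mul_cancel₀ _ (hc i).ne', Rat.cast_intCast]
  have hrat : ∀ β : Dual K S.h, S.W β ≠ ⊥ → ∃ q : ℚ, β x = q := by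
    intro β hβ
    have : ∀ i : S.Simple, ∃ z : ℤ, β (S.co i.1) = z := fun i => i.isTriple.isCoroot.integral hβ
    choose z hz using this
    refine ⟨∑ i ∈ n.support, n i / c i * z i, ?_⟩
    rw [map_sum, Rat.cast_sum]
    refine Finset.sum_congr rfl fun i _ => ?_
    rw [map_smul, hz, smul_eq_mul]; push_cast; rfl
  obtain ⟨q, hq0, hq, hq'⟩ := exists_B_self (hincl m x) x.2 hrat
  have hq1 : q = ∑ i ∈ n.support, n i / c i * S.P i n := by
    have : (q : K) = ((∑ i ∈ n.support, n i / c i * S.P i n : ℚ) : K) := by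
      rw [← hq, hx, map_sum, Rat.cast_sum]
      refine Finset.sum_congr rfl fun i _ => ?_
      rw [map_smul, rt_co, smul_eq_mul]; push_cast; rfl
    exact_mod_cast this
  have hq2 : q ≤ 0 := by
    rw [hq1]
    refine Finset.sum_nonpos fun i hi => ?_
    have h1 : 0 < n i := lt_of_le_of_ne (hn i) (Finsupp.mem_support_iff.mp hi).symm
    refine mul_nonpos_of_nonneg_of_nonpos (div_nonneg ?_ (hc i).le) ?_
    · exact_mod_cast h1.le
    · exact_mod_cast hcon i h1
  ext y
  rw [← hx, B_comm]
  exact B_eq_zero_of_lie_eq_zero _ _ (hq' (le_antisymm hq2 hq0))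

lemma P_nonpos {n : S.Simple →₀ ℤ} (hn : 0 ≤ n) {i : S.Simple} (hi : n i = 0) : S.P i n ≤ 0 := by
  rw [P, Finsupp.linearCombination_apply, Finsupp.sum]
  refine Finset.sum_nonpos fun j hj => ?_
  have hij : i ≠ j := by
    rintro rfl
    exact (Finsupp.mem_support_iff.mp hj) hi
  exact mul_nonpos_of_nonneg_of_nonpos (hn j) (A_nonpos hij)

lemma P_eq_of_rt_eq {n m : S.Simple →₀ ℤ} (h : S.rt n = S.rt m) (i : S.Simple) :
    S.P i n = S.P i m := by
  have := rt_co i n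
  rw [h, rt_co] at this
  exact_mod_cast this.symm

theorem rt_injective : Function.Injective S.rt := by
  rw [← LinearMap.ker_eq_bot, LinearMap.ker_eq_bot']
  intro n hn
  let p : S.Simple →₀ ℤ := n.mapRange (fun z => max z 0) (by simp)
  let q : S.Simple →₀ ℤ := n.mapRange (fun z => max (-z) 0) (by simp)
  have hp : 0 ≤ p := fun i => le_max_right _ _
  have hq : 0 ≤ q := fun i => le_max_right _ _
  have hpq : n = p - q := by
    ext i
    show n i = max (n i) 0 - max (-n i) 0
    omega
  have hrt : S.rt p = S.rt q := by
    rw [hpq, map_sub, sub_eq_zero] at hn; exact hn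
  have hp0 : p = 0 := by
    by_contra h0
    obtain ⟨i, hi, hP⟩ := exists_P_pos hp h0
    rw [P_eq_of_rt_eq hrt] at hP
    have hqi : q i = 0 := by
      have h1 : 0 < max (n i) 0 := hi
      show max (-n i) 0 = 0
      omega
    exact absurd (P_nonpos hq hqi) (not_le.mpr hP)
  have hq0 : q = 0 := by
    by_contra h0
    apply rt_ne_zero hq h0
    rw [← hrt, hp0, map_zero]
  rw [hpq, hp0, hq0, sub_zero]

theorem exists_coords {β : Dual K S.h} (hβ : β ∈ S.pos) :
    ∃ n : S.Simple →₀ ℤ, 0 ≤ n ∧ S.rt n = β := by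
  let Q : Set (Dual K S.h) := {β | ∃ n : S.Simple →₀ ℤ, 0 ≤ n ∧ S.rt n = β}
  let L : LieSubalgebra K g := { badSum Q with
    lie_mem' := by
      intro a b ha hb
      refine badSum_induction (p := fun a => ⁅a, b⁆ ∈ badSum Q) ?_ ?_ ?_ ha
      · rintro α ⟨n, hn, rfl⟩ x hx
        refine badSum_induction (p := fun b => ⁅x, b⁆ ∈ badSum Q) ?_ ?_ ?_ hb
        · rintro β ⟨m, hm, rfl⟩ y hy
          exact mem_badSum (R := Q) ⟨n + m, add_nonneg hn hm, map_add _ _ _⟩ (lie_mem_W hx hy)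
        · rw [lie_zero]; exact Submodule.zero_mem _
        · intro x y hx hy; rw [lie_add]; exact Submodule.add_mem _ hx hy
      · rw [zero_lie]; exact Submodule.zero_mem _
      · intro x y hx hy; rw [add_lie]; exact Submodule.add_mem _ hx hy }
  obtain ⟨x, hx, hx0⟩ := (Submodule.ne_bot_iff _).mp (W_ne_bot_of_pos hβ)
  have hxL : x ∈ L := by
    refine pos_mem_of_dynkin hD.out ?_ ?_ hβ hx
    · intro y hy
      exact mem_badSum (R := Q) ⟨0, le_rfl, map_zero _⟩ (mem_W_zero.mpr hy)
    · intro α hα y hy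
      refine mem_badSum (R := Q) ⟨Finsupp.single ⟨α, hα⟩ 1, ?_, ?_⟩ hy
      · exact Finsupp.single_nonneg.mpr zero_le_one
      · rw [rt_single, one_smul]
  by_contra hn
  apply hx0
  rw [← comp_of_mem hx]
  refine badSum_induction (p := fun x => S.comp β x = 0) ?_ (map_zero _) ?_
    (show x ∈ badSum Q from hxL)
  · intro α hα x hx
    exact comp_of_mem_ne hx (by rintro rfl; exact hn hα)
  · intro x y hx hy; rw [map_add, hx, hy, add_zero]

/-- A positive root other than `αᵢ` involves another simple root. -/
lemma exists_coord_ne {n : S.Simple →₀ ℤ} (hn : 0 ≤ n) (hp : S.rt n ∈ S.pos) {i : S.Simple}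
    (hi : S.rt n ≠ i.1) : ∃ j, j ≠ i ∧ 0 < n j := by
  by_contra! hcon
  have h1 : n = Finsupp.single i (n i) := by
    ext j
    by_cases hj : j = i
    · subst hj; simp
    · rw [Finsupp.single_eq_of_ne hj]
      exact le_antisymm (hcon j hj) (hn j)
  obtain ⟨k, hk⟩ := Int.eq_ofNat_of_zero_le (hn i)
  have h2 : S.rt n = k • i.1 := by rw [h1, rt_single, hk, natCast_zsmul]
  rw [h2] at hp hi
  rcases k with _ | _ | k
  · rw [zero_smul] at hp; exact (S.pos_root _ hp).1 rfl
  · simp at hi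
  · exact W_ne_bot_of_pos hp (i.isTriple.two_le_smul (by omega))

lemma add_zsmul_ne_zero {β : Dual K S.h} (hβ : β ∈ S.pos) {i : S.Simple} (hi : β ≠ i.1) (z : ℤ) :
    β + z • i.1 ≠ 0 := by
  obtain ⟨n, hn, rfl⟩ := exists_coords hβ
  obtain ⟨j, hji, hj⟩ := exists_coord_ne hn hβ hi
  intro h
  rw [← rt_single, ← map_add, ← map_zero S.rt] at h
  have := DFunLike.congr_fun (rt_injective h) j
  rw [Finsupp.add_apply, Finsupp.single_eq_of_ne hji] at this
  simp at this
  omega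

theorem reflect_pos {β : Dual K S.h} (hβ : β ∈ S.pos) {i : S.Simple} (hi : β ≠ i.1) {z : ℤ}
    (hz : β (S.co i.1) = z) : β - z • i.1 ∈ S.pos := by
  have h0 : β - z • i.1 ≠ 0 := by
    have := add_zsmul_ne_zero hβ hi (-z)
    rwa [neg_smul, ← sub_eq_add_neg] at this
  by_contra hp
  have hp' := neg_mem_pos ⟨h0, i.isTriple.reflect_weight (W_ne_bot_of_pos hβ) hz⟩ hp
  obtain ⟨n, hn, rfl⟩ := exists_coords hβ
  obtain ⟨j, hji, hj⟩ := exists_coord_ne hn hβ hi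
  obtain ⟨m, hm, hm'⟩ := exists_coords hp'
  have h : m = -(n - Finsupp.single i z) := by
    apply rt_injective
    rw [hm', map_neg, map_sub, rt_single]
  have := DFunLike.congr_fun h j
  rw [Finsupp.neg_apply, Finsupp.sub_apply, Finsupp.single_eq_of_ne hji] at this
  have := hm j
  simp only [Finsupp.coe_zero, Pi.zero_apply] at this
  omega

lemma co_neg {α : Dual K S.h} (h : IsRootOf K g S.h α) : S.co (-α) = -S.co α :=
  (IsCoroot.eq_co (isTriple h).symm.isCoroot).symm

/-- The coroot of a sum of roots is a combination of the coroots. -/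
lemma co_mem_span_of_add {α β : Dual K S.h} (hα : IsRootOf K g S.h α) (hβ : IsRootOf K g S.h β)
    (h0 : α + β ≠ 0) {x y : g} (hx : x ∈ S.W α) (hy : y ∈ S.W β) (hxy : ⁅x, y⁆ ≠ 0) :
    S.co (α + β) ∈ Submodule.span K {S.co α, S.co β} := by
  have hr : IsRootOf K g S.h (α + β) :=
    ⟨h0, (Submodule.ne_bot_iff _).mpr ⟨_, lie_mem_W hx hy, hxy⟩⟩
  have T := isTriple hr
  have Ta := isTriple hα
  have Tb := isTriple hβ
  obtain ⟨c, hc⟩ := T.span (lie_mem_W hx hy)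
  have hc0 : c ≠ 0 := by
    rintro rfl
    rw [zero_smul] at hc; exact hxy hc
  have h1 : ⁅y, S.fu (α + β)⁆ ∈ S.W (-α) := lie_mem_W' hy T.hf (by abel)
  have h2 : ⁅x, S.fu (α + β)⁆ ∈ S.W (-β) := lie_mem_W' hx T.hf (by abel)
  obtain ⟨a, ha⟩ := Ta.span_neg h1
  obtain ⟨b, hb⟩ := Tb.span_neg h2
  obtain ⟨a', ha'⟩ := Ta.span hx
  obtain ⟨b', hb'⟩ := Tb.span hy
  have key : c • (S.co (α + β) : g) = (a * a') • (S.co α : g) - (b * b') • (S.co β : g) := by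
    rw [← T.hef, ← smul_lie, ← hc, lie_lie, ha, hb, ha', hb', ← Ta.hef, ← Tb.hef]
    simp only [lie_smul, smul_lie, smul_smul]
  have key' : S.co (α + β) = (c⁻¹ * (a * a')) • S.co α + (-(c⁻¹ * (b * b'))) • S.co β := by
    apply Subtype.ext
    have := congrArg (fun v => c⁻¹ • v) key
    simp only [smul_smul, inv_mul_cancel₀ hc0, one_smul, smul_sub] at this
    rw [this, neg_smul, ← sub_eq_add_neg]; rfl
  rw [key']
  exact Submodule.add_mem _ (Submodule.smul_mem _ _ (Submodule.subset_span (by simp)))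
    (Submodule.smul_mem _ _ (Submodule.subset_span (by simp)))

lemma co_mem_span_of_string {α β : Dual K S.h} (hα : IsRootOf K g S.h α) {e x : g}
    (he : e ∈ S.W α) (hx : x ∈ S.W β) (h0 : ∀ k : ℕ, β + k • α ≠ 0) (n : ℕ)
    (hn : (ad K g e ^ n) x ≠ 0) :
    S.co (β + n • α) ∈ Submodule.span K {S.co α, S.co β} := by
  induction n with
  | zero => exact Submodule.subset_span (by simp)
  | succ n ih =>
    rw [pow_succ', Module.End.mul_apply, ad_apply] at hn
    have h1 : (ad K g e ^ n) x ≠ 0 := by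
      intro h; rw [h, lie_zero] at hn; exact hn rfl
    have h2 := ad_pow_mem_W he hx n
    have h3 := co_mem_span_of_add hα (S.isRootOf_of_mem (h0 n) h2 h1) (by
      rw [show α + (β + n • α) = β + (n + 1) • α by rw [succ_nsmul]; abel]; exact h0 _) he h2 hn
    rw [show α + (β + n • α) = β + (n + 1) • α by rw [succ_nsmul]; abel] at h3
    refine (Submodule.span_le.mpr ?_) h3
    rintro _ (rfl | rfl)
    · exact Submodule.subset_span (by simp)
    · exact ih h1

lemma co_reflect_mem_span {β : Dual K S.h} (hβ : β ∈ S.pos) {i : S.Simple} (hi : β ≠ i.1) {z : ℤ}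
    (hz : β (S.co i.1) = z) : S.co (β - z • i.1) ∈ Submodule.span K {S.co i.1, S.co β} := by
  have T := i.isTriple
  obtain ⟨x, hx, hx0⟩ := (Submodule.ne_bot_iff _).mp (W_ne_bot_of_pos hβ)
  rcases le_total 0 z with h | h
  · obtain ⟨d, rfl⟩ := Int.eq_ofNat_of_zero_le h
    have h1 := co_mem_span_of_string (α := -i.1) (by
      exact T.symm.isCoroot.isRootOf) T.hf hx (fun k => by
        have := add_zsmul_ne_zero hβ hi (-k)
        rwa [neg_smul, natCast_zsmul, ← neg_nsmul] at this) d (fun h => hx0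
        (T.ops.eq_zero_of_F_pow (by rw [T.ad_H hx, hz, Int.cast_natCast]) h))
    rw [co_neg (S.pos_root _ i.pos), smul_neg, ← sub_eq_add_neg] at h1
    rw [natCast_zsmul]
    refine (Submodule.span_le.mpr ?_) h1
    rintro _ (rfl | rfl)
    · exact Submodule.neg_mem _ (Submodule.subset_span (by simp))
    · exact Submodule.subset_span (by simp)
  · obtain ⟨d, hd⟩ := Int.eq_ofNat_of_zero_le (neg_nonneg.mpr h)
    obtain rfl : z = -(d : ℤ) := by omega
    have h1 := co_mem_span_of_string (S.pos_root _ i.pos) T.he hx (fun k => by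
        have := add_zsmul_ne_zero hβ hi k
        rwa [natCast_zsmul] at this) d (fun h => hx0
        (T.ops.eq_zero_of_E_pow (by rw [T.ad_H hx, hz, Int.cast_neg, Int.cast_natCast]) h))
    rwa [neg_smul, sub_neg_eq_add, natCast_zsmul]

theorem co_reflect {β : Dual K S.h} (hβ : β ∈ S.pos) {i : S.Simple} (hi : β ≠ i.1) {z : ℤ}
    (hz : β (S.co i.1) = z) :
    S.co (β - z • i.1) = S.co β - i.1 (S.co β) • S.co i.1 := by
  classical
  obtain ⟨a, b, hab⟩ := Submodule.mem_span_pair.mp (co_reflect_mem_span hβ hi hz)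
  have hγ := reflect_pos hβ hi hz
  set γ := β - z • i.1 with hγdef
  obtain ⟨m, hm⟩ := exists_forall_mem_Fr {i.1, β, γ}
  obtain ⟨ci, hci, hBi⟩ := B_co_pos (S.pos_root _ i.pos) (hm i.1 (by simp)).1 (hm i.1 (by simp)).2
  obtain ⟨cb, hcb, hBb⟩ := B_co_pos (S.pos_root _ hβ) (hm β (by simp)).1 (hm β (by simp)).2
  obtain ⟨cg, hcg, hBg⟩ := B_co_pos (S.pos_root _ hγ) (hm γ (by simp)).1 (hm γ (by simp)).2
  have hci' : (ci : K) ≠ 0 := by exact_mod_cast hci.ne'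
  have hcb' : (cb : K) ≠ 0 := by exact_mod_cast hcb.ne'
  have e1 : ∀ x, (a * ci + cg * z) * i.1 x + (b * cb - cg) * β x = 0 := by
    intro x
    have h1 := hBg x
    rw [← hab, map_add, map_add, map_smul, map_smul, map_smul, map_smul, LinearMap.add_apply,
      LinearMap.smul_apply, LinearMap.smul_apply, hBi, hBb, hγdef, LinearMap.sub_apply,
      LinearMap.smul_apply, zsmul_eq_mul, smul_eq_mul, smul_eq_mul] at h1
    linear_combination h1
  have e2 : b * cb - cg = 0 := by
    by_contra h0
    have h1 := e1 (S.co i.1)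
    rw [i.isTriple.h2, hz] at h1
    apply add_zsmul_ne_zero hβ hi (0 : ℤ)
    have h2 : (2 : ℤ) • β + (-z) • i.1 = 0 := by
      ext x
      have h3 := e1 x
      have h4 : (b * cb - cg) * (2 * β x - z * i.1 x) = 0 := by
        linear_combination 2 * h3 - (i.1 x) * h1
      rcases mul_eq_zero.mp h4 with h4 | h4
      · exact absurd h4 h0
      · rw [LinearMap.add_apply, LinearMap.smul_apply, LinearMap.smul_apply, zsmul_eq_mul,
          zsmul_eq_mul]
        push_cast
        rw [LinearMap.zero_apply]
        linear_combination h4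
    obtain ⟨n, hn, rfl⟩ := exists_coords hβ
    obtain ⟨j, hji, hj⟩ := exists_coord_ne hn hβ hi
    rw [← rt_single, ← map_smul, ← map_add, ← map_zero S.rt] at h2
    have := DFunLike.congr_fun (rt_injective h2) j
    rw [Finsupp.add_apply, Finsupp.single_eq_of_ne hji] at this
    simp at this
    omega
  have e3 : a * ci + cg * z = 0 := by
    have h1 := e1 (S.co i.1)
    rw [i.isTriple.h2, e2, zero_mul, add_zero] at h1
    exact (mul_eq_zero.mp h1).resolve_right two_ne_zero
  have e4 : (ci : K) * i.1 (S.co β) = cb * z := by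
    rw [← hBi, B_comm, hBb, hz]
  have e5 : a = -b * i.1 (S.co β) := by
    have : (ci : K) * a = ci * (-b * i.1 (S.co β)) := by
      linear_combination e3 + b * e4 + z * e2
    exact mul_left_cancel₀ hci' this
  have e6 : γ (S.co γ) = 2 := (isTriple_of_pos hγ).h2
  have e7 : b = 1 := by
    rw [← hab, map_add, map_smul, map_smul, hγdef, LinearMap.sub_apply, LinearMap.sub_apply,
      LinearMap.smul_apply, LinearMap.smul_apply, hz, i.isTriple.h2, (isTriple_of_pos hβ).h2,
      zsmul_eq_mul, zsmul_eq_mul, smul_eq_mul, smul_eq_mul, e5] at e6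
    have : b * 2 = 1 * 2 := by linear_combination e6
    exact mul_right_cancel₀ two_ne_zero this
  rw [← hab, e5, e7]
  module

variable (S) in
/-- The height. -/
def ht : (S.Simple →₀ ℤ) →ₗ[ℤ] ℤ := Finsupp.linearCombination ℤ fun _ => 1

lemma ht_single (i : S.Simple) (z : ℤ) : S.ht (Finsupp.single i z) = z := by
  rw [ht, Finsupp.linearCombination_single, smul_eq_mul, mul_one]

lemma ht_nonneg {n : S.Simple →₀ ℤ} (hn : 0 ≤ n) : 0 ≤ S.ht n := by
  rw [ht, Finsupp.linearCombination_apply, Finsupp.sum]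
  exact Finset.sum_nonneg fun i _ => by simpa using hn i

end Setup

end

section
open LieAlgebra LieModule Module
namespace Setup
variable {K : Type} [Field K] [IsAlgClosed K] [CharZero K]
variable {g : Type} [LieRing g] [LieAlgebra K g] {S : Setup K g}
variable [hD : Fact S.IsDynkin]

/-- Induction on positive roots via simple reflections. -/
theorem pos_induction {p : Dual K S.h → Prop} (simple : ∀ i : S.Simple, p i.1)
    (step : ∀ (i : S.Simple) (β : Dual K S.h) (z : ℤ), β ∈ S.pos → β ≠ i.1 → β (S.co i.1) = z →
      0 < z → β - z • i.1 ∈ S.pos → p (β - z • i.1) → p β) {β : Dual K S.h} (hβ : β ∈ S.pos) :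
    p β := by
  obtain ⟨n, hn, rfl⟩ := exists_coords hβ
  obtain ⟨k, hk⟩ := Int.eq_ofNat_of_zero_le (ht_nonneg hn)
  induction k using Nat.strong_induction_on generalizing n with
  | _ k ih =>
    by_cases hs : S.IsSimpleRoot (S.rt n)
    · exact simple ⟨_, hs⟩
    have h0 : n ≠ 0 := by
      rintro rfl
      exact (S.pos_root _ hβ).1 (map_zero _)
    obtain ⟨i, hi, hP⟩ := exists_P_pos hn h0
    have hne : S.rt n ≠ i.1 := fun h => hs (h ▸ i.2)
    have hpos := reflect_pos hβ hne (rt_co i n)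
    have hrt : S.rt n - S.P i n • i.1 = S.rt (n - Finsupp.single i (S.P i n)) := by
      rw [map_sub, rt_single]
    refine step i _ _ hβ hne (rt_co i n) hP hpos ?_
    obtain ⟨m, hm, hm'⟩ := exists_coords hpos
    have hmn : m = n - Finsupp.single i (S.P i n) := rt_injective (hm'.trans hrt)
    rw [← hm']
    have hht : S.ht m = S.ht n - S.P i n := by rw [hmn, map_sub, ht_single]
    have := ht_nonneg hm
    refine ih (S.ht m).toNat (by omega) m hm (hm' ▸ hpos) (by omega)

lemma smul_integral {β : Dual K S.h} (hβ : β ∈ S.pos) :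
    ∀ (c : K) (t : S.Simple →₀ ℤ), c • β = S.rt t → ∃ z : ℤ, c = z := by
  refine pos_induction (p := fun β => ∀ (c : K) (t : S.Simple →₀ ℤ), c • β = S.rt t →
    ∃ z : ℤ, c = z) ?_ ?_ hβ
  · intro i c t h
    have h1 := congrArg (fun φ : Dual K S.h => φ (S.co i.1)) h
    simp only [LinearMap.smul_apply, i.isTriple.h2, rt_co, smul_eq_mul] at h1
    have h2 : S.rt ((2 : ℤ) • t) = S.rt (Finsupp.single i (S.P i t)) := by
      rw [map_smul, rt_single, ← h, ← Int.cast_smul_eq_zsmul K (2 : ℤ),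
        ← Int.cast_smul_eq_zsmul K (S.P i t), ← h1, smul_smul]
      push_cast; rw [mul_comm]
    have h3 := DFunLike.congr_fun (rt_injective h2) i
    rw [Finsupp.single_eq_same, Finsupp.smul_apply] at h3
    refine ⟨t i, ?_⟩
    rw [← h3] at h1
    push_cast [smul_eq_mul] at h1
    rw [mul_comm] at h1
    exact mul_left_cancel₀ two_ne_zero h1
  · intro i β z hβ hne hz hz0 hpos ih c t h
    have h1 := congrArg (fun φ : Dual K S.h => φ (S.co i.1)) h
    simp only [LinearMap.smul_apply, hz, rt_co, smul_eq_mul] at h1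
    refine ih c (t - Finsupp.single i (S.P i t)) ?_
    rw [map_sub, rt_single, ← h, smul_sub, ← Int.cast_smul_eq_zsmul K z,
      ← Int.cast_smul_eq_zsmul K (S.P i t), ← h1, smul_smul]

lemma wle_iff {lam mu : Dual K S.h} : S.wle lam mu ↔ ∃ n : S.Simple →₀ ℤ, 0 ≤ n ∧
    mu - lam = S.rt n := by
  constructor
  · rintro ⟨s, hs, h⟩
    rw [h]
    clear h
    induction s using Multiset.induction_on with
    | empty => exact ⟨0, le_rfl, by simp⟩
    | cons β s ih =>
      obtain ⟨n, hn, h⟩ := ih fun γ hγ => hs γ (Multiset.mem_cons_of_mem hγ)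
      obtain ⟨m, hm, h'⟩ := exists_coords (hs β (by simp))
      exact ⟨m + n, add_nonneg hm hn, by rw [Multiset.sum_cons, h, map_add, h']⟩
  · rintro ⟨n, hn, h⟩
    obtain ⟨s, hs, h1, -⟩ := exists_multiset hn
    exact ⟨s, hs, h.trans h1⟩

lemma wle_dotReflect_iff {ρ α mu : Dual K S.h} (hα : α ∈ S.pos) {H : S.h} :
    S.wle (S.dotReflect ρ α H mu) mu ↔ ∃ n : ℕ, (mu + ρ) H = n := by
  rw [wle_iff, dotReflect, sub_sub_cancel]
  obtain ⟨m, hm, hm'⟩ := exists_coords hα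
  constructor
  · rintro ⟨n, hn, h⟩
    obtain ⟨z, hz⟩ := smul_integral hα _ n h
    rw [hz, Int.cast_smul_eq_zsmul K z α, ← hm', ← map_smul] at h
    have h1 := rt_injective h
    have hm0 : m ≠ 0 := by
      rintro rfl
      exact (S.pos_root _ hα).1 (by rw [← hm', map_zero])
    obtain ⟨j, hj, -⟩ := exists_P_pos hm hm0
    have h2 := DFunLike.congr_fun h1 j
    rw [Finsupp.smul_apply, smul_eq_mul] at h2
    have h3 : 0 ≤ n j := hn j
    have hz0 : 0 ≤ z := by
      by_contra! h
      have := mul_neg_of_neg_of_pos h hj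
      omega
    obtain ⟨k, rfl⟩ := Int.eq_ofNat_of_zero_le hz0
    exact ⟨k, by rw [hz, Int.cast_natCast]⟩
  · rintro ⟨n, hn⟩
    refine ⟨n • m, nsmul_nonneg hm n, ?_⟩
    rw [hn, map_nsmul, hm', Nat.cast_smul_eq_nsmul K]

section rho
variable {n : ℕ}

lemma mem_b_iff {x : g} : x ∈ S.b ↔ ∀ β, S.comp β x ≠ 0 → β = 0 ∨ β ∈ S.pos := by
  constructor
  · intro hx β h
    rw [← LieSubalgebra.mem_toSubmodule, S.b_eq] at hx
    obtain ⟨a, ha, y, hy, rfl⟩ := Submodule.mem_sup.mp hx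
    by_contra! hcon
    apply h
    rw [map_add, comp_of_mem_ne (mem_W_zero.mpr ha) hcon.1.symm, zero_add]
    refine badSum_induction (R := S.pos) (p := fun y => S.comp β y = 0) ?_ (map_zero _) ?_ hy
    · intro α hα x hx
      exact comp_of_mem_ne hx (by rintro rfl; exact hcon.2 hα)
    · intro x y hx hy; rw [map_add, hx, hy, add_zero]
  · intro h
    refine mem_of_comp (S := S) S.b.toSubmodule fun β => ?_
    by_cases h0 : S.comp β x = 0
    · rw [h0]; exact Submodule.zero_mem _
    · rcases h β h0 with rfl | hβ
      · rw [S.b_eq]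
        exact Submodule.mem_sup_left (mem_W_zero.mp (comp_mem _ _))
      · exact mem_b_of_pos hβ (comp_mem _ _)

variable (S n) in
/-- `F n` as a module over `h ∩ F n`. -/
def Mn : LieSubmodule K (S.hn n) g :=
  { (S.F n).toSubmodule with
    lie_mem := fun {x _} hy => (S.F n).lie_mem x.2.2 hy }

lemma posRootsN_finite : (S.posRootsN n).Finite := by
  have := S.F_findim n
  have : FiniteDimensional K (S.Mn n) := inferInstanceAs (FiniteDimensional K (S.F n))
  have : IsLieAbelian (S.hn n) := (S.h_maxToral n).1.2.1
  have hfin := LieModule.finite_genWeightSpace_ne_bot K (S.hn n) (S.Mn n)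
  refine Set.Finite.of_finite_image (f := fun γ : Dual K (S.hn n) => (γ : S.hn n → K))
    (hfin.subset ?_) DFunLike.coe_injective.injOn
  rintro _ ⟨γ, hγ, rfl⟩
  obtain ⟨y, hy, hy0⟩ := (Submodule.ne_bot_iff _).mp hγ.2.1
  intro hbot
  have h1 : (⟨y, hy.1⟩ : S.Mn n) ∈ LieModule.weightSpace (S.Mn n) (γ : S.hn n → K) := by
    rw [LieModule.mem_weightSpace]
    intro t
    exact Subtype.ext (hy.2 t)
  have h2 := LieModule.weightSpace_le_genWeightSpace (S.Mn n) (γ : S.hn n → K) h1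
  rw [hbot, LieSubmodule.mem_bot] at h2
  exact hy0 (congrArg Subtype.val h2)

variable {i : S.Simple} (he : S.eu i.1 ∈ S.F n) (hf : S.fu i.1 ∈ S.F n)
include he hf

lemma co_mem_F : (S.co i.1 : g) ∈ S.F n := by
  rw [← i.isTriple.hef]
  exact (S.F n).lie_mem he hf

omit he hf in
lemma adWeightSpace_resDual {β : Dual K S.h} {x : g} (hx : x ∈ S.W β) :
    x ∈ adWeightSpace K g (S.hn n) (S.resDual n β) := fun t => hx ⟨t, t.2.1⟩

omit he hf hD in
lemma ad_pow_mem_adWeightSpace {α γ : Dual K (S.hn n)} {x y : g}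
    (hx : x ∈ adWeightSpace K g (S.hn n) α) (hy : y ∈ adWeightSpace K g (S.hn n) γ) (k : ℕ) :
    (ad K g x ^ k) y ∈ adWeightSpace K g (S.hn n) (γ + k • α) := by
  induction k with
  | zero => simpa using hy
  | succ k ih =>
    rw [pow_succ', Module.End.mul_apply, ad_apply]
    intro t
    rw [leibniz_lie, hx t, ih t, smul_lie, lie_smul, ← add_smul]
    congr 1
    simp only [LinearMap.add_apply, LinearMap.smul_apply, nsmul_eq_mul]
    push_cast; ring

/-- A power of `e` or `f` shifting weights by `z αᵢ`. -/
lemma exists_shift (z : ℤ) : ∃ T : End K g, (∀ β, ∀ x ∈ S.W β, T x ∈ S.W (β + z • i.1)) ∧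
    (∀ x ∈ S.F n, T x ∈ S.F n) ∧
    (∀ γ, ∀ x ∈ adWeightSpace K g (S.hn n) γ,
      T x ∈ adWeightSpace K g (S.hn n) (γ + z • S.resDual n i.1)) ∧
    ∀ x, ⁅(S.co i.1 : g), x⁆ = (-z : K) • x → T x = 0 → x = 0 := by
  have T := i.isTriple
  rcases le_total 0 z with h | h
  · obtain ⟨d, rfl⟩ := Int.eq_ofNat_of_zero_le h
    refine ⟨ad K g (S.eu i.1) ^ d, ?_, ?_, ?_, ?_⟩
    · intro β x hx
      rw [natCast_zsmul]
      exact ad_pow_mem_W T.he hx d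
    · exact fun x hx => ad_pow_mem_F he hx d
    · intro γ x hx
      rw [natCast_zsmul]
      exact ad_pow_mem_adWeightSpace (adWeightSpace_resDual T.he) hx d
    · intro x hx h
      exact T.ops.eq_zero_of_E_pow (by rw [ad_apply, hx, Int.cast_natCast]) h
  · obtain ⟨d, hd⟩ := Int.eq_ofNat_of_zero_le (neg_nonneg.mpr h)
    obtain rfl : z = -(d : ℤ) := by omega
    refine ⟨ad K g (S.fu i.1) ^ d, ?_, ?_, ?_, ?_⟩
    · intro β x hx
      have := ad_pow_mem_W T.hf hx d
      rwa [neg_nsmul, ← natCast_zsmul, ← neg_smul] at this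
    · exact fun x hx => ad_pow_mem_F hf hx d
    · intro γ x hx
      have := ad_pow_mem_adWeightSpace (adWeightSpace_resDual T.hf) hx d
      rw [show S.resDual n (-i.1) = -S.resDual n i.1 from rfl] at this
      rwa [neg_nsmul, ← natCast_zsmul, ← neg_smul] at this
    · intro x hx h
      exact T.ops.eq_zero_of_F_pow (by
        rw [ad_apply, hx, Int.cast_neg, Int.cast_natCast, neg_neg]) h

omit he hf in
lemma comp_shift {T : End K g} {δ : Dual K S.h} (hT : ∀ β, ∀ x ∈ S.W β, T x ∈ S.W (β + δ))
    (β : Dual K S.h) (x : g) : S.comp (β + δ) (T x) = T (S.comp β x) := by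
  induction x using S.W_induction with
  | mem γ x hx =>
    by_cases h : γ = β
    · subst h
      rw [comp_of_mem hx, comp_of_mem (hT _ x hx)]
    · rw [comp_of_mem_ne hx h, comp_of_mem_ne (hT _ x hx) (by simpa using h), map_zero]
  | add x y hx hy => simp only [map_add, hx, hy]

omit he hf in
lemma comp_lie_h (t : S.h) (β : Dual K S.h) (x : g) :
    S.comp β ⁅(t : g), x⁆ = β t • S.comp β x := by
  have := comp_shift (S := S) (T := ad K g (t : g)) (δ := 0) (fun γ x hx => by
    rw [ad_apply, hx t, add_zero]; exact Submodule.smul_mem _ _ hx) β x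
  rw [add_zero, ad_apply, ad_apply, comp_mem β x t] at this
  exact this

omit he hf in
lemma fu_not_mem_b : S.fu i.1 ∉ S.b := by
  intro h
  have h1 := mem_b_iff.mp h (-i.1) (by rw [comp_of_mem i.isTriple.hf]; exact i.isTriple.f_ne_zero)
  rcases h1 with h1 | h1
  · exact (S.pos_root _ i.pos).1 (neg_eq_zero.mp h1)
  · exact neg_not_mem_pos i.pos h1

lemma rootSpaceN_simple_le : S.rootSpaceN n (S.resDual n i.1) ≤ S.b.toSubmodule := by
  intro x hx
  have T := i.isTriple
  have hHF := co_mem_F he hf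
  have hxf : ⁅x, S.fu i.1⁆ ∈ S.h := by
    refine S.mem_h_of_commute ((S.F n).lie_mem hx.1 hf) fun t ht => ?_
    rw [leibniz_lie, hx.2 ⟨t, ht⟩, adWeightSpace_resDual (n := n) T.hf ⟨t, ht⟩, smul_lie, lie_smul,
      ← add_smul, show S.resDual n (-i.1) = -S.resDual n i.1 from rfl, LinearMap.neg_apply,
      add_neg_cancel, zero_smul]
  set Hx : S.h := ⟨_, hxf⟩ with hHx
  set c := i.1 Hx / 2
  have h0 : x - c • S.eu i.1 = 0 := by
    refine T.ops.eq_zero_of_F_pow (d := 2) ?_ ?_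
    · have h1 := hx.2 ⟨S.co i.1, (S.co i.1).2, hHF⟩
      have h2 : S.resDual n i.1 ⟨S.co i.1, (S.co i.1).2, hHF⟩ = 2 := T.h2
      rw [h2] at h1
      have h3 := T.he (S.co i.1)
      rw [T.h2] at h3
      rw [map_sub, map_smul, ad_apply, ad_apply, h1, h3, smul_sub, smul_comm c]; norm_num
    · have h1 : ⁅S.fu i.1, x - c • S.eu i.1⁆ = ((c • S.co i.1 - Hx : S.h) : g) := by
        rw [lie_sub, lie_smul, ← lie_skew, ← lie_skew (S.fu i.1) (S.eu i.1), T.hef, smul_neg]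
        show -⁅x, S.fu i.1⁆ - -(c • (S.co i.1 : g)) = c • (S.co i.1 : g) - ⁅x, S.fu i.1⁆
        abel
      rw [pow_two, Module.End.mul_apply, ad_apply, ad_apply, h1, ← lie_skew, T.hf,
        LinearMap.neg_apply, map_sub, map_smul, T.h2, smul_eq_mul, div_mul_cancel₀ _ two_ne_zero,
        sub_self, neg_zero, zero_smul, neg_zero]
  rw [sub_eq_zero] at h0
  rw [h0]
  exact Submodule.smul_mem _ _ (mem_b_of_pos i.pos T.he)

lemma simple_mem_posRootsN : S.resDual n i.1 ∈ S.posRootsN n := by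
  refine ⟨?_, ?_, rootSpaceN_simple_le he hf⟩
  · intro h
    have h2 : S.resDual n i.1 ⟨S.co i.1, (S.co i.1).2, co_mem_F he hf⟩ = 2 := i.isTriple.h2
    rw [h] at h2
    exact two_ne_zero h2.symm
  · exact (Submodule.ne_bot_iff _).mpr ⟨S.eu i.1, ⟨he, adWeightSpace_resDual i.isTriple.he⟩,
      i.isTriple.e_ne_zero⟩

lemma reflect_mem_posRootsN {H : S.hn n} (hH : (H : g) = S.co i.1) {γ : Dual K (S.hn n)}
    (hγ : γ ∈ S.posRootsN n) (hne : γ ≠ S.resDual n i.1) :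
    γ - γ H • S.resDual n i.1 ∈ S.posRootsN n ∧
      γ - γ H • S.resDual n i.1 ≠ S.resDual n i.1 := by
  have T := i.isTriple
  have hα : S.resDual n i.1 H = 2 := by
    rw [← T.h2]
    exact congrArg i.1 (Subtype.ext hH)
  obtain ⟨y, hy, hy0⟩ := (Submodule.ne_bot_iff _).mp hγ.2.1
  have hHy : ⁅(S.co i.1 : g), y⁆ = γ H • y := by rw [← hH]; exact hy.2 H
  obtain ⟨z, hz⟩ := T.ops.integral (x := y) hHy hy0
  rw [hz, Int.cast_smul_eq_zsmul K z (S.resDual n i.1)]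
  refine ⟨⟨?_, ?_, ?_⟩, ?_⟩
  · intro h
    rw [sub_eq_zero] at h
    have h1 := congrArg (fun φ : Dual K (S.hn n) => φ H) h
    simp only [LinearMap.smul_apply, hα, hz, zsmul_eq_mul] at h1
    have h2 : (z : K) = 0 := by linear_combination -h1
    rw [Int.cast_eq_zero] at h2
    rw [h2, zero_smul] at h
    exact hγ.1 h
  · obtain ⟨U, -, hU2, hU3, hU4⟩ := exists_shift he hf (-z)
    refine (Submodule.ne_bot_iff _).mpr ⟨U y, ⟨hU2 y hy.1, ?_⟩, fun h => hy0 (hU4 y ?_ h)⟩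
    · have := hU3 γ y hy.2
      rwa [neg_smul, ← sub_eq_add_neg] at this
    · rw [hHy, hz, Int.cast_neg, neg_neg]
  · intro x hx
    obtain ⟨U, hU1, hU2, hU3, hU4⟩ := exists_shift he hf z
    have hUx : U x ∈ S.b := hγ.2.2 ⟨hU2 x hx.1, by
      have := hU3 _ x hx.2
      rwa [sub_add_cancel] at this⟩
    refine mem_b_iff.mpr fun β hβ => ?_
    have hwt : ∀ t : S.hn n, S.resDual n β t = (γ - z • S.resDual n i.1) t := by
      intro t
      have h1 : S.comp β ⁅(t : g), x⁆ = S.resDual n β t • S.comp β x :=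
        comp_lie_h (S := S) ⟨(t : g), t.2.1⟩ β x
      have h2 : ⁅(t : g), x⁆ = (γ - z • S.resDual n i.1) t • x := hx.2 t
      rw [h2, map_smul] at h1
      exact (smul_left_injective K hβ h1).symm
    have hβH : β (S.co i.1) = -z := by
      have h1 : S.resDual n β H = β (S.co i.1) := congrArg β (Subtype.ext hH)
      rw [← h1, hwt, LinearMap.sub_apply, LinearMap.smul_apply, hα, hz, zsmul_eq_mul]
      ring
    have hne0 : S.comp (β + z • i.1) (U x) ≠ 0 := by
      rw [comp_shift hU1]
      intro h
      refine hβ (hU4 _ ?_ h)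
      rw [comp_mem β x, hβH]
    have hδ : (β + z • i.1) (S.co i.1) = z := by
      rw [LinearMap.add_apply, LinearMap.smul_apply, hβH, T.h2, zsmul_eq_mul]; ring
    rcases mem_b_iff.mp hUx _ hne0 with h | h
    · left
      rw [h, LinearMap.zero_apply] at hδ
      have : z = 0 := by exact_mod_cast hδ.symm
      rwa [this, zero_smul, add_zero] at h
    · right
      by_cases hi : β + z • i.1 = i.1
      · exfalso
        apply hne
        have h1 : S.resDual n β + z • S.resDual n i.1 = S.resDual n i.1 :=
          congrArg (S.resDual n) hi
        rw [← h1, LinearMap.ext hwt, sub_add_cancel]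
      · have := reflect_pos h hi hδ
        rwa [add_sub_cancel_right] at this
  · intro h
    have h1 := congrArg (fun φ : Dual K (S.hn n) => φ H) h
    simp only [LinearMap.smul_apply, LinearMap.sub_apply, hα, hz, zsmul_eq_mul] at h1
    have h2 : (z : K) = (-2 : ℤ) := by push_cast; linear_combination -h1
    rw [Int.cast_inj] at h2
    have h3 : γ = S.resDual n (-i.1) := by
      rw [show S.resDual n (-i.1) = -S.resDual n i.1 from rfl, sub_eq_iff_eq_add.mp h, h2]
      module
    refine fu_not_mem_b (i := i) (hγ.2.2 ⟨hf, ?_⟩)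
    rw [h3]
    exact adWeightSpace_resDual T.hf

end rho

theorem rho_co {ρ : Dual K S.h} (hρ : S.IsGlobalRho ρ) (i : S.Simple) : ρ (S.co i.1) = 1 := by
  classical
  have T := i.isTriple
  obtain ⟨n, he, hf⟩ := S.exists_mem_F_pair (S.eu i.1) (S.fu i.1)
  let H : S.hn n := ⟨S.co i.1, (S.co i.1).2, co_mem_F he hf⟩
  have hα : S.resDual n i.1 H = 2 := T.h2
  have h1 : ρ (S.co i.1) = S.rhoN n H := by
    rw [← hρ n]; rfl
  rw [h1, rhoN, finsum_mem_eq_finite_toFinset_sum _ posRootsN_finite,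
    ← Finset.add_sum_erase _ _ (posRootsN_finite.mem_toFinset.mpr (simple_mem_posRootsN he hf)),
    LinearMap.smul_apply, LinearMap.add_apply, hα, LinearMap.sum_apply]
  set s := (posRootsN_finite (S := S) (n := n)).toFinset.erase (S.resDual n i.1)
  have hs : ∀ γ, γ ∈ s ↔ γ ∈ S.posRootsN n ∧ γ ≠ S.resDual n i.1 := by
    intro γ
    rw [Finset.mem_erase, Set.Finite.mem_toFinset]
    tauto
  let σ : Dual K (S.hn n) → Dual K (S.hn n) := fun γ => γ - γ H • S.resDual n i.1
  have hσH : ∀ γ, σ γ H = -γ H := by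
    intro γ
    show γ H - γ H * S.resDual n i.1 H = _
    rw [hα]; ring
  have hσσ : ∀ γ, σ (σ γ) = γ := by
    intro γ
    show σ γ - σ γ H • S.resDual n i.1 = γ
    rw [hσH]
    show γ - γ H • S.resDual n i.1 - _ = γ
    module
  have hσs : ∀ γ ∈ s, σ γ ∈ s := fun γ hγ =>
    (hs _).mpr (reflect_mem_posRootsN he hf (H := H) rfl ((hs γ).mp hγ).1 ((hs γ).mp hγ).2)
  have hsum : ∑ γ ∈ s, γ H = -∑ γ ∈ s, γ H := by
    rw [← Finset.sum_neg_distrib]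
    refine Finset.sum_bij' (fun γ _ => σ γ) (fun γ _ => σ γ) hσs hσs (fun γ _ => hσσ γ)
      (fun γ _ => hσσ γ) fun γ _ => ?_
    rw [hσH, neg_neg]
  have hsum0 : ∑ γ ∈ s, γ H = 0 := by
    have : (2 : K) * ∑ γ ∈ s, γ H = 0 := by linear_combination hsum
    exact (mul_eq_zero.mp this).resolve_left two_ne_zero
  rw [hsum0, add_zero, smul_eq_mul, inv_mul_cancel₀ two_ne_zero]

end Setup

end

section
open LieAlgebra LieModule Module
namespace Setup
attribute [local instance] LieRing.ofAssociativeRing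
variable {K : Type} [Field K] [IsAlgClosed K] [CharZero K]
variable {g : Type} [LieRing g] [LieAlgebra K g] {S : Setup K g}
variable [hD : Fact S.IsDynkin]
local notation "ε" => UniversalEnvelopingAlgebra.ι K

section ind

variable (S) in
/-- the coordinate along `fu β` of the component of weight `-β` -/
lemma exists_functional (β : {β // β ∈ S.pos}) : ∃ φ : Dual K g, φ (S.fu β) = 1 := by
  have h0 : S.fu β.1 ≠ 0 := (isTriple_of_pos β.2).f_ne_zero
  have h1 : ¬ ∀ φ : Dual K g, φ (S.fu β) = 0 := fun h =>
    h0 ((Module.forall_dual_apply_eq_zero_iff K _).mp h)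
  push Not at h1
  obtain ⟨φ, hφ⟩ := h1
  exact ⟨(φ (S.fu β))⁻¹ • φ, by rw [LinearMap.smul_apply, smul_eq_mul, inv_mul_cancel₀ hφ]⟩

variable (S) in
def coord (β : {β // β ∈ S.pos}) : g →ₗ[K] K := (S.exists_functional β).choose ∘ₗ S.comp (-β.1)

open Classical in
lemma coord_fu (β γ : {β // β ∈ S.pos}) : S.coord β (S.fu γ) = if γ = β then 1 else 0 := by
  have hγ := (isTriple_of_pos γ.2).hf
  split_ifs with h
  · subst h
    rw [coord, LinearMap.comp_apply, comp_of_mem hγ]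
    exact (S.exists_functional γ).choose_spec
  · rw [coord, LinearMap.comp_apply, comp_of_mem_ne hγ, map_zero]
    exact fun h' => h (Subtype.ext (neg_injective h'))

lemma comp_ne_zero_finite (x : g) : {β | S.comp β x ≠ 0}.Finite := by
  classical
  refine (DFinsupp.support (S.decomp x)).finite_toSet.subset fun β hβ => ?_
  rw [Finset.mem_coe, DFinsupp.mem_support_iff]
  intro h
  apply hβ
  show ((S.decomp x β : S.W β) : g) = 0
  rw [h]; rfl

lemma coord_finite (x : g) : (Function.support fun β => S.coord β x).Finite := by
  refine Set.Finite.subset (Set.Finite.preimage (f := fun β : {β // β ∈ S.pos} => -β.1)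
    (Set.injOn_of_injective (neg_injective.comp Subtype.val_injective))
    (comp_ne_zero_finite (S := S) x)) fun β hβ => ?_
  intro h
  apply hβ
  show S.coord β x = 0
  rw [coord, LinearMap.comp_apply, h, map_zero]

variable (S) in
def coords : g →ₗ[K] ({β // β ∈ S.pos} →₀ K) where
  toFun x := Finsupp.ofSupportFinite (fun β => S.coord β x) (coord_finite x)
  map_add' x y := by ext β; exact map_add (S.coord β) x y
  map_smul' c x := by ext β; exact map_smul (S.coord β) c x

lemma coords_apply (x : g) (β : {β // β ∈ S.pos}) : S.coords x β = S.coord β x := rfl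

lemma coords_fu (β : {β // β ∈ S.pos}) : S.coords (S.fu β) = Finsupp.single β 1 := by
  classical
  ext γ
  rw [coords_apply, coord_fu, Finsupp.single_apply]

lemma coords_eq_zero {x : g} : S.coords x = 0 ↔ x ∈ S.b := by
  constructor
  · intro h
    refine mem_b_iff.mpr fun β hβ => ?_
    by_contra! hcon
    have hr : IsRootOf K g S.h β := S.isRootOf_of_mem hcon.1 (comp_mem β x) hβ
    let γ : {β // β ∈ S.pos} := ⟨-β, neg_mem_pos hr hcon.2⟩
    have hγ : -γ.1 = β := neg_neg β
    obtain ⟨c, hc⟩ : ∃ c : K, S.comp β x = c • S.fu γ.1 :=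
      (isTriple_of_pos γ.2).span_neg (hγ.symm ▸ comp_mem β x)
    have h1 := coords_apply x γ
    have hc' : S.comp (-γ.1) x = c • S.fu γ.1 := by rw [hγ, hc]
    rw [h, Finsupp.zero_apply, coord, LinearMap.comp_apply, hc', map_smul,
      (S.exists_functional γ).choose_spec, smul_eq_mul, mul_one] at h1
    rw [hc, ← h1, zero_smul] at hβ
    exact hβ rfl
  · intro h
    ext β
    rw [coords_apply, coord, LinearMap.comp_apply]
    by_cases h0 : S.comp (-β.1) x = 0
    · rw [h0, map_zero]; rfl
    · rcases mem_b_iff.mp h _ h0 with h1 | h1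
      · exact absurd (neg_eq_zero.mp h1) (S.pos_root _ β.2).1
      · exact absurd h1 (neg_not_mem_pos β.2)

variable (S) in
/-- projection to `h` -/
def proj0 : g →ₗ[K] S.h :=
  (S.comp 0).codRestrict S.h.toSubmodule fun x => mem_W_zero.mp (comp_mem 0 x)

lemma proj0_of_mem (H : S.h) : S.proj0 (H : g) = H :=
  Subtype.ext (comp_of_mem (mem_W_zero.mpr H.2))

lemma proj0_of_mem_W {β : Dual K S.h} (hβ : β ≠ 0) {x : g} (hx : x ∈ S.W β) : S.proj0 x = 0 :=
  Subtype.ext (comp_of_mem_ne hx hβ)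

lemma b_induction {p : g → Prop} (h : ∀ x ∈ S.h, p x) (n : ∀ α ∈ S.pos, ∀ x ∈ S.W α, p x)
    (add : ∀ x y, p x → p y → p (x + y)) {x : g} (hx : x ∈ S.b) : p x := by
  rw [← LieSubalgebra.mem_toSubmodule, S.b_eq] at hx
  obtain ⟨y, hy, z, hz, rfl⟩ := Submodule.mem_sup.mp hx
  exact add _ _ (h y hy) (badSum_induction (R := S.pos) (p := p) n
    (h 0 S.h.zero_mem) add hz)

lemma proj0_lie {x y : g} (hx : x ∈ S.b) (hy : y ∈ S.b) : S.proj0 ⁅x, y⁆ = 0 := by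
  refine b_induction (p := fun x => S.proj0 ⁅x, y⁆ = 0) ?_ ?_ ?_ hx
  · intro x hx
    refine b_induction (p := fun y => S.proj0 ⁅x, y⁆ = 0) ?_ ?_ ?_ hy
    · intro y hy
      have : ⁅x, y⁆ = 0 := by
        have := (mem_W_zero.mpr hy) ⟨x, hx⟩
        rwa [LinearMap.zero_apply, zero_smul] at this
      rw [this, map_zero]
    · intro α hα y hy
      have := hy ⟨x, hx⟩
      rw [this, map_smul, proj0_of_mem_W (S.pos_root α hα).1 hy, smul_zero]
    · intro y z hy hz; rw [lie_add, map_add, hy, hz, add_zero]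
  · intro α hα x hx
    refine b_induction (p := fun y => S.proj0 ⁅x, y⁆ = 0) ?_ ?_ ?_ hy
    · intro y hy
      have := hx ⟨y, hy⟩
      rw [← lie_skew, this, map_neg, map_smul, proj0_of_mem_W (S.pos_root α hα).1 hx, smul_zero,
        neg_zero]
    · intro β hβ y hy
      exact proj0_of_mem_W (pos_add_ne_zero hα hβ) (lie_mem_W hx hy)
    · intro y z hy hz; rw [lie_add, map_add, hy, hz, add_zero]
  · intro y z hy hz; rw [add_lie, map_add, hy, hz, add_zero]

variable (S) in
def ind [LinearOrder {β // β ∈ S.pos}] (lam : Dual K S.h) : IndData K g {β // β ∈ S.pos} where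
  X β := S.fu β
  π := S.coords
  μ := lam ∘ₗ S.proj0
  π_X := coords_fu
  μ_X β := by
    rw [LinearMap.comp_apply, proj0_of_mem_W (neg_ne_zero.mpr (S.pos_root _ β.2).1)
      (isTriple_of_pos β.2).hf, map_zero]
  π_lie y z hy hz := by
    rw [coords_eq_zero] at *
    exact S.b.lie_mem hy hz
  μ_lie y z hy hz := by
    rw [coords_eq_zero] at *
    rw [LinearMap.comp_apply, proj0_lie hy hz, map_zero]

lemma ind_ideal [LinearOrder {β // β ∈ S.pos}] (lam : Dual K S.h) :
    (S.ind lam).ideal = S.vermaIdeal lam := by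
  apply le_antisymm
  · refine Submodule.span_le.mpr ?_
    rintro _ ⟨y, hy, rfl⟩
    have hy : y ∈ S.b := coords_eq_zero.mp hy
    show ε y - algebraMap K _ (lam (S.proj0 y)) ∈ S.vermaIdeal lam
    refine b_induction (p := fun y => ε y - algebraMap K _ (lam (S.proj0 y)) ∈ S.vermaIdeal lam)
      ?_ ?_ ?_ hy
    · intro x hx
      have := proj0_of_mem (S := S) ⟨x, hx⟩
      rw [show x = ((⟨x, hx⟩ : S.h) : g) from rfl, this]
      exact Submodule.subset_span (Or.inr ⟨_, rfl⟩)
    · intro α hα x hx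
      rw [proj0_of_mem_W (S.pos_root α hα).1 hx, map_zero, map_zero, sub_zero]
      exact Submodule.subset_span (Or.inl ⟨x, mem_badSum hα hx, rfl⟩)
    · intro x y hx hy
      have := Submodule.add_mem _ hx hy
      simp only [map_add]
      rwa [add_sub_add_comm]
  · refine Submodule.span_le.mpr ?_
    rintro _ (⟨x, hx, rfl⟩ | ⟨H, rfl⟩)
    · refine Submodule.subset_span ⟨x, ?_, ?_⟩
      · refine coords_eq_zero.mpr ?_
        rw [← LieSubalgebra.mem_toSubmodule, S.b_eq]
        exact Submodule.mem_sup_right hx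
      · have : S.proj0 x = 0 := badSum_induction (R := S.pos) (p := fun x => S.proj0 x = 0)
          (fun α hα x hx => proj0_of_mem_W (S.pos_root α hα).1 hx) (map_zero _)
          (fun x y hx hy => by rw [map_add, hx, hy, add_zero]) hx
        show ε x = ε x - algebraMap K _ (lam (S.proj0 x))
        rw [this, map_zero, map_zero, sub_zero]
    · refine Submodule.subset_span ⟨H, ?_, ?_⟩
      · refine coords_eq_zero.mpr ?_
        rw [← LieSubalgebra.mem_toSubmodule, S.b_eq]
        exact Submodule.mem_sup_left H.2
      · show _ = ε _ - algebraMap K _ (lam (S.proj0 H))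
        rw [proj0_of_mem]

end ind

section algebra

variable (S) in
/-- the enveloping algebra of the sum of the root spaces `W (-β)`, `β ∈ R` -/
def Nsub (R : Set (Dual K S.h)) : Subalgebra K (Env K g) :=
  Algebra.adjoin K {u | ∃ β ∈ R, ∃ x ∈ S.W (-β), u = ε x}

lemma ε_mem_Nsub {R : Set (Dual K S.h)} {β : Dual K S.h} (hβ : β ∈ R) {x : g} (hx : x ∈ S.W (-β)) :
    ε x ∈ S.Nsub R := Algebra.subset_adjoin ⟨β, hβ, x, hx, rfl⟩

variable (S) in
abbrev Nm : Subalgebra K (Env K g) := S.Nsub S.pos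

variable (S) in
abbrev Nmi (i : S.Simple) : Subalgebra K (Env K g) := S.Nsub {β | β ∈ S.pos ∧ β ≠ i.1}

lemma Nmi_le (i : S.Simple) : S.Nmi i ≤ S.Nm :=
  Algebra.adjoin_mono fun _ ⟨β, hβ, h⟩ => ⟨β, hβ.1, h⟩

variable [LinearOrder {β // β ∈ S.pos}]

lemma ind_sub (lam : Dual K S.h) (s : Set {β // β ∈ S.pos}) :
    (S.ind lam).sub s = S.Nsub (Subtype.val '' s) := by
  apply le_antisymm
  · refine Algebra.adjoin_le ?_
    rintro _ ⟨β, hβ, rfl⟩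
    exact ε_mem_Nsub (R := Subtype.val '' s) ⟨β, hβ, rfl⟩ (isTriple_of_pos β.2).hf
  · refine Algebra.adjoin_le ?_
    rintro _ ⟨_, ⟨β, hβ, rfl⟩, x, hx, rfl⟩
    obtain ⟨c, rfl⟩ := (isTriple_of_pos β.2).span_neg hx
    rw [map_smul]
    have h1 : ε (S.fu β.1) ∈ (S.ind lam).sub s := Algebra.subset_adjoin ⟨β, hβ, rfl⟩
    exact Subalgebra.smul_mem _ h1 c

lemma ind_sub_univ (lam : Dual K S.h) : (S.ind lam).sub Set.univ = S.Nm := by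
  rw [ind_sub, Set.image_univ, Subtype.range_val]

lemma ind_sub_ne (lam : Dual K S.h) (i : S.Simple) :
    (S.ind lam).sub {β | β ≠ ⟨i.1, i.pos⟩} = S.Nmi i := by
  rw [ind_sub]
  congr 1
  ext β
  constructor
  · rintro ⟨β, h, rfl⟩
    exact ⟨β.2, fun h' => h (Subtype.ext h')⟩
  · rintro ⟨h1, h2⟩
    exact ⟨⟨β, h1⟩, fun h => h2 (congrArg Subtype.val h), rfl⟩

lemma ind_closed (lam : Dual K S.h) {R : Set (Dual K S.h)}
    (h : ∀ α ∈ R, ∀ β ∈ R, α + β ∈ S.pos → α + β ∈ R) : (S.ind lam).Closed {β | β.1 ∈ R} := by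
  intro α hα β hβ
  show ⁅S.fu α.1, S.fu β.1⁆ ∈ _
  by_cases h0 : ⁅S.fu α.1, S.fu β.1⁆ = 0
  · rw [h0]; exact Submodule.zero_mem _
  have h1 : ⁅S.fu α.1, S.fu β.1⁆ ∈ S.W (-(α.1 + β.1)) :=
    lie_mem_W' (isTriple_of_pos α.2).hf (isTriple_of_pos β.2).hf (by abel)
  have hne := pos_add_ne_zero α.2 β.2
  have hr := S.isRootOf_of_mem (neg_ne_zero.mpr hne) h1 h0
  have hr' : IsRootOf K g S.h (α.1 + β.1) := ⟨hne, by
    have := (isTriple hr)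
    intro hbot
    have h2 : S.fu (-(α.1 + β.1)) ∈ S.W (α.1 + β.1) := by
      have := this.hf
      rwa [neg_neg] at this
    rw [W, hbot, Submodule.mem_bot] at h2
    exact this.f_ne_zero h2⟩
  have hp := S.pos_add _ α.2 _ β.2 hr'
  have hRr := h _ hα _ hβ hp
  obtain ⟨c, hc⟩ := (isTriple_of_pos hp).span_neg h1
  rw [hc]
  exact Submodule.smul_mem _ _ (Submodule.subset_span ⟨⟨α.1 + β.1, hp⟩, hRr, rfl⟩)

lemma ind_closed_univ (lam : Dual K S.h) : (S.ind lam).Closed Set.univ := by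
  have := ind_closed (S := S) lam (R := S.pos) fun _ _ _ _ h => h
  convert this using 1
  ext β; simp

lemma ind_closed_ne (lam : Dual K S.h) (i : S.Simple) :
    (S.ind lam).Closed {β | β ≠ ⟨i.1, i.pos⟩} := by
  have := ind_closed (S := S) lam (R := {β | β ∈ S.pos ∧ β ≠ i.1})
    fun α hα β hβ h => ⟨h, fun h' => i.2.ne_add hα.1 hβ.1 h'⟩
  convert this using 1
  ext β
  simp [Subtype.ext_iff]

end algebra

section pbw

lemma Nm_mul_ne_zero {u w : Env K g} (hu : u ∈ S.Nm) (hw : w ∈ S.Nm) (hu0 : u ≠ 0) (hw0 : w ≠ 0) :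
    u * w ≠ 0 := by
  classical
  let _ : LinearOrder {β // β ∈ S.pos} := linearOrderOfSTO WellOrderingRel
  rw [← ind_sub_univ (0 : Dual K S.h)] at hu hw
  exact IndData.sub_mul_ne_zero _ (ind_closed_univ 0) hu hw hu0 hw0

lemma exists_Nm (lam : Dual K S.h) (u : Env K g) : ∃ a ∈ S.Nm, u - a ∈ S.vermaIdeal lam := by
  classical
  let _ : LinearOrder {β // β ∈ S.pos} := linearOrderOfSTO WellOrderingRel
  rw [← ind_sub_univ lam, ← ind_ideal]
  exact IndData.exists_sub _ u

lemma eq_zero_of_mem {lam : Dual K S.h} {u : Env K g} (hu : u ∈ S.Nm) (h : u ∈ S.vermaIdeal lam) :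
    u = 0 := by
  classical
  let _ : LinearOrder {β // β ∈ S.pos} := linearOrderOfSTO WellOrderingRel
  rw [← ind_sub_univ lam] at hu
  rw [← ind_ideal] at h
  exact IndData.eq_zero_of_mem_ideal _ (ind_closed_univ lam) hu h

/-- a linear order in which `i` is the least element -/
lemma exists_order (i : {β // β ∈ S.pos}) :
    ∃ o : LinearOrder {β // β ∈ S.pos}, ∀ j, o.le i j := by
  classical
  let o1 : LinearOrder {β // β ∈ S.pos} := linearOrderOfSTO WellOrderingRel
  let f : {β // β ∈ S.pos} → Lex (Bool × {β // β ∈ S.pos}) := fun j => toLex (decide (j ≠ i), j)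
  have hf : Function.Injective f := fun a b h => (Prod.mk.inj (toLex.injective h)).2
  refine ⟨LinearOrder.lift' f hf, fun j => ?_⟩
  show f i ≤ f j
  rw [Prod.Lex.toLex_le_toLex]
  by_cases h : j = i
  · subst h; right; exact ⟨rfl, le_rfl⟩
  · left; simp [h]

theorem mem_of_add_mem {lam : Dual K S.h} {i : S.Simple} {w a : Env K g} (ha : a ∈ S.Nmi i)
    (h : ε (S.fu i.1) * w + a ∈ S.vermaIdeal lam) :
    w ∈ S.vermaIdeal lam ∧ a ∈ S.vermaIdeal lam := by
  obtain ⟨o, ho⟩ := exists_order (S := S) ⟨i.1, i.pos⟩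
  let _ := o
  rw [← ind_sub_ne lam] at ha
  rw [← ind_ideal] at h ⊢
  exact IndData.mem_of_add_mem _ ho (ind_closed_ne lam i) ha h

theorem exists_mul_add (lam : Dual K S.h) (i : S.Simple) (u : Env K g) :
    ∃ w, ∃ a ∈ S.Nmi i, u - (ε (S.fu i.1) * w + a) ∈ S.vermaIdeal lam := by
  obtain ⟨o, ho⟩ := exists_order (S := S) ⟨i.1, i.pos⟩
  let _ := o
  rw [← ind_sub_ne lam, ← ind_ideal]
  exact IndData.exists_mul_add _ u ho

end pbw

end Setup

end

section
open LieAlgebra LieModule Module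
namespace Setup
attribute [local instance] LieRing.ofAssociativeRing
variable {K : Type} [Field K] [IsAlgClosed K] [CharZero K]
variable {g : Type} [LieRing g] [LieAlgebra K g] {S : Setup K g}
variable [hD : Fact S.IsDynkin]
local notation "ε" => UniversalEnvelopingAlgebra.ι K

lemma ε_mul (x y : g) : ε x * ε y = ε y * ε x + ε ⁅x, y⁆ := by
  rw [LieHom.map_lie, LieRing.of_associative_ring_bracket]; abel

section generic
variable {M : Type} [AddCommGroup M] [Module K M] [Module (Env K g) M] [IsScalarTower K (Env K g) M]

lemma smul_smul_comm (c : K) (u : Env K g) (x : M) : u • c • x = c • u • x :=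
  smul_comm u c x

lemma ε_smul_smul (x y : g) (m : M) : ε x • ε y • m = ε y • ε x • m + ε ⁅x, y⁆ • m := by
  rw [← mul_smul, ε_mul, add_smul, mul_smul]

variable (S) in
/-- `x` is a weight vector of weight `κ` -/
def IsWt (κ : Dual K S.h) (x : M) : Prop := ∀ H : S.h, ε (H : g) • x = κ H • x

lemma IsWt.congr {κ κ' : Dual K S.h} {x : M} (hx : S.IsWt κ x) (h : κ = κ') : S.IsWt κ' x := h ▸ hx

lemma IsWt.smul {κ : Dual K S.h} {x : M} (hx : S.IsWt κ x) (c : K) : S.IsWt κ (c • x) := by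
  intro H
  rw [smul_smul_comm, hx H, smul_comm]

lemma IsWt.act {κ β : Dual K S.h} {x : M} (hx : S.IsWt κ x) {y : g} (hy : y ∈ S.W β) :
    S.IsWt (κ + β) (ε y • x) := by
  intro H
  rw [ε_smul_smul, hx H, hy H, smul_smul_comm, map_smul, smul_assoc, ← add_smul, LinearMap.add_apply]

lemma IsWt.f_pow {κ : Dual K S.h} {x : M} (hx : S.IsWt κ x) (i : S.Simple) (n : ℕ) :
    S.IsWt (κ - n • i.1) (ε (S.fu i.1) ^ n • x) := by
  induction n with
  | zero => rw [pow_zero, one_smul, zero_smul, sub_zero]; exact hx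
  | succ n ih =>
    rw [pow_succ', mul_smul]
    exact (ih.act i.isTriple.hf).congr (by rw [succ_nsmul]; abel)

lemma e_f_smul (i : S.Simple) (x : M) : ε (S.eu i.1) • ε (S.fu i.1) • x =
    ε (S.fu i.1) • ε (S.eu i.1) • x + ε (S.co i.1 : g) • x := by
  rw [ε_smul_smul, i.isTriple.hef]

lemma e_f_comm {i j : S.Simple} (h : i ≠ j) (x : M) : ε (S.eu j.1) • ε (S.fu i.1) • x =
    ε (S.fu i.1) • ε (S.eu j.1) • x := by
  rw [ε_smul_smul, Simple.lie_eq_zero h j.isTriple.he i.isTriple.hf, map_zero, zero_smul, add_zero]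

lemma e_f_pow_comm {i j : S.Simple} (h : i ≠ j) (n : ℕ) (x : M) :
    ε (S.eu j.1) • ε (S.fu i.1) ^ n • x = ε (S.fu i.1) ^ n • ε (S.eu j.1) • x := by
  induction n with
  | zero => rw [pow_zero, one_smul, one_smul]
  | succ n ih => rw [pow_succ', mul_smul, mul_smul, e_f_comm h, ih]

lemma IsWt.e_f_pow {κ : Dual K S.h} {x : M} (hx : S.IsWt κ x) (i : S.Simple) (n : ℕ) :
    ε (S.eu i.1) • ε (S.fu i.1) ^ (n + 1) • x = ε (S.fu i.1) ^ (n + 1) • ε (S.eu i.1) • x +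
      ((n + 1) * (κ (S.co i.1) - n)) • ε (S.fu i.1) ^ n • x := by
  induction n with
  | zero =>
    rw [zero_add, pow_one, pow_zero, one_smul, e_f_smul, hx, Nat.cast_zero, zero_add, one_mul,
      sub_zero]
  | succ n ih =>
    rw [pow_succ' _ (n + 1), mul_smul, e_f_smul, ih, smul_add, smul_smul_comm, ← mul_smul,
      ← mul_smul, ← pow_succ', (hx.f_pow i (n + 1)) _, add_assoc, ← mul_smul (ε (S.fu i.1)),
      ← pow_succ', ← add_smul]
    congr 2
    rw [LinearMap.sub_apply, LinearMap.smul_apply, i.isTriple.h2, nsmul_eq_mul]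
    push_cast; ring

variable (S) in
/-- a weight vector killed by the simple root vectors -/
structure IsSing (κ : Dual K S.h) (x : M) : Prop where
  wt : S.IsWt κ x
  kill : ∀ i : S.Simple, ε (S.eu i.1) • x = 0

lemma IsSing.kill_pos {κ : Dual K S.h} {x : M} (hx : S.IsSing κ x) {α : Dual K S.h}
    (hα : α ∈ S.pos) {y : g} (hy : y ∈ S.W α) : ε y • x = 0 := by
  let L : LieSubalgebra K g :=
    { carrier := {y | ∃ c : K, ε y • x = c • x}
      add_mem' := by
        rintro a b ⟨c, hc⟩ ⟨d, hd⟩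
        exact ⟨c + d, by rw [map_add, add_smul, hc, hd, add_smul]⟩
      zero_mem' := ⟨0, by rw [map_zero, zero_smul, zero_smul]⟩
      smul_mem' := by
        rintro r a ⟨c, hc⟩
        exact ⟨r * c, by rw [map_smul, smul_assoc, hc, mul_smul]⟩
      lie_mem' := by
        rintro a b ⟨c, hc⟩ ⟨d, hd⟩
        refine ⟨0, ?_⟩
        have := ε_smul_smul (K := K) a b x
        rw [hc, hd, smul_smul_comm, smul_smul_comm, hc, hd, smul_comm, left_eq_add] at this
        rw [this, zero_smul] }
  obtain ⟨c, hc⟩ : y ∈ L := by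
    refine pos_mem_of_dynkin hD.out (L := L) ?_ ?_ hα hy
    · intro H hH; exact ⟨_, hx.wt ⟨H, hH⟩⟩
    · intro β hβ z hz
      obtain ⟨c, rfl⟩ := (Simple.isTriple ⟨β, hβ⟩).span hz
      exact ⟨0, by rw [map_smul, smul_assoc, hx.kill ⟨β, hβ⟩, smul_zero, zero_smul]⟩
  have h1 := ε_smul_smul (K := K) (S.co α : g) y x
  rw [hc, hx.wt, smul_smul_comm, smul_smul_comm, hx.wt, hc, smul_comm, left_eq_add, hy,
    (isTriple_of_pos hα).h2, map_smul, smul_assoc] at h1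
  exact (smul_eq_zero.mp h1).resolve_left two_ne_zero

lemma IsSing.ideal_smul {κ : Dual K S.h} {x : M} (hx : S.IsSing κ x) {u : Env K g}
    (hu : u ∈ S.vermaIdeal κ) : u • x = 0 := by
  induction hu using Submodule.span_induction with
  | mem u hu =>
    rcases hu with ⟨y, hy, rfl⟩ | ⟨H, rfl⟩
    · refine badSum_induction (R := S.pos) (p := fun y => ε y • x = 0)
        (fun α hα y hy => hx.kill_pos hα hy) ?_ ?_ hy
      · rw [map_zero, zero_smul]
      · intro a b ha hb; rw [map_add, add_smul, ha, hb, add_zero]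
    · show (ε (H : g) - algebraMap K _ (κ H)) • x = 0
      rw [sub_smul, hx.wt H, algebraMap_smul, sub_self]
  | zero => rw [zero_smul]
  | add a b _ _ ha hb => rw [add_smul, ha, hb, add_zero]
  | smul a b _ hb => rw [smul_eq_mul, mul_smul, hb, smul_zero]

/-- the homomorphism from a Verma module determined by a singular vector -/
def IsSing.hom {κ : Dual K S.h} {x : M} (hx : S.IsSing κ x) : S.Verma κ →ₗ[Env K g] M :=
  (S.vermaIdeal κ).liftQ (LinearMap.toSpanSingleton (Env K g) M x) fun _ hu =>
    LinearMap.mem_ker.mpr (hx.ideal_smul hu)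

end generic

variable (S) in
/-- the highest weight vector -/
def vac (lam : Dual K S.h) : S.Verma lam := Submodule.Quotient.mk 1

variable {lam mu nu : Dual K S.h}

lemma smul_vac (u : Env K g) : u • S.vac lam = Submodule.Quotient.mk u := by
  rw [vac, ← Submodule.Quotient.mk_smul, smul_eq_mul, mul_one]

lemma smul_vac_eq_zero {u : Env K g} : u • S.vac lam = 0 ↔ u ∈ S.vermaIdeal lam := by
  rw [smul_vac, Submodule.Quotient.mk_eq_zero]

lemma exists_smul_vac (x : S.Verma lam) : ∃ u ∈ S.Nm, u • S.vac lam = x := by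
  obtain ⟨u, rfl⟩ := Submodule.Quotient.mk_surjective _ x
  obtain ⟨a, ha, hu⟩ := exists_Nm lam u
  refine ⟨a, ha, ?_⟩
  rw [← smul_vac, ← sub_eq_zero, ← sub_smul, smul_vac_eq_zero, ← neg_sub]
  exact Submodule.neg_mem _ hu

lemma eq_zero_of_smul_vac {u : Env K g} (hu : u ∈ S.Nm) (h : u • S.vac lam = 0) : u = 0 :=
  eq_zero_of_mem hu (smul_vac_eq_zero.mp h)

lemma vac_ne_zero : S.vac lam ≠ 0 := by
  intro h
  have h1 : (1 : Env K g) = 0 := eq_zero_of_smul_vac (lam := lam) (Subalgebra.one_mem _) (by rw [one_smul, h])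
  have h2 := congrArg (UniversalEnvelopingAlgebra.lift K (0 : g →ₗ⁅K⁆ K)) h1
  rw [map_one, map_zero] at h2
  exact one_ne_zero h2

lemma vac_sing : S.IsSing lam (S.vac lam) where
  wt H := by
    rw [← sub_eq_zero, ← algebraMap_smul (Env K g) (lam H), ← sub_smul, smul_vac_eq_zero]
    exact Submodule.subset_span (Or.inr ⟨H, rfl⟩)
  kill i := smul_vac_eq_zero.mpr (Submodule.subset_span
    (Or.inl ⟨_, mem_badSum i.pos i.isTriple.he, rfl⟩))

lemma IsSing.hom_vac {M : Type} [AddCommGroup M] [Module K M] [Module (Env K g) M]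
    [IsScalarTower K (Env K g) M] {κ : Dual K S.h} {x : M} (hx : S.IsSing κ x) :
    hx.hom (S.vac κ) = x := by
  show (1 : Env K g) • x = x
  rw [one_smul]

lemma IsSing.map {M N : Type} [AddCommGroup M] [Module K M] [Module (Env K g) M]
    [IsScalarTower K (Env K g) M] [AddCommGroup N] [Module K N] [Module (Env K g) N]
    [IsScalarTower K (Env K g) N] {κ : Dual K S.h} {x : M} (hx : S.IsSing κ x)
    (φ : M →ₗ[Env K g] N) : S.IsSing κ (φ x) where
  wt H := by
    rw [← map_smul, hx.wt H, ← algebraMap_smul (Env K g), map_smul, algebraMap_smul]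
  kill i := by rw [← map_smul, hx.kill, map_zero]

lemma hom_injective {x : S.Verma mu} (hx : S.IsSing lam x) (h0 : x ≠ 0) :
    Function.Injective hx.hom := by
  rw [injective_iff_map_eq_zero]
  intro y hy
  obtain ⟨u, hu, rfl⟩ := exists_smul_vac y
  obtain ⟨w, hw, rfl⟩ := exists_smul_vac x
  rw [map_smul, hx.hom_vac, ← mul_smul] at hy
  have h1 := eq_zero_of_smul_vac (Subalgebra.mul_mem _ hu hw) hy
  by_contra hne
  refine Nm_mul_ne_zero hu hw ?_ ?_ h1
  · rintro rfl; exact hne (zero_smul _ _)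
  · rintro rfl; exact h0 (zero_smul _ _)

variable (S) in
/-- `M(lam)` embeds into `M(mu)` -/
def Emb (lam mu : Dual K S.h) : Prop := ∃ x : S.Verma mu, x ≠ 0 ∧ S.IsSing lam x

lemma Emb.refl (lam : Dual K S.h) : S.Emb lam lam := ⟨_, vac_ne_zero, vac_sing⟩

lemma Emb.trans (h1 : S.Emb lam mu) (h2 : S.Emb mu nu) : S.Emb lam nu := by
  obtain ⟨x, hx0, hx⟩ := h1
  obtain ⟨y, hy0, hy⟩ := h2
  refine ⟨hy.hom x, fun h => hx0 (hom_injective hy hy0 (h.trans (map_zero _).symm)), hx.map _⟩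

lemma emb_iff : (∃ f : S.Verma lam →ₗ[Env K g] S.Verma mu, f ≠ 0) ↔ S.Emb lam mu := by
  constructor
  · rintro ⟨f, hf⟩
    refine ⟨f (S.vac lam), fun h => hf ?_, vac_sing.map f⟩
    refine LinearMap.ext fun x => ?_
    obtain ⟨u, -, rfl⟩ := exists_smul_vac x
    rw [map_smul, h, smul_zero, LinearMap.zero_apply]
  · rintro ⟨x, hx0, hx⟩
    exact ⟨hx.hom, fun h => hx0 (by rw [← hx.hom_vac, h, LinearMap.zero_apply])⟩

lemma f_smul_injective (i : S.Simple) {x : S.Verma mu} (h : ε (S.fu i.1) • x = 0) : x = 0 := by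
  obtain ⟨u, -, rfl⟩ := exists_smul_vac x
  rw [← mul_smul, smul_vac_eq_zero] at h
  rw [smul_vac_eq_zero]
  exact (mem_of_add_mem (i := i) (a := 0) (Subalgebra.zero_mem _) (by rwa [add_zero])).1

lemma f_pow_smul_injective (i : S.Simple) {x : S.Verma mu} (n : ℕ)
    (h : ε (S.fu i.1) ^ n • x = 0) : x = 0 := by
  induction n with
  | zero => rwa [pow_zero, one_smul] at h
  | succ n ih =>
    rw [pow_succ', mul_smul] at h
    exact ih (f_smul_injective i h)

lemma exists_f_add (i : S.Simple) (x : S.Verma mu) :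
    ∃ y, ∃ a ∈ S.Nmi i, x = ε (S.fu i.1) • y + a • S.vac mu := by
  obtain ⟨u, -, rfl⟩ := exists_smul_vac x
  obtain ⟨w, a, ha, h⟩ := exists_mul_add mu i u
  refine ⟨w • S.vac mu, a, ha, ?_⟩
  rw [← smul_vac_eq_zero, sub_smul, add_smul, mul_smul, sub_eq_zero] at h
  exact h

lemma f_add_eq_zero {i : S.Simple} {y : S.Verma mu} {a : Env K g} (ha : a ∈ S.Nmi i)
    (h : ε (S.fu i.1) • y + a • S.vac mu = 0) : y = 0 ∧ a = 0 := by
  obtain ⟨u, -, rfl⟩ := exists_smul_vac y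
  rw [← mul_smul, ← add_smul, smul_vac_eq_zero] at h
  obtain ⟨h1, h2⟩ := mem_of_add_mem ha h
  exact ⟨smul_vac_eq_zero.mpr h1, eq_zero_of_mem (Nmi_le i ha) h2⟩

variable (S) in
/-- the simple dot-reflection -/
def srefl (i : S.Simple) (mu : Dual K S.h) : Dual K S.h := mu - (mu (S.co i.1) + 1) • i.1

lemma srefl_co (i : S.Simple) (mu : Dual K S.h) :
    S.srefl i mu (S.co i.1) = - mu (S.co i.1) - 2 := by
  rw [srefl, LinearMap.sub_apply, LinearMap.smul_apply, i.isTriple.h2, smul_eq_mul]; ring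

lemma srefl_srefl (i : S.Simple) (mu : Dual K S.h) : S.srefl i (S.srefl i mu) = mu := by
  conv_lhs => rw [srefl, srefl_co, srefl]
  module

lemma emb_srefl {i : S.Simple} {p : ℕ} (hp : mu (S.co i.1) + 1 = p) : S.Emb (S.srefl i mu) mu := by
  refine ⟨ε (S.fu i.1) ^ p • S.vac mu, fun h => vac_ne_zero (f_pow_smul_injective i p h), ?_, ?_⟩
  · refine (vac_sing.wt.f_pow i p).congr ?_
    rw [srefl, hp, Nat.cast_smul_eq_nsmul K]
  · intro j
    by_cases h : i = j
    · subst h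
      cases p with
      | zero => rw [pow_zero, one_smul]; exact vac_sing.kill i
      | succ n =>
        rw [vac_sing.wt.e_f_pow, vac_sing.kill, smul_zero, zero_add]
        have : mu (S.co i.1) - n = 0 := by push_cast at hp; linear_combination hp
        rw [this, mul_zero, zero_smul]
    · rw [e_f_pow_comm h, vac_sing.kill, smul_zero]

end Setup

end

section

section commutator
variable {K A : Type} [Field K] [CharZero K] [Ring A] [Algebra K A]

/-- generalized binomial coefficients -/
def bin (c : K) : ℕ → K
  | 0 => 1
  | k + 1 => bin c k * (c - k) / (k + 1)

lemma bin_succ (c : K) (k : ℕ) : (k + 1) * bin c (k + 1) = (c - k) * bin c k := by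
  have : (k : K) + 1 ≠ 0 := by exact_mod_cast k.succ_ne_zero
  rw [bin]; field_simp

lemma bin_shift (c : K) (k : ℕ) : c * bin (c - 1) k = (c - k) * bin c k := by
  induction k with
  | zero => simp [bin]
  | succ k ih =>
    have h : (k : K) + 1 ≠ 0 := by exact_mod_cast k.succ_ne_zero
    apply mul_left_cancel₀ h
    have h1 := bin_succ (c - 1) k
    have h2 := bin_succ c k
    push_cast
    linear_combination c * h1 + (c - 1 - k) * ih - (c - (k + 1)) * h2

lemma bin_pascal (c : K) (k : ℕ) : bin (c + 1) (k + 1) = bin c k + bin c (k + 1) := by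
  have h : (k : K) + 1 ≠ 0 := by exact_mod_cast k.succ_ne_zero
  apply mul_left_cancel₀ h
  have h1 := bin_succ (c + 1) k
  have h2 := bin_succ c k
  have h3 := bin_shift (c + 1) k
  rw [add_sub_cancel_right] at h3
  linear_combination h1 - h2 - h3

variable (K) in
/-- the inner derivation of `f` -/
def inn (f : A) : A →ₗ[K] A := LinearMap.mulLeft K f - LinearMap.mulRight K f

lemma inn_apply (f y : A) : inn K f y = f * y - y * f := rfl

lemma inn_pow_succ (f y : A) (k : ℕ) : (inn K f ^ (k + 1)) y = inn K f ((inn K f ^ k) y) := by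
  rw [pow_succ', Module.End.mul_apply]

lemma inn_mul (f x y : A) : inn K f (x * y) = inn K f x * y + x * inn K f y := by
  simp only [inn_apply]; noncomm_ring

lemma inn_pow_mul_right {f b : A} (hb : f * b = b * f) (y : A) (k : ℕ) :
    (inn K f ^ k) (y * b) = (inn K f ^ k) y * b := by
  induction k with
  | zero => rfl
  | succ k ih =>
    rw [inn_pow_succ, ih, inn_mul, inn_apply _ b, hb, sub_self, mul_zero, add_zero, inn_pow_succ]

lemma inn_pow_mul_left {f b : A} (hb : f * b = b * f) (y : A) (k : ℕ) :
    (inn K f ^ k) (b * y) = b * (inn K f ^ k) y := by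
  induction k with
  | zero => rfl
  | succ k ih =>
    rw [inn_pow_succ, ih, inn_mul, inn_apply _ b, hb, sub_self, zero_mul, zero_add, inn_pow_succ]

lemma inn_pow_eq_zero {f y : A} {m n : ℕ} (h : (inn K f ^ m) y = 0) (hmn : m ≤ n) :
    (inn K f ^ n) y = 0 := by
  obtain ⟨k, rfl⟩ := Nat.exists_eq_add_of_le hmn
  rw [add_comm, pow_add, Module.End.mul_apply, h, map_zero]

lemma inn_pow_mul {f : A} (N : ℕ) : ∀ (m n : ℕ) (x y : A), m + n = N → (inn K f ^ m) x = 0 →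
    (inn K f ^ n) y = 0 → (inn K f ^ N) (x * y) = 0 := by
  induction N with
  | zero =>
    intro m n x y h hx hy
    obtain rfl : m = 0 := by omega
    rw [pow_zero, Module.End.one_apply] at hx ⊢
    rw [hx, zero_mul]
  | succ N ih =>
    intro m n x y h hx hy
    rw [pow_succ, Module.End.mul_apply, inn_mul, map_add]
    rcases m with - | m
    · rw [pow_zero, Module.End.one_apply] at hx
      rw [hx, zero_mul, map_zero, zero_mul, map_zero, add_zero]
    rcases n with - | n
    · rw [pow_zero, Module.End.one_apply] at hy
      rw [hy, map_zero, mul_zero, mul_zero, map_zero, add_zero]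
    rw [ih m (n + 1) _ y (by omega) (by rwa [pow_succ, Module.End.mul_apply] at hx) hy,
      ih (m + 1) n x _ (by omega) hx (by rwa [pow_succ, Module.End.mul_apply] at hy), add_zero]

lemma smul_inn_pred (f y : A) (k : ℕ) :
    (k : K) • inn K f ((inn K f ^ (k - 1)) y) = (k : K) • (inn K f ^ k) y := by
  rcases k with - | k
  · simp
  · rw [inn_pow_succ]; rfl

lemma smul_inn_pred' (f y : A) (k : ℕ) :
    ((k : K) * (k - 1)) • inn K f ((inn K f ^ (k - 2)) y) =
      ((k : K) * (k - 1)) • (inn K f ^ (k - 1)) y := by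
  rcases k with - | - | k
  · simp
  · simp
  · rw [show k + 1 + 1 - 1 = k + 1 from rfl, inn_pow_succ]; rfl

lemma inn_self (f : A) : inn K f f = 0 := by rw [inn_apply, sub_self]

lemma mul_inn_pow {f H : A} {a : K} (hH : H * f = f * H - a • f) (y : A) (k : ℕ) :
    H * (inn K f ^ k) y = (inn K f ^ k) (H * y) -
      (a * k) • ((inn K f ^ k) y + (inn K f ^ (k - 1)) y * f) := by
  induction k with
  | zero => simp
  | succ k ih =>
    have h1 : inn K f (H * (inn K f ^ k) y) = a • (f * (inn K f ^ k) y) +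
        H * (inn K f ^ (k + 1)) y := by
      rw [inn_mul, inn_pow_succ, inn_apply f H, hH, sub_sub_cancel, smul_mul_assoc]
    rw [← sub_eq_iff_eq_add'] at h1
    have h2 : f * (inn K f ^ k) y = (inn K f ^ (k + 1)) y + (inn K f ^ k) y * f := by
      rw [inn_pow_succ, inn_apply]; abel
    rw [← h1, ih, map_sub, map_smul, map_add, inn_mul _ _ f, inn_self, mul_zero, add_zero, h2,
      mul_smul, smul_add (k : K), ← smul_mul_assoc, smul_inn_pred, ← inn_pow_succ, ← inn_pow_succ,
      Nat.add_sub_cancel]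
    push_cast
    simp only [smul_mul_assoc]
    module

lemma inn_pow_mul_weight {f H : A} {a : K} (hH : H * f = f * H - a • f) (z : A) (k : ℕ) :
    (inn K f ^ k) (z * H) = (inn K f ^ k) z * H + (a * k) • ((inn K f ^ (k - 1)) z * f) := by
  induction k with
  | zero => simp
  | succ k ih =>
    rw [inn_pow_succ, ih, map_add, map_smul, inn_mul, inn_mul _ _ f, inn_self, mul_zero, add_zero,
      inn_apply f H, hH, sub_sub_cancel, mul_smul a (k : K), ← smul_mul_assoc, smul_inn_pred,
      ← inn_pow_succ, Nat.add_sub_cancel, mul_smul_comm]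
    push_cast
    simp only [smul_mul_assoc]
    module

lemma mul_inn_pow' {e f h : A} (hef : e * f = f * e + h) (hh : h * f = f * h - (2 : K) • f)
    (y : A) (k : ℕ) :
    e * (inn K f ^ k) y = (inn K f ^ k) (e * y) + (k : K) • (inn K f ^ (k - 1)) (h * y) -
      ((k : K) * (k - 1)) • ((inn K f ^ (k - 1)) y + (inn K f ^ (k - 2)) y * f) := by
  induction k with
  | zero => simp
  | succ k ih =>
    have h1 : inn K f (e * (inn K f ^ k) y) = -(h * (inn K f ^ k) y) +
        e * (inn K f ^ (k + 1)) y := by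
      rw [inn_mul, inn_pow_succ, inn_apply f e, hef, sub_add_cancel_left, neg_mul]
    rw [← sub_eq_iff_eq_add', sub_neg_eq_add] at h1
    have h3 : ((k : K) * (k - 1)) • inn K f ((inn K f ^ (k - 1)) y) =
        ((k : K) * (k - 1)) • (inn K f ^ k) y := by
      rw [mul_comm, mul_smul, smul_inn_pred, ← mul_smul]
    rw [← h1, ih, mul_inn_pow hh, map_sub, map_add, map_smul, map_smul, map_add,
      inn_mul _ _ f, inn_self, mul_zero, add_zero, smul_inn_pred, smul_add ((k : K) * (k - 1)),
      ← smul_mul_assoc, smul_inn_pred', h3, ← inn_pow_succ,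
      Nat.add_sub_cancel, show k + 1 - 2 = k - 1 by omega]
    push_cast
    simp only [smul_mul_assoc]
    module

lemma inn_pow_mul' {e f h : A} (hef : e * f = f * e + h) (hh : h * f = f * h - (2 : K) • f)
    (z : A) (k : ℕ) :
    (inn K f ^ k) (z * e) = (inn K f ^ k) z * e - (k : K) • ((inn K f ^ (k - 1)) z * h) -
      ((k : K) * (k - 1)) • ((inn K f ^ (k - 2)) z * f) := by
  induction k with
  | zero => simp
  | succ k ih =>
    have he : inn K f e = -h := by rw [inn_apply, hef, sub_add_cancel_left]
    have hh' : inn K f h = (2 : K) • f := by rw [inn_apply, hh, sub_sub_cancel]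
    have h3 : (k : K) • (inn K f ((inn K f ^ (k - 1)) z) * h) = (k : K) • ((inn K f ^ k) z * h) := by
      rw [← smul_mul_assoc, smul_inn_pred, smul_mul_assoc]
    have h4 : ((k : K) * (k - 1)) • (inn K f ((inn K f ^ (k - 2)) z) * f) =
        ((k : K) * (k - 1)) • ((inn K f ^ (k - 1)) z * f) := by
      rw [← smul_mul_assoc, smul_inn_pred', smul_mul_assoc]
    rw [inn_pow_succ, ih, map_sub, map_sub, map_smul, map_smul, inn_mul, inn_mul, inn_mul,
      inn_self, he, hh', mul_zero, add_zero, smul_add, h3, h4, Nat.add_sub_cancel,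
      show k + 1 - 2 = k - 1 by omega, ← inn_pow_succ, mul_smul_comm, mul_neg]
    push_cast
    module

lemma bin_sum {V : Type} [AddCommGroup V] [Module K V] (c : K) (Y : ℕ → V) (n : ℕ) :
    ∑ k ∈ Finset.range n, ((k : K) * bin c k) • (Y k + Y (k - 1)) =
      c • ∑ k ∈ Finset.range n, bin c k • Y k - ((n : K) * bin c n) • Y (n - 1) := by
  induction n with
  | zero => simp
  | succ n ih =>
    rw [Finset.sum_range_succ, Finset.sum_range_succ, ih, Nat.add_sub_cancel]
    push_cast
    rw [bin_succ]
    module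

variable (K) in
/-- the truncation of `f ^ c * y * f ^ (N - c)` -/
def conj (f : A) (c : K) (N : ℕ) (y : A) : A :=
  ∑ k ∈ Finset.range N, bin c k • ((inn K f ^ k) y * f ^ (N - k))

lemma conj_mul_left {f b : A} (hb : f * b = b * f) (c : K) (N : ℕ) (y : A) :
    conj K f c N (b * y) = b * conj K f c N y := by
  simp only [conj, Finset.mul_sum, inn_pow_mul_left hb, mul_assoc, mul_smul_comm]

lemma conj_add (f : A) (c : K) (N : ℕ) (x y : A) :
    conj K f c N (x + y) = conj K f c N x + conj K f c N y := by
  simp only [conj, map_add, add_mul, smul_add, Finset.sum_add_distrib]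

lemma conj_smul (f : A) (c : K) (N : ℕ) (a : K) (y : A) :
    conj K f c N (a • y) = a • conj K f c N y := by
  simp only [conj, map_smul, smul_mul_assoc, Finset.smul_sum, smul_comm a]

lemma mul_conj {f y : A} (c : K) {N : ℕ} (hy : (inn K f ^ N) y = 0) :
    f * conj K f c N y = conj K f (c + 1) (N + 1) y := by
  have h1 : ∀ k ∈ Finset.range N, f * (bin c k • ((inn K f ^ k) y * f ^ (N - k))) =
      bin c k • ((inn K f ^ (k + 1)) y * f ^ (N - k)) +
      bin c k • ((inn K f ^ k) y * f ^ (N + 1 - k)) := by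
    intro k hk
    rw [Finset.mem_range] at hk
    rw [show N + 1 - k = (N - k) + 1 by omega, pow_succ' f, inn_pow_succ, inn_apply, mul_smul_comm,
      ← smul_add]
    congr 1
    noncomm_ring
  rw [conj, Finset.mul_sum, Finset.sum_congr rfl h1, Finset.sum_add_distrib, conj,
    Finset.sum_range_succ']
  have h2 := Finset.sum_range_succ (fun k => bin c k • ((inn K f ^ k) y * f ^ (N + 1 - k))) N
  rw [hy, zero_mul, smul_zero, add_zero] at h2
  rw [← h2, Finset.sum_range_succ']
  simp only [bin_pascal, add_smul, Finset.sum_add_distrib, Nat.add_sub_add_right]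
  simp only [bin]
  abel

lemma weight_mul_conj {f H y : A} {a : K} (hH : H * f = f * H - a • f) (c : K) {N : ℕ}
    (hy : (inn K f ^ (N - 1)) y = 0) :
    H * conj K f c N y = conj K f c N (H * y) - (a * c) • conj K f c N y := by
  have h1 : ∀ k ∈ Finset.range N, H * (bin c k • ((inn K f ^ k) y * f ^ (N - k))) =
      bin c k • ((inn K f ^ k) (H * y) * f ^ (N - k)) - a • (((k : K) * bin c k) •
      ((inn K f ^ k) y * f ^ (N - k) + (inn K f ^ (k - 1)) y * f ^ (N - (k - 1)))) := by
    intro k hk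
    rw [Finset.mem_range] at hk
    rw [mul_smul_comm, ← mul_assoc, mul_inn_pow hH, sub_mul, smul_mul_assoc, add_mul, mul_assoc,
      ← pow_succ']
    rcases k with - | k
    · simp
    · rw [show N - (k + 1) + 1 = N - (k + 1 - 1) by omega]
      module
  rw [conj, Finset.mul_sum, Finset.sum_congr rfl h1, Finset.sum_sub_distrib, ← Finset.smul_sum,
    bin_sum c (fun k => (inn K f ^ k) y * f ^ (N - k)), hy, zero_mul, smul_zero, sub_zero, mul_smul]
  rfl

lemma raise_mul_conj {e f h y : A} (hef : e * f = f * e + h) (hh : h * f = f * h - (2 : K) • f)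
    (c : K) {N : ℕ} (hy : (inn K f ^ (N - 1)) y = 0) :
    e * conj K f c (N + 1) y = conj K f c (N + 1) (e * y) + c • conj K f (c - 1) N (h * y) -
      (c * (c - 1)) • conj K f (c - 1) N y := by
  have h1 : ∀ k ∈ Finset.range N,
      e * (bin c (k + 1) • ((inn K f ^ (k + 1)) y * f ^ (N + 1 - (k + 1)))) =
      bin c (k + 1) • ((inn K f ^ (k + 1)) (e * y) * f ^ (N + 1 - (k + 1))) +
      c • (bin (c - 1) k • ((inn K f ^ k) (h * y) * f ^ (N - k))) -
      c • (((k : K) * bin (c - 1) k) • ((inn K f ^ k) y * f ^ (N - k) +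
        (inn K f ^ (k - 1)) y * f ^ (N - (k - 1)))) := by
    intro k hk
    rw [Finset.mem_range] at hk
    have hb : ((k : K) + 1) * bin c (k + 1) = c * bin (c - 1) k := by
      rw [bin_succ, bin_shift]
    rw [mul_smul_comm, ← mul_assoc, mul_inn_pow' hef hh, sub_mul, add_mul, smul_mul_assoc,
      smul_mul_assoc, add_mul, mul_assoc _ f, ← pow_succ', Nat.add_sub_cancel, Nat.add_sub_add_right,
      show k + 1 - 2 = k - 1 by omega, smul_sub, smul_add, ← mul_smul (bin c (k + 1)),
      ← mul_smul (bin c (k + 1)), ← mul_smul c, ← mul_smul c]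
    push_cast
    rw [show bin c (k + 1) * ((k : K) + 1) = c * bin (c - 1) k by rw [← hb]; ring,
      show bin c (k + 1) * (((k : K) + 1) * ((k : K) + 1 - 1)) = c * (k * bin (c - 1) k) by
        linear_combination (k : K) * hb]
    rcases k with - | k
    · simp
    · rw [show N - (k + 1) + 1 = N - (k + 1 - 1) by omega]
  rw [conj, Finset.mul_sum, Finset.sum_range_succ', Finset.sum_congr rfl h1,
    Finset.sum_sub_distrib, Finset.sum_add_distrib, ← Finset.smul_sum, ← Finset.smul_sum,
    bin_sum (c - 1) (fun k => (inn K f ^ k) y * f ^ (N - k)), hy, zero_mul, smul_zero, sub_zero,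
    conj, Finset.sum_range_succ', mul_smul c, conj, conj, mul_smul_comm, ← mul_assoc, pow_zero,
    Module.End.one_apply, Module.End.one_apply]
  abel

lemma inn_pow_conj {f y : A} (c : K) {r N : ℕ} (hy : (inn K f ^ (r + 1)) y = 0) :
    (inn K f ^ r) (conj K f c (N + 1) y) = (inn K f ^ r) y * f ^ (N + 1) := by
  have h1 : ∀ n : ℕ, f * f ^ n = f ^ n * f := fun n => (pow_succ' f n).symm.trans (pow_succ f n)
  rw [conj, map_sum, Finset.sum_range_succ', Finset.sum_eq_zero, zero_add]
  · rw [map_smul, inn_pow_mul_right (h1 _), pow_zero, Module.End.one_apply, bin, one_smul,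
      Nat.sub_zero]
  · intro k _
    rw [map_smul, inn_pow_mul_right (h1 _), ← Module.End.mul_apply, ← pow_add,
      inn_pow_eq_zero hy (by omega), zero_mul, smul_zero]

end commutator

end

section
open LieAlgebra LieModule Module

lemma triple_sum {K V : Type} [Field K] [CharZero K] [AddCommGroup V] [Module K V] (c N : K)
    (X : ℕ → V) (n : ℕ) :
    ∑ k ∈ Finset.range n, ((-((N - k) * (c - k)) * bin c k) • X k +
      ((k : K) * (c + N + 1 - 2 * k) * bin c k) • X (k - 1) -
      ((k : K) * (k - 1) * bin c k) • X (k - 2)) =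
      (-((N - n + 1) * (n * bin c n))) • X (n - 1) + ((n : K) * (n - 1) * bin c n) • X (n - 2) := by
  induction n with
  | zero => simp
  | succ n ih =>
    rw [Finset.sum_range_succ, ih, Nat.add_sub_cancel, show n + 1 - 2 = n - 1 by omega]
    push_cast
    have h := bin_succ c n
    rw [show ((n : K) + 1) * ((n : K) + 1 - 1) * bin c (n + 1) = n * ((c - n) * bin c n) by
      rw [← h]; ring, h]
    module

namespace Setup
attribute [local instance] LieRing.ofAssociativeRing
variable {K : Type} [Field K] [IsAlgClosed K] [CharZero K]
variable {g : Type} [LieRing g] [LieAlgebra K g] {S : Setup K g}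
variable [hD : Fact S.IsDynkin]
local notation "ε" => UniversalEnvelopingAlgebra.ι K

lemma inn_pow_ε (f x : g) (n : ℕ) : (inn K (ε f) ^ n) (ε x) = ε (((ad K g f) ^ n) x) := by
  induction n with
  | zero => rfl
  | succ n ih =>
    rw [inn_pow_succ, ih, pow_succ', Module.End.mul_apply, ad_apply, LieHom.map_lie,
      LieRing.of_associative_ring_bracket, inn_apply]

lemma inn_nilpotent {α : Dual K S.h} (hα : α ≠ 0) {x : g} (hx : x ∈ S.W α) (u : Env K g) :
    ∃ n, (inn K (ε x) ^ n) u = 0 := by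
  have hu : u ∈ Algebra.adjoin K (Set.range (ε : g → UniversalEnvelopingAlgebra K g)) := by
    rw [IndData.adjoin_range_ι]; trivial
  induction hu using Algebra.adjoin_induction with
  | mem u hu =>
    obtain ⟨y, rfl⟩ := hu
    obtain ⟨n, hn⟩ := ad_nilpotent hα hx y
    exact ⟨n, by rw [inn_pow_ε, hn, map_zero]⟩
  | algebraMap r =>
    exact ⟨1, by rw [pow_one, inn_apply, Algebra.commutes, sub_self]⟩
  | add a b _ _ ha hb =>
    obtain ⟨m, hm⟩ := ha
    obtain ⟨n, hn⟩ := hb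
    exact ⟨m + n, by rw [map_add, inn_pow_eq_zero hm (by omega), inn_pow_eq_zero hn (by omega),
      add_zero]⟩
  | mul a b _ _ ha hb =>
    obtain ⟨m, hm⟩ := ha
    obtain ⟨n, hn⟩ := hb
    exact ⟨m + n, inn_pow_mul _ m n a b rfl hm hn⟩

lemma inn_f_nilpotent (i : S.Simple) (u : Env K g) :
    ∃ n, ∀ N ≥ n, (inn K (ε (S.fu i.1)) ^ N) u = 0 := by
  obtain ⟨n, hn⟩ := inn_nilpotent (neg_ne_zero.mpr i.isTriple.isCoroot.isRootOf.1) i.isTriple.hf u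
  exact ⟨n, fun N hN => inn_pow_eq_zero hn hN⟩

lemma env_ef (i : S.Simple) : ε (S.eu i.1) * ε (S.fu i.1) =
    ε (S.fu i.1) * ε (S.eu i.1) + ε (S.co i.1 : g) := by
  rw [ε_mul, i.isTriple.hef]

lemma env_hf (i : S.Simple) (H : S.h) : ε (H : g) * ε (S.fu i.1) =
    ε (S.fu i.1) * ε (H : g) - i.1 H • ε (S.fu i.1) := by
  rw [ε_mul, i.isTriple.hf H, LinearMap.neg_apply, neg_smul, map_neg, map_smul, sub_eq_add_neg]

lemma env_cof (i : S.Simple) : ε (S.co i.1 : g) * ε (S.fu i.1) =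
    ε (S.fu i.1) * ε (S.co i.1 : g) - (2 : K) • ε (S.fu i.1) := by
  rw [env_hf, i.isTriple.h2]

lemma env_ef_comm {i j : S.Simple} (h : i ≠ j) : ε (S.fu i.1) * ε (S.eu j.1) =
    ε (S.eu j.1) * ε (S.fu i.1) := by
  rw [ε_mul (S.eu j.1), Simple.lie_eq_zero h j.isTriple.he i.isTriple.hf, map_zero, add_zero]

lemma vermaIdeal_le (lam : Dual K S.h) : S.vermaIdeal lam ≤ Submodule.span (Env K g)
    (Set.range (fun i : S.Simple => ε (S.eu i.1)) ∪
      Set.range fun H : S.h => ε (H : g) - algebraMap K _ (lam H)) := by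
  set J := Submodule.span (Env K g) (Set.range (fun i : S.Simple => ε (S.eu i.1)) ∪
      Set.range fun H : S.h => ε (H : g) - algebraMap K _ (lam H)) with hJ
  have h1 : ∀ u : Env K g, u • (Submodule.Quotient.mk 1 : Env K g ⧸ J) =
      Submodule.Quotient.mk u := fun u => by
    rw [← Submodule.Quotient.mk_smul, smul_eq_mul, mul_one]
  have hs : S.IsSing lam (Submodule.Quotient.mk 1 : Env K g ⧸ J) :=
    { wt := fun H => by
        rw [← sub_eq_zero, ← algebraMap_smul (Env K g) (lam H), ← sub_smul, h1,
          Submodule.Quotient.mk_eq_zero]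
        exact Submodule.subset_span (Or.inr ⟨H, rfl⟩)
      kill := fun i => by
        rw [h1, Submodule.Quotient.mk_eq_zero]
        exact Submodule.subset_span (Or.inl ⟨i, rfl⟩) }
  intro u hu
  have := hs.ideal_smul hu
  rwa [h1, Submodule.Quotient.mk_eq_zero] at this

section
variable {M : Type} [AddCommGroup M] [Module K M] [Module (Env K g) M] [IsScalarTower K (Env K g) M]
variable {i : S.Simple} {mu : Dual K S.h} {v : M}

lemma conj_weight_smul (hv : S.IsSing (S.srefl i mu) v) (z : Env K g) (H : S.h) {N : ℕ}
    (hz : (inn K (ε (S.fu i.1)) ^ (N - 1)) z = 0) :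
    conj K (ε (S.fu i.1)) (mu (S.co i.1) + 1 + N) N
      (z * (ε (H : g) - algebraMap K _ (mu H))) • v = 0 := by
  set f := ε (S.fu i.1) with hf
  set c := mu (S.co i.1) + 1 + N with hc
  have h1 : ∀ k ∈ Finset.range N, (bin c k • ((inn K f ^ k) (z * (ε (H : g) -
      algebraMap K _ (mu H))) * f ^ (N - k))) • v = i.1 H • (((k : K) * bin c k) •
        ((((inn K f ^ k) z * f ^ (N - k)) • v) +
          (((inn K f ^ (k - 1)) z * f ^ (N - (k - 1))) • v))) -
        (i.1 H * c) • (bin c k • (((inn K f ^ k) z * f ^ (N - k)) • v)) := by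
    intro k hk
    rw [Finset.mem_range] at hk
    have hw := (hv.wt.f_pow i (N - k)) H
    rw [← hf] at hw
    rw [mul_sub, ← Algebra.commutes, ← Algebra.smul_def, map_sub, map_smul,
      inn_pow_mul_weight (env_hf i H), sub_mul, add_mul, smul_mul_assoc, smul_mul_assoc,
      mul_assoc _ f, ← pow_succ', mul_assoc, smul_assoc, sub_smul, add_smul, smul_assoc, smul_assoc,
      mul_smul, mul_smul, hw, smul_smul_comm, ← mul_smul _ (f ^ (N - k)), LinearMap.sub_apply,
      srefl, LinearMap.sub_apply, LinearMap.smul_apply, LinearMap.smul_apply, nsmul_eq_mul,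
      smul_eq_mul, Nat.cast_sub hk.le]
    rcases k with - | k
    · simp only [Nat.cast_zero, mul_zero, zero_smul, hc]
      generalize ((inn K f ^ 0) z * f ^ (N - 0)) • v = Y
      module
    · rw [show N - (k + 1) + 1 = N - (k + 1 - 1) by omega, hc]
      generalize ((inn K f ^ (k + 1)) z * f ^ (N - (k + 1))) • v = Y
      generalize ((inn K f ^ (k + 1 - 1)) z * f ^ (N - (k + 1 - 1))) • v = Y'
      module
  rw [conj, Finset.sum_smul, Finset.sum_congr rfl h1, Finset.sum_sub_distrib, ← Finset.smul_sum,
    ← Finset.smul_sum, bin_sum c (fun k => ((inn K f ^ k) z * f ^ (N - k)) • v), hz, zero_mul,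
    zero_smul, smul_zero, sub_zero, ← mul_smul, sub_self]

lemma conj_raise_smul (hv : S.IsSing (S.srefl i mu) v) (z : Env K g) {N : ℕ}
    (hz : (inn K (ε (S.fu i.1)) ^ (N - 1)) z = 0) (hz' : (inn K (ε (S.fu i.1)) ^ (N - 2)) z = 0) :
    conj K (ε (S.fu i.1)) (mu (S.co i.1) + 1 + N) N (z * ε (S.eu i.1)) • v = 0 := by
  set f := ε (S.fu i.1) with hf
  set c := mu (S.co i.1) + 1 + N with hc
  have h1 : ∀ k ∈ Finset.range N, (bin c k • ((inn K f ^ k) (z * ε (S.eu i.1)) *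
      f ^ (N - k))) • v =
      ((-((N - k) * (c - k)) * bin c k) • (((inn K f ^ k) z * f ^ (N - 1 - k)) • v) +
      ((k : K) * (c + N + 1 - 2 * k) * bin c k) •
        (((inn K f ^ (k - 1)) z * f ^ (N - 1 - (k - 1))) • v) -
      ((k : K) * (k - 1) * bin c k) • (((inn K f ^ (k - 2)) z * f ^ (N - 1 - (k - 2))) • v)) := by
    intro k hk
    rw [Finset.mem_range] at hk
    have hw := (hv.wt.f_pow i (N - k)) (S.co i.1)
    have hew := hv.wt.e_f_pow i (N - 1 - k)
    rw [show N - 1 - k + 1 = N - k by omega, hv.kill, smul_zero, zero_add, srefl_co, ← hf] at hew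
    rw [LinearMap.sub_apply, srefl_co, LinearMap.smul_apply, i.isTriple.h2, nsmul_eq_mul,
      ← hf] at hw
    have hN : ((N - 1 - k : ℕ) : K) = N - 1 - k := by
      rw [Nat.sub_sub, Nat.cast_sub (by omega)]; push_cast; ring
    rw [Nat.cast_sub hk.le] at hw
    rw [hN] at hew
    rw [inn_pow_mul' (env_ef i) (env_cof i), sub_mul, sub_mul, smul_mul_assoc, smul_mul_assoc,
      mul_assoc _ f, ← pow_succ', mul_assoc _ (ε (S.eu i.1)), mul_assoc _ (ε (S.co i.1 : g)),
      smul_assoc, sub_smul, sub_smul, smul_assoc, smul_assoc,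
      mul_smul ((inn K f ^ k) z) (ε (S.eu i.1) * _), mul_smul ((inn K f ^ (k - 1)) z),
      mul_smul (ε (S.eu i.1)), mul_smul (ε (S.co i.1 : g)), hw, hew, smul_smul_comm,
      smul_smul_comm, ← mul_smul ((inn K f ^ k) z), ← mul_smul ((inn K f ^ (k - 1)) z)]
    rcases k with - | - | k
    · simp only [Nat.cast_zero, hc, Nat.sub_zero, zero_mul, zero_smul]
      generalize ((inn K f ^ 0) z * f ^ (N - 1)) • v = X
      module
    · simp only [zero_add, Nat.cast_one, hc, Nat.sub_zero, Nat.sub_self, sub_self, mul_zero,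
        zero_mul, zero_smul]
      generalize ((inn K f ^ 1) z * f ^ (N - 1 - 1)) • v = X
      generalize ((inn K f ^ 0) z * f ^ (N - 1)) • v = X'
      module
    · rw [show N - (k + 1 + 1) = N - 1 - (k + 1 + 1 - 1) by omega,
        show N - 1 - (k + 1 + 1 - 1) + 1 = N - 1 - (k + 1 + 1 - 2) by omega, hc]
      simp only [Nat.cast_add, Nat.cast_one]
      generalize ((inn K f ^ (k + 1 + 1)) z * f ^ (N - 1 - (k + 1 + 1))) • v = X
      generalize ((inn K f ^ (k + 1 + 1 - 1)) z * f ^ (N - 1 - (k + 1 + 1 - 1))) • v = X'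
      generalize ((inn K f ^ (k + 1 + 1 - 2)) z * f ^ (N - 1 - (k + 1 + 1 - 2))) • v = X''
      module
  rw [conj, Finset.sum_smul, Finset.sum_congr rfl h1,
    triple_sum c (N : K) (fun k => ((inn K f ^ k) z * f ^ (N - 1 - k)) • v), hz, hz', zero_mul,
    zero_smul, smul_zero, zero_mul, zero_smul, smul_zero, add_zero]

lemma conj_ideal_smul (hv : S.IsSing (S.srefl i mu) v) {y : Env K g} (hy : y ∈ S.vermaIdeal mu) :
    ∃ n : ℕ, ∀ N ≥ n, conj K (ε (S.fu i.1)) (mu (S.co i.1) + 1 + N) N y • v = 0 := by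
  suffices h : ∀ z : Env K g, ∃ n : ℕ, ∀ N : ℕ, N ≥ n →
      conj K (ε (S.fu i.1)) (mu (S.co i.1) + 1 + N) N (z * y) • v = 0 by
    simpa only [one_mul] using h 1
  replace hy := vermaIdeal_le mu hy
  induction hy using Submodule.span_induction with
  | mem u hu =>
    intro z
    obtain ⟨n, hn⟩ := inn_f_nilpotent i z
    refine ⟨n + 2, fun N hN => ?_⟩
    rcases hu with ⟨j, rfl⟩ | ⟨H, rfl⟩
    · by_cases hij : i = j
      · subst hij
        exact conj_raise_smul hv z (hn _ (by omega)) (hn _ (by omega))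
      · rw [conj, Finset.sum_smul]
        refine Finset.sum_eq_zero fun k _ => ?_
        rw [inn_pow_mul_right (env_ef_comm hij), smul_assoc, mul_assoc, mul_smul, mul_smul,
          e_f_pow_comm hij, hv.kill, smul_zero, smul_zero, smul_zero]
    · exact conj_weight_smul hv z H (hn _ (by omega))
  | zero =>
    intro z
    exact ⟨0, fun N _ => by rw [mul_zero]; simp [conj]⟩
  | add a b _ _ ha hb =>
    intro z
    obtain ⟨m, hm⟩ := ha z
    obtain ⟨n, hn⟩ := hb z
    exact ⟨m + n, fun N hN => by
      rw [mul_add, conj_add, add_smul, hm N (by omega), hn N (by omega), add_zero]⟩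
  | smul a b _ hb =>
    intro z
    simp_rw [smul_eq_mul, ← mul_assoc]
    exact hb (z * a)

end

lemma H_f_pow {M : Type} [AddCommGroup M] [Module K M] [Module (Env K g) M]
    [IsScalarTower K (Env K g) M] (i : S.Simple) (H : S.h) (k : ℕ) (x : M) :
    ε (H : g) • ε (S.fu i.1) ^ k • x =
      ε (S.fu i.1) ^ k • ε (H : g) • x - (k * i.1 H) • ε (S.fu i.1) ^ k • x := by
  induction k with
  | zero => simp
  | succ k ih =>
    rw [pow_succ', mul_smul, ← mul_smul (ε (H : g)), env_hf, sub_smul, mul_smul, ih, smul_sub,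
      smul_smul_comm, smul_assoc, mul_smul, mul_smul]
    push_cast
    generalize ε (S.fu i.1) • ε (S.fu i.1) ^ k • x = X
    generalize ε (S.fu i.1) • ε (S.fu i.1) ^ k • ε (H : g) • x = X'
    module

/-- The twisted copy of a singular vector inside the reflected Verma module. -/
lemma exists_conj {i : S.Simple} {lam mu : Dual K S.h} (h : S.Emb lam mu) :
    ∃ (x : ℕ → S.Verma (S.srefl i mu)) (n : ℕ), ∀ N ≥ n, x N ≠ 0 ∧
      S.IsWt (lam - (mu (S.co i.1) + 1 + N) • i.1) (x N) ∧
      ε (S.fu i.1) • x N = x (N + 1) ∧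
      ε (S.eu i.1) • x (N + 1) = ((mu (S.co i.1) + 1 + (N + 1)) *
        (lam (S.co i.1) - mu (S.co i.1) - (N + 1))) • x N ∧
      ∀ j, j ≠ i → ε (S.eu j.1) • x N = 0 := by
  obtain ⟨x, hx0, hx⟩ := h
  obtain ⟨u, hu, rfl⟩ := exists_smul_vac x
  set f := ε (S.fu i.1) with hf
  set p := mu (S.co i.1) + 1 with hp
  set v := S.vac (S.srefl i mu) with hvdef
  have hv : S.IsSing (S.srefl i mu) v := vac_sing
  have hu0 : u ≠ 0 := fun h => hx0 (by rw [h, zero_smul])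
  obtain ⟨n₀, hn₀⟩ := inn_f_nilpotent i u
  have hker : ∀ y : Env K g, y • S.vac mu = 0 → ∃ n : ℕ, ∀ N ≥ n, conj K f (p + N) N y • v = 0 :=
    fun y hy => conj_ideal_smul hv (smul_vac_eq_zero.mp hy)
  have hwt : ∀ H : S.h, (ε (H : g) * u - lam H • u) • S.vac mu = 0 := fun H => by
    rw [sub_smul, mul_smul, hx.wt, smul_assoc, sub_self]
  obtain ⟨n₁, hn₁⟩ := hker (ε (S.eu i.1) * u) (by rw [mul_smul, hx.kill])
  obtain ⟨n₂, hn₂⟩ := hker _ (hwt (S.co i.1))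
  have hF : ∀ N ≥ n₀, f • conj K f (p + N) N u • v = conj K f (p + (N + 1 : ℕ)) (N + 1) u • v := by
    intro N hN
    rw [← mul_smul, mul_conj _ (hn₀ N hN), Nat.cast_add, Nat.cast_one, add_assoc]
  have hFp : ∀ k, ∀ N ≥ n₀, f ^ k • conj K f (p + N) N u • v =
      conj K f (p + (N + k : ℕ)) (N + k) u • v := by
    intro k N hN
    induction k with
    | zero => rw [pow_zero, one_smul, add_zero]
    | succ k ih => rw [pow_succ', mul_smul, ih, hF _ (by omega)]; rfl
  have hfm : f ∈ S.Nm := ε_mem_Nsub i.pos i.isTriple.hf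
  have hDm : ∀ y ∈ S.Nm, ∀ k, (inn K f ^ k) y ∈ S.Nm := by
    intro y hy k
    induction k with
    | zero => exact hy
    | succ k ih =>
      rw [inn_pow_succ, inn_apply]
      exact Subalgebra.sub_mem _ (Subalgebra.mul_mem _ hfm ih) (Subalgebra.mul_mem _ ih hfm)
  have hconj : ∀ (c : K) (N : ℕ), conj K f c N u ∈ S.Nm := by
    intro c N
    refine Subalgebra.sum_mem _ fun k _ => Subalgebra.smul_mem _ (Subalgebra.mul_mem _ ?_
      (Subalgebra.pow_mem _ hfm _)) _
    exact hDm u hu k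
  refine ⟨fun N => conj K f (p + N) N u • v, n₀ + n₁ + n₂ + 1, fun N hN => ⟨?_, ?_, hF N (by omega),
    ?_, ?_⟩⟩
  · intro h
    have h1 := eq_zero_of_smul_vac (hconj _ _) h
    obtain ⟨r, hr, hr'⟩ : ∃ r, (inn K f ^ r) u ≠ 0 ∧ (inn K f ^ (r + 1)) u = 0 := by
      classical
      have hex : ∃ n, (inn K f ^ n) u = 0 := ⟨n₀, hn₀ _ le_rfl⟩
      have hpos : Nat.find hex ≠ 0 := fun h => hu0 (by simpa [h] using Nat.find_spec hex)
      refine ⟨Nat.find hex - 1, Nat.find_min hex (by omega), ?_⟩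
      rw [Nat.sub_add_cancel (by omega)]
      exact Nat.find_spec hex
    have h2 := inn_pow_conj (p + N) (N := N - 1) hr'
    rw [Nat.sub_add_cancel (by omega), h1, map_zero] at h2
    have hf0 : ∀ k, f ^ k ≠ 0 := fun k h => vac_ne_zero
      (f_pow_smul_injective (mu := mu) i k (by rw [← hf, h, zero_smul]))
    exact Nm_mul_ne_zero (hDm u hu r) (Subalgebra.pow_mem _ hfm N) hr (hf0 N) h2.symm
  · intro H
    obtain ⟨n₃, hn₃⟩ := hker _ (hwt H)
    have h1 := hn₃ (N + n₃) (by omega)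
    rw [sub_eq_add_neg, ← neg_smul, conj_add, conj_smul, add_smul, smul_assoc, neg_smul,
      ← sub_eq_add_neg, sub_eq_zero] at h1
    have h2 : ε (H : g) • conj K f (p + (N + n₃ : ℕ)) (N + n₃) u • v =
        (lam H - i.1 H * (p + (N + n₃ : ℕ))) • conj K f (p + (N + n₃ : ℕ)) (N + n₃) u • v := by
      rw [← mul_smul, weight_mul_conj (env_hf i H) _ (hn₀ _ (by omega)), sub_smul, h1, smul_assoc,
        sub_smul]
    rw [← hFp _ _ (by omega), H_f_pow] at h2
    rw [← sub_eq_zero]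
    refine f_pow_smul_injective i n₃ ?_
    rw [smul_sub, sub_eq_zero, eq_add_of_sub_eq h2, smul_smul_comm, ← add_smul,
      LinearMap.sub_apply, LinearMap.smul_apply, smul_eq_mul]
    congr 1
    push_cast
    ring
  · have h1 := hn₁ (N + 1) (by omega)
    have h2 := hn₂ N (by omega)
    rw [sub_eq_add_neg, ← neg_smul, conj_add, conj_smul, add_smul, smul_assoc, neg_smul,
      ← sub_eq_add_neg, sub_eq_zero] at h2
    rw [← mul_smul, raise_mul_conj (env_ef i) (env_cof i) _ (hn₀ _ (by omega)), sub_smul, add_smul,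
      h1, zero_add, Nat.cast_add, Nat.cast_one, show p + (N + 1) - 1 = p + N by ring, smul_assoc,
      smul_assoc, h2]
    show _ = _ • conj K f (p + N) N u • v
    generalize conj K f (p + N) N u • v = X
    rw [hp]
    module
  · intro j hj
    obtain ⟨n₃, hn₃⟩ := hker (ε (S.eu j.1) * u) (by rw [mul_smul, hx.kill])
    refine f_pow_smul_injective i n₃ ?_
    rw [← e_f_pow_comm hj.symm, hFp _ _ (by omega), ← mul_smul,
      ← conj_mul_left (env_ef_comm hj.symm)]
    exact hn₃ _ (by omega)

end Setup

end

section
open LieAlgebra LieModule Module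
namespace Setup
attribute [local instance] LieRing.ofAssociativeRing
variable {K : Type} [Field K] [IsAlgClosed K] [CharZero K]
variable {g : Type} [LieRing g] [LieAlgebra K g] {S : Setup K g}
variable [hD : Fact S.IsDynkin]
local notation "ε" => UniversalEnvelopingAlgebra.ι K
variable {lam mu nu : Dual K S.h}

lemma IsWt.of_f {i : S.Simple} {κ : Dual K S.h} {y : S.Verma nu}
    (hy : S.IsWt κ (ε (S.fu i.1) • y)) : S.IsWt (κ + i.1) y := by
  intro H
  rw [← sub_eq_zero]
  refine f_smul_injective i ?_
  have h1 := H_f_pow i H 1 y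
  rw [pow_one, hy H, Nat.cast_one, one_mul] at h1
  rw [smul_sub, sub_eq_zero, eq_add_of_sub_eq h1.symm, smul_smul_comm, ← add_smul]
  rfl

lemma e_eq_zero_of_f {i j : S.Simple} (h : j ≠ i) {y : S.Verma nu}
    (hy : ε (S.eu j.1) • ε (S.fu i.1) • y = 0) : ε (S.eu j.1) • y = 0 := by
  rw [e_f_comm h.symm] at hy
  exact f_smul_injective i hy

lemma descent {i : S.Simple} {κ : Dual K S.h} (T : ℕ) : ∀ {x : S.Verma nu}, x ≠ 0 →
    S.IsWt (κ - T • i.1) x → (∀ j, j ≠ i → ε (S.eu j.1) • x = 0) →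
    ε (S.fu i.1) • ε (S.eu i.1) • x = ((T : K) * (κ (S.co i.1) - T + 1)) • x →
    (∀ k < T, κ (S.co i.1) ≠ k) → S.Emb κ nu := by
  induction T with
  | zero =>
    intro x hx0 hx he hf _
    rw [zero_smul, sub_zero] at hx
    rw [Nat.cast_zero, zero_mul, zero_smul] at hf
    refine ⟨x, hx0, hx, fun j => ?_⟩
    by_cases h : j = i
    · rw [h]; exact f_smul_injective i hf
    · exact he j h
  | succ T ih =>
    intro x hx0 hx he hf ha
    set a := κ (S.co i.1) with hadef
    have hc : ((T : K) + 1) * (a - T) ≠ 0 :=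
      mul_ne_zero (by exact_mod_cast T.succ_ne_zero) (sub_ne_zero.mpr (ha T T.lt_succ_self))
    set c := ((T : K) + 1) * (a - T) with hcdef
    have hf' : ε (S.fu i.1) • (c⁻¹ • ε (S.eu i.1) • x) = x := by
      rw [smul_smul_comm, hf, ← mul_smul]
      convert one_smul K x
      rw [inv_mul_eq_one₀ hc, hcdef]
      push_cast
      ring
    set y : S.Verma nu := c⁻¹ • ε (S.eu i.1) • x with hy
    have hex : ε (S.eu i.1) • x = c • y := by rw [hy, smul_inv_smul₀ hc]
    have hwy : S.IsWt (κ - T • i.1) y := by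
      have : S.IsWt (κ - (T + 1) • i.1) (ε (S.fu i.1) • y) := by rwa [hf']
      refine this.of_f.congr ?_
      rw [succ_nsmul]; abel
    refine ih (x := y) ?_ hwy ?_ ?_ fun k hk => ha k (by omega)
    · intro h
      rw [h, smul_zero] at hf'
      exact hx0 hf'.symm
    · intro j hj
      exact e_eq_zero_of_f hj (by rw [hf', he j hj])
    · have h1 := e_f_smul i y
      rw [hf', hex, hwy, LinearMap.sub_apply, LinearMap.smul_apply, i.isTriple.h2,
        nsmul_eq_mul] at h1
      rw [← sub_eq_iff_eq_add.mpr h1, ← sub_smul, hcdef]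
      congr 1
      ring

/-- A singular vector of the reflected Verma module obtained from the twisted copy. -/
lemma emb_of_conj {i : S.Simple} (h : S.Emb lam mu) (κ : Dual K S.h) (z : ℤ) (c : K)
    (hκ : κ = lam + c • i.1) (hz : mu (S.co i.1) + 1 + c = z)
    (hc : c = 0 ∨ c = -(lam (S.co i.1) + 1))
    (hk : ∀ k : ℕ, κ (S.co i.1) ≠ k) : S.Emb κ (S.srefl i mu) := by
  obtain ⟨x, n, hx⟩ := exists_conj (i := i) h
  obtain ⟨T, hT⟩ := Int.eq_ofNat_of_zero_le (a := (n + z.natAbs + 1 : ℕ) + z) (by omega)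
  have hTK : (T : K) = (n + z.natAbs + 1 : ℕ) + (mu (S.co i.1) + 1 + c) := by
    rw [hz, ← Int.cast_natCast T, ← hT, Int.cast_add, Int.cast_natCast]
  obtain ⟨h0, hw, hf, -, hj⟩ := hx (n + z.natAbs + 1) (by omega)
  obtain ⟨-, -, hf', he', -⟩ := hx (n + z.natAbs) (by omega)
  refine descent T h0 (hw.congr ?_) hj ?_ fun k _ => hk k
  · rw [hκ, ← Nat.cast_smul_eq_nsmul K, hTK]
    module
  · rw [he', smul_smul_comm, hf', hTK, hκ, LinearMap.add_apply, LinearMap.smul_apply,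
      i.isTriple.h2, smul_eq_mul]
    congr 1
    push_cast
    rcases hc with rfl | rfl <;> ring

lemma sum_eq_zero_of_wt {M : Type} [AddCommGroup M] [Module K M] [Module (Env K g) M]
    [IsScalarTower K (Env K g) M] (n : ℕ) : ∀ w : Fin n → M, (∀ k, ∃ κ, κ ≠ lam ∧ S.IsWt κ (w k)) →
    S.IsWt lam (∑ k, w k) → ∑ k, w k = 0 := by
  induction n with
  | zero => intro w _ _; rw [Fin.sum_univ_zero]
  | succ n ih =>
    intro w hw hx
    obtain ⟨κ, hκ, hκw⟩ := hw (Fin.last n)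
    obtain ⟨H, hH⟩ : ∃ H, κ H ≠ lam H := by
      by_contra! h
      exact hκ (LinearMap.ext h)
    have h1 : (lam H - κ H) • ∑ k, w k =
        ∑ k : Fin n, (ε (H : g) • w k.castSucc - κ H • w k.castSucc) := by
      rw [sub_smul, ← hx H, Finset.smul_sum, Finset.smul_sum, ← Finset.sum_sub_distrib,
        Fin.sum_univ_castSucc, hκw H, sub_self, add_zero]
    have h2 := hx.smul (lam H - κ H)
    rw [h1] at h2
    have h3 := ih _ ?_ h2
    · rw [← h1] at h3
      exact (smul_eq_zero.mp h3).resolve_left (sub_ne_zero.mpr hH.symm)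
    · intro k
      obtain ⟨κ', h', hκ'⟩ := hw k.castSucc
      refine ⟨κ', h', ?_⟩
      rw [hκ' H, ← sub_smul]
      exact hκ'.smul _

lemma exists_sub_eq_rt {x : S.Verma mu} (hx0 : x ≠ 0) (hx : S.IsWt lam x) :
    ∃ n, 0 ≤ n ∧ mu - lam = S.rt n := by
  by_contra! hcon
  set V : Submodule K (S.Verma mu) :=
    Submodule.span K {w | ∃ n, 0 ≤ n ∧ S.IsWt (mu - S.rt n) w} with hV
  have hvac : S.vac mu ∈ V := Submodule.subset_span
    ⟨0, le_rfl, vac_sing.wt.congr (by rw [map_zero, sub_zero])⟩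
  have hgen : ∀ β ∈ S.pos, ∀ y ∈ S.W (-β), ∀ w ∈ V, ε y • w ∈ V := by
    intro β hβ y hy w hw
    induction hw using Submodule.span_induction with
    | mem w hw =>
      obtain ⟨n, hn, hw⟩ := hw
      obtain ⟨m, hm, rfl⟩ := exists_coords hβ
      exact Submodule.subset_span ⟨n + m, add_nonneg hn hm,
        (hw.act hy).congr (by rw [map_add]; abel)⟩
    | zero => rw [smul_zero]; exact V.zero_mem
    | add a b _ _ ha hb => rw [smul_add]; exact V.add_mem ha hb
    | smul c a _ ha => rw [smul_smul_comm]; exact V.smul_mem _ ha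
  have hall : ∀ u ∈ S.Nm, ∀ w ∈ V, u • w ∈ V := by
    intro u hu
    induction hu using Algebra.adjoin_induction with
    | mem u hu =>
      obtain ⟨β, hβ, y, hy, rfl⟩ := hu
      exact hgen β hβ y hy
    | algebraMap r => intro w hw; rw [algebraMap_smul]; exact V.smul_mem _ hw
    | add a b _ _ ha hb => intro w hw; rw [add_smul]; exact V.add_mem (ha w hw) (hb w hw)
    | mul a b _ _ ha hb => intro w hw; rw [mul_smul]; exact ha _ (hb w hw)
  obtain ⟨u, hu, rfl⟩ := exists_smul_vac x
  obtain ⟨n, c, w, h⟩ := Submodule.mem_span_set'.mp (hall u hu _ hvac)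
  refine hx0 ?_
  rw [← h] at hx ⊢
  refine sum_eq_zero_of_wt n _ (fun k => ?_) hx
  obtain ⟨m, hm, hw⟩ := (w k).2
  refine ⟨_, ?_, hw.smul (c k)⟩
  rintro rfl
  exact hcon m hm (by abel)

lemma Emb.exists_rt (h : S.Emb lam mu) : ∃ n, 0 ≤ n ∧ mu - lam = S.rt n := by
  obtain ⟨x, hx0, hx⟩ := h
  exact exists_sub_eq_rt hx0 hx.wt

lemma Emb.co_sub (h : S.Emb lam mu) (i : S.Simple) :
    ∃ z : ℤ, mu (S.co i.1) - lam (S.co i.1) = z := by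
  obtain ⟨n, -, hn⟩ := h.exists_rt
  exact ⟨S.P i n, by rw [← rt_co, ← hn]; rfl⟩

lemma Emb.srefl_of_ne {i : S.Simple} (h : S.Emb lam mu)
    (hq : ∀ k : ℕ, lam (S.co i.1) + 1 ≠ -(k + 1)) : S.Emb (S.srefl i lam) (S.srefl i mu) := by
  obtain ⟨z, hz⟩ := h.co_sub i
  refine emb_of_conj h _ z (-(lam (S.co i.1) + 1)) ?_ ?_ (Or.inr rfl) ?_
  · rw [srefl]; module
  · rw [← hz]; ring
  · intro k hk
    rw [srefl_co] at hk
    exact hq k (by linear_combination -hk)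

lemma Emb.srefl_right {i : S.Simple} (h : S.Emb lam mu) {z : ℤ} (hz : mu (S.co i.1) = z)
    (hq : ∀ k : ℕ, lam (S.co i.1) ≠ k) : S.Emb lam (S.srefl i mu) := by
  refine emb_of_conj h _ (z + 1) 0 ?_ ?_ (Or.inl rfl) hq
  · rw [zero_smul, add_zero]
  · rw [hz]; push_cast; ring

end Setup

end

section
open LieAlgebra LieModule Module
namespace Setup
attribute [local instance] LieRing.ofAssociativeRing
variable {K : Type} [Field K] [IsAlgClosed K] [CharZero K]
variable {g : Type} [LieRing g] [LieAlgebra K g] {S : Setup K g}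
variable [hD : Fact S.IsDynkin]
local notation "ε" => UniversalEnvelopingAlgebra.ι K
variable {lam mu nu : Dual K S.h}

lemma inn_mem_Nsub {R : Set (Dual K S.h)} {a : g}
    (h : ∀ β ∈ R, ∀ x ∈ S.W (-β), ε ⁅a, x⁆ ∈ S.Nsub R) {u : Env K g} (hu : u ∈ S.Nsub R) :
    inn K (ε a) u ∈ S.Nsub R := by
  induction hu using Algebra.adjoin_induction with
  | mem u hu =>
    obtain ⟨β, hβ, x, hx, rfl⟩ := hu
    rw [inn_apply, ← LieRing.of_associative_ring_bracket, ← LieHom.map_lie]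
    exact h β hβ x hx
  | algebraMap r =>
    rw [inn_apply, Algebra.commutes, sub_self]
    exact Subalgebra.zero_mem _
  | add a b _ _ ha hb => rw [map_add]; exact Subalgebra.add_mem _ ha hb
  | mul a b h1 h2 ha hb =>
    rw [inn_mul]
    exact Subalgebra.add_mem _ (Subalgebra.mul_mem _ ha h2) (Subalgebra.mul_mem _ h1 hb)

lemma inn_h_mem (i : S.Simple) (H : S.h) {u : Env K g} (hu : u ∈ S.Nmi i) :
    inn K (ε (H : g)) u ∈ S.Nmi i := by
  refine inn_mem_Nsub (fun β hβ x hx => ?_) hu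
  rw [hx H, map_smul]
  exact Subalgebra.smul_mem _ (ε_mem_Nsub hβ hx) _

lemma inn_e_mem (i : S.Simple) {u : Env K g} (hu : u ∈ S.Nmi i) :
    inn K (ε (S.eu i.1)) u ∈ S.Nmi i := by
  refine inn_mem_Nsub (fun β hβ x hx => ?_) hu
  have hne : ∀ z : ℤ, β + z • i.1 ≠ 0 := add_zsmul_ne_zero hβ.1 hβ.2
  have h1 : ⁅S.eu i.1, x⁆ ∈ S.W (-(β - i.1)) := lie_mem_W' i.isTriple.he hx (by abel)
  by_cases h0 : ⁅S.eu i.1, x⁆ = 0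
  · rw [h0, map_zero]; exact Subalgebra.zero_mem _
  have hroot : IsRootOf K g S.h (-(β - i.1)) := isRootOf_of_mem (by
    rw [neg_ne_zero, sub_eq_add_neg]; simpa using hne (-1)) h1 h0
  refine ε_mem_Nsub (R := {β | β ∈ S.pos ∧ β ≠ i.1}) (β := β - i.1) ⟨?_, fun h => hne (-2) ?_⟩ h1
  · by_contra hp
    have hpos : -(β - i.1) ∈ S.pos := by
      by_contra h
      exact hp (by simpa using neg_mem_pos hroot h)
    exact i.2.ne_add hβ.1 hpos (by abel)
  · rw [sub_eq_iff_eq_add] at h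
    rw [h]; module

lemma env_ops (i : S.Simple) : Sl2Ops (inn K (ε (S.eu i.1))) (inn K (ε (S.fu i.1)))
    (inn K (ε (S.co i.1 : g))) where
  EF x := by
    rw [← sub_eq_iff_eq_add'.mpr (env_ef i)]
    simp only [inn_apply]
    noncomm_ring
  HE x := by
    have h : ε (S.co i.1 : g) * ε (S.eu i.1) =
        ε (S.eu i.1) * ε (S.co i.1 : g) + (2 : K) • ε (S.eu i.1) := by
      rw [ε_mul, i.isTriple.he (S.co i.1), i.isTriple.h2, map_smul]
    have h' : inn K (ε (S.co i.1 : g)) (ε (S.eu i.1)) = (2 : K) • ε (S.eu i.1) := by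
      rw [inn_apply, h, add_sub_cancel_left]
    rw [inn_apply (ε (S.eu i.1)) x, map_sub, inn_mul, inn_mul, h', inn_apply (ε (S.eu i.1)),
      smul_mul_assoc, mul_smul_comm, smul_sub]
    abel
  HF x := by
    have h' : inn K (ε (S.co i.1 : g)) (ε (S.fu i.1)) = -((2 : K) • ε (S.fu i.1)) := by
      rw [inn_apply, env_cof, sub_sub_cancel_left]
    rw [inn_apply (ε (S.fu i.1)) x, map_sub, inn_mul, inn_mul, h', inn_apply (ε (S.fu i.1)),
      neg_mul, mul_neg, smul_mul_assoc, mul_smul_comm, smul_sub]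
    abel
  nilpE := inn_nilpotent i.isTriple.isCoroot.isRootOf.1 i.isTriple.he
  nilpF := inn_nilpotent (neg_ne_zero.mpr i.isTriple.isCoroot.isRootOf.1) i.isTriple.hf

/-- A singular vector of negative weight lies in the image of `f`. -/
lemma exists_f_smul_eq {i : S.Simple} {w : S.Verma nu} (hw : S.IsSing lam w) {P Q : ℕ}
    (hQ : lam (S.co i.1) = -(Q : K) - 2) (hP : nu (S.co i.1) + 1 = P) :
    ∃ y, ε (S.fu i.1) • y = w := by
  set f := ε (S.fu i.1) with hf
  set e := ε (S.eu i.1) with he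
  set h := ε (S.co i.1 : g) with hh
  set v := S.vac nu with hvdef
  have hv : S.IsSing nu v := vac_sing
  have hev : ∀ a : Env K g, e • a • v = inn K e a • v := fun a => by
    rw [inn_apply, sub_smul, mul_smul, mul_smul, hv.kill, smul_zero, sub_zero]
  have hhv : ∀ a : Env K g, h • a • v = inn K h a • v + nu (S.co i.1) • a • v := fun a => by
    rw [inn_apply, sub_smul, mul_smul, mul_smul, hv.wt, smul_smul_comm, sub_add_cancel]
  have hef : ∀ y : S.Verma nu, e • f • y = f • e • y + h • y := e_f_smul i
  have hhf : ∀ y : S.Verma nu, h • f • y = f • h • y - (2 : K) • f • y := fun y => by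
    rw [← mul_smul, env_cof, sub_smul, mul_smul, smul_assoc]
  -- splitting off the image of `f` is compatible with weights
  have hsplit : ∀ (c : K) (y y' : S.Verma nu) (a : Env K g), a ∈ S.Nmi i → y = f • y' + a • v →
      h • y = c • y → h • y' = (c + 2) • y' ∧ inn K h a = (c - nu (S.co i.1)) • a := by
    intro c y y' a ha hy hc
    have h1 : f • (h • y' - (c + 2) • y') + (inn K h a - (c - nu (S.co i.1)) • a) • v = 0 := by
      rw [hy, smul_add, hhf, hhv, smul_add] at hc
      rw [smul_sub, sub_smul, smul_smul_comm, smul_assoc]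
      rw [← sub_eq_zero] at hc
      rw [← hc]
      generalize f • h • y' = X
      generalize f • y' = X'
      generalize inn K h a • v = Y
      generalize a • v = Z
      module
    obtain ⟨h2, h3⟩ := f_add_eq_zero (Subalgebra.sub_mem _ (inn_h_mem i _ ha)
      (Subalgebra.smul_mem _ ha _)) h1
    exact ⟨sub_eq_zero.mp h2, sub_eq_zero.mp h3⟩
  obtain ⟨y₁, a₀, ha₀, hy₁⟩ := exists_f_add i w
  obtain ⟨hw₁, hwa⟩ := hsplit _ _ _ _ ha₀ hy₁ (hw.wt _)
  have hind : ∀ k : ℕ, ∃ (y : S.Verma nu) (a : Env K g) (c : K), a ∈ S.Nmi i ∧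
      (inn K e ^ (k + 1)) a₀ = c • inn K e a ∧ h • y = (2 * k - Q : K) • y ∧
      f • e • y + (((k : K) + 1) * (k - Q)) • y + inn K e a • v = 0 := by
    intro k
    induction k with
    | zero =>
      refine ⟨y₁, a₀, 1, ha₀, ?_, ?_, ?_⟩
      · rw [one_smul, zero_add, pow_one]
      · rw [hw₁, hQ]; congr 1; push_cast; ring
      · have h1 := hw.kill i
        rw [← he, hy₁, smul_add, hev, hef, hw₁, hQ] at h1
        rw [← h1]
        congr 3
        push_cast; ring
    | succ k ih =>
      obtain ⟨y, a, c, ha, hpow, hwt, hrel⟩ := ih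
      obtain ⟨y', a', ha', hy'⟩ := exists_f_add i y
      obtain ⟨hw', -⟩ := hsplit _ _ _ _ ha' hy' hwt
      have h1 : f • (e • y + (((k : K) + 1) * (k - Q)) • y') +
          (inn K e a + (((k : K) + 1) * (k - Q)) • a') • v = 0 := by
        have hc := congrArg (fun t => (((k : K) + 1) * (k - Q)) • t) hy'
        simp only [smul_add] at hc
        rw [← hrel, smul_add, add_smul, smul_smul_comm, smul_assoc, hc]
        abel
      obtain ⟨h2, h3⟩ := f_add_eq_zero (Subalgebra.add_mem _ (inn_e_mem i ha)
        (Subalgebra.smul_mem _ ha' _)) h1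
      refine ⟨y', a', c * (-(((k : K) + 1) * (k - Q))), ha', ?_, ?_, ?_⟩
      · rw [inn_pow_succ, hpow, map_smul, eq_neg_of_add_eq_zero_left h3, map_neg, map_smul,
          ← neg_smul, smul_smul]
      · rw [hw']; congr 1; push_cast; ring
      · rw [hy', smul_add, hev, hef, hw'] at h2
        rw [← h2]
        push_cast
        generalize f • e • y' = X
        generalize inn K e a' • v = X'
        module
  obtain ⟨y, a, c, ha, hpow, -, hrel⟩ := hind Q
  rw [sub_self, mul_zero, zero_smul, add_zero] at hrel
  rw [(f_add_eq_zero (inn_e_mem i ha) hrel).2, smul_zero] at hpow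
  have ha₀' : a₀ = 0 := by
    refine (env_ops i).eq_zero_of_E_pow (d := P + (Q + 1)) ?_ ?_
    · rw [← hh, hwa, hQ, eq_sub_of_add_eq hP]
      congr 1; push_cast; ring
    · rw [pow_add, Module.End.mul_apply, ← he, hpow, map_zero]
  exact ⟨y₁, by rw [hy₁, ha₀', zero_smul, add_zero]⟩

lemma Emb.srefl_of_neg {i : S.Simple} (h : S.Emb lam mu) {P Q : ℕ}
    (hQ : lam (S.co i.1) = -(Q : K) - 2) (hP : mu (S.co i.1) + 1 = -(P : K)) :
    S.Emb (S.srefl i lam) (S.srefl i mu) := by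
  have hP' : S.srefl i mu (S.co i.1) + 1 = P := by
    rw [srefl_co]; linear_combination -hP
  obtain ⟨w, hw0, hw⟩ := h.trans (srefl_srefl (S := S) i mu ▸ emb_srefl hP')
  obtain ⟨y, rfl⟩ := exists_f_smul_eq hw hQ hP'
  have hy0 : y ≠ 0 := by
    rintro rfl
    exact hw0 (smul_zero _)
  have hy : S.IsWt (lam + i.1) y := hw.wt.of_f
  have hκ : S.srefl i lam (S.co i.1) = Q := by
    rw [srefl_co, hQ]; ring
  refine descent (i := i) Q hy0 (hy.congr ?_) (fun j hj => e_eq_zero_of_f hj (hw.kill j)) ?_ ?_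
  · rw [srefl, hQ, ← Nat.cast_smul_eq_nsmul K]; module
  · have h1 := e_f_smul i y
    rw [hw.kill, hy, LinearMap.add_apply, i.isTriple.h2, hQ] at h1
    rw [eq_neg_of_add_eq_zero_left h1.symm, ← neg_smul, hκ]
    congr 1; ring
  · intro k hk
    rw [hκ]
    exact_mod_cast hk.ne'

/-- Simple reflections preserve embeddings, except when the source becomes larger and the target
smaller. -/
lemma Emb.srefl {i : S.Simple} (h : S.Emb lam mu)
    (hne : ∀ k l : ℕ, lam (S.co i.1) + 1 = -(k + 1) → mu (S.co i.1) + 1 = l + 1 → False) :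
    S.Emb (S.srefl i lam) (S.srefl i mu) := by
  by_cases hq : ∀ k : ℕ, lam (S.co i.1) + 1 ≠ -(k + 1)
  · exact h.srefl_of_ne hq
  push Not at hq
  obtain ⟨Q, hQ⟩ := hq
  obtain ⟨z, hz⟩ := h.co_sub i
  have hmu : mu (S.co i.1) + 1 = ((z - (Q + 1) : ℤ) : K) := by
    push_cast; linear_combination hz + hQ
  rcases le_or_gt (z - (Q + 1) : ℤ) 0 with hle | hlt
  · obtain ⟨P, hP⟩ := Int.exists_eq_neg_ofNat hle
    refine h.srefl_of_neg (P := P) (Q := Q) (by linear_combination hQ) ?_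
    rw [hmu, hP]; push_cast; rfl
  · obtain ⟨P, hP⟩ := Int.eq_succ_of_zero_lt hlt
    refine (hne Q P hQ ?_).elim
    rw [hmu, hP]; push_cast; rfl

lemma Emb.srefl_left {i : S.Simple} (h : S.Emb lam mu) {k l : ℕ}
    (hk : lam (S.co i.1) + 1 = -(k + 1)) (hl : mu (S.co i.1) + 1 = l + 1) :
    S.Emb (S.srefl i lam) mu := by
  have h1 : S.Emb lam (S.srefl i mu) := by
    refine h.srefl_right (z := l) ?_ ?_
    · rw [add_right_cancel hl]; push_cast; rfl
    · intro n hn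
      rw [hn] at hk
      have : ((n + k + 2 : ℕ) : K) = 0 := by push_cast; linear_combination hk
      exact Nat.cast_ne_zero.mpr (by omega) this
  have h2 := h1.srefl (i := i) (fun k' l' _ h' => by
    rw [srefl_co, add_right_cancel hl] at h'
    have : ((l + l' + 2 : ℕ) : K) = 0 := by push_cast; linear_combination -h'
    exact Nat.cast_ne_zero.mpr (by omega) this)
  rwa [srefl_srefl] at h2

end Setup

end

section
open LieAlgebra LieModule Module
namespace Setup
variable {K : Type} [Field K] [IsAlgClosed K] [CharZero K]
variable {g : Type} [LieRing g] [LieAlgebra K g] {S : Setup K g}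
variable [hD : Fact S.IsDynkin]
variable {ρ lam mu nu : Dual K S.h}

lemma srefl_sub_smul (hρ : S.IsGlobalRho ρ) {i : S.Simple} {β : Dual K S.h} (hβ : β ∈ S.pos)
    (hne : β ≠ i.1) {z : ℤ} (hz : β (S.co i.1) = z) {n : K} (hn : (mu + ρ) (S.co β) = n) :
    (S.srefl i mu + ρ) (S.co (β - z • i.1)) = n ∧
      S.srefl i (mu - n • β) = S.srefl i mu - n • (β - z • i.1) := by
  constructor
  · rw [co_reflect hβ hne hz, srefl]
    rw [← hn]
    simp only [LinearMap.add_apply, LinearMap.sub_apply, LinearMap.smul_apply, map_sub, map_smul,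
      smul_eq_mul, i.isTriple.h2, rho_co hρ]
    ring
  · rw [srefl, srefl, ← Int.cast_smul_eq_zsmul K z]
    simp only [LinearMap.sub_apply, LinearMap.smul_apply, smul_eq_mul, hz]
    module

lemma coe_co_of_pos {β : Dual K S.h} (hβ : β ∈ S.pos) (i : S.Simple) :
    ∃ z : ℤ, β (S.co i.1) = z := by
  obtain ⟨m, -, rfl⟩ := exists_coords hβ
  exact ⟨_, rt_co i m⟩

/-- Verma's theorem on reflections. -/
lemma emb_reflection (hρ : S.IsGlobalRho ρ) {β : Dual K S.h} (hβ : β ∈ S.pos) {n : ℕ}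
    (hn : (mu + ρ) (S.co β) = n) : S.Emb (mu - (n : K) • β) mu := by
  revert mu n
  refine pos_induction (p := fun β => ∀ {mu : Dual K S.h} {n : ℕ}, (mu + ρ) (S.co β) = n →
    S.Emb (mu - (n : K) • β) mu) ?_ ?_ hβ
  · intro i mu n hn
    rw [LinearMap.add_apply, rho_co hρ] at hn
    have := emb_srefl hn
    rwa [srefl, hn] at this
  · intro i β z hβ hne hz hz0 hpos ih mu n hn
    obtain ⟨h1, h2⟩ := srefl_sub_smul hρ hβ hne hz hn
    have h3 := ih h1
    rw [← h2] at h3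
    have h4 := h3.srefl (i := i) (fun k l hk hl => by
      rw [srefl_co, LinearMap.sub_apply, LinearMap.smul_apply, hz, smul_eq_mul] at hk
      rw [srefl_co] at hl
      have : ((l + 1 + n * z + k + 1 : ℤ) : K) = 0 := by
        push_cast; linear_combination hk - hl
      have h5 : (0 : ℤ) ≤ n * z := mul_nonneg (by positivity) hz0.le
      have h6 := Int.cast_eq_zero.mp this
      omega)
    rwa [srefl_srefl, srefl_srefl] at h4

theorem StronglyLinked.emb (hρ : S.IsGlobalRho ρ) (h : S.StronglyLinked ρ lam mu) :
    S.Emb lam mu := by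
  induction h with
  | refl => exact Emb.refl _
  | @step mu α H hα hH hle _ ih =>
    obtain ⟨n, hn⟩ := (wle_dotReflect_iff hα).mp hle
    refine ih.trans ?_
    rw [dotReflect, hn]
    exact emb_reflection hρ hα (hH.eq_co ▸ hn)

namespace StronglyLinked

lemma trans (h1 : S.StronglyLinked ρ lam mu) (h2 : S.StronglyLinked ρ mu nu) :
    S.StronglyLinked ρ lam nu := by
  induction h2 with
  | refl => exact h1
  | step α H hα hH hle _ ih => exact .step α H hα hH hle ih

lemma sub_smul {β : Dual K S.h} (hβ : β ∈ S.pos) {n : ℕ} (hn : (mu + ρ) (S.co β) = n) :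
    S.StronglyLinked ρ (mu - (n : K) • β) mu := by
  refine .step β (S.co β) hβ (isTriple_of_pos hβ).isCoroot ((wle_dotReflect_iff hβ).mpr ⟨n, hn⟩) ?_
  rw [dotReflect, hn]
  exact .refl _

lemma of_srefl (hρ : S.IsGlobalRho ρ) {i : S.Simple} {n : ℕ} (hn : mu (S.co i.1) + 1 = n) :
    S.StronglyLinked ρ (S.srefl i mu) mu := by
  rw [srefl, hn]
  exact sub_smul i.pos (by rw [LinearMap.add_apply, rho_co hρ, hn])

lemma to_srefl (hρ : S.IsGlobalRho ρ) {i : S.Simple} {n : ℕ} (hn : mu (S.co i.1) + 1 = -n) :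
    S.StronglyLinked ρ mu (S.srefl i mu) := by
  have h := of_srefl (mu := S.srefl i mu) hρ (i := i) (n := n) (by
    rw [srefl_co]; linear_combination -hn)
  rwa [srefl_srefl] at h

/-- Induction along strong linkage, compared with its image under a simple reflection. -/
lemma srefl_induction (hρ : S.IsGlobalRho ρ) (i : S.Simple) {p : Dual K S.h → Prop}
    (refl : p lam)
    (swap : ∀ (mu : Dual K S.h) (n : ℕ), mu (S.co i.1) + 1 = n → S.StronglyLinked ρ (S.srefl i mu) mu →
      p (S.srefl i mu) → p mu)
    (step : ∀ (mu mu' : Dual K S.h) (z : ℤ), S.StronglyLinked ρ mu' mu →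
      S.StronglyLinked ρ (S.srefl i mu') (S.srefl i mu) →
      mu' (S.co i.1) = mu (S.co i.1) + z → p mu' → p mu)
    (h : S.StronglyLinked ρ lam mu) : p mu := by
  induction h with
  | refl => exact refl
  | @step mu α H hα hH hle _ ih =>
    obtain ⟨n, hn⟩ := (wle_dotReflect_iff hα).mp hle
    have ih' := ih
    rw [dotReflect, hn] at ih'
    rw [hH.eq_co] at hn
    by_cases hi : α = i.1
    · subst hi
      have h1 : mu (S.co i.1) + 1 = n := by rw [← hn, LinearMap.add_apply, rho_co hρ]
      refine swap mu n h1 (of_srefl hρ h1) ?_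
      rwa [srefl, h1]
    · obtain ⟨z, hz⟩ := coe_co_of_pos hα i
      obtain ⟨h1, h2⟩ := srefl_sub_smul hρ hα hi hz hn
      refine step mu _ (-(n * z)) (sub_smul hα hn) ?_ ?_ ih'
      · rw [h2]
        exact sub_smul (reflect_pos hα hi hz) h1
      · rw [LinearMap.sub_apply, LinearMap.smul_apply, hz, smul_eq_mul]; push_cast; ring

lemma srefl_of_nonintegral (hρ : S.IsGlobalRho ρ) {i : S.Simple} (h : S.StronglyLinked ρ lam mu)
    (hp : ∀ z : ℤ, mu (S.co i.1) ≠ z) : S.StronglyLinked ρ (S.srefl i lam) (S.srefl i mu) := by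
  revert hp
  refine srefl_induction hρ i (p := fun mu => (∀ z : ℤ, mu (S.co i.1) ≠ z) →
    S.StronglyLinked ρ (S.srefl i lam) (S.srefl i mu)) (fun _ => .refl _) ?_ ?_ h
  · intro mu n hn _ _ hp
    exact (hp (n - 1) (by push_cast; linear_combination hn)).elim
  · intro mu mu' z _ h1 hz ih hp
    refine (ih fun y hy => hp (y - z) ?_).trans h1
    push_cast; linear_combination hy - hz

lemma srefl_left (hρ : S.IsGlobalRho ρ) {i : S.Simple} (h : S.StronglyLinked ρ lam mu)
    (h1 : S.StronglyLinked ρ mu nu) (h2 : S.StronglyLinked ρ (S.srefl i mu) nu) :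
    S.StronglyLinked ρ (S.srefl i lam) nu := by
  revert h1 h2
  refine srefl_induction hρ i (p := fun mu => S.StronglyLinked ρ mu nu →
    S.StronglyLinked ρ (S.srefl i mu) nu → S.StronglyLinked ρ (S.srefl i lam) nu)
    (fun _ h => h) ?_ ?_ h
  · intro mu n _ _ ih h1 h2
    exact ih h2 (by rwa [srefl_srefl])
  · intro mu mu' z h3 h4 _ ih h1 h2
    exact ih (h3.trans h1) (h4.trans h2)

lemma srefl_right (hρ : S.IsGlobalRho ρ) {i : S.Simple} (h : S.StronglyLinked ρ lam mu)
    (h1 : S.StronglyLinked ρ nu lam) (h2 : S.StronglyLinked ρ nu (S.srefl i lam)) :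
    S.StronglyLinked ρ nu (S.srefl i mu) := by
  refine (srefl_induction hρ i (p := fun mu => S.StronglyLinked ρ nu mu ∧
    S.StronglyLinked ρ nu (S.srefl i mu)) ⟨h1, h2⟩ ?_ ?_ h).2
  · rintro mu n _ h3 ⟨h4, h5⟩
    rw [srefl_srefl] at h5
    exact ⟨h5, h4⟩
  · rintro mu mu' z h3 h4 _ ⟨h5, h6⟩
    exact ⟨h5.trans h3, h6.trans h4⟩

lemma exists_dotAct (h : S.StronglyLinked ρ lam mu) : ∃ w ∈ S.weylGroup, lam = S.dotAct ρ w mu := by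
  induction h with
  | refl => exact ⟨1, one_mem _, (add_sub_cancel_right _ ρ).symm⟩
  | @step mu α H hα hH _ _ ih =>
    obtain ⟨w, hw, rfl⟩ := ih
    refine ⟨w * S.reflection α H hH.1, mul_mem hw
      (Subgroup.subset_closure ⟨α, H, hH, S.pos_root α hα, rfl⟩), ?_⟩
    have h1 : S.dotReflect ρ α H mu + ρ = S.reflection α H hH.1 (mu + ρ) := by
      change mu - ((mu + ρ) H) • α + ρ = mu + ρ - ((mu + ρ) H) • α
      abel
    rw [dotAct, h1]
    rfl

end StronglyLinked

theorem Emb.stronglyLinked (hρ : S.IsGlobalRho ρ) (h : S.Emb lam mu) :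
    S.StronglyLinked ρ lam mu := by
  obtain ⟨n, hn, hrt⟩ := h.exists_rt
  generalize hN : (S.ht n).toNat = N
  induction N using Nat.strong_induction_on generalizing lam mu n with
  | _ N ih =>
  by_cases h0 : n = 0
  · rw [h0, map_zero, sub_eq_zero] at hrt
    rw [hrt]
    exact .refl _
  obtain ⟨i, -, hP⟩ := exists_P_pos hn h0
  have hpq : mu (S.co i.1) - lam (S.co i.1) = S.P i n := by
    rw [← rt_co, ← hrt]; rfl
  have hih : ∀ {lam' mu' : Dual K S.h} (z : ℤ), 0 < z → mu' - lam' = mu - lam - (z : K) • i.1 →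
      S.Emb lam' mu' → S.StronglyLinked ρ lam' mu' := by
    intro lam' mu' z hz heq h'
    obtain ⟨n', hn', hrt'⟩ := h'.exists_rt
    have h1 : n' = n - Finsupp.single i z := rt_injective (by
      rw [← hrt', heq, hrt, map_sub, rt_single, ← Int.cast_smul_eq_zsmul K z])
    refine ih _ ?_ h' n' hn' hrt' rfl
    have h2 : S.ht n' = S.ht n - z := by rw [h1, map_sub, ht_single]
    have h3 := ht_nonneg hn'
    omega
  by_cases hex : ∃ k l : ℕ, lam (S.co i.1) + 1 = -(k + 1) ∧ mu (S.co i.1) + 1 = l + 1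
  · obtain ⟨k, l, hk, hl⟩ := hex
    refine (StronglyLinked.to_srefl hρ (i := i) (n := k + 1) (by rw [hk]; push_cast; rfl)).trans ?_
    refine hih (k + 1) (by positivity) ?_ (h.srefl_left hk hl)
    rw [Setup.srefl, hk]; push_cast; module
  have h1 : S.StronglyLinked ρ (S.srefl i lam) (S.srefl i mu) := by
    refine hih (S.P i n) hP ?_ (h.srefl fun k l hk hl => hex ⟨k, l, hk, hl⟩)
    rw [Setup.srefl, Setup.srefl, ← hpq]; module
  by_cases hp : ∃ k : ℕ, mu (S.co i.1) + 1 = k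
  · obtain ⟨k, hk⟩ := hp
    have h2 := h1.srefl_left (nu := mu) hρ (i := i) (.of_srefl hρ hk)
      (by rw [srefl_srefl]; exact .refl _)
    rwa [srefl_srefl] at h2
  by_cases hq : ∃ k : ℕ, lam (S.co i.1) + 1 = -k
  · obtain ⟨k, hk⟩ := hq
    have h2 := h1.srefl_right (nu := lam) hρ (i := i) (.to_srefl hρ hk)
      (by rw [srefl_srefl]; exact .refl _)
    rwa [srefl_srefl] at h2
  have h2 := h1.srefl_of_nonintegral (i := i) hρ (fun z hz => by
    rw [srefl_co] at hz
    rcases le_or_gt z (-1) with h | h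
    · obtain ⟨k, hk⟩ := Int.eq_ofNat_of_zero_le (a := -1 - z) (by omega)
      refine hp ⟨k, ?_⟩
      rw [← Int.cast_natCast k, ← hk]
      push_cast; linear_combination -hz
    · obtain ⟨k, hk⟩ := Int.eq_ofNat_of_zero_le (a := z + 1 + S.P i n) (by omega)
      refine hq ⟨k, ?_⟩
      rw [← Int.cast_natCast k, ← hk]
      push_cast; linear_combination -hz - hpq)
  rwa [srefl_srefl, srefl_srefl] at h2

end Setup

end

/-- BGG theorem.  For `lam, mu ∈ h^*`, there is a nonzero `g`-module
homomorphism `M(lam) → M(mu)` if and only if `lam` is strongly linked to `mu`; in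
particular every Verma submodule of `M(mu)` is of the form `M(w · mu)` for some `w` in the
Weyl group. -/
theorem bgg_theorem
    (K : Type) [Field K] [IsAlgClosed K] [CharZero K]
    (g : Type) [LieRing g] [LieAlgebra K g] (S : Setup K g) (hDynkin : S.IsDynkin)
    (ρ : Module.Dual K S.h) (hρ : S.IsGlobalRho ρ) (lam mu : Module.Dual K S.h) :
    ((∃ f : S.Verma lam →ₗ[Env K g] S.Verma mu, f ≠ 0) ↔ S.StronglyLinked ρ lam mu) ∧
    (∀ N : Submodule (Env K g) (S.Verma mu),
      (∃ ν : Module.Dual K S.h, Nonempty (N ≃ₗ[Env K g] S.Verma ν)) →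
      ∃ w ∈ S.weylGroup, Nonempty (N ≃ₗ[Env K g] S.Verma (S.dotAct ρ w mu))) := by
  have : Fact S.IsDynkin := ⟨hDynkin⟩
  have hiff : ∀ ν : Module.Dual K S.h, (∃ f : S.Verma ν →ₗ[Env K g] S.Verma mu, f ≠ 0) ↔
      S.StronglyLinked ρ ν mu := fun ν =>
    Setup.emb_iff.trans ⟨fun h => h.stronglyLinked hρ, fun h => h.emb hρ⟩
  refine ⟨hiff lam, ?_⟩
  rintro N ⟨ν, ⟨e⟩⟩
  have hf : N.subtype ∘ₗ e.symm.toLinearMap ≠ 0 := fun h => by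
    have h1 : ((e.symm (S.vac ν) : N) : S.Verma mu) = 0 := DFunLike.congr_fun h (S.vac ν)
    rw [ZeroMemClass.coe_eq_zero, LinearEquiv.map_eq_zero_iff] at h1
    exact Setup.vac_ne_zero h1
  obtain ⟨w, hw, rfl⟩ := ((hiff ν).mp ⟨_, hf⟩).exists_dotAct
  exact ⟨w, hw, ⟨e⟩⟩

end Paper
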